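/- Fix n ≥ 2. Let F ∈ ℤ[Y,X₁,…,Xₙ] with deg_Y F ≥ 2 be a (1,n)-allowable polynomial of the form (1.2) with parameter m ≥ 2. Then there exists an integer h ≥ 1 depending only on n and deg F such that for every ε > 0 there is a constant C, depending only on n, deg F and ε, with N(F,B) ≤ C · ‖F‖^h · B^{n−1+1/(n+1)+ε} for all real B ≥ 1. -/

import Mathlib

open Polynomial

noncomputable section

/-- The rational function field `ℚ(X₁,…,Xₙ)`. -/
abbrev RF (n : ℕ) := FractionRing (MvPolynomial (Fin n) ℚ)

/-- Base change a polynomial `F ∈ ℤ[Y,X₁,…,Xₙ]` (written as a polynomial in `Y`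
with coefficients in `ℤ[X₁,…,Xₙ]`) to `ℚ[Y,X₁,…,Xₙ]`. -/
def toQ {n : ℕ} (F : Polynomial (MvPolynomial (Fin n) ℤ)) :
    Polynomial (MvPolynomial (Fin n) ℚ) :=
  F.map (MvPolynomial.map (Int.castRingHom ℚ))

/-- View a polynomial in `ℚ[X][Y]` as a polynomial in `ℚ(X)[Y]`. -/
def toFracQ {n : ℕ} (F : Polynomial (MvPolynomial (Fin n) ℚ)) : Polynomial (RF n) :=
  F.map (algebraMap (MvPolynomial (Fin n) ℚ) (RF n))

/-- View a polynomial in `ℤ[X][Y]` as a polynomial in `ℚ(X)[Y]`. -/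
def toFrac {n : ℕ} (F : Polynomial (MvPolynomial (Fin n) ℤ)) : Polynomial (RF n) :=
  toFracQ (toQ F)

/-- The degree of `F(Y,X)` in the variable `Xᵢ`. -/
def degX {n : ℕ} {R : Type*} [CommSemiring R]
    (F : Polynomial (MvPolynomial (Fin n) R)) (i : Fin n) : ℕ :=
  F.support.sup fun k => (F.coeff k).degreeOf i

/-- The total degree of `F(Y,X₁,…,Xₙ)` as a polynomial in `n+1` variables. -/
def totalDeg {n : ℕ} {R : Type*} [CommSemiring R]
    (F : Polynomial (MvPolynomial (Fin n) R)) : ℕ :=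
  F.support.sup fun k => k + (F.coeff k).totalDegree

/-- `‖g‖`: the maximum absolute value of a coefficient of `g ∈ ℤ[X₁,…,Xₙ]`. -/
def mvNorm {n : ℕ} (g : MvPolynomial (Fin n) ℤ) : ℕ :=
  g.support.sup fun m => (g.coeff m).natAbs

/-- `‖F‖`: the maximum absolute value of a coefficient of `F ∈ ℤ[Y,X₁,…,Xₙ]`. -/
def polyNorm {n : ℕ} (F : Polynomial (MvPolynomial (Fin n) ℤ)) : ℕ :=
  F.support.sup fun k => mvNorm (F.coeff k)

/-- The counting function
`N(F,B) = #{x ∈ ℤⁿ ∩ [−B,B]ⁿ : ∃ y ∈ ℤ, F(y,x) = 0}`. -/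
def NFB {n : ℕ} (F : Polynomial (MvPolynomial (Fin n) ℤ)) (B : ℝ) : ℕ :=
  Set.ncard {x : Fin n → ℤ | (∀ i, |(x i : ℝ)| ≤ B) ∧
    ∃ y : ℤ, Polynomial.eval y (F.map (MvPolynomial.eval x)) = 0}

/-- `F ∈ ℤ[Y,X₁,…,Xₙ]` is absolutely irreducible: irreducible over `ℚ̄`. -/
def AbsIrred {n : ℕ} (F : Polynomial (MvPolynomial (Fin n) ℤ)) : Prop :=
  Irreducible (F.map (MvPolynomial.map (Int.castRingHom (AlgebraicClosure ℚ))))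

/-- `G` has positive degree in `Y` and in each variable `Xᵢ`. -/
def AllPosDeg {n : ℕ} (G : Polynomial (MvPolynomial (Fin n) ℤ)) : Prop :=
  0 < G.natDegree ∧ ∀ i : Fin n, 0 < degX G i

/-- A field extension `M` of `ℚ(X₁,…,Xₙ)` is an `n`-genuine extension: every
`G ∈ ℤ[Y,X₁,…,Xₙ]` irreducible over `ℚ(X)` with `M ≅ ℚ(X)[Y]/(G)` has positive
degree in each of `Y, X₁, …, Xₙ`. -/
def IsGenuineExt (n : ℕ) (M : Type*) [Field M] [Algebra (RF n) M] : Prop :=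
  ∀ G : Polynomial (MvPolynomial (Fin n) ℤ), Irreducible (toFrac G) →
    Nonempty (AdjoinRoot (toFrac G) ≃ₐ[RF n] M) → AllPosDeg G

/-- A field extension `M` of `ℚ(X₁,…,Xₙ)` is strongly `n`-genuine: every
intermediate field strictly containing `ℚ(X)` is `n`-genuine. -/
def IsStronglyGenuineExt (n : ℕ) (M : Type*) [Field M] [Algebra (RF n) M] : Prop :=
  ∀ M' : IntermediateField (RF n) M, M' ≠ ⊥ → IsGenuineExt n M'

/-- The extension `ℚ(X)[Y]/(Fq)` presented by `Fq ∈ ℚ[X][Y]` is `n`-genuine. -/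
def GenuineExtOfQ {n : ℕ} (Fq : Polynomial (MvPolynomial (Fin n) ℚ)) : Prop :=
  ∀ G : Polynomial (MvPolynomial (Fin n) ℤ), Irreducible (toFrac G) →
    Nonempty (AdjoinRoot (toFrac G) ≃ₐ[RF n] AdjoinRoot (toFracQ Fq)) → AllPosDeg G

/-- The extension `ℚ(X)[Y]/(Fq)` presented by `Fq ∈ ℚ[X][Y]` is strongly
`n`-genuine: for any field `M` isomorphic over `ℚ(X)` to `ℚ(X)[Y]/(Fq)`, every
intermediate field strictly containing `ℚ(X)` is `n`-genuine. -/
def StronglyGenuineExtOfQ {n : ℕ} (Fq : Polynomial (MvPolynomial (Fin n) ℚ)) : Prop :=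
  ∀ (M : Type) [Field M] [Algebra (RF n) M],
    Nonempty (AdjoinRoot (toFracQ Fq) ≃ₐ[RF n] M) → IsStronglyGenuineExt n M

/-- An absolutely irreducible `F ∈ ℤ[Y,X₁,…,Xₙ]` is an `n`-genuine polynomial. -/
def IsGenuinePoly {n : ℕ} (F : Polynomial (MvPolynomial (Fin n) ℤ)) : Prop :=
  AbsIrred F ∧ GenuineExtOfQ (toQ F)

/-- An absolutely irreducible `F ∈ ℤ[Y,X₁,…,Xₙ]` is a strongly `n`-genuine polynomial. -/
def IsStronglyGenuinePoly {n : ℕ} (F : Polynomial (MvPolynomial (Fin n) ℤ)) : Prop :=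
  AbsIrred F ∧ StronglyGenuineExtOfQ (toQ F)

/-- The ring map `ℚ[X₁,…,Xₙ] → ℚ[X₁,…,Xₙ]` induced by the linear substitution
`Xᵢ ↦ Σⱼ σᵢⱼ Xⱼ`. -/
def lsubMv {n : ℕ} (σ : Matrix (Fin n) (Fin n) ℚ) :
    MvPolynomial (Fin n) ℚ →+* MvPolynomial (Fin n) ℚ :=
  (MvPolynomial.aeval (R := ℚ)
    fun i => ∑ j, MvPolynomial.C (σ i j) * MvPolynomial.X j).toRingHom

/-- `F_σ(Y,X) := F(Y,σ(X))` for a linear change of variables `σ`. -/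
def applyGL {n : ℕ} (σ : Matrix (Fin n) (Fin n) ℚ)
    (Fq : Polynomial (MvPolynomial (Fin n) ℚ)) : Polynomial (MvPolynomial (Fin n) ℚ) :=
  Fq.map (lsubMv σ)

/-- `F` is `(1,n)`-allowable: absolutely irreducible, monic in `Y`, and
`ℚ(X)[Y]/(F_σ)` is an `n`-genuine extension for every `σ ∈ GLₙ(ℚ)`. -/
def IsAllowable {n : ℕ} (F : Polynomial (MvPolynomial (Fin n) ℤ)) : Prop :=
  AbsIrred F ∧ F.Monic ∧
    ∀ σ : Matrix (Fin n) (Fin n) ℚ, IsUnit σ.det → GenuineExtOfQ (applyGL σ (toQ F))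

/-- `F` is strongly `(1,n)`-allowable: absolutely irreducible, monic in `Y`, and
`ℚ(X)[Y]/(F_σ)` is a strongly `n`-genuine extension for every `σ ∈ GLₙ(ℚ)`. -/
def IsStronglyAllowable {n : ℕ} (F : Polynomial (MvPolynomial (Fin n) ℤ)) : Prop :=
  AbsIrred F ∧ F.Monic ∧
    ∀ σ : Matrix (Fin n) (Fin n) ℚ, IsUnit σ.det → StronglyGenuineExtOfQ (applyGL σ (toQ F))

/-- `F` has the form (1.2) with parameter `m`:
`F = Y^{md} + f₁(X) Y^{m(d-1)} + ⋯ + f_{d-1}(X) Y^m + f_d(X)` with `f_d ≠ 0`. -/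
def HasForm (n m : ℕ) (F : Polynomial (MvPolynomial (Fin n) ℤ)) : Prop :=
  ∃ (d : ℕ) (f : ℕ → MvPolynomial (Fin n) ℤ), 1 ≤ d ∧ f d ≠ 0 ∧
    F = Polynomial.X ^ (m * d) +
      ∑ j ∈ Finset.Icc 1 d, Polynomial.C (f j) * Polynomial.X ^ (m * (d - j))

/-- `P` has a linear factor in `Y`: `P = (Y − Q(X))·H̃(Y,X)`. -/
def HasLinearFactorY {n : ℕ} {R : Type*} [CommRing R]
    (P : Polynomial (MvPolynomial (Fin n) R)) : Prop :=
  ∃ (Q : MvPolynomial (Fin n) R) (H : Polynomial (MvPolynomial (Fin n) R)),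
    P = (Polynomial.X - Polynomial.C Q) * H

/-- The canonical map `ℚ[X₁,…,Xₙ] → ℚ(X)[Y]/(F)`. -/
def structMap {n : ℕ} (F : Polynomial (MvPolynomial (Fin n) ℤ)) :
    MvPolynomial (Fin n) ℚ →+* AdjoinRoot (toFrac F) :=
  (algebraMap (RF n) (AdjoinRoot (toFrac F))).comp
    (algebraMap (MvPolynomial (Fin n) ℚ) (RF n))

/-- `z ∈ ℚ(X)[Y]/(F)` lies in the subfield `ℚ((Xᵢ)_{i≠j})`: it can be written
as a quotient of two polynomials not involving `Xⱼ`. -/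
def CoordMem {n : ℕ} (j : Fin n) (F : Polynomial (MvPolynomial (Fin n) ℤ))
    (z : AdjoinRoot (toFrac F)) : Prop :=
  ∃ a b : MvPolynomial (Fin n) ℚ,
    MvPolynomial.degreeOf j a = 0 ∧ MvPolynomial.degreeOf j b = 0 ∧
    structMap F b ≠ 0 ∧ z * structMap F b = structMap F a

/-- `z ∈ ℚ(X)[Y]/(F)` is algebraic over the subfield `ℚ((Xᵢ)_{i≠j})`. -/
def AlgOverCoord {n : ℕ} (j : Fin n) (F : Polynomial (MvPolynomial (Fin n) ℤ))
    (z : AdjoinRoot (toFrac F)) : Prop :=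
  ∃ P : Polynomial (AdjoinRoot (toFrac F)), P ≠ 0 ∧ (∀ k, CoordMem j F (P.coeff k)) ∧
    Polynomial.eval z P = 0

/-- Substitute `Xᵢ = xᵢ` for `i ∈ I` into `F`, over `ℚ̄`. -/
def substSome {n : ℕ} (I : Finset (Fin n)) (x : Fin n → ℚ)
    (F : Polynomial (MvPolynomial (Fin n) ℤ)) :
    Polynomial (MvPolynomial (Fin n) (AlgebraicClosure ℚ)) :=
  (toQ F).map
    ((MvPolynomial.aeval (R := ℚ) fun i =>
      if i ∈ I then MvPolynomial.C (algebraMap ℚ (AlgebraicClosure ℚ) (x i))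
      else MvPolynomial.X i).toRingHom)

/-- Substitute `Xᵢ = xᵢ` for all `i ≠ i₀` into `F`, over `ℚ̄`. -/
def substKeepFirst {n : ℕ} (i0 : Fin n) (x : {i : Fin n // i ≠ i0} → ℤ)
    (F : Polynomial (MvPolynomial (Fin n) ℤ)) :
    Polynomial (MvPolynomial (Fin n) (AlgebraicClosure ℚ)) :=
  F.map
    ((MvPolynomial.aeval (R := ℤ) fun i =>
      if h : i = i0 then (MvPolynomial.X i : MvPolynomial (Fin n) (AlgebraicClosure ℚ))
      else MvPolynomial.C ((x ⟨i, h⟩ : ℤ) : AlgebraicClosure ℚ)).toRingHom)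

/-- `‖L‖`: maximum absolute value of an entry of an integer matrix. -/
def matNorm {n : ℕ} (L : Matrix (Fin n) (Fin n) ℤ) : ℕ :=
  Finset.univ.sup fun p : Fin n × Fin n => (L p.1 p.2).natAbs

/-- The standard additive character `e_p(a) = exp(2πi a/p)` on `ZMod p`. -/
def eZp (p : ℕ) (a : ZMod p) : ℂ :=
  Complex.exp (2 * Real.pi * Complex.I * (a.val : ℂ) / (p : ℂ))

namespace NC

/-- generic bivariate monic polynomial -/
def bpoly {R : Type*} [CommRing R] (d e : ℕ) (c : Fin d × Fin (e+1) → R) : R[X][X] :=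
  X ^ d + ∑ q : Fin d × Fin (e+1), C (C (c q) * X ^ (q.2 : ℕ)) * X ^ (q.1 : ℕ)

/-- coefficient function -/
def cf {R : Type*} [CommRing R] (d e : ℕ) (f : R[X][X]) : Fin d × Fin (e+1) → R :=
  fun q => (f.coeff q.1).coeff q.2

lemma bpoly_deg_lt {R : Type*} [CommRing R] (d e : ℕ) (c : Fin d × Fin (e+1) → R) :
    (∑ q : Fin d × Fin (e+1), C (C (c q) * X ^ (q.2 : ℕ)) * X ^ (q.1 : ℕ) : R[X][X]).degree < d := by
  refine lt_of_le_of_lt (degree_sum_le _ _) ?_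
  refine (Finset.sup_lt_iff (WithBot.bot_lt_coe d)).2 ?_
  intro q _
  refine lt_of_le_of_lt (degree_C_mul_X_pow_le _ _) ?_
  exact WithBot.coe_lt_coe.2 q.1.2

lemma bpoly_monic {R : Type*} [CommRing R] (d e : ℕ) (c : Fin d × Fin (e+1) → R) :
    (bpoly d e c).Monic := monic_X_pow_add (bpoly_deg_lt d e c)

lemma bpoly_natDegree {R : Type*} [CommRing R] [Nontrivial R] (d e : ℕ)
    (c : Fin d × Fin (e+1) → R) : (bpoly d e c).natDegree = d := by
  unfold bpoly
  rw [natDegree_add_eq_left_of_degree_lt, natDegree_X_pow]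
  rw [degree_X_pow]; exact bpoly_deg_lt d e c

lemma bpoly_map {R S : Type*} [CommRing R] [CommRing S] (φ : R →+* S) (d e : ℕ)
    (c : Fin d × Fin (e+1) → R) :
    (bpoly d e c).map (mapRingHom φ) = bpoly d e (fun q => φ (c q)) := by
  simp [bpoly, Polynomial.map_add, Polynomial.map_sum]

lemma bpoly_cf {R : Type*} [CommRing R] (d e : ℕ) (f : R[X][X]) (hf : f.Monic)
    (hd : f.natDegree = d) (he : ∀ i, (f.coeff i).natDegree ≤ e) : bpoly d e (cf d e f) = f := by
  unfold bpoly cf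
  conv_rhs => rw [hf.as_sum, hd]
  congr 1
  rw [Fintype.sum_prod_type, ← Fin.sum_univ_eq_sum_range (fun i => C (f.coeff i) * X ^ i)]
  refine Finset.sum_congr rfl fun i _ => ?_
  dsimp only
  rw [← Finset.sum_mul, ← map_sum]
  congr 2
  conv_rhs => rw [as_sum_range' (f.coeff i) (e+1) (Nat.lt_succ_of_le (he i))]
  rw [← Fin.sum_univ_eq_sum_range (fun j => monomial j ((f.coeff i).coeff j))]
  simp [C_mul_X_pow_eq_monomial]

lemma coeff_coeff_swap' {R : Type*} [CommRing R] (p : R[X][X]) (i j : ℕ) :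
    ((Polynomial.Bivariate.swap p).coeff i).coeff j = (p.coeff j).coeff i := by
  induction p using Polynomial.induction_on' with
  | add p q hp hq => simp [hp, hq]
  | monomial n f =>
    induction f using Polynomial.induction_on' with
    | add p q hp hq => simp only [map_add, coeff_add, hp, hq]
    | monomial m r =>
      rw [Polynomial.Bivariate.swap_monomial_monomial]
      simp only [coeff_monomial]
      split_ifs <;> simp_all [coeff_monomial]

/-- Factor of monic of bounded t-degree has bounded t-degree. -/
lemma tdeg_factor {k : Type*} [Field k] (e : ℕ) (f g h : k[X][X]) (hf : f ≠ 0)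
    (he : ∀ i, (f.coeff i).natDegree ≤ e) (hgh : f = g * h) :
    ∀ i, (g.coeff i).natDegree ≤ e := by
  have key : ∀ p : k[X][X], (∀ i, (p.coeff i).natDegree ≤ e) ↔ (Polynomial.Bivariate.swap p).natDegree ≤ e := by
    intro p
    constructor
    · intro hp
      refine natDegree_le_iff_coeff_eq_zero.2 fun N hN => ?_
      ext i
      rw [coeff_coeff_swap', coeff_zero]
      exact coeff_eq_zero_of_natDegree_lt (lt_of_le_of_lt (hp i) hN)
    · intro hp i
      refine natDegree_le_iff_coeff_eq_zero.2 fun N hN => ?_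
      rw [← coeff_coeff_swap', coeff_eq_zero_of_natDegree_lt (lt_of_le_of_lt hp hN), coeff_zero]
  rw [key] at he ⊢
  have hg : g ≠ 0 := by rintro rfl; simp at hgh; exact hf hgh
  have hh : h ≠ 0 := by rintro rfl; simp at hgh; exact hf hgh
  rw [hgh, map_mul, natDegree_mul (by simpa using hg) (by simpa using hh)] at he
  omega


lemma exists_lift_algClosed {A B k : Type} [CommRing A] [CommRing B] [Algebra A B] [Field k]
    [IsAlgClosed k] [Algebra.IsIntegral A B] (φ : A →+* k)
    (hφ : RingHom.ker (algebraMap A B) ≤ RingHom.ker φ) :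
    ∃ ψ : B →+* k, ψ.comp (algebraMap A B) = φ := by
  obtain ⟨P, hPdef⟩ : ∃ P, P = RingHom.ker φ := ⟨_, rfl⟩
  haveI : P.IsPrime := hPdef ▸ RingHom.ker_isPrime φ
  obtain ⟨Q, -, hQ, hQP⟩ := Ideal.exists_ideal_over_prime_of_isIntegral (S := B) P ⊥
    (by rw [hPdef]; exact hφ)
  haveI : Q.LiesOver P := ⟨hQP.symm⟩
  letI : Algebra (A ⧸ P) k :=
    (Ideal.Quotient.lift P φ (fun a ha => by rwa [hPdef] at ha)).toAlgebra
  have hinj : Function.Injective (algebraMap (A ⧸ P) k) :=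
    RingHom.lift_injective_of_ker_le_ideal _ _ (le_of_eq hPdef.symm)
  haveI : FaithfulSMul (A ⧸ P) k := (faithfulSMul_iff_algebraMap_injective _ _).2 hinj
  haveI : Algebra.IsIntegral (A ⧸ P) (B ⧸ Q) := inferInstance
  haveI : Algebra.IsAlgebraic (A ⧸ P) (B ⧸ Q) := inferInstance
  have hinj2 : Function.Injective (algebraMap (A ⧸ P) (B ⧸ Q)) := FaithfulSMul.algebraMap_injective _ _
  haveI : Module.IsTorsionFree (A ⧸ P) (B ⧸ Q) := by
    exact (Module.isTorsionFree_iff_algebraMap_injective).2 hinj2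
  haveI : Module.IsTorsionFree (A ⧸ P) k := by
    exact (Module.isTorsionFree_iff_algebraMap_injective).2 hinj
  let L : (B ⧸ Q) →ₐ[A ⧸ P] k := IsAlgClosed.lift
  refine ⟨L.toRingHom.comp (Ideal.Quotient.mk Q), ?_⟩
  ext a
  exact L.commutes (Ideal.Quotient.mk P a)

lemma cf_bpoly {R : Type*} [CommRing R] (d e : ℕ) (c : Fin d × Fin (e+1) → R)
    (q : Fin d × Fin (e+1)) : ((bpoly d e c).coeff q.1).coeff q.2 = c q := by
  classical
  obtain ⟨i, j⟩ := q
  have h : ∀ x : Fin d × Fin (e+1), ((C (C (c x) * X ^ (x.2 : ℕ)) * X ^ (x.1 : ℕ) : R[X][X]).coeff i).coeff j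
      = if x = (i, j) then c x else 0 := by
    rintro ⟨a, b⟩
    rw [coeff_C_mul, coeff_X_pow, mul_ite, mul_one, mul_zero]
    by_cases h1 : (i : ℕ) = a
    · rw [if_pos h1, coeff_C_mul, coeff_X_pow, mul_ite, mul_one, mul_zero]
      have h1' : a = i := Fin.ext h1.symm
      by_cases h2 : (j : ℕ) = b
      · have h2' : b = j := Fin.ext h2.symm
        simp [h1', h2']
      · rw [if_neg h2, if_neg]
        rintro ⟨⟩; exact h2 rfl
    · rw [if_neg h1, if_neg]
      · simp
      · rintro ⟨⟩; exact h1 rfl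
  rw [bpoly, coeff_add, coeff_X_pow, if_neg (by have := i.2; simp; omega), zero_add, finsetSum_coeff,
    finsetSum_coeff, Finset.sum_congr rfl (fun x _ => h x)]
  simp

section
attribute [local instance] Polynomial.algebra
lemma hgi_aux {R B : Type} [CommRing R] [CommRing B] [Algebra R B] (f : R[X][X]) (g' : B[X][X])
    (hf : f.Monic) (hg' : g'.Monic)
    (hdvd : g' ∣ f.map (mapRingHom (algebraMap R B))) (i j : ℕ) :
    IsIntegral R ((g'.coeff i).coeff j) := by
  have h1 := Polynomial.isIntegral_coeff_of_dvd (R := R[X]) (S := B[X]) f g' hf hg' hdvd i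
  exact Polynomial.isIntegral_iff_isIntegral_coeff.1 h1 j
end
section core
variable {R P : Type} [CommRing R] [CommRing P] [Algebra R P] (f : R[X][X]) (g h : P[X][X])

def D₀ : P[X][X] := f.map (mapRingHom (algebraMap R P)) - g * h
def JJ : Ideal P := Ideal.span (Set.range fun q : ℕ × ℕ => ((D₀ f g h).coeff q.1).coeff q.2)

lemma hfac : f.map (mapRingHom (algebraMap R (P ⧸ JJ f g h))) =
      g.map (mapRingHom (Ideal.Quotient.mk (JJ f g h))) *
      h.map (mapRingHom (Ideal.Quotient.mk (JJ f g h))) := by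
  rw [← Polynomial.map_mul]
  have h1 : f.map (mapRingHom (algebraMap R (P ⧸ JJ f g h))) =
      (f.map (mapRingHom (algebraMap R P))).map
        (mapRingHom (Ideal.Quotient.mk (JJ f g h))) := by
    rw [Polynomial.map_map, mapRingHom_comp]; rfl
  rw [h1, ← sub_eq_zero, ← Polynomial.map_sub]
  refine Polynomial.ext fun i => Polynomial.ext fun j => ?_
  rw [coeff_map, coe_mapRingHom, coeff_map, coeff_zero, coeff_zero]
  exact Ideal.Quotient.eq_zero_iff_mem.2 (Ideal.subset_span ⟨(i, j), rfl⟩)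

lemma hh_integral (hf : f.Monic) (hg : g.Monic) (hh : h.Monic)
    (hgen : Algebra.adjoin R ((Set.range fun q : ℕ × ℕ => (g.coeff q.1).coeff q.2) ∪
      (Set.range fun q : ℕ × ℕ => (h.coeff q.1).coeff q.2)) = ⊤) :
    Algebra.IsIntegral R (P ⧸ JJ f g h) := by
  have hgi := fun (g' : (P ⧸ JJ f g h)[X][X]) hg' => hgi_aux f g' hf hg'
  have hX : ∀ q ∈ ((Set.range fun q : ℕ × ℕ => (g.coeff q.1).coeff q.2) ∪
      (Set.range fun q : ℕ × ℕ => (h.coeff q.1).coeff q.2)),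
      IsIntegral R (Ideal.Quotient.mk (JJ f g h) q) := by
    rintro _ (⟨q, rfl⟩ | ⟨q, rfl⟩)
    · have := hgi _ (hg.map _) ⟨_, hfac f g h⟩ q.1 q.2
      rwa [coeff_map, coe_mapRingHom, coeff_map] at this
    · have := hgi _ (hh.map _) ⟨_, by rw [hfac f g h]; exact mul_comm _ (h.map (mapRingHom (Ideal.Quotient.mk (JJ f g h))))⟩ q.1 q.2
      rwa [coeff_map, coe_mapRingHom, coeff_map] at this
  constructor
  intro x
  obtain ⟨x, rfl⟩ := Ideal.Quotient.mk_surjective x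
  have hx : x ∈ Algebra.adjoin R ((Set.range fun q : ℕ × ℕ => (g.coeff q.1).coeff q.2) ∪
      (Set.range fun q : ℕ × ℕ => (h.coeff q.1).coeff q.2)) := by rw [hgen]; trivial
  induction hx using Algebra.adjoin_induction with
  | mem x hx => exact hX x hx
  | algebraMap r => exact isIntegral_algebraMap (R := R) (A := P ⧸ JJ f g h) (x := r)
  | add x y _ _ hx hy => rw [map_add]; exact hx.add hy
  | mul x y _ _ hx hy => rw [map_mul]; exact hx.mul hy

lemma core (hf : f.Monic) (hg : g.Monic) (hh : h.Monic)
    (hgen : Algebra.adjoin R ((Set.range fun q : ℕ × ℕ => (g.coeff q.1).coeff q.2) ∪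
      (Set.range fun q : ℕ × ℕ => (h.coeff q.1).coeff q.2)) = ⊤)
    {k : Type} [Field k] [IsAlgClosed k] (φ : R →+* k) :
    (∃ ψ : P →+* k, ψ.comp (algebraMap R P) = φ ∧
      f.map (mapRingHom φ) = g.map (mapRingHom ψ) * h.map (mapRingHom ψ)) ↔
    RingHom.ker (algebraMap R (P ⧸ JJ f g h)) ≤ RingHom.ker φ := by
  constructor
  · rintro ⟨ψ, hψ, hfa⟩
    have hD : (D₀ f g h).map (mapRingHom ψ) = 0 := by
      rw [D₀, Polynomial.map_sub, Polynomial.map_mul, Polynomial.map_map, mapRingHom_comp, hψ,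
        hfa, sub_self]
    have hJ : JJ f g h ≤ RingHom.ker ψ := by
      rw [JJ, Ideal.span_le]
      rintro _ ⟨⟨i, j⟩, rfl⟩
      have h1 : (((D₀ f g h).map (mapRingHom ψ)).coeff i).coeff j = 0 := by rw [hD]; simp
      rw [coeff_map, coe_mapRingHom, coeff_map] at h1
      exact h1
    intro a ha
    have h1 : algebraMap R P a ∈ JJ f g h := Ideal.Quotient.eq_zero_iff_mem.1 ha
    have h2 : (ψ.comp (algebraMap R P)) a = 0 := hJ h1
    rwa [hψ] at h2
  · intro hI
    have := hh_integral f g h hf hg hh hgen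
    obtain ⟨ψ, hψ⟩ := exists_lift_algClosed φ hI
    refine ⟨ψ.comp (Ideal.Quotient.mk _), by rw [← hψ]; rfl, ?_⟩
    have h2 := congrArg (Polynomial.map (mapRingHom ψ)) (hfac f g h)
    rw [Polynomial.map_mul, Polynomial.map_map, Polynomial.map_map, Polynomial.map_map,
      mapRingHom_comp, mapRingHom_comp, hψ] at h2
    exact h2
end core

theorem noether_closed (d e d₁ : ℕ) : ∃ S : Finset (MvPolynomial (Fin d × Fin (e+1)) ℤ),
    ∀ (k : Type) [Field k] [IsAlgClosed k] (f : k[X][X]), f.Monic → f.natDegree = d →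
      (∀ i, (f.coeff i).natDegree ≤ e) →
      ((∃ g h : k[X][X], g.Monic ∧ h.Monic ∧ g.natDegree = d₁ ∧ f = g * h) ↔
        ∀ Φ ∈ S, MvPolynomial.aeval (cf d e f) Φ = 0) := by
  classical
  rcases lt_or_ge d d₁ with hlt | hle
  · refine ⟨{1}, fun k _ _ f hf hd he => ?_⟩
    simp only [Finset.mem_singleton, forall_eq, map_one, one_ne_zero, iff_false]
    rintro ⟨g, h, hg, hh, hgd, rfl⟩
    rw [hg.natDegree_mul hh] at hd
    omega
  obtain ⟨d₂, hd₂⟩ := Nat.exists_eq_add_of_le hle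
  let f₀ : (MvPolynomial (Fin d × Fin (e+1)) ℤ)[X][X] := bpoly d e MvPolynomial.X
  let g₀ : (MvPolynomial ((Fin d₁ × Fin (e+1)) ⊕ (Fin d₂ × Fin (e+1)))
    (MvPolynomial (Fin d × Fin (e+1)) ℤ))[X][X] := bpoly d₁ e fun q => MvPolynomial.X (Sum.inl q)
  let h₀ : (MvPolynomial ((Fin d₁ × Fin (e+1)) ⊕ (Fin d₂ × Fin (e+1)))
    (MvPolynomial (Fin d × Fin (e+1)) ℤ))[X][X] := bpoly d₂ e fun q => MvPolynomial.X (Sum.inr q)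
  have hgen : Algebra.adjoin (MvPolynomial (Fin d × Fin (e+1)) ℤ)
      ((Set.range fun q : ℕ × ℕ => (g₀.coeff q.1).coeff q.2) ∪
      (Set.range fun q : ℕ × ℕ => (h₀.coeff q.1).coeff q.2)) = ⊤ := by
    rw [eq_top_iff, ← MvPolynomial.adjoin_range_X]
    refine Algebra.adjoin_mono ?_
    rintro _ ⟨q | q, rfl⟩
    · exact Or.inl ⟨(q.1, q.2), cf_bpoly d₁ e _ q⟩
    · exact Or.inr ⟨(q.1, q.2), cf_bpoly d₂ e _ q⟩
  have hcore := fun (k : Type) [Field k] [IsAlgClosed k] (φ : MvPolynomial (Fin d × Fin (e+1)) ℤ →+* k) =>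
    core f₀ g₀ h₀ (bpoly_monic _ _ _) (bpoly_monic _ _ _) (bpoly_monic _ _ _) hgen φ
  obtain ⟨I, hIdef⟩ : ∃ I, I = RingHom.ker (algebraMap (MvPolynomial (Fin d × Fin (e+1)) ℤ) (_ ⧸ JJ f₀ g₀ h₀)) := ⟨_, rfl⟩
  rw [← hIdef] at hcore
  obtain ⟨S, hS⟩ : I.FG := IsNoetherian.noetherian I
  refine ⟨S, fun k _ _ f hf hd he => ?_⟩
  have hcf := bpoly_cf d e f hf hd he
  obtain ⟨φ, hφ⟩ : ∃ φ : MvPolynomial (Fin d × Fin (e+1)) ℤ →+* k,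
    φ = (MvPolynomial.aeval (cf d e f)).toRingHom := ⟨_, rfl⟩
  have hφX : ∀ q, φ (MvPolynomial.X q) = cf d e f q := by
    intro q; rw [hφ]; exact MvPolynomial.aeval_X _ _
  have hf0 : f₀.map (mapRingHom φ) = f := by
    rw [bpoly_map]
    conv_rhs => rw [← hcf]
    simp only [hφX]
  have hker : (∀ Φ ∈ S, MvPolynomial.aeval (cf d e f) Φ = 0) ↔ I ≤ RingHom.ker φ := by
    rw [← hS, Ideal.span_le, hφ]; rfl
  rw [hker, ← hcore k φ, hf0]
  constructor
  · rintro ⟨g, h, hg, hh, hgd, hgh⟩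
    have hhd : h.natDegree = d₂ := by
      rw [hgh, hg.natDegree_mul hh] at hd
      omega
    have hge := tdeg_factor e f g h hf.ne_zero he hgh
    have hhe := tdeg_factor e f h g hf.ne_zero he (by rw [hgh, mul_comm])
    have hcg := bpoly_cf d₁ e g hg hgd hge
    have hch := bpoly_cf d₂ e h hh hhd hhe
    refine ⟨MvPolynomial.eval₂Hom φ (Sum.elim (cf d₁ e g) (cf d₂ e h)), ?_, ?_⟩
    · rw [MvPolynomial.algebraMap_eq]; exact MvPolynomial.eval₂Hom_comp_C _ _
    · rw [bpoly_map, bpoly_map]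
      simp only [MvPolynomial.eval₂Hom_X', Sum.elim_inl, Sum.elim_inr]
      exact hgh.trans (congrArg₂ _ hcg.symm hch.symm)
  · rintro ⟨ψ, -, hfa⟩
    refine ⟨_, _, (bpoly_monic d₁ e _).map _, (bpoly_monic d₂ e _).map _, ?_, hfa⟩
    rw [bpoly_map, bpoly_natDegree]

end NC

namespace St

/-- weight predicate: t has weight 1, Y has weight e -/
def wt {L : Type*} [CommRing L] (e w : ℕ) (q : L[X][X]) : Prop :=
  ∀ i j, w < j + e * i → (q.coeff i).coeff j = 0

section
variable {L : Type*} [CommRing L] {e w w' : ℕ} {q q' : L[X][X]}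

lemma wt.mono (h : wt e w q) (hw : w ≤ w') : wt e w' q := fun i j hij => h i j (by omega)
lemma wt_zero : wt e w (0 : L[X][X]) := fun i j _ => by simp
lemma wt.add (h : wt e w q) (h' : wt e w q') : wt e w (q + q') := fun i j hij => by
  simp [h i j hij, h' i j hij]
lemma wt.sub (h : wt e w q) (h' : wt e w q') : wt e w (q - q') := fun i j hij => by
  simp [h i j hij, h' i j hij]
lemma wt_sum {ι : Type*} (s : Finset ι) (g : ι → L[X][X]) (h : ∀ i ∈ s, wt e w (g i)) :
    wt e w (∑ i ∈ s, g i) := by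
  classical
  induction s using Finset.induction_on with
  | empty => simpa using wt_zero
  | insert a s ha ih =>
    rw [Finset.sum_insert ha]
    exact (h a (by simp)).add (ih fun i hi => h i (by simp [hi]))
lemma wt.mul (h : wt e w q) (h' : wt e w' q') : wt e (w + w') (q * q') := by
  intro i j hij
  rw [coeff_mul, finsetSum_coeff]
  refine Finset.sum_eq_zero fun a ha => ?_
  rw [coeff_mul]
  refine Finset.sum_eq_zero fun b hb => ?_
  rw [Finset.HasAntidiagonal.mem_antidiagonal] at ha hb
  by_cases h1 : w < b.1 + e * a.1
  · rw [h _ _ h1, zero_mul]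
  · rw [h' a.2 b.2, mul_zero]
    have : e * i = e * a.1 + e * a.2 := by rw [← ha]; ring
    omega
lemma wt_Y : wt e e (X : L[X][X]) := by
  intro i j hij
  rw [coeff_X]
  split_ifs with h
  · subst h
    rw [coeff_one, if_neg (by omega)]
  · simp
lemma wt_C {a : L[X]} (h : a.natDegree ≤ w) : wt e w (C a) := by
  intro i j hij
  rw [coeff_C]
  split_ifs with h'
  · subst h'
    exact coeff_eq_zero_of_natDegree_lt (by omega)
  · simp
lemma wt_one : wt e 0 (1 : L[X][X]) := by
  rw [← C_1]; exact wt_C (by simp)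
lemma wt.pow (h : wt e w q) (n : ℕ) : wt e (n * w) (q ^ n) := by
  induction n with
  | zero => simpa using wt_one
  | succ n ih => rw [pow_succ, Nat.succ_mul]; exact ih.mul h

lemma wt_of_deg (he : ∀ i, (q.coeff i).natDegree ≤ w') {d : ℕ} (hd : q.natDegree ≤ d) :
    wt e (w' + e * d) q := by
  intro i j hij
  by_cases hi : d < i
  · have h0 : q.coeff i = 0 := coeff_eq_zero_of_natDegree_lt (by omega)
    rw [h0]; simp
  · refine coeff_eq_zero_of_natDegree_lt ?_
    have := he i
    have : e * i ≤ e * d := Nat.mul_le_mul_left _ (by omega)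
    omega

lemma wt_f {f : L[X][X]} (hf : f.Monic) (he : ∀ i, (f.coeff i).natDegree ≤ e) :
    wt e (e * f.natDegree) f := by
  intro i j hij
  rcases lt_trichotomy i f.natDegree with h | h | h
  · refine coeff_eq_zero_of_natDegree_lt (lt_of_le_of_lt (he i) ?_)
    have : e * (i + 1) ≤ e * f.natDegree := Nat.mul_le_mul_left _ h
    rw [mul_add] at this
    omega
  · have : f.coeff i = 1 := by rw [h]; exact hf
    rw [this, coeff_one, if_neg]
    subst h; omega
  · rw [coeff_eq_zero_of_natDegree_lt h]; simp

lemma wt_modByMonic {f : L[X][X]} (hf : f.Monic) (he : ∀ i, (f.coeff i).natDegree ≤ e)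
    (q : L[X][X]) (hq : wt e w q) : wt e w (q %ₘ f) := by
  rcases subsingleton_or_nontrivial L with hL | hL
  · intro i j _; exact Subsingleton.elim _ _
  induction hN : q.natDegree using Nat.strong_induction_on generalizing q with
  | _ N ih =>
    by_cases hlt : q.degree < f.degree
    · rwa [(modByMonic_eq_self_iff hf).2 hlt]
    · push Not at hlt
      have hq0 : q ≠ 0 := by
        rintro rfl
        rw [degree_zero, le_bot_iff, degree_eq_bot] at hlt
        exact hf.ne_zero hlt
      have hle : f.natDegree ≤ q.natDegree := natDegree_le_natDegree hlt
      have hdl := div_wf_lemma ⟨hlt, hq0⟩ hf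
      set s := C q.leadingCoeff * X ^ (q.natDegree - f.natDegree) with hs
      have hmod : (q - f * s) %ₘ f = q %ₘ f := by
        rw [sub_modByMonic, (modByMonic_eq_zero_iff_dvd hf).2 ⟨_, rfl⟩, sub_zero]
      have hwt : wt e w (f * s) := by
        intro i j hij
        by_cases hz : q.leadingCoeff = 0
        · rw [hs, hz]; simp
        have h1 : q.leadingCoeff.natDegree + e * q.natDegree ≤ w := by
          by_contra hcon
          push Not at hcon
          have := hq q.natDegree q.leadingCoeff.natDegree hcon
          rw [coeff_natDegree, coeff_natDegree, leadingCoeff_eq_zero] at this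
          exact hz this
        have h2 : wt e (e * f.natDegree + (q.leadingCoeff.natDegree + (q.natDegree - f.natDegree) * e)) (f * s) :=
          (wt_f hf he).mul ((wt_C le_rfl).mul (wt_Y.pow _))
        refine h2.mono ?_ i j hij
        have : e * q.natDegree = e * f.natDegree + (q.natDegree - f.natDegree) * e := by
          rw [mul_comm _ e, ← mul_add]; congr 1; omega
        omega
      rw [← hmod]
      by_cases h0 : q - f * s = 0
      · rw [h0, zero_modByMonic]; exact wt_zero
      · refine ih _ ?_ _ (hq.sub hwt) rfl
        rw [← hN]
        exact natDegree_lt_natDegree h0 hdl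
end

lemma natDegree_det_le {R : Type*} [CommRing R] {ι : Type*} [Fintype ι] [DecidableEq ι]
    (M : Matrix ι ι R[X]) (b : ℕ) (h : ∀ i j, (M i j).natDegree ≤ b) :
    M.det.natDegree ≤ Fintype.card ι * b := by
  rw [Matrix.det_apply]
  refine natDegree_sum_le_of_forall_le _ _ fun σ _ => ?_
  refine (natDegree_smul_le _ _).trans ?_
  refine (natDegree_prod_le _ _).trans ?_
  refine (Finset.sum_le_sum fun i _ => h (σ i) i).trans ?_
  simp

lemma norm_natDegree_le {L : Type*} [Field L] {e w : ℕ} {f : L[X][X]} (hf : f.Monic)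
    (he : ∀ i, (f.coeff i).natDegree ≤ e) (q : L[X][X]) (hq : wt e w q) :
    (Algebra.norm L[X] (AdjoinRoot.mk f q)).natDegree ≤ f.natDegree * (w + e * f.natDegree) := by
  classical
  rw [Algebra.norm_eq_matrix_det (AdjoinRoot.powerBasisAux' hf)]
  refine (natDegree_det_le _ (w + e * f.natDegree) ?_).trans (by simp)
  intro i j
  rw [Algebra.leftMulMatrix_eq_repr_mul]
  have hb : AdjoinRoot.powerBasisAux' hf j = AdjoinRoot.root f ^ (j : ℕ) :=
    (AdjoinRoot.powerBasis' hf).basis_eq_pow j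
  have : AdjoinRoot.mk f q * AdjoinRoot.root f ^ (j : ℕ) =
      AdjoinRoot.mk f (q * X ^ (j : ℕ)) := by simp
  rw [hb, this]
  rw [AdjoinRoot.powerBasisAux'_repr_apply_to_fun, AdjoinRoot.modByMonicHom_mk]
  have h1 : wt e (w + j * e) (q * X ^ (j : ℕ)) := hq.mul (wt_Y.pow _)
  have h2 := wt_modByMonic hf he _ h1
  refine natDegree_le_iff_coeff_eq_zero.2 fun N hN => h2 _ _ ?_
  have hj : (j : ℕ) < f.natDegree := j.2
  have : (j : ℕ) * e ≤ e * f.natDegree := by rw [mul_comm]; exact Nat.mul_le_mul_left _ hj.le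
  omega

lemma dvd_norm' {R S : Type*} [CommRing R] [CommRing S] [Algebra R S] [Module.Free R S] [Module.Finite R S]
    (x : S) : x ∣ algebraMap R S (Algebra.norm R x) := by
  rcases subsingleton_or_nontrivial R with hR | hR
  · have : Subsingleton S := Module.subsingleton R S
    exact ⟨0, Subsingleton.elim _ _⟩
  have h := LinearMap.aeval_self_charpoly (Algebra.lmul R S x)
  rw [aeval_algHom_apply] at h
  have h2 : aeval x (Algebra.lmul R S x).charpoly = 0 := by
    have := LinearMap.congr_fun h 1
    simpa using this
  rw [← X_mul_divX_add (Algebra.lmul R S x).charpoly] at h2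
  simp only [map_add, map_mul, aeval_X, aeval_C] at h2
  rw [Algebra.norm_apply, LinearMap.det_eq_sign_charpoly_coeff, map_mul]
  refine Dvd.dvd.mul_left ?_ _
  rw [add_comm, add_eq_zero_iff_eq_neg] at h2
  change x ∣ algebraMap R S ((Algebra.lmul R S x).charpoly.coeff 0)
  rw [h2]
  exact (dvd_neg.2 (dvd_mul_right _ _))

end St

namespace St

section ord
variable {K P : Type*} [Field K] [CommRing P] [Algebra K P] (D : Derivation K P P) (ev : P →ₐ[K] K)

/-- vanishing to order `m` along the derivation -/
def ord (m : ℕ) (a : P) : Prop := ∀ j < m, ev (D^[j] a) = 0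

variable {D ev} {m : ℕ} {a b s : P}

lemma ord_zero : ord D ev 0 a := fun j hj => absurd hj (by omega)
lemma ord_succ : ord D ev (m+1) a ↔ ev a = 0 ∧ ord D ev m (D a) := by
  constructor
  · intro h
    exact ⟨h 0 (by omega), fun j hj => by
      have := h (j+1) (by omega)
      rwa [Function.iterate_succ_apply] at this⟩
  · rintro ⟨h1, h2⟩ j hj
    cases j with
    | zero => exact h1
    | succ j => rw [Function.iterate_succ_apply]; exact h2 j (by omega)
lemma ord.mono {m' : ℕ} (h : ord D ev m a) (hm : m' ≤ m) : ord D ev m' a := fun j hj => h j (by omega)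
lemma iter_add (j : ℕ) : D^[j] (a + b) = D^[j] a + D^[j] b := iterate_map_add D j a b
lemma ord.add (h : ord D ev m a) (h' : ord D ev m b) : ord D ev m (a+b) := fun j hj => by
  rw [iter_add, map_add, h j hj, h' j hj, add_zero]
lemma ord.mul (h : ord D ev m a) (b : P) : ord D ev m (a*b) := by
  induction m generalizing a b with
  | zero => exact ord_zero
  | succ m ih =>
    rw [ord_succ, D.leibniz, map_mul, (ord_succ.1 h).1, zero_mul]
    refine ⟨rfl, (ih (h.mono (by omega)) _).add ?_⟩
    rw [smul_eq_mul, mul_comm]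
    exact ih (ord_succ.1 h).2 _
lemma ord.smul_mul (hs : ev s = 0) (h : ord D ev m a) : ord D ev (m+1) (s*a) := by
  induction m generalizing a with
  | zero => exact ord_succ.2 ⟨by rw [map_mul, hs, zero_mul], ord_zero⟩
  | succ m ih =>
    rw [ord_succ, D.leibniz, map_mul, hs, zero_mul]
    exact ⟨rfl, (ih (ord_succ.1 h).2).add (h.mul _)⟩
lemma ord_pow_mul (hs : ev s = 0) (m : ℕ) (b : P) : ord D ev m (s^m*b) := by
  induction m with
  | zero => exact ord_zero
  | succ m ih => rw [pow_succ', mul_assoc]; exact ord.smul_mul hs ih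
lemma ord.lead (h : ord D ev m a) (b : P) : ev (D^[m] (a*b)) = ev (D^[m] a) * ev b := by
  induction m generalizing a b with
  | zero => simp
  | succ m ih =>
    rw [Function.iterate_succ_apply, D.leibniz, iter_add, map_add, smul_eq_mul, smul_eq_mul,
      (h.mul _) m (by omega), zero_add, mul_comm, ih (ord_succ.1 h).2, Function.iterate_succ_apply]
lemma ord.lead_s (hs : ev s = 0) (h : ord D ev m a) :
    ev (D^[m+1] (s*a)) = (m+1) * ev (D s) * ev (D^[m] a) := by
  induction m generalizing a with
  | zero => simp [D.leibniz, hs, mul_comm]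
  | succ m ih =>
    rw [Function.iterate_succ_apply, D.leibniz, iter_add, map_add, smul_eq_mul, smul_eq_mul,
      h.lead, ih (ord_succ.1 h).2, ← Function.iterate_succ_apply]
    push_cast; ring
lemma lead_pow (hs : ev s = 0) (m : ℕ) : ev (D^[m] (s^m)) = m.factorial * ev (D s)^m := by
  induction m with
  | zero => simp
  | succ m ih =>
    rw [pow_succ', ord.lead_s hs (by simpa using ord_pow_mul hs m 1), ih, Nat.factorial_succ]
    push_cast; ring
end ord

lemma indep {K P : Type*} [Field K] [CommRing P] [Algebra K P] (D : Derivation K P P)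
    {I : Type*} [Fintype I] [DecidableEq I] (ev : I → P →ₐ[K] K) (J : Ideal P) (m0 : ℕ)
    (hJ : ∀ a ∈ J, ∀ i, ord D (ev i) m0 a) (s : I → P) (hs : ∀ i, ev i (s i) = 0)
    (hs' : ∀ i, ev i (D (s i)) ≠ 0) (l : I → I → P) (hl : ∀ i j, i ≠ j → ev j (l i j) = 0)
    (hl' : ∀ i j, i ≠ j → ev i (l i j) ≠ 0) (hm : ∀ j < m0, (j.factorial : K) ≠ 0) :
    LinearIndependent K (fun q : I × Fin m0 => Ideal.Quotient.mkₐ K J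
      (s q.1 ^ (q.2 : ℕ) * ∏ j ∈ Finset.univ.erase q.1, l q.1 j ^ m0)) := by
  rw [Fintype.linearIndependent_iff]
  intro c hc
  simp only [← map_smul] at hc
  rw [← map_sum] at hc
  rw [Ideal.Quotient.mkₐ_eq_mk, Ideal.Quotient.eq_zero_iff_mem] at hc
  set E : I × Fin m0 → P := fun q => s q.1 ^ (q.2 : ℕ) * ∏ j ∈ Finset.univ.erase q.1, l q.1 j ^ m0 with hE
  have hoth : ∀ (i : I) (q : I × Fin m0), q.1 ≠ i → ord D (ev i) m0 (E q) := by
    intro i q hq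
    have : i ∈ Finset.univ.erase q.1 := by simp [Ne.symm hq]
    simp only [hE]
    rw [← Finset.mul_prod_erase _ _ this, mul_left_comm]
    exact ord_pow_mul (hl _ _ hq) _ _
  have key : ∀ (j : ℕ) (i : I) (hj : j < m0), c (i, ⟨j, hj⟩) = 0 := by
    intro j i
    induction j using Nat.strong_induction_on with
    | _ j ih =>
      intro hj
      have h1 := hJ _ hc i j hj
      have h2 : ev i (D^[j] (∑ q, c q • E q)) = ∑ q, c q * ev i (D^[j] (E q)) := by
        have : ∀ x, D^[j] x = ((D : P →ₗ[K] P)^j) x := by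
          intro x; rw [Module.End.pow_apply]; rfl
        simp only [this, map_sum, map_smul, smul_eq_mul]
      rw [h2, Finset.sum_eq_single (i, ⟨j, hj⟩)] at h1
      · rcases mul_eq_zero.1 h1 with h | h
        · exact h
        · exfalso
          simp only [hE] at h
          rw [(by simpa using ord_pow_mul (hs i) j 1 : ord D (ev i) j (s i ^ j)).lead,
            lead_pow (hs i), map_prod] at h
          simp only [map_pow] at h
          refine (mul_ne_zero (mul_ne_zero (hm j hj) (pow_ne_zero _ (hs' i))) ?_) h
          refine Finset.prod_ne_zero_iff.2 fun k hk => pow_ne_zero _ (hl' _ _ ?_)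
          simp at hk; exact Ne.symm hk
      · rintro ⟨i', j'⟩ _ hne
        by_cases hi : i' = i
        · subst hi
          rcases lt_trichotomy (j' : ℕ) j with h | h | h
          · rw [ih _ h j'.2, zero_mul]
          · exact absurd (by ext <;> simp [h]) hne
          · rw [(ord_pow_mul (hs i') (j' : ℕ) _) j h, mul_zero]
        · rw [hoth i (i', j') hi j hj, mul_zero]
      · simp
  rintro ⟨i, j⟩
  exact key j i j.2

section biv
variable {K : Type} [Field K]

/-- coefficientwise derivative -/
def Dt : Derivation K K[X][X] K[X][X] :=
  ((PolynomialModule.equivPolynomialSelf : PolynomialModule K[X] K[X] ≃ₗ[K[X][X]] K[X][X]).toLinearMap).compDer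
    ((derivative' : Derivation K K[X] K[X]).mapCoeffs)

lemma Dt_coeff (q : K[X][X]) (i : ℕ) : (Dt q).coeff i = derivative (q.coeff i) := by
  rfl

def DY : Derivation K K[X][X] K[X][X] := (derivative' : Derivation K[X] K[X][X] K[X][X]).restrictScalars K

lemma DY_apply (q : K[X][X]) : DY q = derivative q := rfl

/-- the derivation killing `f` -/
def Dd (f : K[X][X]) : Derivation K K[X][X] K[X][X] := derivative f • Dt - Dt f • DY

lemma Dd_apply (f q : K[X][X]) : Dd f q = derivative f * Dt q - Dt f * derivative q := rfl

lemma Dd_self (f : K[X][X]) : Dd f f = 0 := by rw [Dd_apply]; ring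

def evA (x y : K) : K[X][X] →ₐ[K] K :=
  (aeval x : K[X] →ₐ[K] K).comp ((aeval (C y : K[X]) : K[X][X] →ₐ[K[X]] K[X]).restrictScalars K)

lemma evA_apply (x y : K) (q : K[X][X]) : evA x y q = evalEval x y q := by
  simp [evA, evalEval, coe_aeval_eq_eval]

lemma Dt_C (a : K[X]) : Dt (C a) = C (derivative a) := by
  ext1 i
  rw [Dt_coeff, coeff_C, coeff_C]; split_ifs <;> simp

lemma Dd_t (f : K[X][X]) (x : K) : Dd f (C (X - C x)) = derivative f := by
  rw [Dd_apply, Dt_C]; simp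

lemma wt_Dt {e w : ℕ} {q : K[X][X]} (h : wt e w q) : wt e w (Dt q) := by
  intro i j hij
  rw [Dt_coeff, coeff_derivative, h i (j+1) (by omega), zero_mul]
lemma wt_DY {e w : ℕ} {q : K[X][X]} (h : wt e w q) : wt e w (derivative q) := by
  intro i j hij
  rw [coeff_derivative]
  have : (q.coeff (i+1) * ((i:K[X])+1)).coeff j = (q.coeff (i+1)).coeff j * ((i:K)+1) := by
    have h2 : ((i:K[X])+1) = C ((i:K)+1) := by simp
    rw [h2, coeff_mul_C]
  rw [this, h (i+1) j (by rw [mul_add]; omega), zero_mul]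
lemma wt_Dd {e w w' : ℕ} {q f : K[X][X]} (hf : wt e w' f) (h : wt e w q) : wt e (w' + w) (Dd f q) := by
  rw [Dd_apply]
  exact ((wt_DY hf).mul (wt_Dt h)).sub ((wt_Dt hf).mul (wt_DY h))
lemma wt_Dd_iter {e w w' : ℕ} {q f : K[X][X]} (hf : wt e w' f) (h : wt e w q) (j : ℕ) :
    wt e (j * w' + w) ((Dd f)^[j] q) := by
  induction j with
  | zero => simpa using h
  | succ j ih =>
    rw [Function.iterate_succ_apply']
    exact (wt_Dd hf ih).mono (by rw [Nat.succ_mul]; omega)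

lemma Dd_iter_mul_self (f q : K[X][X]) (j : ℕ) : (Dd f)^[j] (f * q) = f * (Dd f)^[j] q := by
  induction j with
  | zero => rfl
  | succ j ih =>
    rw [Function.iterate_succ_apply', ih, (Dd f).leibniz, Dd_self, smul_zero, add_zero,
      Function.iterate_succ_apply', smul_eq_mul]

lemma zero_count {e w m0 : ℕ} {f : K[X][X]} (hf : f.Monic) (he : ∀ i, (f.coeff i).natDegree ≤ e)
    (hirr : Irreducible f) (Ψ : K[X][X]) (hw : wt e w Ψ) (hΨ : ¬ f ∣ Ψ) (W : Finset (K × K))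
    (hW : ∀ q ∈ W, evA q.1 q.2 f = 0 ∧ evA q.1 q.2 (derivative f) ≠ 0)
    (ho : ∀ q ∈ W, ord (Dd f) (evA q.1 q.2) m0 Ψ)
    (hm : ∀ j < m0, (j.factorial : K) ≠ 0) :
    m0 * W.card ≤ f.natDegree * (w + e * f.natDegree) := by
  classical
  have hp : Prime f := hirr.prime
  haveI : IsDomain (AdjoinRoot f) := AdjoinRoot.isDomain_of_prime hp
  refine le_trans ?_ (norm_natDegree_le hf he Ψ hw)
  have hΨ0 : AdjoinRoot.mk f Ψ ≠ 0 := by rwa [Ne, AdjoinRoot.mk_eq_zero]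
  rw [← finrank_quotient_span_eq_natDegree_norm (AdjoinRoot.powerBasisAux' hf) hΨ0]
  set J : Ideal K[X][X] := Ideal.span {f, Ψ}
  set l : W → W → K[X][X] := fun i j => if i.1.1 = j.1.1 then X - C (C j.1.2) else C (X - C j.1.1)
  have hli := indep (Dd f) (I := W) (fun i => evA i.1.1 i.1.2) J m0 ?_
    (fun i => C (X - C i.1.1)) ?_ ?_ l ?_ ?_ hm
  rotate_left
  · intro a ha i
    obtain ⟨u, v, rfl⟩ := Ideal.mem_span_pair.1 ha
    refine ord.add (fun j hj => ?_) ?_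
    · rw [mul_comm, Dd_iter_mul_self, map_mul, (hW _ i.2).1, zero_mul]
    · rw [mul_comm]; exact (ho _ i.2).mul _
  · intro i; rw [evA_apply, evalEval_C]; simp
  · intro i; rw [Dd_t]; exact (hW _ i.2).2
  · intro i j hij
    simp only [l, evA_apply]; split_ifs
    · simp
    · rw [evalEval_C]; simp
  · intro i j hij
    simp only [l, evA_apply]; split_ifs with h
    · simp only [evalEval_sub, evalEval_X, evalEval_C, eval_C]
      intro h2
      exact hij (Subtype.ext (Prod.ext h (sub_eq_zero.1 h2)))
    · simp only [evalEval_C, eval_sub, eval_X, eval_C]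
      exact fun h2 => h (sub_eq_zero.1 h2)
  -- transport to the quotient of AdjoinRoot
  have hfin : FiniteDimensional K (AdjoinRoot f ⧸ Ideal.span {AdjoinRoot.mk f Ψ}) := by
    have h := Ideal.span_singleton_eq_bot.not.2 hΨ0
    exact Module.Finite.equiv (Ideal.quotientEquivDirectSum K (AdjoinRoot.powerBasisAux' hf) h).symm
  have hmem : ∀ a, AdjoinRoot.mk f a ∈ Ideal.span {AdjoinRoot.mk f Ψ} ↔ a ∈ J := by
    intro a
    rw [Ideal.mem_span_singleton', Ideal.mem_span_pair]
    constructor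
    · rintro ⟨b, hb⟩
      obtain ⟨b, rfl⟩ := AdjoinRoot.mk_surjective b
      rw [← map_mul, AdjoinRoot.mk_eq_mk] at hb
      obtain ⟨c, hc⟩ := hb
      exact ⟨-c, b, by linear_combination hc⟩
    · rintro ⟨u, v, rfl⟩
      exact ⟨AdjoinRoot.mk f v, by simp⟩
  let φ : (K[X][X] ⧸ J) →ₗ[K] (AdjoinRoot f ⧸ Ideal.span {AdjoinRoot.mk f Ψ}) :=
    Submodule.mapQ (J.restrictScalars K) ((Ideal.span {AdjoinRoot.mk f Ψ}).restrictScalars K)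
      ((AdjoinRoot.mkₐ f).restrictScalars K).toLinearMap (fun a ha => (hmem a).2 ha)
  have hφ : Function.Injective φ := by
    rw [injective_iff_map_eq_zero]
    intro x
    obtain ⟨x, rfl⟩ := Ideal.Quotient.mk_surjective x
    intro hx
    refine Ideal.Quotient.eq_zero_iff_mem.2 ((hmem x).1 (Ideal.Quotient.eq_zero_iff_mem.1 ?_))
    exact hx
  have := (hli.map' φ (LinearMap.ker_eq_bot.2 hφ)).fintype_card_le_finrank
  simpa [mul_comm] using this
end biv

end St

namespace NC

/-- `f` has a monic factor of degree `d₁` in the outer variable -/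
def HasFac {R : Type} [CommRing R] (d₁ : ℕ) (f : R[X]) : Prop :=
  ∃ g h : R[X], g.Monic ∧ h.Monic ∧ g.natDegree = d₁ ∧ f = g * h

lemma HasFac.map {R S : Type} [CommRing R] [CommRing S] [Nontrivial S] (φ : R →+* S) {d₁ : ℕ} {f : R[X]}
    (h : HasFac d₁ f) : HasFac d₁ (f.map φ) := by
  obtain ⟨g, h, hg, hh, hd, rfl⟩ := h
  exact ⟨g.map φ, h.map φ, hg.map φ, hh.map φ, by rw [hg.natDegree_map, hd], by rw [Polynomial.map_mul]⟩

lemma irr_iff_fac {R : Type} [CommRing R] [IsDomain R] {f : R[X]} (hf : f.Monic) (h1 : 1 ≤ f.natDegree) :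
    Irreducible f ↔ ∀ d₁, 0 < d₁ → d₁ < f.natDegree → ¬ HasFac d₁ f := by
  rw [hf.irreducible_iff_natDegree]
  constructor
  · rintro ⟨_, h⟩ d₁ h0 hd ⟨g, k, hg, hk, hgd, rfl⟩
    rw [hg.natDegree_mul hk] at hd
    rcases h g k hg hk rfl with h | h <;> omega
  · intro h
    refine ⟨fun h => by simp [h] at h1, fun g k hg hk hgk => ?_⟩
    by_contra hcon
    push Not at hcon
    refine h g.natDegree (by omega) ?_ ⟨g, k, hg, hk, rfl, hgk.symm⟩
    rw [← hgk, hg.natDegree_mul hk]; omega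

lemma cf_map {k L : Type} [Field k] [Field L] (i : k →+* L) (d e : ℕ) (f : k[X][X]) :
    cf d e (f.map (mapRingHom i)) = i ∘ cf d e f := by
  funext q; simp [cf]

lemma aeval_map' {k L : Type} [Field k] [Field L] (i : k →+* L) {σ : Type} (c : σ → k) (Φ : MvPolynomial σ ℤ) :
    MvPolynomial.aeval (i ∘ c) Φ = i (MvPolynomial.aeval c Φ) := by
  rw [MvPolynomial.aeval_def, MvPolynomial.aeval_def, MvPolynomial.eval₂_comp_left]
  congr 1
  exact RingHom.ext_int _ _

lemma exists_bound {R : Type} [CommRing R] (f : R[X][X]) : ∃ e, ∀ i, (f.coeff i).natDegree ≤ e := by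
  refine ⟨f.support.sup fun i => (f.coeff i).natDegree, fun i => ?_⟩
  by_cases h : i ∈ f.support
  · exact Finset.le_sup (f := fun i => (f.coeff i).natDegree) h
  · rw [notMem_support_iff.1 h]; simp

lemma natDegree_coeff_map_le {R S : Type} [CommRing R] [CommRing S] (i : R →+* S) {f : R[X][X]} {e : ℕ}
    (he : ∀ i, (f.coeff i).natDegree ≤ e) (j : ℕ) : ((f.map (mapRingHom i)).coeff j).natDegree ≤ e := by
  rw [coeff_map]; exact natDegree_map_le.trans (he j)

lemma fac_transfer {k K₁ K₂ : Type} [Field k] [Field K₁] [Field K₂] [IsAlgClosed K₁] [IsAlgClosed K₂]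
    (i₁ : k →+* K₁) (i₂ : k →+* K₂) {f : k[X][X]} (hf : f.Monic) {d₁ : ℕ}
    (h : HasFac d₁ (f.map (mapRingHom i₁))) : HasFac d₁ (f.map (mapRingHom i₂)) := by
  obtain ⟨e, he⟩ := exists_bound f
  obtain ⟨S, hS⟩ := noether_closed f.natDegree e d₁
  have h1 := (hS K₁ _ (hf.map _) (hf.natDegree_map _) (natDegree_coeff_map_le i₁ he)).1 h
  refine (hS K₂ _ (hf.map _) (hf.natDegree_map _) (natDegree_coeff_map_le i₂ he)).2 fun Φ hΦ => ?_
  have h2 := h1 Φ hΦ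
  rw [cf_map, aeval_map', map_eq_zero] at h2
  rw [cf_map, aeval_map', h2, map_zero]

lemma irr_transfer {k K₁ K₂ : Type} [Field k] [Field K₁] [Field K₂] [IsAlgClosed K₁]
    (i₁ : k →+* K₁) (i₂ : k →+* K₂) {f : k[X][X]} (hf : f.Monic) 
    (h : Irreducible (f.map (mapRingHom i₁))) : Irreducible (f.map (mapRingHom i₂)) := by
  have h1 : 1 ≤ f.natDegree := by
    have h2 := ((hf.map _).irreducible_iff_natDegree.1 h).1
    by_contra h3
    exact h2 (by rw [hf.natDegree_eq_zero.1 (by omega)]; simp)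
  let j := algebraMap K₂ (AlgebraicClosure K₂)
  have h3 : Irreducible ((f.map (mapRingHom i₂)).map (mapRingHom j)) := by
    rw [Polynomial.map_map, mapRingHom_comp]
    rw [irr_iff_fac (hf.map _) (by rwa [hf.natDegree_map])] at h ⊢
    intro d h0 hd hfac
    refine h d h0 ?_ (fac_transfer _ i₁ hf hfac)
    rwa [hf.natDegree_map] at hd ⊢
  exact Monic.irreducible_of_irreducible_map _ _ (hf.map _) h3

end NC
namespace St
open NC

section nonvanish
variable {p : ℕ} [hp : Fact p.Prime] {K : Type} [Field K] [IsAlgClosed K] [CharP K p]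

/-- p-th power combination: `∑ v_j^p t^j ∈ (f)` with few terms forces each `v_j ∈ (f)` -/
lemma pth_indep {f : K[X][X]} (hirr : Irreducible f) (hY : ¬ f ∣ derivative f) (N : ℕ) (hN : N ≤ p) (v : ℕ → K[X][X])
    (h : f ∣ ∑ j ∈ Finset.range N, v j ^ p * C X ^ j) : ∀ j < N, f ∣ v j := by
  have hpr := hirr.prime
  haveI : CharP K[X][X] p := inferInstance
  have hDp : ∀ a : K[X][X], Dd f (a ^ p) = 0 := by
    intro a; rw [Derivation.leibniz_pow]; simp
  -- general statement with coefficients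
  have key : ∀ (N : ℕ), N ≤ p → ∀ v : ℕ → K[X][X], f ∣ ∑ j ∈ Finset.range N, v j ^ p * C X ^ j →
      ∀ j < N, f ∣ v j := by
    intro N
    induction N with
    | zero => intro _ _ _ j hj; omega
    | succ N ih =>
      intro hN v hv
      have h1 : f ∣ ∑ j ∈ Finset.range N, ((C (C ((frobeniusEquiv K p).symm ((j:K)+1))) : K[X][X]) * v (j+1)) ^ p * C X ^ j := by
        have h2 : f ∣ Dd f (∑ j ∈ Finset.range (N+1), v j ^ p * C X ^ j) := by
          obtain ⟨c, hc⟩ := hv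
          rw [hc, (Dd f).leibniz, Dd_self, smul_zero, add_zero]
          exact dvd_mul_right _ _
        have h3 : Dd f (∑ j ∈ Finset.range (N+1), v j ^ p * C X ^ j) = derivative f *
            ∑ j ∈ Finset.range N, ((C (C ((frobeniusEquiv K p).symm ((j:K)+1))) : K[X][X]) * v (j+1)) ^ p * C X ^ j := by
          rw [map_sum, Finset.sum_range_succ', Finset.mul_sum]
          have h0 : Dd f (C X : K[X][X]) = derivative f := by
            have := Dd_t f 0; simpa using this
          have h4 : Dd f (v 0 ^ p * C X ^ 0) = 0 := by simp [hDp]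
          rw [h4, add_zero]
          refine Finset.sum_congr rfl fun j _ => ?_
          have h10 : (C (C ((frobeniusEquiv K p).symm ((j:K)+1))) : K[X][X]) ^ p = C (C ((j:K)+1)) := by
            rw [← C_pow, ← C_pow, frobeniusEquiv_symm_pow_p]
          rw [(Dd f).leibniz, hDp, smul_zero, add_zero, Derivation.leibniz_pow, h0, mul_pow, h10]
          simp only [Nat.add_sub_cancel, smul_eq_mul, nsmul_eq_mul]
          push_cast
          simp only [map_add, map_natCast, map_one]
          ring
        rw [h3] at h2
        exact (hpr.dvd_or_dvd h2).resolve_left hY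
      have h5 := ih (by omega) _ h1
      have h6 : ∀ j < N, f ∣ v (j+1) := by
        intro j hj
        refine (hpr.dvd_or_dvd (h5 j hj)).resolve_left fun hd => hpr.not_isUnit (isUnit_of_dvd_unit hd ?_)
        refine (((?_ : IsUnit ((frobeniusEquiv K p).symm ((j:K)+1))).map C).map C)
        rw [isUnit_iff_ne_zero, Ne, EmbeddingLike.map_eq_zero_iff]
        have : ((j:K)+1) = ((j+1 : ℕ) : K) := by push_cast; rfl
        rw [this, CharP.cast_eq_zero_iff K p]
        exact Nat.not_dvd_of_pos_of_lt (by omega) (by omega)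
      have h7 : f ∣ v 0 := by
        rw [Finset.sum_range_succ'] at hv
        have h8 : f ∣ ∑ j ∈ Finset.range N, v (j+1) ^ p * C X ^ (j+1) := by
          refine Finset.dvd_sum fun j hj => Dvd.dvd.mul_right ?_ _
          exact dvd_pow (h6 j (Finset.mem_range.1 hj)) hp.out.ne_zero
        have h9 := (dvd_add_right h8).1 hv
        simp only [pow_zero, mul_one] at h9
        exact hpr.dvd_of_dvd_pow h9
      intro j hj
      cases j with
      | zero => exact h7
      | succ j => exact h6 j (by omega)
  exact key N hN v h

/-- the Stepanov auxiliary function -/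
def PsiS (p : ℕ) {K1 δ d0 : ℕ} (a : Fin K1 × Fin δ × Fin δ × Fin (d0+1) → K) : K[X][X] :=
  ∑ q, C (C (a q)) * C X ^ ((q.2.2.2 : ℕ) + p * q.1) * X ^ ((q.2.2.1 : ℕ) + p * q.2.1)

lemma coeff_mono {R : Type} [CommRing R] (c : R) (j i i' j' : ℕ) :
    ((C (C c) * C X ^ j * X ^ i : R[X][X]).coeff i').coeff j' = if i' = i ∧ j' = j then c else 0 := by
  rw [← C_pow, ← C_mul, coeff_C_mul_X_pow]
  by_cases h : i' = i
  · simp only [h, true_and, if_true, coeff_C_mul_X_pow]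
  · simp [h]

lemma deg_sum_lt {R ι : Type} [CommRing R] (s : Finset ι) (g : ι → R[X]) {δ : ℕ}
    (h : ∀ i ∈ s, (g i).degree < (δ : WithBot ℕ)) : (∑ i ∈ s, g i).degree < (δ : WithBot ℕ) :=
  (degree_sum_le _ _).trans_lt ((Finset.sup_lt_iff (WithBot.bot_lt_coe _)).2 h)

lemma deg_mono_lt {R : Type} [CommRing R] (c : R) (j : ℕ) {i δ : ℕ} (h : i < δ) :
    (C (C c) * C X ^ j * X ^ i : R[X][X]).degree < (δ : WithBot ℕ) := by
  rw [← C_pow, ← C_mul]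
  exact (degree_C_mul_X_pow_le _ _).trans_lt (by exact_mod_cast h)

set_option maxHeartbeats 1000000 in
lemma nonvanish_aux {K1 δ d0 e : ℕ} (𝔽 : Type) [Field 𝔽] (ι : K[X][X] →+* 𝔽) (f0 : (ZMod p)[X][X]) (hf0 : f0.Monic) (hd : f0.natDegree = δ)
    (he : ∀ i, (f0.coeff i).natDegree ≤ e) (i0 : ZMod p →+* K)
    (hirr : Irreducible (f0.map (mapRingHom i0)))
    (hY : ¬ (f0.map (mapRingHom i0)) ∣ derivative (f0.map (mapRingHom i0)))
    (hsz : δ * (d0 + e * δ + e * δ) < p)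
    (a : Fin K1 × Fin δ × Fin δ × Fin (d0+1) → K) (ha : a ≠ 0)
    (hιz : ∀ q, ι q = 0 ↔ (f0.map (mapRingHom i0)) ∣ q)
    (hden : ∀ c : ℕ → 𝔽, ∃ (s : 𝔽) (v : ℕ → K[X][X]), s ≠ 0 ∧ ∀ j ∈ Finset.range p, ι (v j) = s * c j) :
    ¬ (f0.map (mapRingHom i0)) ∣ PsiS p a := by
  intro hdiv
  set f := f0.map (mapRingHom i0) with hf
  have hfm : f.Monic := hf0.map _
  have hfd : f.natDegree = δ := by rw [hf, hf0.natDegree_map, hd]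
  haveI hch : CharP 𝔽 p := by
    refine charP_of_injective_ringHom (f := ι.comp (C.comp C)) ?_ p
    exact RingHom.injective _
  set jj : K →+* 𝔽 := ι.comp (C.comp C) with hjj
  set f' : 𝔽[X][X] := f.map (mapRingHom jj) with hf'
  have hf'm : f'.Monic := hfm.map _
  have hf'd : f'.natDegree = δ := by rw [hf', hfm.natDegree_map, hfd]
  have hirr' : Irreducible f' := irr_transfer (RingHom.id K) jj hfm (by simpa using hirr)
  haveI : IsDomain (AdjoinRoot f') := AdjoinRoot.isDomain_of_prime hirr'.prime
  set α : Fin K1 × Fin δ × Fin δ × Fin (d0+1) → K := fun q => (frobeniusEquiv K p).symm (a q) with hα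
  set b : 𝔽[X][X] := ∑ q : Fin K1 × Fin δ × Fin δ × Fin (d0+1),
    C (C (ι (C (C (α q)) * C X ^ (q.1 : ℕ) * X ^ (q.2.1 : ℕ)))) * C X ^ (q.2.2.2 : ℕ) * X ^ (q.2.2.1 : ℕ) with hb
  have hbwt : wt e (d0 + e * δ) b := by
    refine wt_sum _ _ fun q _ => ?_
    intro i j hij
    rw [coeff_mono, if_neg]
    rintro ⟨rfl, rfl⟩
    have h1 := q.2.2.1.2
    have h2 := q.2.2.2.2
    have : e * (q.2.2.1 : ℕ) ≤ e * δ := Nat.mul_le_mul_left _ h1.le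
    omega
  have hδ : 0 < δ := by
    rcases Nat.eq_zero_or_pos δ with h | h
    · exact absurd (by rw [hfm.natDegree_eq_zero.1 (hfd.trans h)]; exact isUnit_one) hirr.not_isUnit
    · exact h
  have hbdeg : b.degree < f'.degree := by
    rw [degree_eq_natDegree hf'm.ne_zero, hf'd]
    exact deg_sum_lt _ _ fun q _ => deg_mono_lt _ _ q.2.2.1.2
  have hb0 : b ≠ 0 := by
    intro hb0
    obtain ⟨q0, hq0⟩ := Function.ne_iff.1 ha
    have h1 : (b.coeff q0.2.2.1).coeff q0.2.2.2 = 0 := by rw [hb0]; simp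
    rw [hb, finsetSum_coeff, finsetSum_coeff] at h1
    simp only [coeff_mono] at h1
    set M : K[X][X] := ∑ q : Fin K1 × Fin δ × Fin δ × Fin (d0+1), if (q0.2.2.1 : ℕ) = q.2.2.1 ∧ (q0.2.2.2 : ℕ) = q.2.2.2 then
      C (C (α q)) * C X ^ (q.1 : ℕ) * X ^ (q.2.1 : ℕ) else 0 with hM
    have h2 : ι M = 0 := by
      rw [← h1, hM, map_sum]
      refine Finset.sum_congr rfl fun q _ => ?_
      split_ifs <;> simp
    rw [hιz] at h2
    have h3 : M.degree < f.degree := by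
      rw [degree_eq_natDegree hfm.ne_zero, hfd]
      refine deg_sum_lt _ _ fun q _ => ?_
      split_ifs
      · exact deg_mono_lt _ _ q.2.1.2
      · rw [degree_zero]; exact WithBot.bot_lt_coe _
    have h4 : M = 0 := eq_zero_of_dvd_of_degree_lt h2 h3
    have h5 : (M.coeff q0.2.1).coeff q0.1 = α q0 := by
      rw [hM, finsetSum_coeff, finsetSum_coeff, Finset.sum_eq_single q0]
      · simp only [and_self, if_true]
        rw [coeff_mono]; simp
      · intro q _ hq
        split_ifs with h
        · rw [coeff_mono, if_neg]
          rintro ⟨h6, h7⟩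
          apply hq
          exact Prod.ext (Fin.ext h7.symm) (Prod.ext (Fin.ext h6.symm)
            (Prod.ext (Fin.ext h.1.symm) (Fin.ext h.2.symm)))
        · simp
      · simp
    rw [h4] at h5
    simp only [coeff_zero] at h5
    exact hq0 (by simpa [hα] using h5.symm)
  have hbnd : AdjoinRoot.mk f' b ≠ 0 := by
    rw [Ne, AdjoinRoot.mk_eq_zero]
    exact fun h => hb0 (eq_zero_of_dvd_of_degree_lt h hbdeg)
  set r := Algebra.norm 𝔽[X] (AdjoinRoot.mk f' b) with hr
  have hr0 : r ≠ 0 := (Algebra.norm_ne_zero_iff_of_basis (AdjoinRoot.powerBasisAux' hf'm)).2 hbnd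
  have hrd : r.natDegree < p := by
    have h := norm_natDegree_le hf'm (natDegree_coeff_map_le jj (natDegree_coeff_map_le i0 he)) b hbwt
    rw [hf'd] at h
    exact h.trans_lt hsz
  haveI : Module.Free 𝔽[X] (AdjoinRoot f') := Module.Free.of_basis (AdjoinRoot.powerBasisAux' hf'm)
  haveI : Module.Finite 𝔽[X] (AdjoinRoot f') := Module.Finite.of_basis (AdjoinRoot.powerBasisAux' hf'm)
  obtain ⟨u, v, huv⟩ : ∃ u v, C r = b * u + f' * v := by
    obtain ⟨u, hu⟩ := dvd_norm' (R := 𝔽[X]) (AdjoinRoot.mk f' b)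
    obtain ⟨u, rfl⟩ := AdjoinRoot.mk_surjective u
    rw [← hr, AdjoinRoot.algebraMap_eq, ← AdjoinRoot.mk_C, ← map_mul, AdjoinRoot.mk_eq_mk] at hu
    obtain ⟨v, hv⟩ := hu
    exact ⟨u, v, by linear_combination hv⟩
  set τ : 𝔽 := ι (C X)
  set υ : 𝔽 := ι X
  set φ : 𝔽[X][X] →+* 𝔽 := eval₂RingHom (eval₂RingHom (frobenius 𝔽 p) τ) υ with hφ
  have hφf : φ f' = 0 := by
    have h1 : φ f' = ι f := by
      have : (φ.comp ((mapRingHom (mapRingHom jj)))).comp (mapRingHom (mapRingHom i0)) =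
          ι.comp (mapRingHom (mapRingHom i0)) := by
        refine Polynomial.ringHom_ext' (Polynomial.ringHom_ext' (Subsingleton.elim _ _) ?_) ?_
        · simp [hφ, τ]
        · simp [hφ, υ]
      exact RingHom.congr_fun this f0
    rw [h1, hιz]
  have hφb : φ b = ι (PsiS p a) := by
    rw [hb, PsiS, map_sum, map_sum]
    refine Finset.sum_congr rfl fun q _ => ?_
    have h10 : (C (C (a q)) : K[X][X]) = C (C (α q)) ^ p := by
      rw [← C_pow, ← C_pow, hα, frobeniusEquiv_symm_pow_p]
    rw [h10]
    simp only [hφ, map_mul, map_pow, coe_eval₂RingHom, eval₂_C, eval₂_X, frobenius_def]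
    ring
  have hsum : ∑ j ∈ Finset.range p, r.coeff j ^ p * τ ^ j = 0 := by
    have h1 : φ (C r) = 0 := by
      rw [huv, map_add, map_mul, map_mul, hφf, hφb, (hιz _).2 hdiv]; ring
    simp only [hφ, coe_eval₂RingHom, eval₂_C] at h1
    rw [eval₂_eq_sum_range' _ hrd] at h1
    simpa [frobenius_def] using h1
  obtain ⟨s, v', hs0, hv'⟩ := hden (fun j => r.coeff j)
  have hdv := pth_indep hirr hY p le_rfl v' (by
    rw [← hιz, map_sum]
    have : ∀ j ∈ Finset.range p, ι (v' j ^ p * C X ^ j) = s ^ p * (r.coeff j ^ p * τ ^ j) := by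
      intro j hj
      rw [map_mul, map_pow, hv' j hj, map_pow]; ring
    rw [Finset.sum_congr rfl this, ← Finset.mul_sum, hsum, mul_zero])
  apply hr0
  ext j
  by_cases hj : j < p
  · have h1 := (hιz _).2 (hdv j hj)
    rw [hv' j (Finset.mem_range.2 hj)] at h1
    rcases mul_eq_zero.1 h1 with h | h
    · exact absurd h hs0
    · simpa using h
  · rw [coeff_eq_zero_of_natDegree_lt (by omega)]; simp

lemma nonvanish {K1 δ d0 e : ℕ} (f0 : (ZMod p)[X][X]) (hf0 : f0.Monic) (hd : f0.natDegree = δ)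
    (he : ∀ i, (f0.coeff i).natDegree ≤ e) (i0 : ZMod p →+* K)
    (hirr : Irreducible (f0.map (mapRingHom i0)))
    (hY : ¬ (f0.map (mapRingHom i0)) ∣ derivative (f0.map (mapRingHom i0)))
    (hsz : δ * (d0 + e * δ + e * δ) < p)
    (a : Fin K1 × Fin δ × Fin δ × Fin (d0+1) → K) (ha : a ≠ 0) :
    ¬ (f0.map (mapRingHom i0)) ∣ PsiS p a := by
  haveI : IsDomain (AdjoinRoot (f0.map (mapRingHom i0))) := AdjoinRoot.isDomain_of_prime hirr.prime
  refine nonvanish_aux (FractionRing (AdjoinRoot (f0.map (mapRingHom i0))))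
    ((algebraMap (AdjoinRoot (f0.map (mapRingHom i0))) _).comp (AdjoinRoot.mk (f0.map (mapRingHom i0))))
    f0 hf0 hd he i0 hirr hY hsz a ha ?_ ?_
  · intro q
    rw [RingHom.comp_apply, FaithfulSMul.algebraMap_eq_zero_iff, AdjoinRoot.mk_eq_zero]
  · intro c
    obtain ⟨s, hs⟩ := IsLocalization.exist_integer_multiples
      (nonZeroDivisors (AdjoinRoot (f0.map (mapRingHom i0)))) (Finset.range p) c
    have hs' : ∀ j ∈ Finset.range p, ∃ v : K[X][X], ((algebraMap (AdjoinRoot (f0.map (mapRingHom i0)))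
        (FractionRing (AdjoinRoot (f0.map (mapRingHom i0))))).comp (AdjoinRoot.mk (f0.map (mapRingHom i0)))) v = algebraMap _ _ (s : AdjoinRoot (f0.map (mapRingHom i0))) * c j := by
      intro j hj
      obtain ⟨w, hw⟩ := hs j hj
      obtain ⟨v, rfl⟩ := AdjoinRoot.mk_surjective w
      refine ⟨v, ?_⟩
      rw [RingHom.comp_apply, hw]
      simp [Algebra.smul_def]
    choose! v' hv' using hs'
    refine ⟨_, v', ?_, hv'⟩
    rw [Ne, FaithfulSMul.algebraMap_eq_zero_iff]
    exact nonZeroDivisors.ne_zero s.2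
end nonvanish
end St

namespace St
open NC

section lin
variable {K : Type} [Field K]

lemma evA_mono (x y c : K) (j i : ℕ) : evA x y (C (C c) * C X ^ j * X ^ i) = c * x ^ j * y ^ i := by
  rw [evA_apply, ← C_pow, ← C_mul]
  simp [evalEval_C]

lemma eq_sum_mono {q : K[X][X]} {δ w : ℕ} (h1 : q.natDegree < δ) (h2 : ∀ i, (q.coeff i).natDegree ≤ w) :
    q = ∑ i ∈ Finset.range δ, ∑ j ∈ Finset.range (w+1), C (C ((q.coeff i).coeff j)) * C X ^ j * X ^ i := by
  conv_lhs => rw [q.as_sum_range' δ h1]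
  refine Finset.sum_congr rfl fun i _ => ?_
  rw [← C_mul_X_pow_eq_monomial]
  conv_lhs => rw [(q.coeff i).as_sum_range' (w+1) (by have := h2 i; omega)]
  rw [map_sum, Finset.sum_mul]
  refine Finset.sum_congr rfl fun j _ => ?_
  rw [← C_mul_X_pow_eq_monomial, C_mul, C_pow]

lemma span_mem {f : K[X][X]} {δ e ε0 w : ℕ} (hf : f.Monic) (hδ : 0 < δ) (hd : f.natDegree = δ)
    (he : ∀ i, (f.coeff i).natDegree ≤ e) (W : Finset (K × K)) (hW : ∀ q ∈ W, evA q.1 q.2 f = 0)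
    (ν : W → K) (c : ℕ → K[X][X]) (hc : ∀ l < ε0, wt e (e * (ε0 - l)) (c l))
    (hν : ∀ z : W, ν z ^ ε0 = ∑ l ∈ Finset.range ε0, evA z.1.1 z.1.2 (c l) * ν z ^ l) (l : ℕ) :
    ∀ (u : ℕ) (q : K[X][X]), wt e u q → u + e * l ≤ w →
    (fun z : W => evA z.1.1 z.1.2 q * ν z ^ l) ∈ Submodule.span K
      (Set.range fun b : Fin (w+1) × Fin δ × Fin ε0 => fun z : W => z.1.1 ^ (b.1 : ℕ) * z.1.2 ^ (b.2.1 : ℕ) * ν z ^ (b.2.2 : ℕ)) := by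
  induction l using Nat.strong_induction_on with
  | _ l ih =>
    intro u q hq hu
    by_cases hl : l < ε0
    · set q' := q %ₘ f with hq'
      have hwt : wt e u q' := wt_modByMonic hf he q hq
      have hdeg : q'.natDegree < δ := by
        rw [← hd]
        refine natDegree_modByMonic_lt _ hf ?_
        rintro rfl; simp at hd; omega
      have h1 : ∀ i, (q'.coeff i).natDegree ≤ w := fun i =>
        natDegree_le_iff_coeff_eq_zero.2 fun N hN => hwt _ _ (by
          have := Nat.zero_le (e * i); have := Nat.zero_le (e*l); omega)
      have h2 : (fun z : W => evA z.1.1 z.1.2 q * ν z ^ l) = ∑ i ∈ Finset.range δ, ∑ j ∈ Finset.range (w+1),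
          ((q'.coeff i).coeff j) • (fun z : W => z.1.1 ^ j * z.1.2 ^ i * ν z ^ l) := by
        funext z
        have h3 : evA z.1.1 z.1.2 q = evA z.1.1 z.1.2 q' := by
          conv_lhs => rw [← modByMonic_add_div q f, map_add, map_mul, hW _ z.2, zero_mul, add_zero]
        rw [h3]
        conv_lhs => rw [eq_sum_mono hdeg h1]
        simp only [map_sum, evA_mono, Finset.sum_mul, Finset.sum_apply, Pi.smul_apply, smul_eq_mul]
        refine Finset.sum_congr rfl fun i _ => Finset.sum_congr rfl fun j _ => ?_
        ring
      rw [h2]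
      refine Submodule.sum_mem _ fun i hi => Submodule.sum_mem _ fun j hj => Submodule.smul_mem _ _ (Submodule.subset_span ?_)
      exact ⟨(⟨j, Finset.mem_range.1 hj⟩, ⟨i, Finset.mem_range.1 hi⟩, ⟨l, hl⟩), rfl⟩
    · push Not at hl
      have h2 : (fun z : W => evA z.1.1 z.1.2 q * ν z ^ l) = ∑ l' ∈ Finset.range ε0,
          (fun z : W => evA z.1.1 z.1.2 (q * c l') * ν z ^ (l' + (l - ε0))) := by
        funext z
        rw [Finset.sum_apply]
        obtain ⟨k, rfl⟩ := Nat.exists_eq_add_of_le hl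
        rw [pow_add, hν, Finset.sum_mul, Finset.mul_sum]
        refine Finset.sum_congr rfl fun l' _ => ?_
        rw [Nat.add_sub_cancel_left, map_mul]; ring
      rw [h2]
      refine Submodule.sum_mem _ fun l' hl' => ?_
      rw [Finset.mem_range] at hl'
      refine ih _ (by omega) _ _ (hq.mul (hc l' hl')) ?_
      have : e * l = e * (ε0 - l') + e * (l' + (l - ε0)) := by
        rw [← mul_add]; congr 1; omega
      omega

lemma stepanov_exists {f : K[X][X]} {δ e ε0 m0 K1 d0 w : ℕ} (hf : f.Monic) (hδ : 0 < δ) (hd : f.natDegree = δ)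
    (he : ∀ i, (f.coeff i).natDegree ≤ e) (W : Finset (K × K)) (hW : ∀ q ∈ W, evA q.1 q.2 f = 0)
    (ν : W → K) (c : ℕ → K[X][X]) (hc : ∀ l < ε0, wt e (e * (ε0 - l)) (c l))
    (hν : ∀ z : W, ν z ^ ε0 = ∑ l ∈ Finset.range ε0, evA z.1.1 z.1.2 (c l) * ν z ^ l)
    (hw : w = d0 + 2 * e * δ + K1 + e * δ * m0)
    (hcount : m0 * ((w + 1) * (δ * ε0)) < K1 * (δ * (δ * (d0 + 1)))) :
    ∃ a : Fin K1 × Fin δ × Fin δ × Fin (d0+1) → K, a ≠ 0 ∧ ∀ j < m0, ∀ z : W,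
      ∑ q, a q * (evA z.1.1 z.1.2 ((Dd f)^[j] (C X ^ (q.2.2.2 : ℕ) * X ^ (q.2.2.1 : ℕ))) * z.1.1 ^ (q.1 : ℕ) * ν z ^ (q.2.1 : ℕ)) = 0 := by
  classical
  set S := Submodule.span K
      (Set.range fun b : Fin (w+1) × Fin δ × Fin ε0 => fun z : W => z.1.1 ^ (b.1 : ℕ) * z.1.2 ^ (b.2.1 : ℕ) * ν z ^ (b.2.2 : ℕ)) with hS
  have hmem : ∀ (j : Fin m0) (q : Fin K1 × Fin δ × Fin δ × Fin (d0+1)),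
      (fun z : W => evA z.1.1 z.1.2 ((Dd f)^[j] (C X ^ (q.2.2.2 : ℕ) * X ^ (q.2.2.1 : ℕ))) * z.1.1 ^ (q.1 : ℕ) * ν z ^ (q.2.1 : ℕ)) ∈ S := by
    intro j q
    have h1 : wt e (d0 + e * δ) (C X ^ (q.2.2.2 : ℕ) * X ^ (q.2.2.1 : ℕ) : K[X][X]) := by
      intro i' j' hij
      have := coeff_mono (1:K) q.2.2.2 q.2.2.1 i' j'
      rw [C_1, C_1, one_mul] at this
      rw [this, if_neg]
      rintro ⟨rfl, rfl⟩
      have h1 := q.2.2.1.2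
      have h2 := q.2.2.2.2
      have : e * (q.2.2.1 : ℕ) ≤ e * δ := Nat.mul_le_mul_left _ h1.le
      omega
    have h2 := wt_Dd_iter (hd ▸ wt_f hf he) h1 j
    have h3 : wt e (q.1:ℕ) (C X ^ (q.1 : ℕ) : K[X][X]) := by
      rw [← C_pow]; exact wt_C (natDegree_X_pow_le _)
    have h4 := span_mem hf hδ hd he W hW ν c hc hν (w := w) q.2.1 _ _ (h2.mul h3) (by
      have h1 := q.2.1.2
      have h2 := q.1.2
      have h3 : e * (q.2.1 : ℕ) ≤ e * δ := Nat.mul_le_mul_left _ h1.le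
      have h4 : (j:ℕ) * (e * δ) ≤ e * δ * m0 := by rw [mul_comm]; exact Nat.mul_le_mul_left _ j.2.le
      have h5 : 2 * e * δ = 2 * (e * δ) := by ring
      omega)
    convert h4 using 2 with z
    congr 1
    rw [map_mul]
    congr 1
    rw [evA_apply, ← C_pow, evalEval_C]; simp
  let T : (Fin K1 × Fin δ × Fin δ × Fin (d0+1) → K) →ₗ[K] (Fin m0 → S) :=
    LinearMap.pi fun j => Fintype.linearCombination K (fun q => (⟨_, hmem j q⟩ : S))
  have hfin : Module.finrank K (Fin m0 → S) < Module.finrank K (Fin K1 × Fin δ × Fin δ × Fin (d0+1) → K) := by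
    rw [Module.finrank_pi_fintype, Module.finrank_fintype_fun_eq_card]
    simp only [Fintype.card_prod, Fintype.card_fin, Finset.sum_const, Finset.card_univ, smul_eq_mul]
    refine lt_of_le_of_lt (Nat.mul_le_mul_left _ ?_) hcount
    refine (finrank_range_le_card _).trans ?_
    simp
  obtain ⟨a, ha, ha0⟩ := (Submodule.ne_bot_iff _).1 (LinearMap.ker_ne_bot_of_finrank_lt (f := T) hfin)
  refine ⟨a, ha0, fun j hj z => ?_⟩
  have h1 := congrArg (fun v : W → K => v z) (congrArg Subtype.val (congr_fun (LinearMap.mem_ker.1 ha) ⟨j, hj⟩))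
  simpa [T, Fintype.linearCombination_apply, Finset.sum_apply] using h1
end lin

section bound
variable {p : ℕ} [hp : Fact p.Prime] {K : Type} [Field K] [IsAlgClosed K] [CharP K p]

lemma Dd_iter_pth (f c b : K[X][X]) (j : ℕ) : (Dd f)^[j] (c ^ p * b) = c ^ p * (Dd f)^[j] b := by
  have hDp : Dd f (c ^ p) = 0 := by
    rw [Derivation.leibniz_pow]; simp
  induction j with
  | zero => rfl
  | succ j ih =>
    rw [Function.iterate_succ_apply', ih, (Dd f).leibniz, hDp, smul_zero, add_zero,
      Function.iterate_succ_apply', smul_eq_mul]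

lemma stepanov_bound {δ e ε0 m0 K1 d0 w : ℕ} (f0 : (ZMod p)[X][X]) (hf0 : f0.Monic) (hδ : 0 < δ) (hd : f0.natDegree = δ)
    (he : ∀ i, (f0.coeff i).natDegree ≤ e) (i0 : ZMod p →+* K)
    (hirr : Irreducible (f0.map (mapRingHom i0)))
    (hY : ¬ (f0.map (mapRingHom i0)) ∣ derivative (f0.map (mapRingHom i0)))
    (hsz : δ * (d0 + e * δ + e * δ) < p)
    (W : Finset (K × K)) (hW : ∀ q ∈ W, evA q.1 q.2 (f0.map (mapRingHom i0)) = 0 ∧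
      evA q.1 q.2 (derivative (f0.map (mapRingHom i0))) ≠ 0)
    (hWx : ∀ q ∈ W, q.1 ^ p = q.1)
    (c : ℕ → K[X][X]) (hc : ∀ l < ε0, wt e (e * (ε0 - l)) (c l))
    (hν : ∀ z ∈ W, (z.2 ^ p) ^ ε0 = ∑ l ∈ Finset.range ε0, evA z.1 z.2 (c l) * (z.2 ^ p) ^ l)
    (hw : w = d0 + 2 * e * δ + K1 + e * δ * m0) (hm : m0 ≤ p)
    (hcount : m0 * ((w + 1) * (δ * ε0)) < K1 * (δ * (δ * (d0 + 1)))) :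
    m0 * W.card ≤ δ * (d0 + p * K1 + p * (e * δ) + e * δ + e * δ) := by
  set f := f0.map (mapRingHom i0) with hf
  have hfm : f.Monic := hf0.map _
  have hfd : f.natDegree = δ := by rw [hf, hf0.natDegree_map, hd]
  have he' := natDegree_coeff_map_le i0 he
  obtain ⟨a, ha0, ha⟩ := stepanov_exists hfm hδ hfd he' W (fun q hq => (hW q hq).1) (fun z => z.1.2 ^ p) c hc
    (fun z => hν z.1 z.2) hw hcount
  have hnv := nonvanish f0 hf0 hd he i0 hirr hY hsz a ha0
  rw [← hf] at hnv
  have hwt : wt e (d0 + p * K1 + p * (e * δ) + e * δ) (PsiS p a) := by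
    refine wt_sum _ _ fun q _ => ?_
    intro i j hij
    rw [coeff_mono, if_neg]
    rintro ⟨rfl, rfl⟩
    have h1 := q.2.2.1.2
    have h2 := q.2.2.2.2
    have h3 := q.2.1.2
    have h4 := q.1.2
    have : e * (q.2.2.1 : ℕ) ≤ e * δ := Nat.mul_le_mul_left _ h1.le
    have : p * (q.1 : ℕ) ≤ p * K1 := Nat.mul_le_mul_left _ h4.le
    have : e * (p * (q.2.1 : ℕ)) ≤ p * (e * δ) := by
      rw [mul_left_comm]; exact Nat.mul_le_mul_left _ (Nat.mul_le_mul_left _ h3.le)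
    rw [mul_add] at hij
    omega
  have := zero_count (m0 := m0) hfm he' hirr (PsiS p a) hwt hnv W hW ?_ ?_
  · rwa [hfd] at this
  · intro z hz j hj
    have h1 := ha j hj ⟨z, hz⟩
    rw [← h1, PsiS]
    have h2 : ∀ x, (Dd f)^[j] x = ((Dd f : K[X][X] →ₗ[K] K[X][X])^j) x := by
      intro x; rw [Module.End.pow_apply]; rfl
    rw [h2, map_sum, map_sum]
    refine Finset.sum_congr rfl fun q _ => ?_
    rw [← h2]
    have h3 : (C (C (a q)) * C X ^ ((q.2.2.2 : ℕ) + p * q.1) * X ^ ((q.2.2.1 : ℕ) + p * q.2.1) : K[X][X]) =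
        a q • ((C X ^ (q.1 : ℕ) * X ^ (q.2.1 : ℕ)) ^ p * (C X ^ (q.2.2.2 : ℕ) * X ^ (q.2.2.1 : ℕ))) := by
      have : ∀ b : K[X][X], a q • b = C (C (a q)) * b := by
        intro b; rw [Algebra.smul_def]; rfl
      rw [this]
      ring
    rw [h3, h2, map_smul, ← h2, Dd_iter_pth, map_smul, smul_eq_mul, map_mul]
    have h4 : evA z.1 z.2 ((C X ^ (q.1 : ℕ) * X ^ (q.2.1 : ℕ)) ^ p) = z.1 ^ (q.1:ℕ) * (z.2 ^ p) ^ (q.2.1 : ℕ) := by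
      have := evA_mono z.1 z.2 1 (q.1 * p) (q.2.1 * p)
      rw [C_1, C_1, one_mul, one_mul] at this
      rw [mul_pow, ← pow_mul, ← pow_mul, this]
      nth_rw 2 [← hWx z hz]
      ring
    rw [h4]
    ring
  · intro j hj h
    rw [CharP.cast_eq_zero_iff K p, hp.out.dvd_factorial] at h
    omega
end bound
end St

namespace St
open NC

lemma ar1 {r a b : ℕ} (h : a + b + 2 ≤ r) : r * a + b < r * r := by
  have h1 : r * (a + (b + 1)) ≤ r * r := Nat.mul_le_mul_left _ (by omega)
  have h2 : b + 1 ≤ r * (b + 1) := Nat.le_mul_of_pos_left _ (by omega)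
  rw [mul_add] at h1
  omega

lemma ar2 {r a b s p x : ℕ} (h1 : 2 * (s + 1) * p ≤ x + b) (h2 : r * a + b < r * r) (hr : r * r ≤ p) :
    r * a + r * r * s < x := by
  have h3 : r * r * s ≤ p * s := Nat.mul_le_mul_right _ hr
  have h4 : 2 * (s + 1) * p = 2 * (p * s) + 2 * p := by ring
  omega

lemma ar3 {p d0 e0 r c ed : ℕ} (hd : d0 ≤ p) (hp : 1 ≤ p) :
    d0 + p * (e0 * (r + c)) + p * ed + ed + ed ≤ e0 * p * r + p * (e0 * c + 3 * ed + 1) := by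
  have h1 : ed ≤ p * ed := Nat.le_mul_of_pos_left _ hp
  have h2 : e0 * p * r + p * (e0 * c + 3 * ed + 1) = p * (e0 * (r + c)) + 3 * (p * ed) + p := by ring
  omega

lemma ar4 {p e0 r k : ℕ} (hp : p * k ≤ 4 * (r * r) * k) : e0 * p * r + p * k ≤ r * (e0 * p + 4 * k * r) := by
  have h2 : r * (e0 * p + 4 * k * r) = e0 * p * r + 4 * (r * r) * k := by ring
  omega

lemma ar5 {p r : ℕ} (h : p < (r+1)*(r+1)) (hr : 1 ≤ r) : p ≤ 4 * (r * r) := by nlinarith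

lemma stepanov_num (δ e ε0 : ℕ) (hδ : 0 < δ) (hε : 0 < ε0) : ∃ C p0 : ℕ, δ < p0 ∧ ∀ (p : ℕ) [Fact p.Prime] (K : Type) [Field K] [IsAlgClosed K]
    [CharP K p] (f0 : (ZMod p)[X][X]) (i0 : ZMod p →+* K) (W : Finset (K × K)) (c : ℕ → K[X][X]), p0 ≤ p → f0.Monic → f0.natDegree = δ →
    (∀ i, (f0.coeff i).natDegree ≤ e) → Irreducible (f0.map (mapRingHom i0)) →
    (¬ (f0.map (mapRingHom i0)) ∣ derivative (f0.map (mapRingHom i0))) → (∀ q ∈ W, evA q.1 q.2 (f0.map (mapRingHom i0)) = 0 ∧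
      evA q.1 q.2 (derivative (f0.map (mapRingHom i0))) ≠ 0) → (∀ q ∈ W, q.1 ^ p = q.1) →
    (∀ l < ε0, wt e (e * (ε0 - l)) (c l)) →
    (∀ z ∈ W, (z.2 ^ p) ^ ε0 = ∑ l ∈ Finset.range ε0, evA z.1 z.2 (c l) * (z.2 ^ p) ^ l) →
    W.card ≤ ε0 * p + C * Nat.sqrt p := by
  set s := ε0 + e * δ ^ 2 with hs
  set c := 2 * δ * (s + 1) with hc
  set M := 2 * e * δ + ε0 * c + 4 * (s + 1) * (e * δ^2) + 2 + δ + 2 * e * δ ^ 2 with hM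
  refine ⟨4 * (ε0 * c + 3 * (e * δ) + 1), (M + 1)^2, ?_, ?_⟩
  · nlinarith [Nat.zero_le (2 * e * δ), Nat.zero_le (ε0 * c), Nat.zero_le (4 * (s + 1) * (e * δ^2)), Nat.zero_le (2 * e * δ ^ 2)]
  intro p hp K _ _ _ f0 i0 W cc hp0 hf0 hd he hirr hY hW hWx hcc hν
  set r := Nat.sqrt p with hr
  have hr1 : r * r ≤ p := Nat.sqrt_le p
  have hr2 : p < (r + 1) * (r + 1) := Nat.lt_succ_sqrt p
  have hrM : M ≤ r := by
    by_contra h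
    push Not at h
    have : (r+1)*(r+1) ≤ (M+1)^2 := by nlinarith
    omega
  have hr0 : 1 ≤ r := by omega
  set d1 := (p - 1) / δ with hd1
  have hd1a : δ * d1 ≤ p - 1 := Nat.mul_div_le _ _
  have hd1b : p - 1 < δ * d1 + δ := by
    have := Nat.lt_mul_div_succ (p-1) hδ
    rw [mul_add, mul_one] at this; exact this
  have hp1 : 1 ≤ p := hp.out.one_lt.le
  have hMd : 2 * (e * δ) ≤ d1 := by
    rw [hd1, Nat.le_div_iff_mul_le hδ]
    have : 2 * (e * δ) * δ = 2 * e * δ^2 := by ring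
    have : M + 1 ≤ p := by nlinarith
    omega
  obtain ⟨d0, hd0⟩ := Nat.exists_eq_add_of_le hMd
  have hδr : δ * r ≤ p := by
    have : δ ≤ r := by omega
    nlinarith
  have hlow : p ≤ δ * (d0 + 1) + 2 * (e * δ ^ 2) := by
    have : δ * d1 + δ = δ * (d0 + 1) + 2 * (e * δ ^ 2) := by rw [hd0]; ring
    omega
  have hup : δ * (d0 + e * δ + e * δ) < p := by
    have : δ * (d0 + e * δ + e * δ) = δ * d1 := by rw [hd0]; ring
    omega
  have hmain : r * (2 * e * δ + ε0 * c) + r * r * s < c * (d0 + 1) := by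
    have h1 : 2 * (s + 1) * p ≤ c * (d0 + 1) + 4 * (s+1) * (e * δ ^ 2) := by
      have : c * (d0 + 1) + 4 * (s+1) * (e * δ ^ 2) = 2 * (s+1) * (δ * (d0 + 1) + 2 * (e * δ ^ 2)) := by rw [hc]; ring
      rw [this]; exact Nat.mul_le_mul_left _ hlow
    have h2 : r * (2 * e * δ + ε0 * c) + 4 * (s+1) * (e * δ ^ 2) < r * r := by
      exact ar1 (by omega)
    exact ar2 h1 h2 hr1
  have hb := stepanov_bound (m0 := δ * r) (K1 := ε0 * (r + c)) (d0 := d0) (ε0 := ε0) (e := e) f0 hf0 hδ hd he i0 hirr hY hup W hW hWx cc hcc hν rfl hδr (by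
    have h1 : r * (d0 + 2 * e * δ + ε0 * (r + c) + e * δ * (δ * r) + 1) < (r + c) * (d0 + 1) := by
      have : r * (d0 + 2 * e * δ + ε0 * (r + c) + e * δ * (δ * r) + 1) = r * (d0 + 1) + (r * (2 * e * δ + ε0 * c) + r * r * s) := by
        rw [hs]; ring
      rw [this, add_mul]
      omega
    have h2 : 0 < δ * δ * ε0 := by positivity
    calc _ = (δ * δ * ε0) * (r * (d0 + 2 * e * δ + ε0 * (r + c) + e * δ * (δ * r) + 1)) := by ring
      _ < (δ * δ * ε0) * ((r + c) * (d0 + 1)) := Nat.mul_lt_mul_of_pos_left h1 h2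
      _ = _ := by ring)
  rw [mul_assoc] at hb
  have hb' := Nat.le_of_mul_le_mul_left hb hδ
  have hd0p : d0 ≤ p := by
    have : d0 ≤ δ * (d0 + e * δ + e * δ) := le_trans (by omega) (Nat.le_mul_of_pos_left _ hδ)
    omega
  have hp4 : p ≤ 4 * (r * r) := ar5 hr2 hr0
  refine Nat.le_of_mul_le_mul_left (c := r) ?_ hr0
  refine hb'.trans ?_
  refine (ar3 hd0p hp1).trans ?_
  exact ar4 (Nat.mul_le_mul_right _ hp4)

end St

namespace St
open NC

/-- resultant-type elimination -/
lemma elim {L : Type*} [Field L] {e w : ℕ} {f : L[X][X]} (hf : f.Monic)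
    (he : ∀ i, (f.coeff i).natDegree ≤ e) (hirr : Irreducible f) (q : L[X][X]) (hq : wt e w q)
    (hndvd : ¬ f ∣ q) :
    ∃ D : L[X], D ≠ 0 ∧ D.natDegree ≤ f.natDegree * (w + e * f.natDegree) ∧ ∃ u v : L[X][X], C D = u * f + v * q := by
  have : IsDomain (AdjoinRoot f) := AdjoinRoot.isDomain_of_prime hirr.prime
  have hΨ0 : AdjoinRoot.mk f q ≠ 0 := by
    rw [Ne, AdjoinRoot.mk_eq_zero]; exact hndvd
  have : Module.Free L[X] (AdjoinRoot f) := hf.free_adjoinRoot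
  have : Module.Finite L[X] (AdjoinRoot f) := hf.finite_adjoinRoot
  refine ⟨Algebra.norm L[X] (AdjoinRoot.mk f q), ?_, norm_natDegree_le hf he q hq, ?_⟩
  · exact (Algebra.norm_ne_zero_iff_of_basis (AdjoinRoot.powerBasisAux' hf)).2 hΨ0
  · obtain ⟨b, hb⟩ := dvd_norm' (R := L[X]) (AdjoinRoot.mk f q)
    obtain ⟨b, rfl⟩ := AdjoinRoot.mk_surjective b
    rw [AdjoinRoot.algebraMap_eq, ← AdjoinRoot.mk_C, ← map_mul, AdjoinRoot.mk_eq_mk] at hb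
    obtain ⟨c, hc⟩ := hb
    exact ⟨c, b, by linear_combination hc⟩

section
variable {K : Type} [Field K]

lemma evalEval_sum_coeff {δ : ℕ} {f : K[X][X]} (hd : f.natDegree = δ) (x y : K) :
    evalEval x y f = ∑ i ∈ Finset.range (δ + 1), (f.coeff i).eval x * y ^ i := by
  conv_lhs => rw [f.as_sum_range_C_mul_X_pow, hd]
  rw [evalEval_finsetSum]
  simp [evalEval_mul, evalEval_pow, evalEval_C]

lemma roots_nodup_of_sep [IsAlgClosed K] {g : K[X]} (hg : g.Monic) (h : ∀ y, g.eval y = 0 → (derivative g).eval y ≠ 0) :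
    g.roots.Nodup := by
  classical
  rw [Multiset.nodup_iff_count_le_one]
  intro y
  rw [count_roots]
  by_contra hh
  push Not at hh
  have := (one_lt_rootMultiplicity_iff_isRoot hg.ne_zero).1 hh
  exact h y this.1 this.2

/-- the coefficients of `(f(V)-f(Y))/(V-Y)` -/
def cdiv (δ : ℕ) (f : K[X][X]) (l : ℕ) : K[X][X] :=
  ∑ i ∈ Finset.Ico (l + 1) (δ + 1), C (f.coeff i) * X ^ (i - 1 - l)

lemma cdiv_wt {δ e : ℕ} {f : K[X][X]} (hf : f.Monic) (hd : f.natDegree = δ)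
    (he : ∀ i, (f.coeff i).natDegree ≤ e) (l : ℕ) (hl : l < δ - 1) : wt e (e * (δ - 1 - l)) (cdiv δ f l) := by
  refine wt_sum _ _ fun i hi => ?_
  rw [Finset.mem_Ico] at hi
  rcases Nat.lt_or_ge i δ with h | h
  · refine ((wt_C (he i)).mul (wt_Y.pow _)).mono ?_
    have : e + (i - 1 - l) * e = e * (i - 1 - l + 1) := by ring
    rw [this]
    exact Nat.mul_le_mul_left _ (by omega)
  · have : i = δ := by omega
    subst this
    have h1 : f.coeff i = 1 := by rw [← hd]; exact hf.coeff_natDegree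
    rw [h1, C_1, one_mul, mul_comm]
    exact (wt_Y.pow _)

lemma cdiv_rel {δ : ℕ} (hδ : 1 ≤ δ) {f : K[X][X]} (hf : f.Monic) (hd : f.natDegree = δ) (x y V : K)
    (h1 : evalEval x y f = 0) (h2 : evalEval x V f = 0) (hV : V ≠ y) :
    V ^ (δ - 1) = ∑ l ∈ Finset.range (δ - 1), evA x y (-cdiv δ f l) * V ^ l := by
  have hfδ : f.coeff δ = 1 := by rw [← hd]; exact hf.coeff_natDegree
  have h3 : (∑ l ∈ Finset.range δ, evA x y (cdiv δ f l) * V ^ l) * (V - y) = 0 := by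
    rw [evalEval_sum_coeff hd] at h1 h2
    have h4 : ∑ l ∈ Finset.range δ, evA x y (cdiv δ f l) * V ^ l =
        ∑ i ∈ Finset.range (δ + 1), ∑ l ∈ Finset.range i, (f.coeff i).eval x * (V ^ l * y ^ (i - 1 - l)) := by
      rw [Finset.sum_comm' (t' := Finset.range δ) (s' := fun l => Finset.Ico (l+1) (δ+1))]
      · refine Finset.sum_congr rfl fun l _ => ?_
        rw [cdiv, evA_apply, evalEval_finsetSum, Finset.sum_mul]
        refine Finset.sum_congr rfl fun i _ => ?_
        rw [evalEval_mul, evalEval_pow, evalEval_C, evalEval_X]; ring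
      · intro i l; simp only [Finset.mem_range, Finset.mem_Ico]; omega
    rw [h4, Finset.sum_mul]
    have : ∀ i ∈ Finset.range (δ+1), (∑ l ∈ Finset.range i, (f.coeff i).eval x * (V ^ l * y ^ (i - 1 - l))) * (V - y) =
        (f.coeff i).eval x * V ^ i - (f.coeff i).eval x * y ^ i := by
      intro i _
      rw [← Finset.mul_sum, mul_assoc, (Commute.all V y).geom_sum₂_mul]; ring
    rw [Finset.sum_congr rfl this, Finset.sum_sub_distrib, h1, h2, sub_zero]
  have h5 := (mul_eq_zero.1 h3).resolve_right (sub_ne_zero.2 hV)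
  obtain ⟨k, rfl⟩ : ∃ k, δ = k + 1 := ⟨δ - 1, by omega⟩
  rw [Finset.sum_range_succ] at h5
  have h6 : evA x y (cdiv (k+1) f k) = 1 := by
    rw [cdiv]
    rw [show Finset.Ico (k+1) (k+1+1) = {k+1} by ext; simp, Finset.sum_singleton, hfδ]
    simp
  rw [h6, one_mul] at h5
  simp only [map_neg, neg_mul, Finset.sum_neg_distrib, Nat.add_sub_cancel]
  linear_combination h5
end

lemma not_dvd_der {K : Type*} [Field K] {p δ : ℕ} [CharP K p] (hδ : 1 ≤ δ) (hp : δ < p) {f : K[X][X]} (hf : f.Monic) (hd : f.natDegree = δ) :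
    ¬ f ∣ derivative f := by
  have h1 : derivative f ≠ 0 := by
    intro h
    have := congrArg (fun q => q.coeff (δ - 1)) h
    simp only [coeff_derivative, coeff_zero] at this
    rw [Nat.sub_add_cancel hδ, ← hd, hf.coeff_natDegree, one_mul, hd] at this
    have h2 : ((δ : ℕ) : K[X]) = 0 := by
      rw [← this]; push_cast [Nat.cast_sub hδ]; ring
    rw [← C_eq_natCast, C_eq_zero, CharP.cast_eq_zero_iff K p] at h2
    exact absurd (Nat.le_of_dvd (by omega) h2) (by omega)
  refine hf.not_dvd_of_natDegree_lt h1 ?_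
  exact natDegree_derivative_lt (by omega)

/-- number of zeros over `F_p` -/
def Np (p : ℕ) [NeZero p] (f0 : (ZMod p)[X][X]) : ℕ :=
  (Finset.univ.filter fun q : ZMod p × ZMod p => evalEval q.1 q.2 f0 = 0).card

section weilsec
variable {p : ℕ} [hp : Fact p.Prime] {K : Type} [Field K] [IsAlgClosed K] [CharP K p] (i0 : ZMod p →+* K)

lemma mem_range_of_frob (y : K) (hy : y ^ p = y) : ∃ z : ZMod p, i0 z = y := by
  have h1 := (Subfield.mem_bot_iff_pow_eq_self (F := K) (p := p)).2 hy
  have h2 : (⊥ : Subfield K) ≤ i0.fieldRange := bot_le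
  exact h2 h1

lemma frob_root (f0 : (ZMod p)[X][X]) (x : ZMod p) (y : K) (h : evalEval (i0 x) y (f0.map (mapRingHom i0)) = 0) :
    evalEval (i0 x) (y ^ p) (f0.map (mapRingHom i0)) = 0 := by
  rw [evalEval_sum_coeff rfl] at h ⊢
  have h2 := congrArg (fun z => z ^ p) h
  simp only [sum_pow_char, zero_pow hp.out.ne_zero] at h2
  rw [← h2]
  refine Finset.sum_congr rfl fun i _ => ?_
  rw [mul_pow]
  congr 1
  · rw [coeff_map, coe_mapRingHom, eval_map_apply, ← map_pow, ZMod.pow_card]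
  · ring

lemma card_bad_fiber (f0 : (ZMod p)[X][X]) (hf0 : f0.Monic) {δ : ℕ} (hd : f0.natDegree = δ) (S : Finset (ZMod p)) :
    ((Finset.univ.filter fun q : ZMod p × ZMod p => evalEval q.1 q.2 f0 = 0).filter fun q => q.1 ∈ S).card ≤ δ * S.card := by
  classical
  rw [mul_comm]
  refine (Finset.card_le_mul_card_image_of_maps_to (f := Prod.fst) (t := S) (fun q hq => (Finset.mem_filter.1 hq).2) δ fun x _ => ?_).trans (by rw [mul_comm])
  have h1 : (f0.map (evalRingHom x)).roots.toFinset.card ≤ δ := by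
    refine (Multiset.toFinset_card_le _).trans ((card_roots' _).trans ?_)
    rw [hf0.natDegree_map, hd]
  refine le_trans ?_ h1
  refine Finset.card_le_card_of_injOn Prod.snd ?_ ?_
  · intro q hq
    simp only [Finset.coe_filter, Finset.mem_filter, Finset.mem_univ, true_and, Set.mem_ofPred_eq] at hq
    simp only [Finset.mem_coe, Multiset.mem_toFinset]
    rw [mem_roots (hf0.map _).ne_zero, IsRoot, map_evalRingHom_eval, ← hq.2]
    exact hq.1.1
  · intro q hq q' hq' h
    simp only [Finset.coe_filter, Finset.mem_filter, Finset.mem_univ, true_and, Set.mem_ofPred_eq] at hq hq'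
    exact Prod.ext (hq.2.trans hq'.2.symm) h

theorem weil_aux (δ e : ℕ) (hδ : 2 ≤ δ) (C1 C2 p1 p2 : ℕ)
   (f0 : (ZMod p)[X][X]) (hp1 : p1 ≤ p) (hp2 : p2 ≤ p) (hp3 : δ < p)
   (hf0 : f0.Monic) (hd : f0.natDegree = δ) (he : ∀ i, (f0.coeff i).natDegree ≤ e) 
   (hirr : Irreducible (f0.map (mapRingHom i0)))
   (H : ∀ (W : Finset (K × K)),
      (∀ q ∈ W, evA q.1 q.2 (f0.map (mapRingHom i0)) = 0 ∧
      evA q.1 q.2 (derivative (f0.map (mapRingHom i0))) ≠ 0) → (∀ q ∈ W, ∃ z, q.1 = i0 z) → 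
      ((∀ q ∈ W, q.2 ^ p = q.2) → W.card ≤ p + C1 * p.sqrt) ∧ 
      ((∀ q ∈ W, q.2 ^ p ≠ q.2) → W.card ≤ (δ - 1) * p + C2 * p.sqrt)) :
   p ≤ Np p f0 + C2 * p.sqrt + δ * (δ * (e * δ + e * δ + e * δ)) ∧
     Np p f0 ≤ p + C1 * p.sqrt + δ * (δ * (e * δ + e * δ + e * δ)) := by
  classical
  set f := f0.map (mapRingHom i0) with hf
  have hfm : f.Monic := hf0.map _
  have hfd : f.natDegree = δ := by rw [hf, hf0.natDegree_map, hd]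
  have he' := natDegree_coeff_map_le i0 he
  have hY := not_dvd_der (K := K) (p := p) (by omega) hp3 hfm hfd
  have hw : wt e (e * δ + e * δ) (derivative f) := by
    refine (wt_of_deg (w' := e) (d := δ) ?_ ?_).mono ?_
    · intro i
      rw [coeff_derivative]
      refine natDegree_mul_le.trans ?_
      have : (↑i + 1 : K[X]).natDegree = 0 := by
        rw [← Nat.cast_succ]; exact natDegree_natCast _
      rw [this]; exact he' _
    · exact (natDegree_derivative_le _).trans (by omega)
    · nlinarith [Nat.zero_le e]
  obtain ⟨D, hD0, hDd, u, v, huv⟩ := elim hfm he' hirr (derivative f) hw hY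
  rw [hfd] at hDd
  set Bad := Finset.univ.filter fun x : ZMod p => D.eval (i0 x) = 0 with hBad
  set Good := Finset.univ.filter fun x : ZMod p => ¬ D.eval (i0 x) = 0 with hGood
  have hcard : Bad.card + Good.card = p := by
    rw [hBad, hGood, Finset.card_filter_add_card_filter_not, Finset.card_univ, ZMod.card]
  have hBadc : Bad.card ≤ δ * (e * δ + e * δ + e * δ) := by
    refine le_trans ?_ hDd
    refine le_trans ?_ (card_roots' D)
    refine le_trans ?_ (Multiset.toFinset_card_le _)
    refine Finset.card_le_card_of_injOn i0 ?_ i0.injective.injOn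
    intro x hx
    simp only [hBad, Finset.coe_filter, Finset.mem_univ, true_and, Set.mem_ofPred_eq] at hx
    simp only [Finset.mem_coe, Multiset.mem_toFinset, mem_roots hD0, IsRoot, hx]
  have hgood : ∀ x ∈ Good, ∀ y, evalEval (i0 x) y f = 0 → evalEval (i0 x) y (derivative f) ≠ 0 := by
    intro x hx y h1 h2
    have := congrArg (evalEval (i0 x) y) huv
    rw [evalEval_C, evalEval_add, evalEval_mul, evalEval_mul, h1, h2, mul_zero, mul_zero, add_zero] at this
    exact (Finset.mem_filter.1 hx).2 this
  let R : ZMod p → Finset K := fun x => (f.map (evalRingHom (i0 x))).roots.toFinset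
  have hR : ∀ x y, y ∈ R x ↔ evalEval (i0 x) y f = 0 := by
    intro x y
    simp only [R, Multiset.mem_toFinset]
    rw [mem_roots (hfm.map _).ne_zero, IsRoot, map_evalRingHom_eval]
  have hRc : ∀ x ∈ Good, (R x).card = δ := by
    intro x hx
    simp only [R]
    rw [Multiset.toFinset_card_of_nodup, IsAlgClosed.card_roots_eq_natDegree, hfm.natDegree_map, hfd]
    refine roots_nodup_of_sep (hfm.map _) fun y hy => ?_
    rw [derivative_map, map_evalRingHom_eval]
    exact hgood x hx y (by rwa [map_evalRingHom_eval] at hy)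
  let emb : (Σ _ : ZMod p, K) ↪ K × K := ⟨fun s => (i0 s.1, s.2), by
    rintro ⟨a, b⟩ ⟨c, d⟩ h
    simp only [Prod.mk.injEq] at h
    obtain ⟨h1, h2⟩ := h
    rw [i0.injective h1, h2]⟩
  let Z : Finset (K × K) := (Good.sigma R).map emb
  have hZm : ∀ q, q ∈ Z ↔ ∃ x ∈ Good, q.1 = i0 x ∧ evalEval (i0 x) q.2 f = 0 := by
    intro q
    simp only [Z, Finset.mem_map, Finset.mem_sigma, emb, Function.Embedding.coeFn_mk]
    constructor
    · rintro ⟨⟨x, y⟩, ⟨hx, hy⟩, rfl⟩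
      exact ⟨x, hx, rfl, (hR _ _).1 hy⟩
    · rintro ⟨x, hx, h1, h2⟩
      exact ⟨⟨x, q.2⟩, ⟨hx, (hR _ _).2 h2⟩, Prod.ext h1.symm rfl⟩
  have hZc : Z.card = δ * Good.card := by
    rw [Finset.card_map, Finset.card_sigma, Finset.sum_congr rfl hRc, Finset.sum_const, smul_eq_mul, mul_comm]
  have hZ1 : ∀ q ∈ Z, evA q.1 q.2 f = 0 ∧ evA q.1 q.2 (derivative f) ≠ 0 := by
    intro q hq
    obtain ⟨x, hx, h1, h2⟩ := (hZm q).1 hq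
    rw [evA_apply, evA_apply, h1]
    exact ⟨h2, hgood x hx _ h2⟩
  have hZ2 : ∀ q ∈ Z, ∃ z, q.1 = i0 z := by
    intro q hq
    obtain ⟨x, hx, h1, h2⟩ := (hZm q).1 hq
    exact ⟨x, h1⟩
  set W := Z.filter fun q => q.2 ^ p = q.2 with hW
  set W' := Z.filter fun q => ¬ q.2 ^ p = q.2 with hW'
  have hWW : W.card + W'.card = Z.card := Finset.card_filter_add_card_filter_not _
  have hWle := (H W (fun q hq => hZ1 q (Finset.mem_filter.1 hq).1) (fun q hq => hZ2 q (Finset.mem_filter.1 hq).1)).1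
    (fun q hq => (Finset.mem_filter.1 hq).2)
  have hWle' := (H W' (fun q hq => hZ1 q (Finset.mem_filter.1 hq).1) (fun q hq => hZ2 q (Finset.mem_filter.1 hq).1)).2
    (fun q hq => (Finset.mem_filter.1 hq).2)
  -- compare with N
  set N := Finset.univ.filter fun q : ZMod p × ZMod p => evalEval q.1 q.2 f0 = 0 with hN
  have hev : ∀ x y : ZMod p, evalEval (i0 x) (i0 y) f = i0 (evalEval x y f0) := fun x y => by
    rw [hf, map_mapRingHom_evalEval]
  have e1 : W.card ≤ N.card := by
    refine (Finset.card_le_card (t := N.image fun q => (i0 q.1, i0 q.2)) ?_).trans Finset.card_image_le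
    intro q hq
    rw [hW, Finset.mem_filter] at hq
    obtain ⟨x, hx, h1, h2⟩ := (hZm q).1 hq.1
    obtain ⟨y, hy⟩ := mem_range_of_frob i0 q.2 hq.2
    rw [Finset.mem_image]
    refine ⟨(x, y), ?_, by rw [← h1, hy]⟩
    rw [hN, Finset.mem_filter]
    refine ⟨Finset.mem_univ _, i0.injective ?_⟩
    rw [map_zero, ← hev, hy, h2]
  have e2 : N.card ≤ W.card + δ * Bad.card := by
    rw [← Finset.card_filter_add_card_filter_not (s := N) (fun q => q.1 ∈ Bad), add_comm]
    refine Nat.add_le_add ?_ (card_bad_fiber f0 hf0 hd Bad)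
    refine Finset.card_le_card_of_injOn (fun q => (i0 q.1, i0 q.2)) ?_ ?_
    · intro q hq
      simp only [Finset.coe_filter, Set.mem_ofPred_eq, hN, Finset.mem_filter, Finset.mem_univ, true_and] at hq
      rw [Finset.mem_coe, hW, Finset.mem_filter, hZm]
      refine ⟨⟨q.1, ?_, rfl, ?_⟩, ?_⟩
      · have := hq.2
        rw [hBad, Finset.mem_filter] at this
        rw [hGood, Finset.mem_filter]
        exact ⟨Finset.mem_univ _, fun h => this ⟨Finset.mem_univ _, h⟩⟩
      · rw [hev, hq.1, map_zero]
      · rw [← map_pow, ZMod.pow_card]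
    · rintro ⟨a, b⟩ _ ⟨c, d⟩ _ h
      simp only [Prod.mk.injEq] at h
      rw [i0.injective h.1, i0.injective h.2]
  have e3 : δ * Bad.card ≤ δ * (δ * (e * δ + e * δ + e * δ)) := Nat.mul_le_mul_left _ hBadc
  have e4 : δ * Bad.card + δ * Good.card = δ * p := by rw [← mul_add, hcard]
  have e5 : (δ - 1) * p + p = δ * p := by
    obtain ⟨k, rfl⟩ : ∃ k, δ = k + 1 := ⟨δ - 1, by omega⟩
    simp; ring
  have e6 : Np p f0 = N.card := rfl
  omega

end weilsec

theorem weil (δ e : ℕ) (hδ : 2 ≤ δ) : ∃ C : ℕ, ∀ (p : ℕ) [Fact p.Prime] (K : Type) [Field K] [IsAlgClosed K]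
    [CharP K p] (i0 : ZMod p →+* K) (f0 : (ZMod p)[X][X]), f0.Monic → f0.natDegree = δ →
    (∀ i, (f0.coeff i).natDegree ≤ e) → Irreducible (f0.map (mapRingHom i0)) →
    p ≤ Np p f0 + C * p.sqrt ∧ Np p f0 ≤ p + C * p.sqrt := by
  obtain ⟨C1, p1, hp1, H1⟩ := stepanov_num δ e 1 (by omega) (by omega)
  obtain ⟨C2, p2, hp2, H2⟩ := stepanov_num δ e (δ - 1) (by omega) (by omega)
  set T := δ * (δ * (e * δ + e * δ + e * δ)) with hT
  refine ⟨C1 + C2 + T + (p1 + p2) * (p1 + p2), ?_⟩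
  intro p hp K _ _ _ i0 f0 hf0 hd he hirr
  have hr : 1 ≤ p.sqrt := Nat.sqrt_pos.2 hp.out.pos
  have hexp : (C1 + C2 + T + (p1 + p2) * (p1 + p2)) * p.sqrt = C1 * p.sqrt + C2 * p.sqrt + T * p.sqrt + (p1 + p2) * (p1 + p2) * p.sqrt := by ring
  rw [hexp]
  by_cases hsmall : p < p1 + p2
  · have h1 : p * p ≤ (p1 + p2) * (p1 + p2) := Nat.mul_le_mul hsmall.le hsmall.le
    have h2 : Np p f0 ≤ p * p := by
      refine (Finset.card_le_univ _).trans ?_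
      rw [Fintype.card_prod, ZMod.card]
    have h3 : (p1 + p2) * (p1 + p2) ≤ (p1 + p2) * (p1 + p2) * p.sqrt := Nat.le_mul_of_pos_right _ hr
    have h4 : p ≤ p * p := Nat.le_mul_of_pos_left _ hp.out.pos
    omega
  push Not at hsmall
  have hfm : (f0.map (mapRingHom i0)).Monic := hf0.map _
  have hfd : (f0.map (mapRingHom i0)).natDegree = δ := by rw [hf0.natDegree_map, hd]
  have hY := not_dvd_der (K := K) (p := p) (δ := δ) (by omega) (by omega) hfm hfd
  have := weil_aux i0 δ e hδ C1 C2 p1 p2 f0 (by omega) (by omega) (by omega) hf0 hd he hirr (by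
    intro W hW hWx
    have hWx' : ∀ q ∈ W, q.1 ^ p = q.1 := by
      intro q hq
      obtain ⟨z, hz⟩ := hWx q hq
      rw [hz, ← map_pow, ZMod.pow_card]
    constructor
    · intro hy
      have := H1 p K f0 i0 W (fun _ => X) (by omega) hf0 hd he hirr hY hW hWx' (fun l hl => wt_Y.mono (by
        have : l = 0 := by omega
        subst this; simp)) (fun z hz => by
        rw [hy z hz]; simp [evA_apply])
      rwa [one_mul] at this
    · intro hy
      refine H2 p K f0 i0 W (fun l => - cdiv δ (f0.map (mapRingHom i0)) l) (by omega) hf0 hd he hirr hY hW hWx' ?_ ?_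
      · intro l hl
        have := wt_zero.sub (cdiv_wt hfm hfd (natDegree_coeff_map_le i0 he) l hl)
        rwa [zero_sub] at this
      · intro z hz
        obtain ⟨x, hx⟩ := hWx z hz
        have h1 := (hW z hz).1
        rw [evA_apply] at h1
        refine cdiv_rel (by omega) hfm hfd _ _ _ h1 ?_ (hy z hz)
        rw [hx] at h1 ⊢
        exact frob_root i0 f0 x z.2 h1)
  have h5 : T ≤ T * p.sqrt := Nat.le_mul_of_pos_right _ hr
  omega

end St

namespace St
open NC

lemma newton (f : ℤ[X][X]) {p : ℕ} (hp : p.Prime) (t0 y0 : ℤ)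
    (h : ¬ (p : ℤ) ∣ evalEval t0 y0 (derivative f)) (s : ℕ) :
    ∃ ψ : ℤ[X], ∀ t y : ℤ, (p : ℤ) ∣ t - t0 → (p : ℤ) ∣ y - y0 → evalEval t y f = 0 → (p : ℤ) ^ (s + 1) ∣ y - ψ.eval t := by
  have : Fact p.Prime := ⟨hp⟩
  induction s with
  | zero => exact ⟨C y0, fun t y _ hy _ => by simpa using hy⟩
  | succ s ih =>
    obtain ⟨ψ, hψ⟩ := ih
    obtain ⟨v, hv⟩ : ∃ v : ℤ, (p : ℤ) ∣ 1 - v * evalEval t0 y0 (derivative f) := by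
      obtain ⟨a, b, hab⟩ := (Nat.prime_iff_prime_int.1 hp).coprime_iff_not_dvd.2 h
      exact ⟨b, a, by linear_combination -hab⟩
    refine ⟨ψ - C v * (f.eval ψ), fun t y ht hy hf => ?_⟩
    have h1 := hψ t y ht hy hf
    have hcong : (p : ℤ) ∣ evalEval t y (derivative f) - evalEval t0 y0 (derivative f) := by
      rw [← ZMod.intCast_zmod_eq_zero_iff_dvd, Int.cast_sub, sub_eq_zero]
      have ht' : ((t : ℤ) : ZMod p) = t0 := by
        rw [← sub_eq_zero, ← Int.cast_sub, ZMod.intCast_zmod_eq_zero_iff_dvd]; exact ht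
      have hy' : ((y : ℤ) : ZMod p) = y0 := by
        rw [← sub_eq_zero, ← Int.cast_sub, ZMod.intCast_zmod_eq_zero_iff_dvd]; exact hy
      rw [← eq_intCast (Int.castRingHom (ZMod p)), ← eq_intCast (Int.castRingHom (ZMod p)),
        ← map_mapRingHom_evalEval, ← map_mapRingHom_evalEval]
      simp only [eq_intCast, ht', hy']
    have hev : (f.eval ψ).eval t = evalEval t (ψ.eval t) f := by
      rw [← map_evalRingHom_eval, ← coe_evalRingHom t, ← eval₂_hom, eval₂_eq_eval_map]
    obtain ⟨k, hk⟩ := binomExpansion (f.map (evalRingHom t)) y (ψ.eval t - y)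
    rw [derivative_map, map_evalRingHom_eval, map_evalRingHom_eval, map_evalRingHom_eval, hf, add_sub_cancel, zero_add] at hk
    rw [eval_sub, eval_mul, eval_C, hev, hk]
    obtain ⟨a, ha⟩ := h1
    obtain ⟨b, hb⟩ := hcong
    obtain ⟨c, hc⟩ := hv
    have e1 : ψ.eval t = y - p^(s+1) * a := by linear_combination -ha
    have e2 : evalEval t y (derivative f) = evalEval t0 y0 (derivative f) + p * b := by linear_combination hb
    rw [e1, e2]
    refine ⟨a * c - v * b * a + v * k * p ^ s * a ^ 2, ?_⟩
    have e3 : v * evalEval t0 y0 (derivative f) = 1 - p * c := by linear_combination -hc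
    linear_combination (- (p:ℤ)^(s+1) * a) * e3

lemma dvd_eval_of_coeff {p : ℤ} {s : ℕ} (G : ℤ[X]) (h : ∀ k < s, p ^ (s - k) ∣ G.coeff k) (w : ℤ) (hw : p ∣ w) :
    p ^ s ∣ G.eval w := by
  rw [eval_eq_sum_range]
  refine Finset.dvd_sum fun k _ => ?_
  rcases Nat.lt_or_ge k s with hk | hk
  · have := mul_dvd_mul (h k hk) (pow_dvd_pow_of_dvd hw k)
    rwa [← pow_add, Nat.sub_add_cancel hk.le] at this
  · exact Dvd.dvd.mul_left ((pow_dvd_pow _ hk).trans (pow_dvd_pow_of_dvd hw k)) _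

lemma aux_poly (f : ℤ[X][X]) {p : ℕ} (hp : p.Prime) (t0 y0 : ℤ)
    (h : ¬ (p : ℤ) ∣ evalEval t0 y0 (derivative f)) {s k1 δ L H A : ℕ} (hs : s = k1 * δ) (hs0 : 0 < s)
    (hA : s * A < p ^ s) (hbox : ∏ k : Fin s, p ^ (s - k) < ∏ q : Fin k1 × Fin δ, (A / (L ^ (q.1 : ℕ) * H ^ (q.2 : ℕ)) + 1)) :
    ∃ c : Fin k1 × Fin δ → ℤ, c ≠ 0 ∧ ∀ t y : ℤ, (p : ℤ) ∣ t - t0 → (p : ℤ) ∣ y - y0 → evalEval t y f = 0 →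
      |t| ≤ L → |y| ≤ H → ∑ q, c q * (t ^ (q.1 : ℕ) * y ^ (q.2 : ℕ)) = 0 := by
  obtain ⟨ψ, hψ⟩ := newton f hp t0 y0 h (s - 1)
  rw [Nat.sub_add_cancel hs0] at hψ
  set Nq : Fin k1 × Fin δ → ℕ := fun q => A / (L ^ (q.1 : ℕ) * H ^ (q.2 : ℕ)) with hNq
  let G : Fin k1 × Fin δ → ℤ[X] := fun q => (X + C t0) ^ (q.1 : ℕ) * (ψ.comp (X + C t0)) ^ (q.2 : ℕ)
  let Φ : (∀ q, Fin (Nq q + 1)) → (∀ k : Fin s, ZMod (p ^ (s - k))) := fun c k =>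
    (((∑ q, C ((c q : ℕ) : ℤ) * G q).coeff k : ℤ) : ZMod (p ^ (s - k)))
  have : ∀ k : Fin s, NeZero (p ^ (s - k)) := fun k => ⟨pow_ne_zero _ hp.ne_zero⟩
  have hcard : Fintype.card (∀ k : Fin s, ZMod (p ^ (s - k))) < Fintype.card (∀ q, Fin (Nq q + 1)) := by
    simp only [Fintype.card_pi, ZMod.card, Fintype.card_fin]
    exact hbox
  obtain ⟨c, c', hne, heq⟩ := Fintype.exists_ne_map_eq_of_card_lt Φ hcard
  refine ⟨fun q => ((c q : ℕ) : ℤ) - ((c' q : ℕ) : ℤ), ?_, ?_⟩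
  · intro h0
    apply hne
    funext q
    have := congrFun h0 q
    simp only [Pi.zero_apply] at this
    exact Fin.ext (by omega)
  · intro t y ht hy hf htL hyH
    refine Int.eq_zero_of_abs_lt_dvd (m := (p : ℤ) ^ s) ?_ ?_
    · have h1 : (p : ℤ) ^ s ∣ (∑ q, C (((c q : ℕ) : ℤ) - ((c' q : ℕ) : ℤ)) * G q).eval (t - t0) := by
        refine dvd_eval_of_coeff _ ?_ _ ht
        intro k hk
        have h2 := congrFun heq ⟨k, hk⟩
        simp only [Φ] at h2
        rw [← sub_eq_zero, ← Int.cast_sub, ZMod.intCast_zmod_eq_zero_iff_dvd] at h2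
        rw [← coeff_sub, ← Finset.sum_sub_distrib] at h2
        simp only [← sub_mul, ← C_sub] at h2
        rw [Nat.cast_pow] at h2
        exact h2
      rw [eval_finsetSum] at h1
      have h3 : (p : ℤ) ^ s ∣ (∑ q, (((c q : ℕ) : ℤ) - ((c' q : ℕ) : ℤ)) * (t ^ (q.1 : ℕ) * y ^ (q.2 : ℕ))) -
          ∑ q, (C (((c q : ℕ) : ℤ) - ((c' q : ℕ) : ℤ)) * G q).eval (t - t0) := by
        rw [← Finset.sum_sub_distrib]
        refine Finset.dvd_sum fun q _ => ?_
        simp only [G, eval_mul, eval_pow, eval_comp, eval_add, eval_X, eval_C, sub_add_cancel]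
        rw [← mul_sub, ← mul_sub]
        exact Dvd.dvd.mul_left (Dvd.dvd.mul_left ((hψ t y ht hy hf).trans (sub_dvd_pow_sub_pow _ _ _)) _) _
      exact (dvd_sub_left h1).1 h3
    · have h4 : |∑ q, (((c q : ℕ) : ℤ) - ((c' q : ℕ) : ℤ)) * (t ^ (q.1 : ℕ) * y ^ (q.2 : ℕ))| ≤ ∑ q : Fin k1 × Fin δ, (A : ℤ) := by
        refine (Finset.abs_sum_le_sum_abs _ _).trans (Finset.sum_le_sum fun q _ => ?_)
        rw [abs_mul, abs_mul, abs_pow, abs_pow]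
        have h5 : |((c q : ℕ) : ℤ) - ((c' q : ℕ) : ℤ)| ≤ Nq q := by
          have := (c q).2; have := (c' q).2
          rw [abs_le]; constructor <;> omega
        have h6 : |t| ^ (q.1 : ℕ) * |y| ^ (q.2 : ℕ) ≤ L ^ (q.1 : ℕ) * H ^ (q.2 : ℕ) := by gcongr
        calc _ ≤ (Nq q : ℤ) * (L ^ (q.1 : ℕ) * H ^ (q.2 : ℕ)) := by gcongr
          _ ≤ A := by
            have := Nat.div_mul_le_self A (L ^ (q.1 : ℕ) * H ^ (q.2 : ℕ))
            exact_mod_cast this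
      refine h4.trans_lt ?_
      rw [Finset.sum_const, Finset.card_univ, Fintype.card_prod, Fintype.card_fin, Fintype.card_fin, ← hs, nsmul_eq_mul]
      exact_mod_cast hA

lemma class_bound (f : ℤ[X][X]) (hf : f.Monic) {e : ℕ} (he : ∀ i, (f.coeff i).natDegree ≤ e)
    (hirr : Irreducible (f.map (mapRingHom (Int.castRingHom ℚ)))) {p : ℕ} (hp : p.Prime) (t0 y0 : ℤ)
    (h : ¬ (p : ℤ) ∣ evalEval t0 y0 (derivative f)) {s k1 δ L H A : ℕ} (hδ : f.natDegree = δ) (hs : s = k1 * δ) (hs0 : 0 < s)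
    (hA : s * A < p ^ s) (hbox : ∏ k : Fin s, p ^ (s - k) < ∏ q : Fin k1 × Fin δ, (A / (L ^ (q.1 : ℕ) * H ^ (q.2 : ℕ)) + 1))
    (T : Finset ℤ) (hT : ∀ t ∈ T, |t| ≤ L ∧ ∃ y : ℤ, (p : ℤ) ∣ t - t0 ∧ (p : ℤ) ∣ y - y0 ∧ evalEval t y f = 0 ∧ |y| ≤ H) :
    T.card ≤ δ * (k1 + e * δ + e * δ) := by
  classical
  obtain ⟨c, hc0, hc⟩ := aux_poly f hp t0 y0 h hs hs0 hA hbox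
  set i := Int.castRingHom ℚ
  set F := f.map (mapRingHom i) with hF
  have hFm : F.Monic := hf.map _
  have hFd : F.natDegree = δ := by rw [hF, hf.natDegree_map, hδ]
  have he' := natDegree_coeff_map_le i he
  set g : ℚ[X][X] := ∑ q : Fin k1 × Fin δ, C (C (c q : ℚ) * X ^ (q.1 : ℕ)) * X ^ (q.2 : ℕ) with hg
  have hcoef : ∀ a : Fin k1, ∀ b : Fin δ, (g.coeff b).coeff a = c (a, b) := by
    intro a b
    rw [hg, finsetSum_coeff, finsetSum_coeff, Finset.sum_eq_single (a, b)]
    · rw [coeff_C_mul, coeff_X_pow, if_pos rfl, mul_one, coeff_C_mul, coeff_X_pow, if_pos rfl, mul_one]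
    · intro q _ hq
      rw [coeff_C_mul, coeff_X_pow]
      split_ifs with h1
      · rw [mul_one, coeff_C_mul, coeff_X_pow, if_neg, mul_zero]
        intro h2
        exact hq (Prod.ext (Fin.ext h2.symm) (Fin.ext h1.symm))
      · simp
    · simp
  have hg0 : g ≠ 0 := by
    intro h0
    apply hc0
    funext q
    have := hcoef q.1 q.2
    rw [h0] at this
    simpa using this.symm
  have hgd : g.degree < F.degree := by
    rw [degree_eq_natDegree hFm.ne_zero, hFd, hg]
    refine (degree_sum_le _ _).trans_lt ?_
    rw [Finset.sup_lt_iff (by exact WithBot.bot_lt_coe _)]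
    intro q _
    refine (degree_C_mul_X_pow_le _ _).trans_lt ?_
    exact_mod_cast q.2.2
  have hnd : ¬ F ∣ g := hFm.not_dvd_of_degree_lt hg0 hgd
  have hw : wt e (k1 + e * δ) g := by
    refine wt_sum _ _ fun q _ => ?_
    refine ((wt_C (w := k1) ?_).mul ((wt_Y (e := e)).pow _)).mono ?_
    · refine (natDegree_C_mul_X_pow_le _ _).trans q.1.2.le
    · have := Nat.mul_le_mul_left e q.2.2.le
      rw [mul_comm (q.2 : ℕ)]; omega
  obtain ⟨D, hD0, hDd, u, v, huv⟩ := elim hFm he' hirr g hw hnd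
  rw [hFd] at hDd
  refine le_trans ?_ hDd
  refine le_trans ?_ (card_roots' D)
  refine le_trans ?_ (Multiset.toFinset_card_le _)
  refine Finset.card_le_card_of_injOn (fun t : ℤ => (t : ℚ)) ?_ (Int.cast_injective.injOn)
  intro t ht
  obtain ⟨htL, y, h1, h2, h3, h4⟩ := hT t ht
  simp only [Finset.mem_coe, Multiset.mem_toFinset, mem_roots hD0, IsRoot]
  have e1 : evalEval (t : ℚ) (y : ℚ) F = 0 := by
    have := map_mapRingHom_evalEval i f t y
    rw [h3, map_zero] at this
    exact this
  have e2 : evalEval (t : ℚ) (y : ℚ) g = 0 := by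
    have := hc t y h1 h2 h3 htL h4
    rw [hg, evalEval_finsetSum]
    have h5 := congrArg (Int.cast (R := ℚ)) this
    push_cast at h5
    rw [← h5]
    refine Finset.sum_congr rfl fun q _ => ?_
    rw [evalEval_mul, evalEval_C, evalEval_pow, evalEval_X]
    simp [mul_assoc]
  have := congrArg (evalEval (t : ℚ) (y : ℚ)) huv
  rwa [evalEval_C, evalEval_add, evalEval_mul, evalEval_mul, e1, e2, mul_zero, mul_zero, add_zero] at this

end St

namespace St
open NC

lemma prod_pow_sq (x n : ℕ) : (∏ i : Fin n, x ^ (i : ℕ)) ^ 2 = x ^ (n * (n - 1)) := by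
  rw [Fin.prod_univ_eq_prod_range (fun i => x ^ i), Finset.prod_pow_eq_pow_sum, ← pow_mul, Finset.sum_range_id_mul_two]

lemma prod_pow_sq' (x n : ℕ) : (∏ i : Fin n, x ^ (n - (i : ℕ))) ^ 2 = x ^ (n * (n + 1)) := by
  rw [Fin.prod_univ_eq_prod_range (fun i => x ^ (n - i)), Finset.prod_pow_eq_pow_sum, ← pow_mul]
  congr 1
  have : ∑ i ∈ Finset.range n, (n - i) = ∑ i ∈ Finset.range n, (i + 1) := by
    rw [← Finset.sum_range_reflect]
    refine Finset.sum_congr rfl fun i hi => ?_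
    rw [Finset.mem_range] at hi; omega
  rw [this, Finset.sum_add_distrib, add_mul, Finset.sum_range_id_mul_two]
  simp
  cases n with
  | zero => simp
  | succ n => simp; ring

lemma box_num {p s k0 δ L H : ℕ} (hδ : 2 ≤ δ) (hs : s = (k0 + 1) * δ) (hps : s ^ 2 < p) (hL : 1 ≤ L) (hH : 1 ≤ H)
    (hX : L ^ k0 * H ^ 2 ≤ p ^ (2 * k0)) : ∃ A, s * A < p ^ s ∧
    ∏ k : Fin s, p ^ (s - k) < ∏ q : Fin (k0 + 1) × Fin δ, (A / (L ^ (q.1 : ℕ) * H ^ (q.2 : ℕ)) + 1) := by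
  have hs0 : 0 < s := by rw [hs]; positivity
  have hp0 : 0 < p := by omega
  set m : Fin (k0 + 1) × Fin δ → ℕ := fun q => L ^ (q.1 : ℕ) * H ^ (q.2 : ℕ) with hm
  have hm0 : ∀ q, 0 < m q := fun q => by positivity
  refine ⟨(p ^ s - 1) / s, ?_, ?_⟩
  · have := Nat.mul_div_le (p ^ s - 1) s
    have : 0 < p ^ s := by positivity
    omega
  set A := (p ^ s - 1) / s with hA
  have h1 : p ^ s ≤ s * (A + 1) := by
    have := Nat.lt_mul_div_succ (p ^ s - 1) hs0
    rw [← hA] at this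
    omega
  have h2 : ∀ q, p ^ s ≤ (s * m q) * (A / m q + 1) := by
    intro q
    refine h1.trans ?_
    have := Nat.lt_mul_div_succ A (hm0 q)
    rw [mul_assoc]
    exact Nat.mul_le_mul_left _ this
  have h3 : ∏ q : Fin (k0 + 1) × Fin δ, p ^ s ≤ ∏ q, ((s * m q) * (A / m q + 1)) := Finset.prod_le_prod' fun q _ => h2 q
  rw [Finset.prod_mul_distrib, Finset.prod_mul_distrib, Finset.prod_const, Finset.prod_const, Finset.card_univ, Fintype.card_prod, Fintype.card_fin, Fintype.card_fin, ← hs] at h3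
  have h4 : (∏ q, m q) ^ 2 = (L ^ k0 * H ^ (δ - 1)) ^ s := by
    rw [hm, Finset.prod_mul_distrib, Fintype.prod_prod_type, Fintype.prod_prod_type, mul_pow]
    simp only [Finset.prod_const, Finset.card_univ, Fintype.card_fin]
    rw [Finset.prod_pow, pow_right_comm, prod_pow_sq, pow_right_comm (∏ x : Fin δ, H ^ (x : ℕ)), prod_pow_sq, ← pow_mul, ← pow_mul, hs, mul_pow, ← pow_mul, ← pow_mul]
    simp only [Nat.add_sub_cancel]
    congr 2 <;> ring
  have key : s ^ 2 * (L ^ k0 * H ^ (δ - 1)) < p ^ (s - 1) := by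
    have a1 : (L ^ k0 * H ^ δ) ^ 2 ≤ (p ^ (δ * k0)) ^ 2 := by
      calc (L ^ k0 * H ^ δ) ^ 2 = (L ^ k0) ^ 2 * (H ^ 2) ^ δ := by ring
        _ ≤ (L ^ k0) ^ δ * (H ^ 2) ^ δ := by
          gcongr
          exact Nat.one_le_pow _ _ hL
        _ = (L ^ k0 * H ^ 2) ^ δ := by ring
        _ ≤ (p ^ (2 * k0)) ^ δ := Nat.pow_le_pow_left hX _
        _ = _ := by ring
    have a2 : L ^ k0 * H ^ δ ≤ p ^ (δ * k0) := (Nat.pow_le_pow_iff_left (by norm_num)).1 a1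
    calc s ^ 2 * (L ^ k0 * H ^ (δ - 1)) ≤ s ^ 2 * (L ^ k0 * H ^ δ) :=
        Nat.mul_le_mul_left _ (Nat.mul_le_mul_left _ (Nat.pow_le_pow_right hH (by omega)))
      _ < p * (L ^ k0 * H ^ δ) := by
        apply Nat.mul_lt_mul_of_pos_right hps; positivity
      _ ≤ p * p ^ (δ * k0) := Nat.mul_le_mul_left _ a2
      _ = p ^ (δ * k0 + 1) := by ring
      _ ≤ p ^ (s - 1) := by
        apply Nat.pow_le_pow_right hp0
        have : s = δ * k0 + δ := by rw [hs]; ring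
        omega
  by_contra hcon
  push Not at hcon
  have h5 : (p ^ s) ^ s ≤ (s ^ s * ∏ q, m q) * ∏ k : Fin s, p ^ (s - k) := h3.trans (Nat.mul_le_mul_left _ hcon)
  have h6 := Nat.pow_le_pow_left h5 2
  rw [mul_pow, mul_pow, h4, prod_pow_sq'] at h6
  have h7 : ((p ^ s) ^ s) ^ 2 = (p ^ (s - 1)) ^ s * p ^ (s * (s + 1)) := by
    rw [← pow_mul, ← pow_mul, ← pow_mul, ← pow_add]
    congr 1
    obtain ⟨r, rfl⟩ : ∃ r, s = r + 1 := ⟨s - 1, by omega⟩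
    simp; ring
  rw [h7] at h6
  have h8 := Nat.le_of_mul_le_mul_right h6 (by positivity)
  have h9 : (s ^ s) ^ 2 * (L ^ k0 * H ^ (δ - 1)) ^ s = (s ^ 2 * (L ^ k0 * H ^ (δ - 1))) ^ s := by
    rw [mul_pow (s ^ 2), ← pow_mul, ← pow_mul s 2 s, mul_comm s 2]
  rw [h9] at h8
  exact absurd (Nat.pow_lt_pow_left key hs0.ne') (by omega)

lemma exists_primes (k N : ℕ) (hN : 1 ≤ N) : ∃ S : Finset ℕ, S.card = k ∧ ∀ p ∈ S, p.Prime ∧ N < p ∧ p ≤ 2 ^ k * N := by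
  induction k with
  | zero => exact ⟨∅, by simp⟩
  | succ k ih =>
    obtain ⟨S, hS, hS'⟩ := ih
    obtain ⟨p, hp, h1, h2⟩ := Nat.exists_prime_lt_and_le_two_mul (2 ^ k * N) (by positivity)
    refine ⟨insert p S, ?_, ?_⟩
    · rw [Finset.card_insert_of_notMem, hS]
      intro h
      have := (hS' p h).2.2
      omega
    · intro q hq
      have h3 : N ≤ 2 ^ k * N := Nat.le_mul_of_pos_left _ (by positivity)
      rw [pow_succ]
      rcases Finset.mem_insert.1 hq with rfl | hq
      · refine ⟨hp, by omega, ?_⟩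
        calc q ≤ _ := h2
          _ = _ := by ring
      · have := hS' q hq
        refine ⟨this.1, this.2.1, this.2.2.trans ?_⟩
        gcongr; omega

lemma elim_count {L K : Type*} [Field L] [Field K] (i : L →+* K) {e w δ : ℕ} {f : L[X][X]} (hf : f.Monic) (hd : f.natDegree = δ)
    (he : ∀ i, (f.coeff i).natDegree ≤ e) (hirr : Irreducible f) (q : L[X][X]) (hq : wt e w q)
    (hndvd : ¬ f ∣ q) (T : Finset L) (hT : ∀ t ∈ T, ∃ y : K, evalEval (i t) y (f.map (mapRingHom i)) = 0 ∧
      evalEval (i t) y (q.map (mapRingHom i)) = 0) : T.card ≤ δ * (w + e * δ) := by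
  classical
  obtain ⟨D, hD0, hDd, u, v, huv⟩ := elim hf he hirr q hq hndvd
  rw [hd] at hDd
  refine le_trans ?_ hDd
  have : T ⊆ D.roots.toFinset := by
    intro t ht
    obtain ⟨y, h1, h2⟩ := hT t ht
    rw [Multiset.mem_toFinset, mem_roots hD0, IsRoot.def]
    have h3 := congrArg (fun z => evalEval (i t) y (z.map (mapRingHom i))) huv
    simp only [Polynomial.map_add, Polynomial.map_mul, evalEval_add, evalEval_mul, h1, h2, mul_zero, add_zero, map_C, evalEval_C, coe_mapRingHom] at h3
    rw [eval_map, eval₂_hom] at h3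
    exact (map_eq_zero i).1 h3
  exact (Finset.card_le_card this).trans ((Multiset.toFinset_card_le _).trans (card_roots' D))

lemma wt_der {L : Type*} [Field L] {e δ : ℕ} {f : L[X][X]} (hδ : 1 ≤ δ) (hd : f.natDegree = δ)
    (he : ∀ i, (f.coeff i).natDegree ≤ e) : wt e (e * δ + e * δ) (derivative f) := by
  refine (wt_of_deg (w' := e) (d := δ - 1) ?_ ?_).mono ?_
  · intro i
    rw [coeff_derivative]
    refine natDegree_mul_le.trans ?_
    have := he (i + 1)
    have h2 : ((i : L[X]) + 1).natDegree = 0 := by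
      rw [← Nat.cast_succ]; exact natDegree_natCast _
    omega
  · exact (natDegree_derivative_le f).trans (by omega)
  · obtain ⟨r, rfl⟩ : ∃ r, δ = r + 1 := ⟨δ - 1, by omega⟩
    simp; nlinarith

lemma bp_prime (f : ℤ[X][X]) (hf : f.Monic) {e : ℕ} (he : ∀ i, (f.coeff i).natDegree ≤ e)
    (hirr : Irreducible (f.map (mapRingHom (Int.castRingHom ℚ)))) {p : ℕ} (hp : p.Prime) {s k0 δ L H : ℕ} (hδ : f.natDegree = δ)
    (hδ2 : 2 ≤ δ) (hs : s = (k0 + 1) * δ) (hps : s ^ 2 < p) (hL : 1 ≤ L) (hH : 1 ≤ H)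
    (hX : L ^ k0 * H ^ 2 ≤ p ^ (2 * k0))
    (T : Finset ℤ) (hT : ∀ t ∈ T, |t| ≤ L ∧ ∃ y : ℤ, evalEval t y f = 0 ∧ |y| ≤ H ∧ ¬ (p : ℤ) ∣ evalEval t y (derivative f)) :
    T.card ≤ (δ * (k0 + 1 + e * δ + e * δ)) * (δ * p) := by
  classical
  haveI := Fact.mk hp
  obtain ⟨A, hA, hbox⟩ := box_num hδ2 hs hps hL hH hX
  choose! y hy1 hy2 hy3 using fun t ht => (hT t ht).2
  set f0 : (ZMod p)[X][X] := f.map (mapRingHom (Int.castRingHom (ZMod p))) with hf0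
  have hfm0 : f0.Monic := hf.map _
  have hd0 : f0.natDegree = δ := by rw [hf0, hf.natDegree_map, hδ]
  have hS := card_bad_fiber f0 hfm0 hd0 Finset.univ
  simp only [Finset.mem_univ, Finset.filter_true, Finset.card_univ, ZMod.card] at hS
  refine le_trans (Finset.card_le_mul_card_image_of_maps_to (f := fun t : ℤ => ((t : ZMod p), (y t : ZMod p)))
    (t := Finset.univ.filter fun q : ZMod p × ZMod p => evalEval q.1 q.2 f0 = 0) ?_ (δ * (k0 + 1 + e * δ + e * δ)) ?_) (Nat.mul_le_mul_left _ hS)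
  · intro t ht
    rw [Finset.mem_filter]
    refine ⟨Finset.mem_univ _, ?_⟩
    have := map_mapRingHom_evalEval (Int.castRingHom (ZMod p)) f t (y t)
    simp only [eq_intCast] at this
    rw [hf0, this, hy1 t ht]; simp
  · intro q hq
    rcases Finset.eq_empty_or_nonempty (T.filter fun t : ℤ => ((t : ZMod p), (y t : ZMod p)) = q) with h0 | ⟨t0, ht0⟩
    · rw [h0]; simp
    · rw [Finset.mem_filter] at ht0
      refine class_bound f hf he hirr hp t0 (y t0) (hy3 t0 ht0.1) hδ hs (by rw [hs]; positivity) hA hbox _ ?_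
      intro t ht
      rw [Finset.mem_filter] at ht
      refine ⟨(hT t ht.1).1, y t, ?_, ?_, hy1 t ht.1, hy2 t ht.1⟩
      · have := congrArg Prod.fst (ht.2.trans ht0.2.symm)
        simp only at this
        rw [← ZMod.intCast_zmod_eq_zero_iff_dvd]; push_cast; rw [this]; ring
      · have := congrArg Prod.snd (ht.2.trans ht0.2.symm)
        simp only at this
        rw [← ZMod.intCast_zmod_eq_zero_iff_dvd]; push_cast; rw [this]; ring

lemma bp_num {H X k0 L : ℕ} (hL : 1 ≤ L) (hk : 1 ≤ k0) (hX : L ^ k0 * H ^ 2 ≤ X ^ (2 * k0)) (S : Finset ℕ) (hS : S.card = k0)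
    (hSp : ∀ p ∈ S, p.Prime ∧ X < p) (d : ℤ) (hd : d ≠ 0) (hdH : |d| ≤ H) : ∃ p ∈ S, ¬ (p : ℤ) ∣ d := by
  by_contra hcon
  push Not at hcon
  have h1 : ∏ p ∈ S, p ∣ d.natAbs := by
    apply Finset.prod_primes_dvd
    · intro p hp; exact (hSp p hp).1.prime
    · intro p hp; exact Int.natCast_dvd.1 (hcon p hp)
  have h2 := Nat.le_of_dvd (Int.natAbs_pos.2 hd) h1
  have h3 : X ^ k0 < ∏ p ∈ S, p := by
    rw [← hS, ← Finset.prod_const]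
    apply lt_of_lt_of_le (b := ∏ p ∈ S, (X + 1))
    · rw [Finset.prod_const, Finset.prod_const, hS]
      exact Nat.pow_lt_pow_left (by omega) (by omega)
    · exact Finset.prod_le_prod' fun p hp => (hSp p hp).2
  have h4 : H ≤ X ^ k0 := by
    have : H ^ 2 ≤ (X ^ k0) ^ 2 := by
      calc H ^ 2 ≤ L ^ k0 * H ^ 2 := Nat.le_mul_of_pos_left _ (by positivity)
        _ ≤ _ := hX
        _ = _ := by ring
    exact (Nat.pow_le_pow_iff_left (by norm_num)).1 this
  have h5 : (d.natAbs : ℤ) ≤ H := by rw [Int.natCast_natAbs]; exact hdH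
  omega

theorem bp_core (δ e k0 : ℕ) (hδ2 : 2 ≤ δ) (hk : 1 ≤ k0) : ∃ C : ℕ, ∀ f : ℤ[X][X], f.Monic → f.natDegree = δ →
    (∀ i, (f.coeff i).natDegree ≤ e) → Irreducible (f.map (mapRingHom (Int.castRingHom ℚ))) →
    ∀ L H X : ℕ, 1 ≤ L → 1 ≤ H → 1 ≤ X → L ^ k0 * H ^ 2 ≤ X ^ (2 * k0) →
    ∀ T : Finset ℤ, (∀ t ∈ T, |t| ≤ L ∧ ∃ y : ℤ, evalEval t y f = 0 ∧ |y| ≤ H ∧ |evalEval t y (derivative f)| ≤ H) →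
    T.card ≤ C * X := by
  classical
  set s := (k0 + 1) * δ with hs
  refine ⟨δ * (e * δ + e * δ + e * δ) + k0 * ((δ * (k0 + 1 + e * δ + e * δ)) * (δ * (2 ^ k0 * (s ^ 2 + 2)))), ?_⟩
  intro f hf hd he hirr L H X hL hH hX1 hX T hT
  obtain ⟨S, hS, hSp⟩ := exists_primes k0 (X + s ^ 2 + 1) (by omega)
  have hcov : T ⊆ (T.filter fun t => ∃ y : ℤ, evalEval t y f = 0 ∧ evalEval t y (derivative f) = 0) ∪
      S.biUnion fun p => T.filter fun t => ∃ y : ℤ, evalEval t y f = 0 ∧ |y| ≤ H ∧ ¬ (p : ℤ) ∣ evalEval t y (derivative f) := by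
    intro t ht
    obtain ⟨hl, y, h1, h2, h3⟩ := hT t ht
    rw [Finset.mem_union]
    by_cases h0 : evalEval t y (derivative f) = 0
    · left; rw [Finset.mem_filter]; exact ⟨ht, y, h1, h0⟩
    · right
      obtain ⟨p, hp, hpd⟩ := bp_num hL hk hX S hS (fun p hp => ⟨(hSp p hp).1, by have := (hSp p hp).2.1; omega⟩) _ h0 h3
      rw [Finset.mem_biUnion]
      exact ⟨p, hp, Finset.mem_filter.2 ⟨ht, y, h1, h2, hpd⟩⟩
  have hsing : (T.filter fun t => ∃ y : ℤ, evalEval t y f = 0 ∧ evalEval t y (derivative f) = 0).card ≤ δ * (e * δ + e * δ + e * δ) := by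
    set g := f.map (mapRingHom (Int.castRingHom ℚ)) with hg
    have hgm : g.Monic := hf.map _
    have hgd : g.natDegree = δ := by rw [hg, hf.natDegree_map, hd]
    have hge : ∀ i, (g.coeff i).natDegree ≤ e := fun i => by
      rw [hg, coeff_map]; exact natDegree_map_le.trans (he i)
    have hnd : ¬ g ∣ derivative g := by
      apply hgm.not_dvd_of_natDegree_lt
      · intro h0
        have := derivative_eq_zero.1 h0
        omega
      · rw [hgd]
        exact (natDegree_derivative_lt (by omega)).trans_le (by omega)
    rw [← Finset.card_image_of_injective _ (Int.cast_injective (α := ℚ))]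
    refine elim_count (RingHom.id ℚ) hgm hgd hge hirr (derivative g) (wt_der (by omega) hgd hge) hnd _ ?_
    intro t ht
    obtain ⟨t, ht', rfl⟩ := Finset.mem_image.1 ht
    obtain ⟨_, y, h1, h2⟩ := Finset.mem_filter.1 ht'
    have h3 := map_mapRingHom_evalEval (Int.castRingHom ℚ) f t y
    have h4 := map_mapRingHom_evalEval (Int.castRingHom ℚ) (derivative f) t y
    refine ⟨(y : ℚ), ?_, ?_⟩
    · simp only [mapRingHom_id, Polynomial.map_id, RingHom.id_apply]
      simpa [h1] using h3
    · simp only [mapRingHom_id, Polynomial.map_id, RingHom.id_apply]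
      rw [hg, derivative_map]
      simpa [h2] using h4
  have hpr : ∀ p ∈ S, (T.filter fun t => ∃ y : ℤ, evalEval t y f = 0 ∧ |y| ≤ H ∧ ¬ (p : ℤ) ∣ evalEval t y (derivative f)).card ≤
      (δ * (k0 + 1 + e * δ + e * δ)) * (δ * (2 ^ k0 * (s ^ 2 + 2))) * X := by
    intro p hp
    obtain ⟨hpp, hp1, hp2⟩ := hSp p hp
    have := bp_prime f hf he hirr hpp hd hδ2 hs (by omega) hL hH (hX.trans (Nat.pow_le_pow_left (by omega) _))
      (T.filter fun t => ∃ y : ℤ, evalEval t y f = 0 ∧ |y| ≤ H ∧ ¬ (p : ℤ) ∣ evalEval t y (derivative f)) (by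
        intro t ht
        rw [Finset.mem_filter] at ht
        exact ⟨(hT t ht.1).1, ht.2⟩)
    refine this.trans ?_
    rw [mul_assoc (δ * (k0 + 1 + e * δ + e * δ))]
    apply Nat.mul_le_mul_left
    rw [mul_assoc]
    apply Nat.mul_le_mul_left
    refine hp2.trans ?_
    rw [mul_assoc]
    apply Nat.mul_le_mul_left
    nlinarith [Nat.zero_le (s ^ 2)]
  refine (Finset.card_le_card hcov).trans ((Finset.card_union_le _ _).trans ?_)
  rw [add_mul]
  refine Nat.add_le_add (hsing.trans (Nat.le_mul_of_pos_right _ (by omega))) ?_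
  refine Finset.card_biUnion_le.trans ((Finset.sum_le_card_nsmul _ _ _ hpr).trans ?_)
  rw [hS, smul_eq_mul, mul_assoc k0]

end St

namespace St
open NC

lemma lift_factor {f : ℤ[X][X]} (hf : f.Monic) {g : ℚ[X][X]} (hg : g.Monic)
    (h : g ∣ f.map (mapRingHom (Int.castRingHom ℚ))) :
    ∃ g0 : ℤ[X][X], g0.map (mapRingHom (Int.castRingHom ℚ)) = g ∧ g0.natDegree = g.natDegree ∧ g0.Monic := by
  letI : Algebra ℤ[X] ℚ[X] := (mapRingHom (algebraMap ℤ ℚ)).toAlgebra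
  refine lifts_and_natDegree_eq_and_monic ((lifts_iff_coeff_lifts _).2 fun i => ?_) hg
  have h1 : IsIntegral ℤ[X] (g.coeff i) := isIntegral_coeff_of_dvd f g hf hg h i
  have h2 : g.coeff i ∈ lifts (Int.castRingHom ℚ) := by
    refine (lifts_iff_coeff_lifts _).2 fun j => ?_
    have h3 := IsIntegral.coeff h1 j
    obtain ⟨z, hz⟩ := IsIntegrallyClosed.isIntegral_iff.1 h3
    exact ⟨z, hz⟩
  exact h2

lemma irr_Q_of_irr {f : ℤ[X][X]} (hf : f.Monic) (h : Irreducible f) :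
    Irreducible (f.map (mapRingHom (Int.castRingHom ℚ))) := by
  have hinj : Function.Injective (Polynomial.map (mapRingHom (Int.castRingHom ℚ))) :=
    map_injective _ (map_injective _ Int.cast_injective)
  rw [(hf.map _).irreducible_iff_natDegree]
  rw [hf.irreducible_iff_natDegree] at h
  refine ⟨fun h1 => h.1 (hinj (by rw [h1, Polynomial.map_one])), ?_⟩
  intro g1 g2 hg1 hg2 hg
  obtain ⟨a, ha, had, ham⟩ := lift_factor hf hg1 ⟨g2, hg.symm⟩
  obtain ⟨b, hb, hbd, hbm⟩ := lift_factor hf hg2 ⟨g1, by rw [mul_comm, hg]⟩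
  rw [← had, ← hbd]
  refine h.2 a b ham hbm (hinj ?_)
  rw [Polynomial.map_mul, ha, hb, hg]

/-- all complex roots of `f(t,·)`, `|t| ≤ L`, are bounded by `M` -/
def RB (f : ℤ[X][X]) (L M : ℕ) : Prop :=
  ∀ t : ℤ, |t| ≤ L → ∀ z : ℂ, ((f.map (evalRingHom t)).map (Int.castRingHom ℂ)).eval z = 0 → ‖z‖ ≤ M

lemma RB.of_dvd {f g : ℤ[X][X]} {L M : ℕ} (h : RB f L M) (hg : g ∣ f) : RB g L M := by
  intro t ht z hz
  refine h t ht z ?_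
  obtain ⟨q, rfl⟩ := hg
  rw [Polynomial.map_mul, Polynomial.map_mul, eval_mul, hz, zero_mul]

/-- derivative at a root -/
lemma der_bound (g : ℂ[X]) (hg : g.Monic) (M : ℝ) (hM : ∀ z, g.eval z = 0 → ‖z‖ ≤ M) (z : ℂ) (hz : g.eval z = 0) :
    ‖(derivative g).eval z‖ ≤ (2 * M) ^ (g.natDegree - 1) := by
  classical
  have hs := IsAlgClosed.splits g
  have hz' : z ∈ g.roots := by rw [mem_roots hg.ne_zero]; exact hz
  have h1 : (derivative g).eval z = ((g.roots.erase z).map (fun a => z - a)).prod := by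
    exact Splits.eval_root_derivative hs hg hz'
  rw [h1]
  have h2 : ∀ m : Multiset ℂ, (∀ a ∈ m, ‖a‖ ≤ M) → ‖(m.map (fun a => z - a)).prod‖ ≤ (2 * M) ^ Multiset.card m := by
    intro m
    induction m using Multiset.induction with
    | empty => intro _; simp
    | cons a m ih =>
      intro h
      have h3 := hM z hz
      have h4 := h a (Multiset.mem_cons_self _ _)
      have h5 : 0 ≤ M := (norm_nonneg _).trans h3
      rw [Multiset.map_cons, Multiset.prod_cons, Multiset.card_cons, norm_mul, pow_succ']
      refine mul_le_mul ?_ (ih fun b hb => h b (Multiset.mem_cons_of_mem hb)) (norm_nonneg _) (by positivity)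
      exact (norm_sub_le _ _).trans (by linarith)
  refine (h2 _ fun a ha => hM a ?_).trans ?_
  · exact (mem_roots hg.ne_zero).1 (Multiset.mem_of_mem_erase ha)
  · rw [Multiset.card_erase_of_mem hz', ← hs.natDegree_eq_card_roots]; rfl

lemma der_bound_int (f : ℤ[X][X]) (hf : f.Monic) {δ L M : ℕ} (hd : f.natDegree = δ) (hRB : RB f L M) (t y : ℤ) (ht : |t| ≤ L)
    (h : evalEval t y f = 0) : |y| ≤ M ∧ |evalEval t y (derivative f)| ≤ ((2 * M) ^ (δ - 1) : ℕ) := by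
  set g := (f.map (evalRingHom t)).map (Int.castRingHom ℂ) with hg
  have hev : ∀ q : ℤ[X][X], ((q.map (evalRingHom t)).map (Int.castRingHom ℂ)).eval (y : ℂ) = (evalEval t y q : ℤ) := by
    intro q
    rw [← map_evalRingHom_eval, ← eq_intCast (Int.castRingHom ℂ) y, eval_map, eval₂_hom]; simp
  have hgy : g.eval (y : ℂ) = 0 := by rw [hg, hev, h]; simp
  have h1 := hRB t ht y hgy
  have h2 := der_bound g ((hf.map _).map _) M (hRB t ht) y hgy
  have hgd : g.natDegree = δ := by rw [hg, (hf.map _).natDegree_map, hf.natDegree_map, hd]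
  rw [hgd, hg, derivative_map, derivative_map, hev] at h2
  rw [Complex.norm_intCast] at h1 h2
  refine ⟨by exact_mod_cast h1, by exact_mod_cast h2⟩

/-- integer points on `P(t,z)=0` off the integral polynomial roots -/
theorem bpfac (δ e k0 : ℕ) (hk : 1 ≤ k0) : ∃ C : ℕ, ∀ P : ℤ[X][X], P.Monic → P.natDegree ≤ δ →
    (∀ i, (P.coeff i).natDegree ≤ e) →
    ∀ L M X : ℕ, 1 ≤ L → 1 ≤ M → 1 ≤ X → RB P L M → L ^ k0 * (2 * M) ^ (2 * δ) ≤ X ^ (2 * k0) →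
    ∀ T : Finset ℤ, (∀ t ∈ T, |t| ≤ L ∧ ∃ z : ℤ, evalEval t z P = 0 ∧ ∀ r : ℤ[X], P.eval r = 0 → r.eval t ≠ z) →
    T.card ≤ C * X := by
  classical
  have hC : ∀ δ', ∃ C : ℕ, 2 ≤ δ' → ∀ f : ℤ[X][X], f.Monic → f.natDegree = δ' →
    (∀ i, (f.coeff i).natDegree ≤ e) → Irreducible (f.map (mapRingHom (Int.castRingHom ℚ))) →
    ∀ L H X : ℕ, 1 ≤ L → 1 ≤ H → 1 ≤ X → L ^ k0 * H ^ 2 ≤ X ^ (2 * k0) →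
    ∀ T : Finset ℤ, (∀ t ∈ T, |t| ≤ L ∧ ∃ y : ℤ, evalEval t y f = 0 ∧ |y| ≤ H ∧ |evalEval t y (derivative f)| ≤ H) →
    T.card ≤ C * X := by
    intro δ'
    by_cases h : 2 ≤ δ'
    · obtain ⟨C, hC⟩ := bp_core δ' e k0 h hk
      exact ⟨C, fun _ => hC⟩
    · exact ⟨0, fun h' => absurd h' h⟩
  choose C hC using hC
  induction δ with
  | zero =>
    refine ⟨0, ?_⟩
    intro P hP hd _ L M X _ _ _ _ _ T hT
    have : P = 1 := hP.natDegree_eq_zero.1 (by omega)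
    subst this
    have : T = ∅ := Finset.eq_empty_of_forall_notMem fun t ht => by
      obtain ⟨_, z, hz, _⟩ := hT t ht
      simp at hz
    simp [this]
  | succ δ ih =>
    obtain ⟨C0, hC0⟩ := ih
    refine ⟨C (δ + 1) + 2 * C0, ?_⟩
    intro P hP hd he L M X hL hM hX hRB hLX T hT
    have hmono : L ^ k0 * (2 * M) ^ (2 * δ) ≤ X ^ (2 * k0) := by
      refine le_trans (Nat.mul_le_mul_left _ (Nat.pow_le_pow_right (by omega) (by omega))) hLX
    rcases hd.lt_or_eq with hd' | hd'
    · refine (hC0 P hP (by omega) he L M X hL hM hX hRB hmono T hT).trans ?_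
      exact Nat.mul_le_mul_right _ (by omega)
    by_cases hirr : Irreducible P
    · by_cases hδ : 2 ≤ δ + 1
      · refine le_trans (hC (δ + 1) hδ P hP hd' he (irr_Q_of_irr hP hirr) L ((2 * M) ^ (δ + 1)) X hL (Nat.one_le_pow _ _ (by omega)) hX ?_ T ?_) ?_
        · rw [← pow_mul, mul_comm (δ + 1) 2]; exact hLX
        · intro t ht
          obtain ⟨h1, z, h2, _⟩ := hT t ht
          obtain ⟨h3, h4⟩ := der_bound_int P hP hd' hRB t z h1 h2
          refine ⟨h1, z, h2, h3.trans ?_, h4.trans ?_⟩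
          · have : 2 * M ≤ (2 * M) ^ (δ + 1) := Nat.le_self_pow (by omega) _
            have h5 : M ≤ (2 * M) ^ (δ + 1) := by omega
            exact_mod_cast h5
          · have : (2 * M) ^ (δ + 1 - 1) ≤ (2 * M) ^ (δ + 1) := Nat.pow_le_pow_right (by omega) (by omega)
            exact_mod_cast this
        · exact Nat.mul_le_mul_right _ (by omega)
      · have h1 : P.natDegree = 1 := by omega
        have hP1 : P = Polynomial.X + Polynomial.C (P.coeff 0) := by
          exact hP.eq_X_add_C h1
        have : T = ∅ := Finset.eq_empty_of_forall_notMem fun t ht => by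
          obtain ⟨_, z, hz, hr⟩ := hT t ht
          refine hr (-(P.coeff 0)) ?_ ?_
          · rw [hP1]; simp
          · rw [hP1, evalEval_add, evalEval_X, evalEval_C] at hz; simp; linarith
        simp [this]
    · have h1 : P ≠ 1 := by rintro rfl; simp at hd'
      rw [hP.irreducible_iff_natDegree] at hirr
      push Not at hirr
      obtain ⟨g, h, hg, hh, hgh, hg0, hh0⟩ := hirr h1
      have hsum : g.natDegree + h.natDegree = δ + 1 := by rw [← hg.natDegree_mul hh, hgh, hd']
      have hinj : ∀ q : ℤ[X], (q.map (Int.castRingHom ℚ)).natDegree = q.natDegree := fun q =>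
        natDegree_map_eq_of_injective Int.cast_injective q
      have htd : ∀ g h : ℤ[X][X], g * h = P → ∀ i, (g.coeff i).natDegree ≤ e := by
        intro g h hgh i
        have := tdeg_factor e (P.map (mapRingHom (Int.castRingHom ℚ))) (g.map (mapRingHom (Int.castRingHom ℚ))) (h.map (mapRingHom (Int.castRingHom ℚ)))
          (hP.map _).ne_zero (natDegree_coeff_map_le _ he) (by rw [← Polynomial.map_mul, hgh]) i
        rwa [coeff_map, coe_mapRingHom, hinj] at this
      have hcov : T ⊆ (T.filter fun t => ∃ z : ℤ, evalEval t z g = 0 ∧ ∀ r : ℤ[X], g.eval r = 0 → r.eval t ≠ z) ∪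
         (T.filter fun t => ∃ z : ℤ, evalEval t z h = 0 ∧ ∀ r : ℤ[X], h.eval r = 0 → r.eval t ≠ z) := by
        intro t ht
        obtain ⟨_, z, hz, hr⟩ := hT t ht
        rw [← hgh, evalEval_mul] at hz
        rw [Finset.mem_union]
        rcases mul_eq_zero.1 hz with h2 | h2
        · left; exact Finset.mem_filter.2 ⟨ht, z, h2, fun r hr' => hr r (by rw [← hgh, eval_mul, hr', zero_mul])⟩
        · right; exact Finset.mem_filter.2 ⟨ht, z, h2, fun r hr' => hr r (by rw [← hgh, eval_mul, hr', mul_zero])⟩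
      refine (Finset.card_le_card hcov).trans ((Finset.card_union_le _ _).trans ?_)
      have e1 := hC0 g hg (by omega) (htd g h hgh) L M X hL hM hX (hRB.of_dvd ⟨h, hgh.symm⟩) hmono (T.filter fun t => ∃ z : ℤ, evalEval t z g = 0 ∧ ∀ r : ℤ[X], g.eval r = 0 → r.eval t ≠ z) (by
        intro t ht
        rw [Finset.mem_filter] at ht
        exact ⟨(hT t ht.1).1, ht.2⟩)
      have e2 := hC0 h hh (by omega) (htd h g (by rw [mul_comm, hgh])) L M X hL hM hX (hRB.of_dvd ⟨g, by rw [mul_comm, hgh]⟩) hmono (T.filter fun t => ∃ z : ℤ, evalEval t z h = 0 ∧ ∀ r : ℤ[X], h.eval r = 0 → r.eval t ≠ z) (by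
        intro t ht
        rw [Finset.mem_filter] at ht
        exact ⟨(hT t ht.1).1, ht.2⟩)
      nlinarith [Nat.zero_le (C (δ + 1) * X)]
end St

namespace St
open NC

lemma map_freeMonic {R : Type} [CommRing R] [Nontrivial R] {δ : ℕ} (φ : MvPolynomial (Fin δ) ℤ →+* R) (f : R[X]) (hf : f.Monic) (hd : f.natDegree = δ)
    (h : ∀ i : Fin δ, φ (MvPolynomial.X i) = f.coeff i) : (freeMonic ℤ δ).map φ = f := by
  ext i
  rw [coeff_map, coeff_freeMonic]
  split_ifs with h1 h2
  · rw [h]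
  · subst h2; rw [map_one, ← hd, hf.coeff_natDegree]
  · rw [map_zero, coeff_eq_zero_of_natDegree_lt (by omega)]

lemma univ_fac (δ r j : ℕ) : ∃ P : (MvPolynomial (Fin δ) ℤ)[X], P.Monic ∧ ∀ g h : ℤ[X], g.Monic → h.Monic → g.natDegree = r →
    (g * h).natDegree = δ → (P.map (MvPolynomial.eval (fun i : Fin δ => (g * h).coeff i))).eval (g.coeff j) = 0 := by
  by_cases hr : r ≤ δ
  swap
  · refine ⟨1, monic_one, fun g h hg hh hgr hgh => ?_⟩
    rw [hg.natDegree_mul hh] at hgh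
    omega
  set G : (MvPolynomial (Fin r ⊕ Fin (δ - r)) ℤ)[X] := (freeMonic ℤ r).map (MvPolynomial.rename Sum.inl).toRingHom with hG
  set H : (MvPolynomial (Fin r ⊕ Fin (δ - r)) ℤ)[X] := (freeMonic ℤ (δ - r)).map (MvPolynomial.rename Sum.inr).toRingHom with hH
  have hGm : G.Monic := (monic_freeMonic _ _).map _
  have hHm : H.Monic := (monic_freeMonic _ _).map _
  have hd : (G * H).natDegree = δ := by
    rw [hGm.natDegree_mul hHm, hG, hH, (monic_freeMonic _ _).natDegree_map, (monic_freeMonic _ _).natDegree_map,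
      natDegree_freeMonic, natDegree_freeMonic]
    omega
  set a : MvPolynomial (Fin δ) ℤ →+* (MvPolynomial (Fin r ⊕ Fin (δ - r)) ℤ) := (MvPolynomial.aeval (fun i : Fin δ => (G * H).coeff i)).toRingHom with ha
  have haU : (freeMonic ℤ δ).map a = G * H := map_freeMonic a _ (hGm.mul hHm) hd (fun i => by simp [ha])
  letI := a.toAlgebra
  obtain ⟨P, hP, hP0⟩ := isIntegral_coeff_of_dvd (freeMonic ℤ δ) G (monic_freeMonic _ _) hGm ⟨H, haU⟩ j
  refine ⟨P, hP, fun g h hg hh hgr hgh => ?_⟩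
  have hhr : h.natDegree = δ - r := by rw [hg.natDegree_mul hh] at hgh; omega
  set ψ : (MvPolynomial (Fin r ⊕ Fin (δ - r)) ℤ) →+* ℤ := MvPolynomial.eval (Sum.elim (fun i : Fin r => g.coeff i) (fun i : Fin (δ - r) => h.coeff i)) with hψ
  have e1 : G.map ψ = g := by
    rw [hG, Polynomial.map_map]
    exact map_freeMonic _ g hg hgr (fun i => by simp [hψ])
  have e2 : H.map ψ = h := by
    rw [hH, Polynomial.map_map]
    exact map_freeMonic _ h hh hhr (fun i => by simp [hψ])
  have e3 : ψ.comp a = MvPolynomial.eval (fun i : Fin δ => (g * h).coeff i) := by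
    refine MvPolynomial.ringHom_ext (fun x => by simp) (fun i => ?_)
    have e5 : g * h = (G * H).map ψ := by rw [Polynomial.map_mul, e1, e2]
    rw [e5]
    simp [ha, -Polynomial.map_mul]
  have e4 : g.coeff j = ψ (G.coeff j) := by rw [← coeff_map, e1]
  rw [← e3, e4, eval_map, ← hom_eval₂]
  have : eval₂ a (G.coeff j) P = 0 := hP0
  rw [this, map_zero]

lemma mv_bound {σ : Type*} (P : MvPolynomial σ ℤ) : ∃ K a : ℕ, ∀ (M : ℕ), 1 ≤ M → ∀ x : σ → ℤ, (∀ i, |x i| ≤ M) →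
    |MvPolynomial.eval x P| ≤ (K * M ^ a : ℕ) := by
  induction P using MvPolynomial.induction_on with
  | C c =>
    refine ⟨c.natAbs, 0, fun M _ x _ => ?_⟩
    simp
  | add p q hp hq =>
    obtain ⟨K, a, h⟩ := hp
    obtain ⟨K', a', h'⟩ := hq
    refine ⟨K + K', a + a', fun M hM x hx => ?_⟩
    have h1 := h M hM x hx
    have h2 := h' M hM x hx
    have h3 : M ^ a ≤ M ^ (a + a') := Nat.pow_le_pow_right hM (by omega)
    have h4 : M ^ a' ≤ M ^ (a + a') := Nat.pow_le_pow_right hM (by omega)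
    have h5 : K * M ^ a + K' * M ^ a' ≤ (K + K') * M ^ (a + a') := by nlinarith
    rw [map_add]
    refine (abs_add_le _ _).trans ((add_le_add h1 h2).trans ?_)
    exact_mod_cast h5
  | mul_X p i hp =>
    obtain ⟨K, a, h⟩ := hp
    refine ⟨K, a + 1, fun M hM x hx => ?_⟩
    rw [map_mul, MvPolynomial.eval_X, abs_mul, pow_succ, ← mul_assoc, Nat.cast_mul]
    exact mul_le_mul (h M hM x hx) (hx i) (abs_nonneg _) (by positivity)

lemma mv_bound_finset {σ : Type*} (S : Finset (MvPolynomial σ ℤ)) : ∃ K a : ℕ, ∀ P ∈ S, ∀ (M : ℕ), 1 ≤ M → ∀ x : σ → ℤ, (∀ i, |x i| ≤ M) →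
    |MvPolynomial.eval x P| ≤ (K * M ^ a : ℕ) := by
  classical
  choose K a h using fun P : MvPolynomial σ ℤ => mv_bound P
  refine ⟨S.sup K, S.sup a, fun P hP M hM x hx => (h P M hM x hx).trans ?_⟩
  have h1 : K P ≤ S.sup K := Finset.le_sup hP
  have h2 : a P ≤ S.sup a := Finset.le_sup hP
  have h3 : M ^ a P ≤ M ^ S.sup a := Nat.pow_le_pow_right hM h2
  exact_mod_cast Nat.mul_le_mul h1 h3

lemma RB_of_coeff (f : ℤ[X][X]) (hf : f.Monic) (L M : ℕ) (h : ∀ t : ℤ, |t| ≤ L → ∀ i < f.natDegree, |(f.coeff i).eval t| ≤ M) : RB f L (M + 1) := by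
  intro t ht z hz
  set g := (f.map (evalRingHom t)).map (Int.castRingHom ℂ) with hg
  have hgm : g.Monic := (hf.map _).map _
  have hgd : g.natDegree = f.natDegree := by rw [hg, (hf.map _).natDegree_map, hf.natDegree_map]
  have h1 := IsRoot.norm_lt_cauchyBound hgm.ne_zero (show g.IsRoot z from hz)
  have h1' : ‖z‖ ≤ (cauchyBound g : ℝ) := by exact_mod_cast h1.le
  refine h1'.trans ?_
  unfold cauchyBound
  rw [hgm.leadingCoeff]
  simp only [nnnorm_one, div_one]
  push_cast
  gcongr
  have : (Finset.range g.natDegree).sup (fun x => ‖g.coeff x‖₊) ≤ (M : NNReal) := by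
    refine Finset.sup_le fun i hi => ?_
    rw [Finset.mem_range, hgd] at hi
    have h2 := h t ht i hi
    rw [hg, coeff_map, coeff_map, ← NNReal.coe_le_coe]
    simp only [coe_evalRingHom, eq_intCast, coe_nnnorm, Complex.norm_intCast, NNReal.coe_natCast]
    exact_mod_cast h2
  exact_mod_cast this

lemma root_deg {Q : ℤ[X][X]} (hQ : Q.Monic) {e : ℕ} (he : ∀ i, (Q.coeff i).natDegree ≤ e) (r : ℤ[X]) (hr : Q.eval r = 0) : r.natDegree ≤ e := by
  obtain ⟨q, hq⟩ := dvd_iff_isRoot.2 (show Q.IsRoot r from hr)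
  have hinj : ∀ q : ℤ[X], (q.map (Int.castRingHom ℚ)).natDegree = q.natDegree := fun q =>
    natDegree_map_eq_of_injective Int.cast_injective q
  have := tdeg_factor e (Q.map (mapRingHom (Int.castRingHom ℚ))) ((X - C r).map (mapRingHom (Int.castRingHom ℚ))) (q.map (mapRingHom (Int.castRingHom ℚ)))
          (hQ.map _).ne_zero (natDegree_coeff_map_le _ he) (by rw [← Polynomial.map_mul, ← hq]) 0
  rw [coeff_map, coe_mapRingHom, hinj] at this
  simpa using this

lemma hit_aux (δ e r j : ℕ) : ∃ A e' Dm : ℕ, ∀ k0, 1 ≤ k0 → ∃ Cc : ℕ, ∀ f : ℤ[X][X], f.Monic → f.natDegree = δ →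
    (∀ i, (f.coeff i).natDegree ≤ e) → ∀ L M X : ℕ, 1 ≤ L → 2 ≤ M → 1 ≤ X →
    (∀ t : ℤ, |t| ≤ L → ∀ i, |(f.coeff i).eval t| ≤ M) → L ^ k0 * M ^ A ≤ X ^ (2 * k0) →
    ∃ Rts : Finset ℤ[X], Rts.card ≤ Dm ∧ (∀ ρ ∈ Rts, ρ.natDegree ≤ e') ∧
    ∀ T : Finset ℤ, (∀ t ∈ T, |t| ≤ L ∧ ∃ g h : ℤ[X], g.Monic ∧ h.Monic ∧ g.natDegree = r ∧ f.map (evalRingHom t) = g * h ∧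
      ∀ ρ ∈ Rts, ρ.eval t ≠ g.coeff j) → T.card ≤ Cc * X := by
  classical
  obtain ⟨P, hP, hPfac⟩ := univ_fac δ r j
  obtain ⟨K, a, hK⟩ := mv_bound_finset ((Finset.range P.natDegree).image fun i => P.coeff i)
  set m := (Finset.range (P.natDegree + 1)).sup (fun i => (P.coeff i).totalDegree) with hm
  have hmi : ∀ i, (P.coeff i).totalDegree ≤ m := by
    intro i
    by_cases hi : i < P.natDegree + 1
    · exact Finset.le_sup (f := fun i => (P.coeff i).totalDegree) (Finset.mem_range.2 hi)
    · rw [coeff_eq_zero_of_natDegree_lt (by omega)]; simp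
  set d := P.natDegree with hd
  refine ⟨(a + 2 * (K + 1)) * (2 * d), m * e, d, fun k0 hk => ?_⟩
  obtain ⟨Cc, hC⟩ := bpfac d (m * e) k0 hk
  refine ⟨Cc, fun f hf hfd he L M X hL hM hX hfM hLX => ?_⟩
  set φ : MvPolynomial (Fin δ) ℤ →+* ℤ[X] := (MvPolynomial.aeval (fun i : Fin δ => f.coeff i)).toRingHom with hφ
  set Q : ℤ[X][X] := P.map φ with hQ
  have hQm : Q.Monic := hP.map _
  have hQd : Q.natDegree = d := hP.natDegree_map _
  have hQe : ∀ i, (Q.coeff i).natDegree ≤ m * e := fun i => by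
    rw [hQ, coeff_map]
    exact MvPolynomial.aeval_natDegree_le _ (hmi i) _ (fun i => he i)
  have hcomp : ∀ t : ℤ, (evalRingHom t).comp φ = MvPolynomial.eval (fun i : Fin δ => (f.coeff i).eval t) := by
    intro t
    refine MvPolynomial.ringHom_ext (fun x => by simp) (fun i => by simp [hφ])
  have hRB : RB Q L (K * M ^ a + 1) := by
    apply RB_of_coeff Q hQm
    intro t ht i hi
    rw [hQ, coeff_map]
    have := hK (P.coeff i) (Finset.mem_image_of_mem _ (by rw [Finset.mem_range, ← hQd]; exact hi)) M (by omega) (fun i : Fin δ => (f.coeff i).eval t) (fun i => hfM t ht i)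
    rw [← hcomp] at this
    exact this
  have hM' : 2 * (K * M ^ a + 1) ≤ M ^ (a + 2 * (K + 1)) := by
    have h1 : 2 * (K + 1) ≤ M ^ (2 * (K + 1)) := (Nat.lt_pow_self (by omega)).le
    have h2 : 1 ≤ M ^ a := Nat.one_le_pow _ _ (by omega)
    rw [pow_add]
    calc 2 * (K * M ^ a + 1) ≤ M ^ a * (2 * (K + 1)) := by nlinarith
      _ ≤ _ := Nat.mul_le_mul_left _ h1
  refine ⟨Q.roots.toFinset, ?_, ?_, ?_⟩
  · rw [← hQd]; exact (Multiset.toFinset_card_le _).trans (card_roots' Q)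
  · intro ρ hρ
    rw [Multiset.mem_toFinset, mem_roots hQm.ne_zero] at hρ
    exact root_deg hQm hQe ρ hρ
  · intro T hT
    refine hC Q hQm hQd.le hQe L (K * M ^ a + 1) X hL (by omega) hX hRB ?_ T ?_
    · refine le_trans (Nat.mul_le_mul_left _ ?_) hLX
      rw [pow_mul M]
      exact Nat.pow_le_pow_left hM' _
    · intro t ht
      obtain ⟨h1, g, h, hg, hh, hgr, hfgh, hρ⟩ := hT t ht
      refine ⟨h1, g.coeff j, ?_, ?_⟩
      · have h2 := hPfac g h hg hh hgr (by rw [← hfgh, hf.natDegree_map, hfd])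
        rw [← map_evalRingHom_eval, hQ, Polynomial.map_map, hcomp]
        convert h2 using 4
        ext i
        rw [← hfgh, coeff_map]; rfl
      · intro ρ hρ'
        exact hρ ρ (by rw [Multiset.mem_toFinset, mem_roots hQm.ne_zero]; exact hρ')

lemma exists_tup {R : Type*} [CommRing R] [Nontrivial R] (r : ℕ) : ∃ G : (Fin r → R) → R[X], (∀ ρ, (G ρ).Monic) ∧ (∀ ρ, (G ρ).natDegree = r) ∧
    ∀ ρ i, (G ρ).coeff i = if h : i < r then ρ ⟨i, h⟩ else if i = r then 1 else 0 := by
  have hlow : ∀ ρ : Fin r → R, (∑ j : Fin r, C (ρ j) * X ^ (j : ℕ)).degree < (r : WithBot ℕ) := by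
    intro ρ
    refine (degree_sum_le _ _).trans_lt ((Finset.sup_lt_iff (WithBot.bot_lt_coe r)).2 ?_)
    intro j _
    refine (degree_C_mul_X_pow_le _ _).trans_lt ?_
    exact WithBot.coe_lt_coe.2 j.2
  refine ⟨fun ρ => X ^ r + ∑ j : Fin r, C (ρ j) * X ^ (j : ℕ), fun ρ => monic_X_pow_add (hlow ρ), ?_, ?_⟩
  · intro ρ
    rw [natDegree_add_eq_left_of_degree_lt, natDegree_X_pow]
    rw [degree_X_pow]; exact hlow ρ
  · intro ρ i
    simp only [coeff_add, coeff_X_pow, finsetSum_coeff, coeff_C_mul, mul_ite, mul_one, mul_zero]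
    by_cases h : i < r
    · rw [dif_pos h, if_neg (by omega), zero_add, Finset.sum_eq_single ⟨i, h⟩]
      · simp
      · intro b _ hb
        rw [if_neg]
        intro h2; apply hb; ext; simp [h2]
      · simp
    · rw [dif_neg h, Finset.sum_eq_zero, add_zero]
      intro b _
      rw [if_neg]; have := b.2; omega

set_option maxHeartbeats 800000 in
lemma hit_r (δ e r : ℕ) (hr0 : 0 < r) (hrδ : r < δ) : ∃ A : ℕ, ∀ k0, 1 ≤ k0 → ∃ Cc : ℕ, ∀ f : ℤ[X][X], f.Monic → f.natDegree = δ →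
    (∀ i, (f.coeff i).natDegree ≤ e) → Irreducible (f.map (mapRingHom (Int.castRingHom ℚ))) →
    ∀ L M X : ℕ, 1 ≤ L → 2 ≤ M → 1 ≤ X →
    (∀ t : ℤ, |t| ≤ L → ∀ i, |(f.coeff i).eval t| ≤ M) → L ^ k0 * M ^ A ≤ X ^ (2 * k0) →
    ∀ T : Finset ℤ, (∀ t ∈ T, |t| ≤ L ∧ HasFac r (f.map (evalRingHom t))) → T.card ≤ Cc * X := by
  classical
  choose A e' Dm h using fun j : Fin r => hit_aux δ e r j
  refine ⟨Finset.univ.sup A, fun k0 hk => ?_⟩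
  choose Cj hC using fun j : Fin r => h j k0 hk
  set ee := Finset.univ.sup e' with hee
  refine ⟨∑ j, Cj j + (∏ j, Dm j) * (δ * ((ee + e * r) + e * δ)), fun f hf hfd he hirr L M X hL hM hX hfM hLX T hT => ?_⟩
  have hLXj : ∀ j, L ^ k0 * M ^ A j ≤ X ^ (2 * k0) := fun j =>
    le_trans (Nat.mul_le_mul_left _ (Nat.pow_le_pow_right (by omega) (Finset.le_sup (Finset.mem_univ j)))) hLX
  choose Rts hR1 hR2 hR3 using fun j => hC j f hf hfd he L M X hL hM hX hfM (hLXj j)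
  choose! g h' hg hh hgr hgh using fun t ht => (hT t ht).2
  obtain ⟨G, hGm, hGd, hcoef⟩ := exists_tup (R := ℤ[X]) r
  have hcov : T ⊆ (Finset.univ.biUnion fun j : Fin r => T.filter fun t => ∀ ρ ∈ Rts j, ρ.eval t ≠ (g t).coeff j) ∪
      (Fintype.piFinset Rts).biUnion fun ρ => T.filter fun t => ∀ j, (ρ j).eval t = (g t).coeff j := by
    intro t ht
    rw [Finset.mem_union]
    by_cases hc : ∃ j : Fin r, ∀ ρ ∈ Rts j, ρ.eval t ≠ (g t).coeff j
    · left
      obtain ⟨j, hj⟩ := hc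
      exact Finset.mem_biUnion.2 ⟨j, Finset.mem_univ _, Finset.mem_filter.2 ⟨ht, hj⟩⟩
    · right
      push Not at hc
      choose ρ hρ1 hρ2 using hc
      exact Finset.mem_biUnion.2 ⟨ρ, Fintype.mem_piFinset.2 hρ1, Finset.mem_filter.2 ⟨ht, hρ2⟩⟩
  refine (Finset.card_le_card hcov).trans ((Finset.card_union_le _ _).trans ?_)
  rw [add_mul]
  refine Nat.add_le_add ?_ ?_
  · refine Finset.card_biUnion_le.trans ?_
    rw [Finset.sum_mul]
    refine Finset.sum_le_sum fun j _ => ?_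
    refine hR3 j _ fun t ht => ?_
    rw [Finset.mem_filter] at ht
    exact ⟨(hT t ht.1).1, g t, h' t, hg t ht.1, hh t ht.1, hgr t ht.1, hgh t ht.1, ht.2⟩
  · refine le_trans ?_ (Nat.le_mul_of_pos_right _ (by omega))
    refine Finset.card_biUnion_le.trans ?_
    have hone : ∀ ρ ∈ Fintype.piFinset Rts, (T.filter fun t => ∀ j, (ρ j).eval t = (g t).coeff j).card ≤ δ * ((ee + e * r) + e * δ) := by
      intro ρ hρ
      rw [Fintype.mem_piFinset] at hρ
      set F := f.map (mapRingHom (Int.castRingHom ℚ)) with hF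
      set q := (G ρ).map (mapRingHom (Int.castRingHom ℚ)) with hq
      have hqe : ∀ i, (q.coeff i).natDegree ≤ ee := by
        intro i
        rw [hq, coeff_map, coe_mapRingHom, hcoef]
        refine natDegree_map_le.trans ?_
        split_ifs with h1 h2
        · exact (hR2 _ _ (hρ _)).trans (Finset.le_sup (Finset.mem_univ _))
        · simp
        · simp
      have hFm : F.Monic := hf.map _
      have hFd : F.natDegree = δ := by rw [hF, hf.natDegree_map, hfd]
      have hqd : q.natDegree = r := by rw [hq, (hGm ρ).natDegree_map, hGd]
      rw [← Finset.card_image_of_injective _ (Int.cast_injective (α := ℚ))]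
      refine elim_count (algebraMap ℚ ℂ) hFm hFd (natDegree_coeff_map_le _ he) hirr q (wt_of_deg hqe hqd.le) ?_ _ ?_
      · apply hFm.not_dvd_of_natDegree_lt
        · exact ((hGm ρ).map _).ne_zero
        · omega
      · intro t' ht'
        obtain ⟨t, ht, rfl⟩ := Finset.mem_image.1 ht'
        rw [Finset.mem_filter] at ht
        have hgG : g t = (G ρ).map (evalRingHom t) := by
          ext i
          rw [coeff_map, coe_evalRingHom, hcoef]
          split_ifs with h1 h2
          · exact (ht.2 ⟨i, h1⟩).symm
          · rw [h2, ← hgr t ht.1, (hg t ht.1).coeff_natDegree]; simp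
          · rw [coeff_eq_zero_of_natDegree_lt]; simp
            rw [hgr t ht.1]; omega
        obtain ⟨y, hy⟩ := IsAlgClosed.exists_root ((g t).map (Int.castRingHom ℂ)) (by
          rw [degree_eq_natDegree ((hg t ht.1).map _).ne_zero, (hg t ht.1).natDegree_map, hgr t ht.1]
          exact_mod_cast hr0.ne')
        have hyg : ((g t).map (Int.castRingHom ℂ)).eval y = 0 := hy
        have hev : ∀ s : ℤ[X][X], evalEval ((algebraMap ℚ ℂ) (t : ℚ)) y ((s.map (mapRingHom (Int.castRingHom ℚ))).map (mapRingHom (algebraMap ℚ ℂ))) =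
            ((s.map (evalRingHom t)).map (Int.castRingHom ℂ)).eval y := by
          intro s
          rw [← map_evalRingHom_eval, Polynomial.map_map, Polynomial.map_map, Polynomial.map_map]
          congr 2
          refine Polynomial.ringHom_ext (fun x => ?_) ?_
          · simp
          · simp
        refine ⟨y, ?_, ?_⟩
        · rw [hF, hev, hgh t ht.1, Polynomial.map_mul, eval_mul, hyg, zero_mul]
        · rw [hq, hev, ← hgG, hyg]
    refine (Finset.sum_le_card_nsmul _ _ _ hone).trans ?_
    rw [smul_eq_mul, Fintype.card_piFinset]
    exact Nat.mul_le_mul_right _ (Finset.prod_le_prod' fun j _ => hR1 j)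

theorem hit1 (δ e : ℕ) (hδ : 1 ≤ δ) : ∃ A : ℕ, ∀ k0, 1 ≤ k0 → ∃ Cc : ℕ, ∀ f : ℤ[X][X], f.Monic → f.natDegree = δ →
    (∀ i, (f.coeff i).natDegree ≤ e) → Irreducible (f.map (mapRingHom (Int.castRingHom ℚ))) →
    ∀ L M X : ℕ, 1 ≤ L → 2 ≤ M → 1 ≤ X →
    (∀ t : ℤ, |t| ≤ L → ∀ i, |(f.coeff i).eval t| ≤ M) → L ^ k0 * M ^ A ≤ X ^ (2 * k0) →
    ∀ T : Finset ℤ, (∀ t ∈ T, |t| ≤ L ∧ ¬ Irreducible (f.map (evalRingHom t))) → T.card ≤ Cc * X := by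
  classical
  have key : ∀ r, ∃ A : ℕ, ∀ k0, 1 ≤ k0 → ∃ Cc : ℕ, 0 < r → r < δ → ∀ f : ℤ[X][X], f.Monic → f.natDegree = δ →
    (∀ i, (f.coeff i).natDegree ≤ e) → Irreducible (f.map (mapRingHom (Int.castRingHom ℚ))) →
    ∀ L M X : ℕ, 1 ≤ L → 2 ≤ M → 1 ≤ X →
    (∀ t : ℤ, |t| ≤ L → ∀ i, |(f.coeff i).eval t| ≤ M) → L ^ k0 * M ^ A ≤ X ^ (2 * k0) →
    ∀ T : Finset ℤ, (∀ t ∈ T, |t| ≤ L ∧ HasFac r (f.map (evalRingHom t))) → T.card ≤ Cc * X := by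
    intro r
    by_cases h : 0 < r ∧ r < δ
    · obtain ⟨A, hA⟩ := hit_r δ e r h.1 h.2
      refine ⟨A, fun k0 hk => ?_⟩
      obtain ⟨Cc, hC⟩ := hA k0 hk
      exact ⟨Cc, fun _ _ => hC⟩
    · exact ⟨0, fun k0 _ => ⟨0, fun h1 h2 => absurd ⟨h1, h2⟩ h⟩⟩
  choose A hA using key
  refine ⟨(Finset.range δ).sup A, fun k0 hk => ?_⟩
  choose Cc hC using fun r => hA r k0 hk
  refine ⟨∑ r ∈ Finset.range δ, Cc r, fun f hf hfd he hirr L M X hL hM hX hfM hLX T hT => ?_⟩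
  have hcov : T ⊆ ((Finset.range δ).filter fun r => 0 < r).biUnion fun r => T.filter fun t => HasFac r (f.map (evalRingHom t)) := by
    intro t ht
    have h1 := (hT t ht).2
    rw [irr_iff_fac (hf.map _) (by rw [hf.natDegree_map]; omega)] at h1
    push Not at h1
    obtain ⟨r, h2, h3, h4⟩ := h1
    rw [hf.natDegree_map, hfd] at h3
    exact Finset.mem_biUnion.2 ⟨r, by simp [h2, h3], Finset.mem_filter.2 ⟨ht, h4⟩⟩
  refine (Finset.card_le_card hcov).trans (Finset.card_biUnion_le.trans ?_)
  rw [Finset.sum_mul]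
  refine (Finset.sum_le_sum (g := fun r => Cc r * X) ?_).trans (Finset.sum_le_sum_of_subset (Finset.filter_subset _ _))
  intro r hr
  simp only [Finset.mem_filter, Finset.mem_range] at hr
  refine hC r hr.2 hr.1 f hf hfd he hirr L M X hL hM hX hfM ?_ _ ?_
  · exact le_trans (Nat.mul_le_mul_left _ (Nat.pow_le_pow_right (by omega) (Finset.le_sup (Finset.mem_range.2 hr.1)))) hLX
  · intro t ht
    rw [Finset.mem_filter] at ht
    exact ⟨(hT t ht.1).1, ht.2⟩

end St

namespace St
open NC

lemma kernel_poly (α β : ℝ) (h0 : 0 < α) (hαβ : α < β) (h1 : β < 1) : ∃ P : ℝ[X], (∀ x ∈ Set.Icc (0:ℝ) 1, P.eval x ≤ 1) ∧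
    (∀ x ∈ Set.Icc (0:ℝ) 1, (x < α ∨ β < x) → P.eval x ≤ 0) ∧
    0 < ∑ k ∈ Finset.range (P.natDegree + 1), P.coeff k / (k + 1) := by
  set f : ℝ → ℝ := fun x => max 0 (min (x - α) (β - x)) with hf
  have hfc : Continuous f := by fun_prop
  have hI : 0 < ∫ x in (0:ℝ)..1, f x := by
    refine intervalIntegral.integral_pos (by norm_num) hfc.continuousOn (fun x _ => le_max_left _ _) ⟨(α + β) / 2, ⟨by linarith, by linarith⟩, ?_⟩
    apply lt_max_of_lt_right
    apply lt_min <;> linarith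
  set I := ∫ x in (0:ℝ)..1, f x with hIdef
  obtain ⟨P, hP⟩ := exists_polynomial_near_of_continuousOn 0 1 (fun x => f x - 2 * (I / 4)) (by fun_prop) (I / 4) (by linarith)
  refine ⟨P, ?_, ?_, ?_⟩
  · intro x hx
    have h2 := abs_lt.1 (hP x hx)
    have h3 : f x ≤ 1 := max_le (by norm_num) ((min_le_left _ _).trans (by linarith [hx.2]))
    linarith [h2.2]
  · intro x hx hxx
    have h2 := abs_lt.1 (hP x hx)
    have h3 : f x ≤ 0 := by
      apply max_le le_rfl
      rcases hxx with h | h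
      · exact (min_le_left _ _).trans (by linarith)
      · exact (min_le_right _ _).trans (by linarith)
    linarith [h2.2]
  · have h2 : ∑ k ∈ Finset.range (P.natDegree + 1), P.coeff k / (k + 1) = ∫ x in (0:ℝ)..1, P.eval x := by
      simp_rw [eval_eq_sum_range]
      rw [intervalIntegral.integral_finsetSum]
      · refine Finset.sum_congr rfl fun k _ => ?_
        rw [intervalIntegral.integral_const_mul, integral_pow]
        simp [div_eq_mul_inv]
      · intro k _
        exact (Continuous.intervalIntegrable (by fun_prop) _ _)
    rw [h2]
    have h3 : ∫ x in (0:ℝ)..1, (f x - 3 * (I / 4)) ≤ ∫ x in (0:ℝ)..1, P.eval x := by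
      refine intervalIntegral.integral_mono_on (by norm_num) (Continuous.intervalIntegrable (by fun_prop) _ _) (Continuous.intervalIntegrable (by fun_prop) _ _) fun x hx => ?_
      have h2 := abs_lt.1 (hP x hx)
      linarith [h2.1]
    have h4 : ∫ x in (0:ℝ)..1, (f x - 3 * (I / 4)) = I - 3 * (I / 4) := by
      rw [intervalIntegral.integral_sub (hfc.intervalIntegrable _ _) (by simp)]
      simp [hIdef]
    linarith

open ArithmeticFunction vonMangoldt in
lemma res_bound {q : ℕ} [NeZero q] {a : ZMod q} (ha : IsUnit a) :
    ∃ C : ℝ, ∀ {x : ℝ} (_ : x ∈ Set.Ioc 1 2),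
      |∑' n, residueClass a n / (n : ℝ) ^ x - (q.totient : ℝ)⁻¹ / (x - 1)| ≤ C := by
  have H {x : ℝ} (hx : 1 < x) :
      ∑' n, residueClass a n / (n : ℝ) ^ x =
        (LFunctionResidueClassAux a x).re + (q.totient : ℝ)⁻¹ / (x - 1) := by
    refine Complex.ofReal_injective ?_
    simp only [Complex.ofReal_tsum, Complex.ofReal_div, Complex.ofReal_cpow (Nat.cast_nonneg _), Complex.ofReal_natCast,
      Complex.ofReal_add, Complex.ofReal_inv, Complex.ofReal_sub, Complex.ofReal_one]
    simp_rw [← LFunctionResidueClassAux_real ha hx,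
      eqOn_LFunctionResidueClassAux ha <| Set.mem_ofPred.mpr (Complex.ofReal_re x ▸ hx), sub_add_cancel,
      LSeries, LSeries.term]
    refine tsum_congr fun n ↦ ?_
    split_ifs with hn
    · simp only [hn, residueClass_apply_zero, Complex.ofReal_zero, zero_div]
    · rfl
  have : ContinuousOn (fun x : ℝ ↦ (LFunctionResidueClassAux a x).re) (Set.Icc 1 2) :=
    Complex.continuous_re.continuousOn.comp (t := Set.univ) (continuousOn_LFunctionResidueClassAux a)
      (fun ⦃x⦄ a ↦ trivial) |>.comp Complex.continuous_ofReal.continuousOn fun x hx ↦ by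
        simpa only [Set.mem_ofPred_eq, Complex.ofReal_re] using hx.1
  obtain ⟨C, hC⟩ := IsCompact.exists_bound_of_continuousOn isCompact_Icc this
  refine ⟨C, fun {x} hx ↦ ?_⟩
  rw [H hx.1, add_sub_cancel_right]
  exact hC x (Set.mem_Icc_of_Ioc hx)

open ArithmeticFunction vonMangoldt in
/-- weighted lower bound in the window -/
lemma window_bound {q : ℕ} [NeZero q] {a : ZMod q} (ha : IsUnit a) (ε : ℝ) (h0 : 0 < ε) (h1 : ε < 1) :
    ∃ c > 0, ∃ C : ℝ, ∃ X0 : ℝ, 3 ≤ X0 ∧ ∀ X : ℝ, X0 ≤ X → c * Real.log X - C ≤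
      ∑' n : ℕ, if X ^ (1 - ε) ≤ n ∧ (n : ℝ) ≤ X then residueClass a n / n else 0 := by
  obtain ⟨P, hP1, hP2, hP3⟩ := kernel_poly (Real.exp (-1)) (Real.exp (-(1 - ε))) (Real.exp_pos _) (by simpa using h0) (by simpa using h1)
  obtain ⟨C, hC⟩ := res_bound ha
  have hφ : 0 < (q.totient : ℝ)⁻¹ := inv_pos.2 (by exact_mod_cast Nat.totient_pos.2 (NeZero.pos q))
  set I := ∑ k ∈ Finset.range (P.natDegree + 1), P.coeff k / (k + 1) with hI
  refine ⟨(q.totient : ℝ)⁻¹ * I, mul_pos hφ hP3, ∑ k ∈ Finset.range (P.natDegree + 1), |P.coeff k| * C,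
    max 3 (Real.exp (P.natDegree + 1)), le_max_left _ _, fun X hX => ?_⟩
  have hX3 : 3 ≤ X := (le_max_left _ _).trans hX
  have hXp : 0 < X := by linarith
  have hlog : (P.natDegree : ℝ) + 1 ≤ Real.log X := by
    rw [Real.le_log_iff_exp_le hXp]; exact (le_max_right _ _).trans hX
  have hlp : 0 < Real.log X := by have : (0:ℝ) ≤ P.natDegree := by positivity
                                  linarith
  set σ := (Real.log X)⁻¹ with hσ
  have hσp : 0 < σ := inv_pos.2 hlp
  set A : ℝ → ℝ := fun s => ∑' n, residueClass a n / (n : ℝ) ^ s with hA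
  have hsum : ∀ s : ℝ, 1 < s → Summable fun n : ℕ => residueClass a n / (n : ℝ) ^ s := fun s hs =>
    LSeries.summable_real_of_abscissaOfAbsConv_lt ((abscissaOfAbsConv_residueClass_le_one a).trans_lt (mod_cast hs))
  -- the smoothed sum
  have hks : ∀ k : ℕ, 1 < 1 + ((k:ℝ) + 1) * σ := by
    intro k
    have : 0 < ((k:ℝ) + 1) * σ := by positivity
    linarith
  have hterm : ∀ n : ℕ, residueClass a n / n * ((n : ℝ) ^ (-σ) * P.eval ((n : ℝ) ^ (-σ))) =
      ∑ k ∈ Finset.range (P.natDegree + 1), P.coeff k * (residueClass a n / (n : ℝ) ^ (1 + (k + 1) * σ)) := by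
    intro n
    rcases n.eq_zero_or_pos with rfl | hn
    · simp
    · have hn' : (0:ℝ) < n := by exact_mod_cast hn
      rw [eval_eq_sum_range, Finset.mul_sum, Finset.mul_sum]
      refine Finset.sum_congr rfl fun k _ => ?_
      rw [← Real.rpow_natCast, ← Real.rpow_mul hn'.le, Real.rpow_add hn', Real.rpow_one]
      have h3 : (n : ℝ) ^ (-σ) * (P.coeff k * (n : ℝ) ^ (-σ * k)) = P.coeff k * ((n : ℝ) ^ ((k + 1) * σ))⁻¹ := by
        rw [← Real.rpow_neg hn'.le, mul_left_comm, ← Real.rpow_add hn']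
        ring_nf
      rw [h3]; field_simp
  have hSsum : Summable fun n : ℕ => residueClass a n / n * ((n : ℝ) ^ (-σ) * P.eval ((n : ℝ) ^ (-σ))) := by
    simp_rw [hterm]
    exact summable_sum fun k _ => (hsum _ (hks k)).mul_left _
  have hS : ∑' n : ℕ, residueClass a n / n * ((n : ℝ) ^ (-σ) * P.eval ((n : ℝ) ^ (-σ))) =
      ∑ k ∈ Finset.range (P.natDegree + 1), P.coeff k * A (1 + (k + 1) * σ) := by
    simp_rw [hterm]
    rw [Summable.tsum_finsetSum fun k _ => (hsum _ (hks k)).mul_left _]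
    refine Finset.sum_congr rfl fun k _ => ?_
    rw [tsum_mul_left]
  have hlow : (q.totient : ℝ)⁻¹ * I * Real.log X - ∑ k ∈ Finset.range (P.natDegree + 1), |P.coeff k| * C ≤
      ∑ k ∈ Finset.range (P.natDegree + 1), P.coeff k * A (1 + (k + 1) * σ) := by
    rw [hI, Finset.mul_sum, Finset.sum_mul, ← Finset.sum_sub_distrib]
    refine Finset.sum_le_sum fun k hk => ?_
    have hk' : (k : ℝ) ≤ P.natDegree := by
      exact_mod_cast Nat.lt_succ_iff.1 (Finset.mem_range.1 hk)
    have h4 := hC (x := 1 + (k + 1) * σ) ⟨hks k, by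
      have : ((k:ℝ) + 1) * σ ≤ 1 := by
        rw [hσ, ← div_eq_mul_inv, div_le_one hlp]; linarith
      linarith⟩
    have h5 : (q.totient : ℝ)⁻¹ / (1 + (k + 1) * σ - 1) = (q.totient : ℝ)⁻¹ * Real.log X / (k + 1) := by
      rw [hσ]; have : (k:ℝ) + 1 ≠ 0 := by positivity
      field_simp; ring
    rw [h5] at h4
    have h6 : |P.coeff k * (A (1 + (k + 1) * σ) - (q.totient : ℝ)⁻¹ * Real.log X / (k + 1))| ≤ |P.coeff k| * C := by
      rw [abs_mul]; exact mul_le_mul_of_nonneg_left h4 (abs_nonneg _)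
    have h7 := (abs_le.1 h6).1
    have h8 : (q.totient : ℝ)⁻¹ * (P.coeff k / (k + 1)) * Real.log X = P.coeff k * ((q.totient : ℝ)⁻¹ * Real.log X / (k + 1)) := by ring
    rw [h8]; linarith
  refine hlow.trans (hS ▸ ?_)
  refine Summable.tsum_le_tsum (fun n => ?_) hSsum ?_
  · rcases n.eq_zero_or_pos with rfl | hn
    · simp
    · have hn' : (0:ℝ) < n := by exact_mod_cast hn
      have hn1 : (1:ℝ) ≤ n := by exact_mod_cast hn
      have hr0 : 0 ≤ residueClass a n / n := div_nonneg (residueClass_nonneg a n) hn'.le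
      have hx0 : 0 < (n:ℝ) ^ (-σ) := Real.rpow_pos_of_pos hn' _
      have hx1 : (n:ℝ) ^ (-σ) ≤ 1 := Real.rpow_le_one_of_one_le_of_nonpos hn1 (by linarith)
      split_ifs with hw
      · have h9 : (n:ℝ) ^ (-σ) * P.eval ((n : ℝ) ^ (-σ)) ≤ 1 := by
          have := hP1 _ ⟨hx0.le, hx1⟩
          nlinarith
        calc _ ≤ residueClass a n / n * 1 := mul_le_mul_of_nonneg_left h9 hr0
          _ = _ := mul_one _
      · apply mul_nonpos_of_nonneg_of_nonpos hr0
        apply mul_nonpos_of_nonneg_of_nonpos hx0.le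
        apply hP2 _ ⟨hx0.le, hx1⟩
        rw [not_and_or, not_le, not_le] at hw
        rw [Real.rpow_def_of_pos hn', Real.exp_lt_exp, Real.exp_lt_exp]
        rcases hw with h | h
        · right
          have h10 := Real.log_lt_log hn' h
          rw [Real.log_rpow hXp] at h10
          have h11 : Real.log n * σ < 1 - ε := by
            rw [hσ, ← div_eq_mul_inv, div_lt_iff₀ hlp]; exact h10
          linarith
        · left
          have h10 := Real.log_lt_log hXp h
          have h11 : 1 < Real.log n * σ := by
            rw [hσ, ← div_eq_mul_inv, one_lt_div hlp]; exact h10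
          linarith
  · apply summable_of_hasFiniteSupport
    refine (Set.finite_Iic ⌊X⌋₊).subset fun n hn => ?_
    rw [Function.mem_support] at hn
    have : X ^ (1 - ε) ≤ n ∧ (n : ℝ) ≤ X := by by_contra h; simp [h] at hn
    exact Nat.le_floor this.2

open ArithmeticFunction vonMangoldt in
theorem ap (q : ℕ) [NeZero q] (ε : ℝ) (h0 : 0 < ε) (h1 : ε < 1) : ∃ X0 : ℝ, ∀ X : ℝ, X0 ≤ X →
    X ^ (1 - 2 * ε) ≤ ((Finset.range (⌊X⌋₊ + 1)).filter fun p : ℕ => p.Prime ∧ (p : ZMod q) = 1 ∧ X ^ (1 - ε) ≤ (p : ℝ)).card := by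
  classical
  obtain ⟨c, hc, C, X0, hX0, hX⟩ := window_bound (q := q) (a := 1) isUnit_one ε h0 h1
  have hs := summable_residueClass_non_primes_div (q := q) 1
  set C' := ∑' n : ℕ, (if n.Prime then 0 else residueClass (1 : ZMod q) n) / n with hC'
  have hev : ∀ᶠ X : ℝ in Filter.atTop, (1 + C + C') / c ≤ Real.log X := Real.tendsto_log_atTop.eventually_ge_atTop _
  have hev2 : ∀ᶠ X : ℝ in Filter.atTop, Real.log X ≤ X ^ ε := by
    filter_upwards [(isLittleO_log_rpow_atTop h0).bound (one_pos), Filter.eventually_ge_atTop 1] with X h h2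
    rw [one_mul, Real.norm_of_nonneg (Real.log_nonneg h2), Real.norm_of_nonneg (Real.rpow_nonneg (by linarith) _)] at h
    exact h
  obtain ⟨X1, hX1⟩ := Filter.eventually_atTop.1 (hev.and hev2)
  refine ⟨max X0 X1, fun X hXX => ?_⟩
  obtain ⟨h3, h4⟩ := hX1 X ((le_max_right _ _).trans hXX)
  have hX3 : 3 ≤ X := hX0.trans ((le_max_left _ _).trans hXX)
  have hXp : 0 < X := by linarith
  have h5 := hX X ((le_max_left _ _).trans hXX)
  set S := (Finset.range (⌊X⌋₊ + 1)).filter fun p : ℕ => p.Prime ∧ (p : ZMod q) = 1 ∧ X ^ (1 - ε) ≤ (p : ℝ) with hS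
  set g : ℕ → ℝ := fun n => if n ∈ S then Real.log X * (X ^ (1 - ε))⁻¹ else 0 with hg
  have hgs : HasSum g (∑ n ∈ S, g n) := hasSum_sum_of_ne_finset_zero (fun n hn => by simp [hg, hn])
  have hgsum : ∑ n ∈ S, g n = S.card * (Real.log X * (X ^ (1 - ε))⁻¹) := by
    rw [Finset.sum_congr rfl (fun n hn => by simp only [hg]; rw [if_pos hn]), Finset.sum_const, nsmul_eq_mul]
  have h6 : ∑' n : ℕ, (if X ^ (1 - ε) ≤ n ∧ (n : ℝ) ≤ X then residueClass (1 : ZMod q) n / n else 0) ≤ C' + S.card * (Real.log X * (X ^ (1 - ε))⁻¹) := by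
    rw [← hgsum, hC', ← hgs.tsum_eq, ← hs.tsum_add hgs.summable]
    refine Summable.tsum_le_tsum (fun n => ?_) ?_ (hs.add hgs.summable)
    · have hr0 : 0 ≤ (if n.Prime then 0 else residueClass (1 : ZMod q) n) / n := by
        apply div_nonneg _ (Nat.cast_nonneg _)
        split_ifs
        · exact le_rfl
        · exact residueClass_nonneg _ _
      have hlogX : 0 ≤ Real.log X := Real.log_nonneg (by linarith)
      have hg0 : 0 ≤ g n := by
        simp only [hg]; split_ifs
        · positivity
        · exact le_rfl
      split_ifs with hw hp
      · by_cases hq : (n : ZMod q) = 1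
        · have hnS : n ∈ S := by
            rw [hS, Finset.mem_filter, Finset.mem_range]
            exact ⟨Nat.lt_succ_of_le (Nat.le_floor hw.2), hp, hq, hw.1⟩
          simp only [hg, zero_div, zero_add]
          rw [if_pos hnS]
          have hn' : (0:ℝ) < n := by exact_mod_cast hp.pos
          rw [div_eq_mul_inv]
          apply mul_le_mul _ _ (by positivity) hlogX
          · refine (residueClass_le _ _).trans (vonMangoldt_le_log.trans (Real.log_le_log hn' hw.2))
          · exact inv_anti₀ (by positivity) hw.1
        · have : residueClass (1 : ZMod q) n = 0 := by
            rw [residueClass, Set.indicator_of_notMem]; exact hq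
          simp only [this, zero_div, zero_add]; exact hg0
      · rw [if_neg hp] at hr0; linarith
      · simp only [zero_div, zero_add]; exact hg0
      · rename_i hp; rw [if_neg hp] at hr0; linarith
    · apply summable_of_hasFiniteSupport
      refine (Set.finite_Iic ⌊X⌋₊).subset fun n hn => ?_
      rw [Function.mem_support] at hn
      have : X ^ (1 - ε) ≤ n ∧ (n : ℝ) ≤ X := by by_contra h; simp [h] at hn
      exact Nat.le_floor this.2
  have h7 : 1 ≤ S.card * (Real.log X * (X ^ (1 - ε))⁻¹) := by
    rw [div_le_iff₀ hc] at h3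
    linarith
  have h8 : (S.card : ℝ) * (Real.log X * (X ^ (1 - ε))⁻¹) ≤ S.card * (X ^ ε * (X ^ (1 - ε))⁻¹) := by
    gcongr
  have h9 : X ^ ε * (X ^ (1 - ε))⁻¹ = (X ^ (1 - 2 * ε))⁻¹ := by
    rw [← Real.rpow_neg hXp.le, ← Real.rpow_neg hXp.le, ← Real.rpow_add hXp]; ring_nf
  rw [h9] at h8
  have h10 := h7.trans h8
  rw [← div_eq_mul_inv, one_le_div (by positivity)] at h10
  exact h10

end St

namespace St
open NC

/-- the standard additive character on dot products -/
def chi (M : ℕ) [NeZero M] {n : ℕ} (s x : Fin n → ZMod M) : ℂ := ZMod.stdAddChar (s ⬝ᵥ x)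

lemma map_sum_chi {A ι : Type*} [AddCommMonoid A] (ψ : AddChar A ℂ) (t : Finset ι) (f : ι → A) : ψ (∑ i ∈ t, f i) = ∏ i ∈ t, ψ (f i) := by
  classical
  induction t using Finset.induction_on with
  | empty => simp
  | insert a t ha ih => rw [Finset.sum_insert ha, Finset.prod_insert ha, AddChar.map_add_eq_mul, ih]

lemma chi_prod (M : ℕ) [NeZero M] {n : ℕ} (s x : Fin n → ZMod M) : chi M s x = ∏ i, ZMod.stdAddChar (s i * x i) := by
  rw [chi, dotProduct]
  exact map_sum_chi _ _ _

lemma chi_comm (M : ℕ) [NeZero M] {n : ℕ} (s x : Fin n → ZMod M) : chi M s x = chi M x s := by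
  rw [chi, chi, dotProduct_comm]

lemma chi_add (M : ℕ) [NeZero M] {n : ℕ} (s t x : Fin n → ZMod M) : chi M (s + t) x = chi M s x * chi M t x := by
  rw [chi, add_dotProduct, AddChar.map_add_eq_mul]; rfl

lemma chi_neg (M : ℕ) [NeZero M] {n : ℕ} (s x : Fin n → ZMod M) : chi M (-s) x = (starRingEnd ℂ) (chi M s x) := by
  rw [chi, neg_dotProduct, AddChar.map_neg_eq_conj]; rfl

lemma chi_norm (M : ℕ) [NeZero M] {n : ℕ} (s x : Fin n → ZMod M) : ‖chi M s x‖ = 1 := by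
  rw [chi]; exact AddChar.norm_apply _ _

lemma chi_orth (M : ℕ) [NeZero M] {n : ℕ} (s : Fin n → ZMod M) : ∑ x, chi M s x = if s = 0 then (M : ℂ) ^ n else 0 := by
  classical
  simp_rw [chi_prod]
  have h := Finset.prod_univ_sum (fun _ : Fin n => (Finset.univ : Finset (ZMod M))) (fun i y => (ZMod.stdAddChar (s i * y) : ℂ))
  rw [Fintype.piFinset_univ] at h
  rw [← h]
  have h2 : ∀ i, ∑ y : ZMod M, (ZMod.stdAddChar (s i * y) : ℂ) = if s i = 0 then (M : ℂ) else 0 := by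
    intro i
    have := AddChar.sum_mulShift (s i) (ZMod.isPrimitive_stdAddChar M)
    simp_rw [mul_comm _ (s i)] at this
    rw [this, ZMod.card]; simp
  simp_rw [h2]
  split_ifs with hs
  · subst hs; simp
  · obtain ⟨i, hi⟩ := Function.ne_iff.1 hs
    exact Finset.prod_eq_zero (Finset.mem_univ i) (if_neg hi)

lemma parseval (M : ℕ) [NeZero M] {n : ℕ} (f : (Fin n → ZMod M) → ℂ) :
    ∑ x, ‖∑ s, f s * chi M s x‖ ^ 2 = (M : ℝ) ^ n * ∑ s, ‖f s‖ ^ 2 := by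
  classical
  have h1 : ∀ z : ℂ, ((‖z‖ ^ 2 : ℝ) : ℂ) = z * (starRingEnd ℂ) z := fun z => by
    rw [Complex.mul_conj, Complex.normSq_eq_norm_sq]
  apply Complex.ofReal_injective
  push_cast
  have h2 : ∀ z : ℂ, ((‖z‖ : ℂ)) ^ 2 = z * (starRingEnd ℂ) z := fun z => by rw [← h1]; push_cast; rfl
  simp_rw [h2, map_sum, Finset.sum_mul_sum, map_mul, ← chi_neg]
  rw [Finset.sum_comm, Finset.mul_sum]
  refine Finset.sum_congr rfl fun s _ => ?_
  rw [Finset.sum_comm]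
  have h3 : ∀ t, ∑ x, f s * chi M s x * ((starRingEnd ℂ) (f t) * chi M (-t) x) = f s * (starRingEnd ℂ) (f t) * (if s - t = 0 then (M : ℂ) ^ n else 0) := by
    intro t
    rw [← chi_orth, Finset.mul_sum]
    refine Finset.sum_congr rfl fun x _ => ?_
    rw [sub_eq_add_neg, chi_add]; ring
  simp_rw [h3, sub_eq_zero]
  simp [mul_comm, mul_assoc, mul_left_comm]

lemma K1 (M J : ℕ) [NeZero M] (x : ℤ) (h : 8 * (J * |x|) ≤ M) :
    (J : ℝ) / 2 ≤ ‖∑ s ∈ Finset.range J, (ZMod.stdAddChar (((s : ℤ) : ZMod M) * (x : ZMod M)) : ℂ)‖ := by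
  refine le_trans ?_ (Complex.re_le_norm _)
  rw [Complex.re_sum]
  have : (J : ℝ) / 2 = ∑ s ∈ Finset.range J, (1/2 : ℝ) := by simp [div_eq_mul_inv]
  rw [this]
  refine Finset.sum_le_sum fun s hs => ?_
  rw [← Int.cast_mul, ZMod.stdAddChar_coe]
  have hM : (0:ℝ) < M := by exact_mod_cast NeZero.pos M
  have h3 : (2 * Real.pi * Complex.I * (((s : ℤ) * x : ℤ) : ℂ) / M) = ((2 * Real.pi * ((s * x : ℤ) : ℝ) / M : ℝ) : ℂ) * Complex.I := by
    push_cast; ring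
  rw [h3, Complex.exp_ofReal_mul_I_re, ← Real.cos_abs, ← Real.cos_pi_div_three]
  apply Real.cos_le_cos_of_nonneg_of_le_pi (abs_nonneg _) (by linarith [Real.pi_pos])
  rw [abs_div, abs_mul, abs_of_pos (by positivity : (0:ℝ) < 2 * Real.pi), abs_of_pos hM, div_le_iff₀ hM]
  have h4 : (8 : ℤ) * |(s : ℤ) * x| ≤ M := by
    rw [abs_mul, abs_of_nonneg (by positivity : (0:ℤ) ≤ s)]
    have : (s : ℤ) ≤ J := by exact_mod_cast (Finset.mem_range.1 hs).le
    nlinarith [abs_nonneg x]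
  have h5 : (8:ℝ) * |((s * x : ℤ) : ℝ)| ≤ M := by exact_mod_cast h4
  nlinarith [Real.pi_pos]

/-- the large sieve inequality -/
lemma large_sieve {ι : Type*} (M J B : ℕ) [NeZero M] {n : ℕ} (hJ : 8 * (J * B) ≤ M) (hJ0 : 0 < J) (hB : 0 < B) (I : Finset ι)
    (θ : ι → Fin n → ZMod M) (c : ι → ℂ) (R : ι → ℕ)
    (hR : ∀ i ∈ I, ∀ S ⊆ I, (∀ j ∈ S, ∃ s : Fin n → ℤ, (∀ l, |s l| < J) ∧ ∀ l, ((s l : ℤ) : ZMod M) = θ j l - θ i l) → S.card ≤ R i)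
    (X : Finset (Fin n → ℤ)) (hX : ∀ x ∈ X, ∀ l, |x l| ≤ B) (hX2 : 2 * B < M) :
    (J : ℝ) ^ n * ∑ x ∈ X, ‖∑ i ∈ I, c i * chi M (θ i) (fun l => (x l : ZMod M))‖ ^ 2 ≤
      (4 * M : ℝ) ^ n * ∑ i ∈ I, ‖c i‖ ^ 2 * R i := by
  classical
  set U : Finset (Fin n → ℕ) := Fintype.piFinset fun _ => Finset.range J with hU
  have hUc : U.card = J ^ n := by simp [hU, Fintype.card_piFinset]
  set cu : (Fin n → ℕ) → Fin n → ZMod M := fun u l => (((u l : ℕ) : ℤ) : ZMod M) with hcu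
  set a : ι → (Fin n → ZMod M) → ℕ := fun i s => (U.filter fun u => s = θ i + cu u).card with ha
  have hJM : J ≤ M := by nlinarith
  have hcuinj : ∀ u ∈ U, ∀ v ∈ U, cu u = cu v → u = v := by
    intro u hu v hv huv
    ext l
    rw [hU, Fintype.mem_piFinset] at hu hv
    have h1 := congrFun huv l
    simp only [hcu] at h1
    have h2 := Finset.mem_range.1 (hu l)
    have h3 := Finset.mem_range.1 (hv l)
    rw [Int.cast_natCast, Int.cast_natCast, ZMod.natCast_eq_natCast_iff', Nat.mod_eq_of_lt (by omega), Nat.mod_eq_of_lt (by omega)] at h1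
    exact h1
  have ha1 : ∀ i s, a i s ≤ 1 := by
    intro i s
    rw [ha, Finset.card_le_one]
    intro u hu v hv
    rw [Finset.mem_filter] at hu hv
    exact hcuinj u hu.1 v hv.1 (add_left_cancel (hu.2.symm.trans hv.2))
  have hasum : ∀ i, ∑ s, a i s = J ^ n := by
    intro i
    rw [← hUc, ha]
    simp only
    rw [Finset.card_eq_sum_card_fiberwise (f := fun u => θ i + cu u) (t := Finset.univ) (by simp)]
    refine Finset.sum_congr rfl fun s _ => ?_
    congr 1; ext u; simp [eq_comm]
  set φ : (Fin n → ZMod M) → ℂ := fun s => ∑ i ∈ I, c i * (a i s : ℂ) with hφ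
  -- Fourier transform of φ
  have hft : ∀ x, ∑ s, φ s * chi M s x = (∑ i ∈ I, c i * chi M (θ i) x) * ∑ u ∈ U, chi M (cu u) x := by
    intro x
    simp only [hφ, Finset.sum_mul]
    rw [Finset.sum_comm]
    refine Finset.sum_congr rfl fun i _ => ?_
    have h1 : ∀ s, c i * (a i s : ℂ) * chi M s x = ∑ u ∈ U, if s = θ i + cu u then c i * chi M s x else 0 := by
      intro s
      rw [ha, ← Finset.sum_filter, Finset.sum_const, nsmul_eq_mul]; ring
    simp_rw [h1]
    rw [Finset.sum_comm, Finset.mul_sum]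
    refine Finset.sum_congr rfl fun u _ => ?_
    rw [Finset.sum_ite_eq' Finset.univ (θ i + cu u) (fun s => c i * chi M s x), if_pos (Finset.mem_univ _), chi_add]; ring
  have hK : ∀ x ∈ X, ((J : ℝ) / 2) ^ n ≤ ‖∑ u ∈ U, chi M (cu u) (fun l => (x l : ZMod M))‖ := by
    intro x hx
    simp_rw [chi_prod]
    have h := Finset.prod_univ_sum (fun _ : Fin n => Finset.range J) (fun i y => (ZMod.stdAddChar (((y : ℤ) : ZMod M) * (x i : ZMod M)) : ℂ))
    rw [hU]
    simp only [hcu]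
    rw [← h, norm_prod]
    have h2 : ((J : ℝ) / 2) ^ n = ∏ _i : Fin n, (J : ℝ) / 2 := by rw [Finset.prod_const]; simp only [Finset.card_univ, Fintype.card_fin]
    rw [h2]
    refine Finset.prod_le_prod (fun _ _ => by positivity) fun i _ => ?_
    apply K1
    have h3 := hX x hx i
    have h4 : (8 * (J * B) : ℤ) ≤ M := by exact_mod_cast hJ
    nlinarith
  -- upper bound for the L2 norm of φ
  have hup : ∑ s, ‖φ s‖ ^ 2 ≤ (J : ℝ) ^ n * ∑ i ∈ I, ‖c i‖ ^ 2 * R i := by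
    have h1 : ∀ s, ‖φ s‖ ^ 2 ≤ ∑ i ∈ I, ‖c i‖ ^ 2 * ((a i s : ℝ) * ∑ j ∈ I, (a j s : ℝ)) := by
      intro s
      have h2 : ‖φ s‖ ≤ ∑ i ∈ I, ‖c i‖ * (a i s : ℝ) := by
        refine (norm_sum_le _ _).trans (Finset.sum_le_sum fun i _ => ?_)
        rw [norm_mul, Complex.norm_natCast]
      have h3 : ‖φ s‖ ^ 2 ≤ (∑ i ∈ I, ‖c i‖ * (a i s : ℝ)) ^ 2 := pow_le_pow_left₀ (norm_nonneg _) h2 2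
      refine h3.trans ?_
      have h4 := Finset.sum_mul_sq_le_sq_mul_sq I (fun i => ‖c i‖ * √(a i s : ℝ)) (fun i => √(a i s : ℝ))
      have h5 : ∀ i, ‖c i‖ * √(a i s : ℝ) * √(a i s : ℝ) = ‖c i‖ * (a i s : ℝ) := fun i => by
        rw [mul_assoc, Real.mul_self_sqrt (Nat.cast_nonneg _)]
      have h6 : ∀ i, (‖c i‖ * √(a i s : ℝ)) ^ 2 = ‖c i‖ ^ 2 * (a i s : ℝ) := fun i => by
        rw [mul_pow, Real.sq_sqrt (Nat.cast_nonneg _)]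
      simp_rw [h5, h6, Real.sq_sqrt (Nat.cast_nonneg _)] at h4
      refine h4.trans (le_of_eq ?_)
      rw [Finset.sum_mul]
      refine Finset.sum_congr rfl fun i _ => by ring
    refine (Finset.sum_le_sum fun s _ => h1 s).trans ?_
    rw [Finset.sum_comm, Finset.mul_sum]
    refine Finset.sum_le_sum fun i hi => ?_
    rw [← Finset.mul_sum, mul_left_comm]
    refine mul_le_mul_of_nonneg_left ?_ (by positivity)
    have h7 : ∑ s, a i s * ∑ j ∈ I, a j s ≤ J ^ n * R i := by
      simp_rw [Finset.mul_sum]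
      rw [Finset.sum_comm]
      set S := I.filter fun j => ∃ s, a i s * a j s ≠ 0 with hS
      have h8 : S.card ≤ R i := by
        refine hR i hi S (Finset.filter_subset _ _) fun j hj => ?_
        obtain ⟨-, s, hs⟩ := Finset.mem_filter.1 hj
        obtain ⟨hs1, hs2⟩ := mul_ne_zero_iff.1 hs
        obtain ⟨u, hu⟩ := Finset.card_pos.1 (Nat.pos_of_ne_zero hs1)
        obtain ⟨v, hv⟩ := Finset.card_pos.1 (Nat.pos_of_ne_zero hs2)
        rw [Finset.mem_filter, hU, Fintype.mem_piFinset] at hu hv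
        refine ⟨fun l => (u l : ℤ) - v l, fun l => ?_, fun l => ?_⟩
        · have h1 := Finset.mem_range.1 (hu.1 l)
          have h2 := Finset.mem_range.1 (hv.1 l)
          rw [abs_lt]; constructor <;> dsimp only <;> omega
        · have h3 := congrFun (hu.2.symm.trans hv.2) l
          simp only [hcu, Pi.add_apply] at h3
          push_cast at h3 ⊢
          linear_combination h3
      calc ∑ j ∈ I, ∑ s, a i s * a j s = ∑ j ∈ S, ∑ s, a i s * a j s := by
            symm
            refine Finset.sum_subset (Finset.filter_subset _ _) fun j hj hjS => ?_
            refine Finset.sum_eq_zero fun s _ => ?_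
            by_contra hne
            exact hjS (Finset.mem_filter.2 ⟨hj, s, hne⟩)
        _ ≤ ∑ j ∈ S, J ^ n := by
            refine Finset.sum_le_sum fun j _ => ?_
            rw [← hasum i]
            exact Finset.sum_le_sum fun s _ => by nlinarith [ha1 j s]
        _ ≤ _ := by
            rw [Finset.sum_const, smul_eq_mul, mul_comm]
            exact Nat.mul_le_mul_left _ h8
    have h9 : ((∑ s, a i s * ∑ j ∈ I, a j s : ℕ) : ℝ) ≤ ((J ^ n * R i : ℕ) : ℝ) := by exact_mod_cast h7
    push_cast at h9
    exact h9
  have hpar := parseval M φ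
  simp_rw [hft] at hpar
  have hinj : Set.InjOn (fun (x : Fin n → ℤ) (l : Fin n) => (x l : ZMod M)) X := by
    intro x hx y hy hxy
    ext l
    have h1 := congrFun hxy l
    simp only at h1
    rw [ZMod.intCast_eq_intCast_iff_dvd_sub] at h1
    have h2 := abs_le.1 (hX x hx l)
    have h3 := abs_le.1 (hX y hy l)
    have := Int.eq_zero_of_abs_lt_dvd h1 (by rw [abs_lt]; constructor <;> omega)
    omega
  have hlow : ((J : ℝ) / 2) ^ (2 * n) * ∑ x ∈ X, ‖∑ i ∈ I, c i * chi M (θ i) (fun l => (x l : ZMod M))‖ ^ 2 ≤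
      ∑ x, ‖(∑ i ∈ I, c i * chi M (θ i) x) * ∑ u ∈ U, chi M (cu u) x‖ ^ 2 := by
    refine le_trans ?_ (Finset.sum_le_sum_of_subset_of_nonneg (Finset.subset_univ (X.image fun x l => (x l : ZMod M))) (fun _ _ _ => by positivity))
    rw [Finset.sum_image hinj, Finset.mul_sum]
    refine Finset.sum_le_sum fun x hx => ?_
    rw [norm_mul, mul_pow, mul_comm]
    refine mul_le_mul_of_nonneg_left ?_ (by positivity)
    rw [mul_comm 2 n, pow_mul]
    exact pow_le_pow_left₀ (by positivity) (hK x hx) 2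
  rw [hpar] at hlow
  have h10 := hlow.trans (mul_le_mul_of_nonneg_left hup (by positivity))
  have hJp : (0:ℝ) < (J : ℝ) ^ n := by positivity
  have h11 : ((J : ℝ) / 2) ^ (2 * n) = (J : ℝ) ^ n * ((J : ℝ) ^ n / 4 ^ n) := by
    rw [div_pow, pow_mul 2, two_mul, pow_add]; norm_num; ring
  rw [h11] at h10
  have h4 : (0:ℝ) < 4 ^ n := by positivity
  rw [mul_assoc, mul_left_comm ((M:ℝ) ^ n)] at h10
  have h12 := le_of_mul_le_mul_left h10 hJp
  rw [mul_pow, mul_assoc]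
  rw [div_mul_eq_mul_div, div_le_iff₀ h4] at h12
  linarith

end St

namespace St
open NC

instance instFactPrimes (p : Nat.Primes) : Fact (p : ℕ).Prime := ⟨p.2⟩

/-- Fourier coefficients -/
def Sh (p : ℕ) [NeZero p] {n : ℕ} (g : (Fin n → ZMod p) → ℝ) (b : Fin n → ZMod p) : ℂ := ∑ x, (g x : ℂ) * chi p (-b) x

lemma Sh_inv (p : ℕ) [NeZero p] {n : ℕ} (g : (Fin n → ZMod p) → ℝ) (x : Fin n → ZMod p) :
    (g x : ℂ) = ∑ b, (Sh p g b / (p : ℂ) ^ n) * chi p b x := by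
  classical
  have hp : (p : ℂ) ^ n ≠ 0 := by
    have := NeZero.ne p
    positivity
  have h1 : ∀ b, (Sh p g b / (p : ℂ) ^ n) * chi p b x = (∑ y, (g y : ℂ) * chi p (x - y) b) / (p : ℂ) ^ n := by
    intro b
    rw [div_mul_eq_mul_div, Sh, Finset.sum_mul]
    congr 1
    refine Finset.sum_congr rfl fun y _ => ?_
    have h2 : chi p (x - y) b = chi p (-b) y * chi p b x := by
      rw [sub_eq_add_neg, chi_add, chi_neg, chi_neg, chi_comm p x, chi_comm p y, mul_comm]
    rw [h2]; ring
  simp_rw [h1]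
  rw [← Finset.sum_div, Finset.sum_comm]
  simp_rw [← Finset.mul_sum, chi_orth, sub_eq_zero]
  rw [eq_div_iff hp]
  simp

/-- line sums -/
def Tl (p : ℕ) [NeZero p] {n : ℕ} (g : (Fin n → ZMod p) → ℝ) (k x : Fin n → ZMod p) : ℝ := ∑ t : ZMod p, g (x + t • k)

lemma line_sum (p : ℕ) [Fact p.Prime] {n : ℕ} (g : (Fin n → ZMod p) → ℝ) (k : Fin n → ZMod p) :
    (p : ℝ) ^ 2 * ∑ b ∈ Finset.univ.filter (fun b => k ⬝ᵥ b = 0), ‖Sh p g b‖ ^ 2 = (p : ℝ) ^ n * ∑ x, Tl p g k x ^ 2 := by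
  classical
  have h := parseval p (n := n) (fun x => (Tl p g k x : ℂ))
  simp only [Complex.norm_real, Real.norm_eq_abs, sq_abs] at h
  rw [← h, Finset.sum_filter, Finset.mul_sum]
  rw [← Equiv.sum_comp (Equiv.neg (Fin n → ZMod p))]
  refine Finset.sum_congr rfl fun b _ => ?_
  simp only [Equiv.neg_apply, Tl, dotProduct_neg, neg_eq_zero]
  have h2 : ∑ s, ((∑ t : ZMod p, g (s + t • k) : ℝ) : ℂ) * chi p s b = Sh p g (-b) * (if k ⬝ᵥ b = 0 then (p : ℂ) else 0) := by
    push_cast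
    simp_rw [Finset.sum_mul]
    rw [Finset.sum_comm]
    have h3 : ∀ t : ZMod p, ∑ s, (g (s + t • k) : ℂ) * chi p s b = Sh p g (-b) * ZMod.stdAddChar (t * -(k ⬝ᵥ b)) := by
      intro t
      rw [Sh, Finset.sum_mul]
      refine Fintype.sum_equiv (Equiv.addRight (t • k)) _ _ fun s => ?_
      simp only [Equiv.coe_addRight, neg_neg]
      rw [chi_comm p b, chi_add, chi, chi, mul_assoc, mul_assoc]
      congr 1
      rw [smul_dotProduct, smul_eq_mul, mul_neg, ← AddChar.map_add_eq_mul]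
      rw [add_neg_cancel, AddChar.map_zero_eq_one, mul_one]
    simp_rw [h3]
    rw [← Finset.mul_sum, AddChar.sum_mulShift _ (ZMod.isPrimitive_stdAddChar p), ZMod.card]
    simp
  rw [h2]
  split_ifs with hk
  · rw [norm_mul, Complex.norm_natCast]; ring
  · simp

lemma std_lift (p M' : ℕ) [NeZero p] [NeZero (p * M')] (z : ℤ) : (ZMod.stdAddChar ((z : ℤ) : ZMod p) : ℂ) = ZMod.stdAddChar (((M' * z : ℤ)) : ZMod (p * M')) := by
  rw [ZMod.stdAddChar_coe, ZMod.stdAddChar_coe]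
  have hp : (p : ℂ) ≠ 0 := by exact_mod_cast NeZero.ne p
  have hM : (M' : ℂ) ≠ 0 := by
    have := NeZero.ne (p * M')
    exact_mod_cast right_ne_zero_of_mul this
  congr 1
  push_cast
  field_simp

lemma chi_lift (p M' M : ℕ) [NeZero p] [NeZero M] (hM : M = p * M') {n : ℕ} (b : Fin n → ZMod p) (x : Fin n → ℤ) :
    chi p b (fun l => (x l : ZMod p)) = chi M (fun l => ((M' * ((b l).val : ℤ) : ℤ) : ZMod M)) (fun l => (x l : ZMod M)) := by
  subst hM
  rw [chi_prod, chi_prod]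
  refine Finset.prod_congr rfl fun l _ => ?_
  have h1 : b l * (x l : ZMod p) = ((((b l).val : ℤ) * x l : ℤ) : ZMod p) := by push_cast; simp
  rw [h1, std_lift p M']
  congr 1
  push_cast; ring

lemma tau_bound (p V n : ℕ) [Fact p.Prime] (b : Fin n → ZMod p) (T : Finset (ZMod p))
    (hT : ∀ t ∈ T, ∀ l, ∃ r : ℤ, (r : ZMod p) = t * b l ∧ 8 * (V * |r|) ≤ p) :
    (T.card : ℝ) * ((V : ℝ) / 2) ^ (2 * n) ≤ p * (((Fintype.piFinset fun _ : Fin n => Finset.range V) ×ˢ (Fintype.piFinset fun _ : Fin n => Finset.range V)).filter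
      fun v => (fun l => ((v.1 l : ZMod p) - (v.2 l : ZMod p))) ⬝ᵥ b = 0).card := by
  classical
  set U : Finset (Fin n → ℕ) := Fintype.piFinset fun _ : Fin n => Finset.range V with hU
  set cv : (Fin n → ℕ) → Fin n → ZMod p := fun v l => (v l : ZMod p) with hcv
  have key : ∑ t : ZMod p, ‖∑ v ∈ U, (ZMod.stdAddChar (t * (cv v ⬝ᵥ b)) : ℂ)‖ ^ 2 =
      p * ((U ×ˢ U).filter fun v => (fun l => ((v.1 l : ZMod p) - (v.2 l : ZMod p))) ⬝ᵥ b = 0).card := by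
    apply Complex.ofReal_injective
    push_cast
    have h2 : ∀ z : ℂ, ((‖z‖ : ℂ)) ^ 2 = z * (starRingEnd ℂ) z := fun z => by
      rw [Complex.mul_conj, Complex.normSq_eq_norm_sq]; push_cast; rfl
    simp_rw [h2, map_sum, Finset.sum_mul_sum, ← AddChar.map_neg_eq_conj, ← AddChar.map_add_eq_mul]
    have h7 : ∀ t : ZMod p, ∑ v ∈ U, ∑ v' ∈ U, (ZMod.stdAddChar (t * (cv v ⬝ᵥ b) + -(t * (cv v' ⬝ᵥ b))) : ℂ) =
        ∑ v ∈ U ×ˢ U, (ZMod.stdAddChar (t * (cv v.1 ⬝ᵥ b) + -(t * (cv v.2 ⬝ᵥ b))) : ℂ) := fun t => by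
      rw [Finset.sum_product]
    rw [Finset.sum_congr rfl fun t _ => h7 t]
    rw [Finset.sum_comm]
    have h3 : ∀ v : (Fin n → ℕ) × (Fin n → ℕ), ∑ t : ZMod p, (ZMod.stdAddChar (t * (cv v.1 ⬝ᵥ b) + -(t * (cv v.2 ⬝ᵥ b))) : ℂ) =
        if (fun l => ((v.1 l : ZMod p) - (v.2 l : ZMod p))) ⬝ᵥ b = 0 then (p : ℂ) else 0 := by
      intro v
      have h4 : (fun l => ((v.1 l : ZMod p) - (v.2 l : ZMod p))) ⬝ᵥ b = cv v.1 ⬝ᵥ b - cv v.2 ⬝ᵥ b := by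
        rw [← sub_dotProduct]; rfl
      rw [h4]
      have h5 := AddChar.sum_mulShift (cv v.1 ⬝ᵥ b - cv v.2 ⬝ᵥ b) (ZMod.isPrimitive_stdAddChar p)
      rw [ZMod.card] at h5
      push_cast at h5
      rw [← h5]
      refine Finset.sum_congr rfl fun t _ => ?_
      congr 1; ring
    simp_rw [h3]
    rw [← Finset.sum_filter, Finset.sum_const, nsmul_eq_mul, mul_comm]
  rw [← key]
  have h5 : (T.card : ℝ) * ((V : ℝ) / 2) ^ (2 * n) = ∑ t ∈ T, ((V : ℝ) / 2) ^ (2 * n) := by rw [Finset.sum_const, nsmul_eq_mul]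
  rw [h5]
  refine le_trans ?_ (Finset.sum_le_sum_of_subset_of_nonneg (Finset.subset_univ T) (fun _ _ _ => by positivity))
  refine Finset.sum_le_sum fun t ht => ?_
  rw [mul_comm 2 n, pow_mul]
  refine pow_le_pow_left₀ (by positivity) ?_ 2
  choose r hr1 hr2 using hT t ht
  have h6 : ∀ v ∈ U, (ZMod.stdAddChar (t * (cv v ⬝ᵥ b)) : ℂ) = ∏ l, (ZMod.stdAddChar (((v l : ℤ) : ZMod p) * (r l : ZMod p)) : ℂ) := by
    intro v _
    rw [← map_sum_chi]
    congr 1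
    rw [dotProduct, Finset.mul_sum]
    refine Finset.sum_congr rfl fun l _ => ?_
    rw [hr1]; push_cast; simp only [hcv]; ring
  rw [Finset.sum_congr rfl h6]
  have h := Finset.prod_univ_sum (fun _ : Fin n => Finset.range V) (fun i y => (ZMod.stdAddChar (((y : ℤ) : ZMod p) * (r i : ZMod p)) : ℂ))
  rw [hU, ← h, norm_prod]
  have h2 : ((V : ℝ) / 2) ^ n = ∏ _i : Fin n, (V : ℝ) / 2 := by
    rw [Finset.prod_const]; simp only [Finset.card_univ, Fintype.card_fin]
  rw [h2]
  exact Finset.prod_le_prod (fun _ _ => by positivity) fun i _ => K1 p V (r i) (hr2 i)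

lemma R_arith (p q P s β β' B Q V t Mp Mq M : ℤ) (hp : 0 < p) (hq : 0 < q) (hqQ : q ≤ Q) (hQV : Q * V ≤ B) (hV : 0 < V)
    (hM : M = 8 * (P * B)) (hP : 0 < P) (hMp : M = p * Mp) (hMq : M = q * Mq) (hs : |s| < P) (hB : 0 < B)
    (h : s = Mq * β' - Mp * β + M * t) : 8 * (V * |p * β' - q * β + p * q * t|) ≤ p := by
  have h1 : p * q * s = M * (p * β' - q * β + p * q * t) := by
    rw [h]
    have : p * q * (Mq * β' - Mp * β + M * t) = p * (q * Mq) * β' - q * (p * Mp) * β + p * q * M * t := by ring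
    rw [this, ← hMp, ← hMq]; ring
  set r := p * β' - q * β + p * q * t with hr
  have h2 : p * q * |s| = M * |r| := by
    have := congrArg abs h1
    have hMpos : 0 < M := by rw [hM]; positivity
    rw [abs_mul (p * q), abs_mul M, abs_of_pos (by positivity : 0 < p * q), abs_of_pos hMpos] at this
    exact this
  have h3 : 8 * B * |r| < p * q := by
    have h4 : p * q * |s| < p * q * P := mul_lt_mul_of_pos_left hs (by positivity)
    rw [h2, hM] at h4
    have : P * (8 * B * |r|) < P * (p * q) := by nlinarith
    exact lt_of_mul_lt_mul_left this hP.le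
  have h5 : Q * (8 * (V * |r|)) ≤ Q * p := by
    have h6 : Q * V * |r| ≤ B * |r| := mul_le_mul_of_nonneg_right hQV (abs_nonneg r)
    nlinarith
  exact le_of_mul_le_mul_left h5 (by linarith)

end St

namespace St
open NC

/-- index set for `R` -/
def Rset (Ps : Finset Nat.Primes) (V : ℕ) {n : ℕ} (p : Nat.Primes) (b : Fin n → ZMod p) : Finset Nat.Primes :=
  haveI := Classical.decPred fun q : Nat.Primes => ∀ l, ∃ r : ℤ, (r : ZMod p) = ((q : ℕ) : ZMod p) * b l ∧ 8 * (V * |r|) ≤ (p : ℕ)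
  Ps.filter fun q => ∀ l, ∃ r : ℤ, (r : ZMod p) = ((q : ℕ) : ZMod p) * b l ∧ 8 * (V * |r|) ≤ (p : ℕ)

lemma mem_Rset (Ps : Finset Nat.Primes) (V : ℕ) {n : ℕ} (p : Nat.Primes) (b : Fin n → ZMod p) (q : Nat.Primes) :
    q ∈ Rset Ps V p b ↔ q ∈ Ps ∧ ∀ l, ∃ r : ℤ, (r : ZMod p) = ((q : ℕ) : ZMod p) * b l ∧ 8 * (V * |r|) ≤ (p : ℕ) := by
  unfold Rset
  exact @Finset.mem_filter _ _ (_) _ _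

/-- box of differences -/
def UU (V n : ℕ) : Finset ((Fin n → ℕ) × (Fin n → ℕ)) :=
  (Fintype.piFinset fun _ : Fin n => Finset.range V) ×ˢ (Fintype.piFinset fun _ : Fin n => Finset.range V)

lemma Rset_card (Ps : Finset Nat.Primes) (Q V : ℕ) {n : ℕ} (hPs : ∀ p ∈ Ps, (p : ℕ) ≤ Q) (hV : 0 < V) (p : Nat.Primes) (hp : p ∈ Ps) (b : Fin n → ZMod p) :
    ((Rset Ps V p b).card : ℝ) * ((V : ℝ) / 2) ^ (2 * n) ≤ 2 * Q * ((UU V n).filter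
      fun v => (fun l => ((v.1 l : ZMod p) - (v.2 l : ZMod p))) ⬝ᵥ b = 0).card := by
  classical
  set T : Finset (ZMod p) := Finset.univ.filter fun t => ∀ l, ∃ r : ℤ, (r : ZMod p) = t * b l ∧ 8 * (V * |r|) ≤ (p : ℕ) with hT
  have h1 := tau_bound p V n b T (fun t ht l => by
    rw [hT, Finset.mem_filter] at ht
    exact ht.2 l)
  have h2 : (Rset Ps V p b).card ≤ (Q / p + 1) * T.card := by
    refine le_trans (Finset.card_le_mul_card_image_of_maps_to (f := fun q : Nat.Primes => ((q : ℕ) : ZMod p)) (t := T) ?_ (Q / p + 1) ?_) le_rfl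
    · intro q hq
      rw [mem_Rset] at hq
      rw [hT, Finset.mem_filter]
      exact ⟨Finset.mem_univ _, hq.2⟩
    · intro t _
      have h3 : Q / p + 1 = (Finset.range (Q / p + 1)).card := by simp
      rw [h3]
      refine Finset.card_le_card_of_injOn (fun q : Nat.Primes => (q : ℕ) / p) ?_ ?_
      · intro q hq
        rw [Finset.mem_coe, Finset.mem_filter, mem_Rset] at hq
        simp only [Finset.coe_range, Set.mem_Iio]
        exact Nat.lt_succ_of_le (Nat.div_le_div_right (hPs q hq.1.1))
      · intro q hq q' hq' hqq
        rw [Finset.mem_coe, Finset.mem_filter] at hq hq'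
        have h4 : ((q : ℕ) : ZMod p) = ((q' : ℕ) : ZMod p) := hq.2.trans hq'.2.symm
        rw [ZMod.natCast_eq_natCast_iff] at h4
        have h5 : (q : ℕ) % p = (q' : ℕ) % p := h4
        dsimp only at hqq
        apply Subtype.ext
        rw [← Nat.div_add_mod (q : ℕ) p, ← Nat.div_add_mod (q' : ℕ) p, h5, hqq]
  have hp0 : (0 : ℝ) < (p : ℕ) := by exact_mod_cast p.2.pos
  have h3 : ((Rset Ps V p b).card : ℝ) * (p : ℕ) ≤ 2 * Q * T.card := by
    have h4 : (Q / p + 1) * (p : ℕ) ≤ 2 * Q := by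
      have := Nat.div_mul_le_self Q p
      have := hPs p hp
      nlinarith
    have h5 : (Rset Ps V p b).card * (p : ℕ) ≤ 2 * Q * T.card := by
      calc _ ≤ ((Q / p + 1) * T.card) * (p : ℕ) := Nat.mul_le_mul_right _ h2
        _ = ((Q / p + 1) * (p : ℕ)) * T.card := by ring
        _ ≤ _ := Nat.mul_le_mul_right _ h4
    exact_mod_cast h5
  refine le_of_mul_le_mul_right ?_ hp0
  calc _ = (((Rset Ps V p b).card : ℝ) * (p : ℕ)) * ((V : ℝ) / 2) ^ (2 * n) := by ring
    _ ≤ (2 * Q * T.card) * ((V : ℝ) / 2) ^ (2 * n) := mul_le_mul_of_nonneg_right h3 (by positivity)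
    _ = 2 * Q * (T.card * ((V : ℝ) / 2) ^ (2 * n)) := by ring
    _ ≤ 2 * Q * (p * _) := mul_le_mul_of_nonneg_left h1 (by positivity)
    _ = _ := by rw [UU]; ring

lemma Rset_S (Ps : Finset Nat.Primes) (Q V B P : ℕ) {n : ℕ} (hPs : ∀ p ∈ Ps, (p : ℕ) ≤ Q) (hV : 0 < V) (hQV : Q * V ≤ B) (hB : 0 < B) (hP : 0 < P)
    (hdiv : ∀ p ∈ Ps, (p : ℕ) ∣ P) (i : Σ p : Nat.Primes, Fin n → ZMod p) (hi : i.1 ∈ Ps)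
    (S : Finset (Σ p : Nat.Primes, Fin n → ZMod p)) (hS : ∀ j ∈ S, j.1 ∈ Ps)
    (h : ∀ j ∈ S, ∃ s : Fin n → ℤ, (∀ l, |s l| < P) ∧ ∀ l, ((s l : ℤ) : ZMod (8 * (P * B))) =
      (((((8 * (P * B)) / (j.1 : ℕ) : ℕ) : ℤ) * ((j.2 l).val : ℤ) : ℤ) : ZMod (8 * (P * B)))
        - (((((8 * (P * B)) / (i.1 : ℕ) : ℕ) : ℤ) * ((i.2 l).val : ℤ) : ℤ) : ZMod (8 * (P * B)))) :
    S.card ≤ (Rset Ps V i.1 i.2).card := by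
  classical
  have hM : ∀ q ∈ Ps, ((8 * (P * B) : ℕ) : ℤ) = ((q : ℕ) : ℤ) * (((8 * (P * B)) / (q : ℕ) : ℕ) : ℤ) := by
    intro q hq
    have h1 : (q : ℕ) ∣ 8 * (P * B) := Dvd.dvd.mul_left (Dvd.dvd.mul_right (hdiv q hq) B) 8
    exact_mod_cast (Nat.mul_div_cancel' h1).symm
  have key : ∀ j ∈ S, ∀ l, ∃ t : ℤ, 8 * (V * |((i.1 : ℕ) : ℤ) * ((j.2 l).val : ℤ) - ((j.1 : ℕ) : ℤ) * ((i.2 l).val : ℤ) + ((i.1 : ℕ) : ℤ) * ((j.1 : ℕ) : ℤ) * t|) ≤ ((i.1 : ℕ) : ℤ) := by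
    intro j hj l
    obtain ⟨s, hs1, hs2⟩ := h j hj
    have h3 := hs2 l
    rw [← Int.cast_sub, ZMod.intCast_eq_intCast_iff_dvd_sub] at h3
    obtain ⟨t, ht⟩ := h3
    refine ⟨-t, ?_⟩
    refine R_arith (i.1 : ℕ) (j.1 : ℕ) P (s l) ((i.2 l).val) ((j.2 l).val) B Q V (-t) _ _ ((8 * (P * B) : ℕ) : ℤ) (by exact_mod_cast i.1.2.pos) (by exact_mod_cast j.1.2.pos)
      (by exact_mod_cast hPs j.1 (hS j hj)) (by exact_mod_cast hQV) (by exact_mod_cast hV) (by push_cast; ring) (by exact_mod_cast hP) (hM i.1 hi) (hM j.1 (hS j hj)) (hs1 l)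
      (by exact_mod_cast hB) ?_
    linarith
  refine Finset.card_le_card_of_injOn (fun j => j.1) ?_ ?_
  · intro j hj
    rw [Finset.mem_coe, mem_Rset]
    refine ⟨hS j hj, fun l => ?_⟩
    obtain ⟨t, ht⟩ := key j hj l
    refine ⟨_, ?_, by rw [← abs_neg] at ht; exact ht⟩
    push_cast
    simp
  · rintro ⟨q, b'⟩ hj ⟨q', b''⟩ hj' hqq
    dsimp only at hqq
    subst hqq
    congr 1
    funext l
    obtain ⟨t, ht⟩ := key _ hj l
    obtain ⟨t', ht'⟩ := key _ hj' l
    dsimp only at ht ht'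
    have hppos : (0 : ℤ) < ((i.1 : ℕ) : ℤ) := by exact_mod_cast i.1.2.pos
    have hV' : (1 : ℤ) ≤ V := by exact_mod_cast hV
    generalize ((i.1 : ℕ) : ℤ) = p at *
    generalize ((i.2 l).val : ℤ) = β at *
    have h6 : ∀ z : ℤ, 8 * (V * |z|) ≤ p → 8 * |z| ≤ p := by
      intro z hz
      have : |z| ≤ V * |z| := le_mul_of_one_le_left (abs_nonneg z) hV'
      linarith
    have h7 := h6 _ ht
    have h8 := h6 _ ht'
    have h9 : p * (((b' l).val : ℤ) - ((b'' l).val : ℤ) + ((q : ℕ) : ℤ) * (t - t')) = 0 := by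
      refine Int.eq_zero_of_abs_lt_dvd (m := p) ⟨_, rfl⟩ ?_
      have h10 : p * (((b' l).val : ℤ) - ((b'' l).val : ℤ) + ((q : ℕ) : ℤ) * (t - t')) = (p * ((b' l).val : ℤ) - ((q : ℕ) : ℤ) * β + p * ((q : ℕ) : ℤ) * t) - (p * ((b'' l).val : ℤ) - ((q : ℕ) : ℤ) * β + p * ((q : ℕ) : ℤ) * t') := by ring
      rw [h10]
      refine lt_of_le_of_lt (abs_sub _ _) ?_
      linarith
    have h11 := (mul_eq_zero.1 h9).resolve_left hppos.ne'
    have h12 := congrArg (fun z : ℤ => (z : ZMod q)) h11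
    push_cast at h12
    simp only [ZMod.natCast_val, ZMod.cast_id', id_eq, CharP.cast_eq_zero, zero_mul, add_zero] at h12
    exact sub_eq_zero.1 h12

theorem sieve_main (n Q V B : ℕ) (Ps : Finset Nat.Primes) (hPs : ∀ p ∈ Ps, (p : ℕ) ≤ Q) (hV : 0 < V) (hQV : Q * V ≤ B) (hB : 0 < B)
    (g : ∀ p : Nat.Primes, (Fin n → ZMod p) → ℝ) (X : Finset (Fin n → ℤ)) (hX : ∀ x ∈ X, ∀ l, |x l| ≤ B) :
    (V : ℝ) ^ (2 * n) * ∑ x ∈ X, (∑ p ∈ Ps, g p (fun l => (x l : ZMod p))) ^ 2 ≤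
      (128 * B : ℝ) ^ n * ∑ p ∈ Ps, 2 * Q / ((p : ℕ) : ℝ) ^ (n + 2) * ∑ v ∈ UU V n, ∑ x, Tl p (g p) (fun l => ((v.1 l : ZMod p) - (v.2 l : ZMod p))) x ^ 2 := by
  classical
  set P : ℕ := ∏ p ∈ Ps, (p : ℕ) with hPdef
  have hP : 0 < P := Finset.prod_pos fun p _ => p.2.pos
  have hdiv : ∀ p ∈ Ps, (p : ℕ) ∣ P := fun p hp => Finset.dvd_prod_of_mem (fun p : Nat.Primes => (p : ℕ)) hp
  haveI : NeZero (8 * (P * B)) := ⟨by positivity⟩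
  have hmain := large_sieve (8 * (P * B)) P B (n := n) le_rfl hP hB (Ps.sigma fun p => (Finset.univ : Finset (Fin n → ZMod p)))
    (fun i l => (((((8 * (P * B)) / (i.1 : ℕ) : ℕ) : ℤ) * ((i.2 l).val : ℤ) : ℤ) : ZMod (8 * (P * B))))
    (fun i => Sh i.1 (g i.1) i.2 / ((i.1 : ℕ) : ℂ) ^ n) (fun i => (Rset Ps V i.1 i.2).card)
    (fun i hi S hS h => Rset_S Ps Q V B P hPs hV hQV hB hP hdiv i (Finset.mem_sigma.1 hi).1 S (fun j hj => (Finset.mem_sigma.1 (hS hj)).1) h)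
    X hX (by nlinarith)
  have h1 : ∀ x : Fin n → ℤ, ‖∑ i ∈ Ps.sigma fun p => (Finset.univ : Finset (Fin n → ZMod p)), Sh i.1 (g i.1) i.2 / ((i.1 : ℕ) : ℂ) ^ n *
      chi (8 * (P * B)) (fun l => (((((8 * (P * B)) / (i.1 : ℕ) : ℕ) : ℤ) * ((i.2 l).val : ℤ) : ℤ) : ZMod (8 * (P * B)))) (fun l => (x l : ZMod (8 * (P * B))))‖ ^ 2
      = (∑ p ∈ Ps, g p (fun l => (x l : ZMod p))) ^ 2 := by
    intro x
    rw [Finset.sum_sigma]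
    have h2 : ∀ p ∈ Ps, ∑ b : Fin n → ZMod p, Sh p (g p) b / ((p : ℕ) : ℂ) ^ n *
      chi (8 * (P * B)) (fun l => (((((8 * (P * B)) / (p : ℕ) : ℕ) : ℤ) * ((b l).val : ℤ) : ℤ) : ZMod (8 * (P * B)))) (fun l => (x l : ZMod (8 * (P * B))))
      = ((g p (fun l => (x l : ZMod p)) : ℝ) : ℂ) := by
      intro p hp
      rw [Sh_inv p (g p)]
      refine Finset.sum_congr rfl fun b _ => ?_
      rw [chi_lift p ((8 * (P * B)) / (p : ℕ)) (8 * (P * B))]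
      exact (Nat.mul_div_cancel' (Dvd.dvd.mul_left (Dvd.dvd.mul_right (hdiv p hp) B) 8)).symm
    rw [Finset.sum_congr rfl h2, ← Complex.ofReal_sum, Complex.norm_real, Real.norm_eq_abs, sq_abs]
  rw [Finset.sum_congr rfl fun x _ => h1 x, Finset.sum_sigma] at hmain
  have hP' : (0 : ℝ) < (P : ℝ) ^ n := by positivity
  have h3 : ∑ x ∈ X, (∑ p ∈ Ps, g p (fun l => (x l : ZMod p))) ^ 2 ≤ (32 * B : ℝ) ^ n * ∑ p ∈ Ps, ∑ b : Fin n → ZMod p, ‖Sh p (g p) b / ((p : ℕ) : ℂ) ^ n‖ ^ 2 * ((Rset Ps V p b).card : ℝ) := by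
    refine le_of_mul_le_mul_left (hmain.trans (le_of_eq ?_)) hP'
    rw [← mul_assoc (_ ^ n) (_ ^ n) (Finset.sum _ _), ← mul_pow]
    congr 2
    push_cast; ring
  have hV2 : (0 : ℝ) < ((V : ℝ) / 2) ^ (2 * n) := by positivity
  have h4 : ∀ p ∈ Ps, (∑ b : Fin n → ZMod p, ‖Sh p (g p) b / ((p : ℕ) : ℂ) ^ n‖ ^ 2 * ((Rset Ps V p b).card : ℝ)) * ((V : ℝ) / 2) ^ (2 * n) ≤
      2 * Q / ((p : ℕ) : ℝ) ^ (n + 2) * ∑ v ∈ UU V n, ∑ x, Tl p (g p) (fun l => ((v.1 l : ZMod p) - (v.2 l : ZMod p))) x ^ 2 := by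
    intro p hp
    have hp0 : (0 : ℝ) < ((p : ℕ) : ℝ) := by exact_mod_cast p.2.pos
    rw [Finset.sum_mul]
    calc _ ≤ ∑ b : Fin n → ZMod p, ‖Sh p (g p) b‖ ^ 2 / ((p : ℕ) : ℝ) ^ (2 * n) * (2 * Q * ((UU V n).filter
      fun v => (fun l => ((v.1 l : ZMod p) - (v.2 l : ZMod p))) ⬝ᵥ b = 0).card) := by
          refine Finset.sum_le_sum fun b _ => ?_
          rw [mul_assoc, norm_div, div_pow, norm_pow, Complex.norm_natCast, ← pow_mul, mul_comm n 2]
          exact mul_le_mul_of_nonneg_left (Rset_card Ps Q V hPs hV p hp b) (by positivity)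
      _ = 2 * Q / ((p : ℕ) : ℝ) ^ (2 * n) * ∑ b : Fin n → ZMod p, ∑ v ∈ UU V n, if (fun l => ((v.1 l : ZMod p) - (v.2 l : ZMod p))) ⬝ᵥ b = 0 then ‖Sh p (g p) b‖ ^ 2 else 0 := by
          rw [Finset.mul_sum]
          refine Finset.sum_congr rfl fun b _ => ?_
          rw [← Finset.sum_filter, Finset.sum_const, nsmul_eq_mul]; ring
      _ = 2 * Q / ((p : ℕ) : ℝ) ^ (2 * n) * ∑ v ∈ UU V n, ((p : ℕ) : ℝ) ^ n / ((p : ℕ) : ℝ) ^ 2 * ∑ x, Tl p (g p) (fun l => ((v.1 l : ZMod p) - (v.2 l : ZMod p))) x ^ 2 := by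
          rw [Finset.sum_comm]
          congr 1
          refine Finset.sum_congr rfl fun v _ => ?_
          have := line_sum p (g p) (fun l => ((v.1 l : ZMod p) - (v.2 l : ZMod p)))
          rw [← Finset.sum_filter, div_mul_eq_mul_div, eq_div_iff (by positivity), ← this, mul_comm]
      _ = _ := by
          rw [← Finset.mul_sum, ← mul_assoc]
          congr 1
          rw [pow_add, two_mul n, pow_add]
          field_simp
  have h5 : ((V : ℝ) / 2) ^ (2 * n) * ∑ x ∈ X, (∑ p ∈ Ps, g p (fun l => (x l : ZMod p))) ^ 2 ≤ (32 * B : ℝ) ^ n * ∑ p ∈ Ps, 2 * Q / ((p : ℕ) : ℝ) ^ (n + 2) * ∑ v ∈ UU V n, ∑ x, Tl p (g p) (fun l => ((v.1 l : ZMod p) - (v.2 l : ZMod p))) x ^ 2 := by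
    calc _ ≤ _ := mul_le_mul_of_nonneg_left h3 hV2.le
      _ = (32 * B : ℝ) ^ n * ∑ p ∈ Ps, (∑ b : Fin n → ZMod p, ‖Sh p (g p) b / ((p : ℕ) : ℂ) ^ n‖ ^ 2 * ((Rset Ps V p b).card : ℝ)) * ((V : ℝ) / 2) ^ (2 * n) := by
          rw [← Finset.sum_mul]; ring
      _ ≤ _ := mul_le_mul_of_nonneg_left (Finset.sum_le_sum h4) (by positivity)
  have h6 : (V : ℝ) ^ (2 * n) = 4 ^ n * ((V : ℝ) / 2) ^ (2 * n) := by
    rw [div_pow, pow_mul (2 : ℝ) 2 n]; norm_num; field_simp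
  have h7 : (128 * B : ℝ) ^ n = 4 ^ n * (32 * B : ℝ) ^ n := by
    rw [← mul_pow]; congr 1; ring
  rw [h6, h7, mul_assoc, mul_assoc]
  exact mul_le_mul_of_nonneg_left h5 (by positivity)

end St

namespace St
open NC

/-- substitution of the line `x + t k` -/
def lnHom {R : Type} [CommRing R] {n : ℕ} (x k : Fin n → R) : MvPolynomial (Fin n) ℤ →+* R[X] :=
  MvPolynomial.eval₂Hom (Int.castRingHom R[X]) (fun l => C (x l) + C (k l) * X)

/-- evaluation at a point -/
def evz {R : Type} [CommRing R] {n : ℕ} (x : Fin n → R) : MvPolynomial (Fin n) ℤ →+* R :=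
  MvPolynomial.eval₂Hom (Int.castRingHom R) x

/-- restriction of `F` to a line -/
def LP {R : Type} [CommRing R] {n : ℕ} (F : Polynomial (MvPolynomial (Fin n) ℤ)) (x k : Fin n → R) : R[X][X] := F.map (lnHom x k)

lemma mvhom_ext {R : Type} [CommRing R] {n : ℕ} {f g : MvPolynomial (Fin n) ℤ →+* R} (h : ∀ l, f (MvPolynomial.X l) = g (MvPolynomial.X l)) : f = g :=
  MvPolynomial.ringHom_ext (fun r => by simp) h

@[simp] lemma lnHom_X {R : Type} [CommRing R] {n : ℕ} (x k : Fin n → R) (l : Fin n) : lnHom x k (MvPolynomial.X l) = C (x l) + C (k l) * X := by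
  simp [lnHom]

@[simp] lemma evz_X {R : Type} [CommRing R] {n : ℕ} (x : Fin n → R) (l : Fin n) : evz x (MvPolynomial.X l) = x l := by
  simp [evz]

lemma evz_eq_aeval {R : Type} [CommRing R] {n : ℕ} (x : Fin n → R) (q) : evz x q = MvPolynomial.aeval x q := by
  have : evz x = (MvPolynomial.aeval (R := ℤ) x : MvPolynomial (Fin n) ℤ →ₐ[ℤ] R).toRingHom := mvhom_ext fun l => by simp
  rw [this]; rfl

lemma evz_int {n : ℕ} (x : Fin n → ℤ) : evz x = MvPolynomial.eval x := mvhom_ext fun l => by simp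

lemma evz_comp {R S : Type} [CommRing R] [CommRing S] {n : ℕ} (φ : R →+* S) (x : Fin n → R) : φ.comp (evz x) = evz (fun l => φ (x l)) :=
  mvhom_ext fun l => by simp

lemma LP_map {R S : Type} [CommRing R] [CommRing S] {n : ℕ} (φ : R →+* S) (F : Polynomial (MvPolynomial (Fin n) ℤ)) (x k : Fin n → R) :
    (LP F x k).map (mapRingHom φ) = LP F (fun l => φ (x l)) (fun l => φ (k l)) := by
  rw [LP, LP, Polynomial.map_map]
  congr 1
  exact mvhom_ext fun l => by simp

lemma LP_eval {R : Type} [CommRing R] {n : ℕ} (F : Polynomial (MvPolynomial (Fin n) ℤ)) (x k : Fin n → R) (t : R) :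
    (LP F x k).map (evalRingHom t) = F.map (evz (fun l => x l + t * k l)) := by
  rw [LP, Polynomial.map_map]
  congr 1
  exact mvhom_ext fun l => by simp [mul_comm t]

lemma LP_monic {R : Type} [CommRing R] {n : ℕ} {F : Polynomial (MvPolynomial (Fin n) ℤ)} (hF : F.Monic) (x k : Fin n → R) : (LP F x k).Monic := hF.map _

lemma LP_natDegree {R : Type} [CommRing R] [Nontrivial R] {n : ℕ} {F : Polynomial (MvPolynomial (Fin n) ℤ)} (hF : F.Monic) (x k : Fin n → R) :
    (LP F x k).natDegree = F.natDegree := hF.natDegree_map _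

lemma coeff_tdeg {n : ℕ} (F : Polynomial (MvPolynomial (Fin n) ℤ)) (i : ℕ) : (F.coeff i).totalDegree ≤ totalDeg F := by
  by_cases h : i ∈ F.support
  · exact (Nat.le_add_left _ i).trans (Finset.le_sup (f := fun k => k + (F.coeff k).totalDegree) h)
  · rw [notMem_support_iff.1 h]; simp

lemma natDegree_le_tdeg {n : ℕ} (F : Polynomial (MvPolynomial (Fin n) ℤ)) : F.natDegree ≤ totalDeg F := by
  by_cases h : F = 0
  · simp [h]
  · exact (Nat.le_add_right _ _).trans (Finset.le_sup (f := fun k => k + (F.coeff k).totalDegree) (natDegree_mem_support_of_nonzero h))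

lemma LP_tdeg {R : Type} [CommRing R] {n : ℕ} (F : Polynomial (MvPolynomial (Fin n) ℤ)) (x k : Fin n → R) (i : ℕ) :
    ((LP F x k).coeff i).natDegree ≤ totalDeg F := by
  refine le_trans ?_ (coeff_tdeg F i)
  rw [LP, coeff_map]
  generalize F.coeff i = q
  rw [lnHom, MvPolynomial.coe_eval₂Hom, MvPolynomial.eval₂_eq']
  refine natDegree_sum_le_of_forall_le _ _ fun m hm => ?_
  refine natDegree_mul_le.trans ?_
  have h1 : (((Int.castRingHom R[X]) (q.coeff m))).natDegree = 0 := by simp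
  rw [h1, zero_add]
  refine (natDegree_prod_le _ _).trans ?_
  have h2 : ∑ l, m l ≤ q.totalDegree := by
    have := MvPolynomial.le_totalDegree hm
    rwa [Finsupp.sum_fintype _ _ (fun _ => rfl)] at this
  refine le_trans (Finset.sum_le_sum fun l _ => ?_) h2
  refine natDegree_pow_le.trans ?_
  have h3 : (C (x l) + C (k l) * X : R[X]).natDegree ≤ 1 := by
    refine natDegree_add_le_of_degree_le (by simp) (natDegree_C_mul_le _ _ |>.trans natDegree_X_le)
  nlinarith

lemma ln_cd {σ S : Type} [CommRing S] {n : ℕ} (x k : Fin n → MvPolynomial σ S) (hx : ∀ l, (x l).totalDegree ≤ 1) (hk : ∀ l, (k l).totalDegree ≤ 1)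
    (q : MvPolynomial (Fin n) ℤ) (j : ℕ) : ((lnHom x k q).coeff j).totalDegree ≤ q.totalDegree := by
  have hmul : ∀ (a b : ℕ) (p r : (MvPolynomial σ S)[X]), (∀ j, (p.coeff j).totalDegree ≤ a) → (∀ j, (r.coeff j).totalDegree ≤ b) →
      ∀ j, ((p * r).coeff j).totalDegree ≤ a + b := by
    intro a b p r hp hr j
    rw [coeff_mul]
    refine MvPolynomial.totalDegree_finsetSum_le fun y _ => ?_
    exact (MvPolynomial.totalDegree_mul _ _).trans (add_le_add (hp _) (hr _))
  have hpow : ∀ (p : (MvPolynomial σ S)[X]), (∀ j, (p.coeff j).totalDegree ≤ 1) → ∀ m : ℕ, ∀ j, ((p ^ m).coeff j).totalDegree ≤ m := by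
    intro p hp m
    induction m with
    | zero =>
      intro j
      rw [pow_zero, coeff_one]
      split_ifs <;> simp
    | succ m ih => rw [pow_succ]; exact hmul m 1 _ _ ih hp
  have hprod : ∀ (s : Finset (Fin n)) (m : Fin n → ℕ) (p : Fin n → (MvPolynomial σ S)[X]), (∀ l j, ((p l).coeff j).totalDegree ≤ 1) → 
      ∀ j, ((∏ l ∈ s, p l ^ m l).coeff j).totalDegree ≤ ∑ l ∈ s, m l := by
    classical
    intro s m p hp
    induction s using Finset.induction_on with
    | empty =>
      intro j
      rw [Finset.prod_empty, coeff_one]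
      split_ifs <;> simp
    | insert a s ha ih =>
      rw [Finset.prod_insert ha, Finset.sum_insert ha]
      exact hmul _ _ _ _ (hpow _ (hp a) _) ih
  rw [lnHom, MvPolynomial.coe_eval₂Hom, MvPolynomial.eval₂_eq', finsetSum_coeff]
  refine MvPolynomial.totalDegree_finsetSum_le fun m hm => ?_
  have h2 : ∑ l, m l ≤ q.totalDegree := by
    have := MvPolynomial.le_totalDegree hm
    rwa [Finsupp.sum_fintype _ _ (fun _ => rfl)] at this
  refine le_trans ?_ h2
  have h3 := hmul 0 _ ((Int.castRingHom (MvPolynomial σ S)[X]) (q.coeff m)) _ (fun j => by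
    have : (Int.castRingHom (MvPolynomial σ S)[X]) (q.coeff m) = C (MvPolynomial.C ((q.coeff m : ℤ) : S)) := by simp
    rw [this, coeff_C]
    split_ifs
    · rw [MvPolynomial.totalDegree_C]
    · simp) (hprod Finset.univ m (fun l => C (x l) + C (k l) * X) (fun l j => by
      rw [coeff_add, coeff_C, coeff_C_mul_X]
      refine (MvPolynomial.totalDegree_add _ _).trans (max_le ?_ ?_)
      · split_ifs
        · exact hx l
        · simp
      · split_ifs
        · exact hk l
        · simp)) j
  simpa using h3

/-- Noether polynomials -/
def NS (d e d₁ : ℕ) : Finset (MvPolynomial (Fin d × Fin (e+1)) ℤ) := (noether_closed d e d₁).choose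

lemma NS_spec (d e d₁ : ℕ) {k : Type} [Field k] [IsAlgClosed k] {f : k[X][X]} (hf : f.Monic) (hd : f.natDegree = d) (he : ∀ i, (f.coeff i).natDegree ≤ e) :
    HasFac d₁ f ↔ ∀ Φ ∈ NS d e d₁, MvPolynomial.aeval (cf d e f) Φ = 0 :=
  (noether_closed d e d₁).choose_spec k f hf hd he

/-- Noether polynomial of the line -/
def Nk {R : Type} [CommRing R] {n : ℕ} (F : Polynomial (MvPolynomial (Fin n) ℤ)) (d e : ℕ) (Φ : MvPolynomial (Fin d × Fin (e+1)) ℤ) (x k : Fin n → R) : R :=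
  MvPolynomial.aeval (cf d e (LP F x k)) Φ

lemma Nk_map {R S : Type} [CommRing R] [CommRing S] {n : ℕ} (φ : R →+* S) (F : Polynomial (MvPolynomial (Fin n) ℤ)) (d e : ℕ) (Φ : MvPolynomial (Fin d × Fin (e+1)) ℤ)
    (x k : Fin n → R) : φ (Nk F d e Φ x k) = Nk F d e Φ (fun l => φ (x l)) (fun l => φ (k l)) := by
  rw [Nk, Nk, ← LP_map]
  have : cf d e ((LP F x k).map (mapRingHom φ)) = φ ∘ cf d e (LP F x k) := by funext q; simp [cf]
  rw [this]
  rw [MvPolynomial.aeval_def, MvPolynomial.aeval_def, MvPolynomial.eval₂_comp_left]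
  congr 1
  exact RingHom.ext_int _ _

lemma aeval_tdeg {τ σ S : Type} [Fintype τ] [CommRing S] (Φ : MvPolynomial τ ℤ) (c : τ → MvPolynomial σ S) (D : ℕ) (hc : ∀ q, (c q).totalDegree ≤ D) :
    (MvPolynomial.aeval c Φ).totalDegree ≤ Φ.totalDegree * D := by
  rw [MvPolynomial.aeval_def, MvPolynomial.eval₂_eq']
  refine MvPolynomial.totalDegree_finsetSum_le fun m hm => ?_
  have h2 : ∑ l, m l ≤ Φ.totalDegree := by
    have := MvPolynomial.le_totalDegree hm
    rwa [Finsupp.sum_fintype _ _ (fun _ => rfl)] at this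
  refine (MvPolynomial.totalDegree_mul _ _).trans ?_
  have h1 : (algebraMap ℤ (MvPolynomial σ S) (Φ.coeff m)).totalDegree = 0 := by
    have : algebraMap ℤ (MvPolynomial σ S) (Φ.coeff m) = MvPolynomial.C ((Φ.coeff m : ℤ) : S) := by simp
    rw [this, MvPolynomial.totalDegree_C]
  rw [h1, zero_add]
  refine (MvPolynomial.totalDegree_finsetProd _ _).trans ?_
  refine le_trans (Finset.sum_le_sum fun l _ => (MvPolynomial.totalDegree_pow _ _).trans (Nat.mul_le_mul_left _ (hc l))) ?_
  rw [← Finset.sum_mul]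
  exact Nat.mul_le_mul_right _ h2

lemma Nk_tdeg {σ S : Type} [CommRing S] {n : ℕ} (F : Polynomial (MvPolynomial (Fin n) ℤ)) (d e : ℕ) (Φ : MvPolynomial (Fin d × Fin (e+1)) ℤ)
    (x k : Fin n → MvPolynomial σ S) (hx : ∀ l, (x l).totalDegree ≤ 1) (hk : ∀ l, (k l).totalDegree ≤ 1) :
    (Nk F d e Φ x k).totalDegree ≤ Φ.totalDegree * totalDeg F := by
  refine aeval_tdeg Φ _ _ fun q => ?_
  rw [cf, LP, coeff_map]
  exact (ln_cd x k hx hk _ _).trans (coeff_tdeg F _)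

lemma LP_fac_iff {K : Type} [Field K] [IsAlgClosed K] {n : ℕ} {F : Polynomial (MvPolynomial (Fin n) ℤ)} (hF : F.Monic) (d₁ : ℕ) (x k : Fin n → K) :
    HasFac d₁ (LP F x k) ↔ ∀ Φ ∈ NS F.natDegree (totalDeg F) d₁, Nk F _ _ Φ x k = 0 :=
  NS_spec _ _ d₁ (LP_monic hF x k) (LP_natDegree hF x k) (LP_tdeg F x k)

/-- generic Noether polynomial in direction `k` -/
def NkG {n : ℕ} (F : Polynomial (MvPolynomial (Fin n) ℤ)) (d e : ℕ) (Φ : MvPolynomial (Fin d × Fin (e+1)) ℤ) (k : Fin n → ℤ) : MvPolynomial (Fin n) ℤ :=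
  Nk F d e Φ (fun l => MvPolynomial.X l) (fun l => MvPolynomial.C (k l))

lemma NkG_ev {K : Type} [CommRing K] {n : ℕ} (F : Polynomial (MvPolynomial (Fin n) ℤ)) (d e : ℕ) (Φ : MvPolynomial (Fin d × Fin (e+1)) ℤ) (k : Fin n → ℤ)
    (x : Fin n → K) : evz x (NkG F d e Φ k) = Nk F d e Φ x (fun l => (k l : K)) := by
  rw [NkG, Nk_map]
  simp

lemma NkG_tdeg {n : ℕ} (F : Polynomial (MvPolynomial (Fin n) ℤ)) (d e : ℕ) (Φ : MvPolynomial (Fin d × Fin (e+1)) ℤ) (k : Fin n → ℤ) :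
    (NkG F d e Φ k).totalDegree ≤ Φ.totalDegree * totalDeg F :=
  Nk_tdeg F d e Φ _ _ (fun l => by simp [MvPolynomial.totalDegree_X]) (fun l => by rw [MvPolynomial.totalDegree_C]; omega)

/-- `k` is a bad direction for factors of degree `d₁` -/
def Bad {n : ℕ} (F : Polynomial (MvPolynomial (Fin n) ℤ)) (d₁ : ℕ) (k : Fin n → ℤ) : Prop :=
  ∀ Φ ∈ NS F.natDegree (totalDeg F) d₁, NkG F _ _ Φ k = 0

lemma Bad.fac {K : Type} [Field K] [IsAlgClosed K] {n : ℕ} {F : Polynomial (MvPolynomial (Fin n) ℤ)} (hF : F.Monic) {d₁ : ℕ} {k : Fin n → ℤ}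
    (hk : Bad F d₁ k) (x : Fin n → K) : HasFac d₁ (LP F x (fun l => (k l : K))) :=
  (LP_fac_iff hF d₁ x _).2 fun Φ hΦ => by rw [← NkG_ev, hk Φ hΦ, map_zero]

end St

namespace St
open NC

lemma field_part {K0 Om : Type} [Field K0] [Field Om] [Algebra K0 Om] [IsGalois K0 Om] (P G : K0[X]) (hP : P.Monic) (hG : G.Monic) (hirr : Irreducible P)
    (hd : G.natDegree = P.natDegree) (η ζ : Om) (hη : aeval η P = 0) (hζ : aeval ζ G = 0) (h : ∀ τ : Om ≃ₐ[K0] Om, τ ζ = ζ → τ η = η) :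
    Irreducible G ∧ Nonempty (AdjoinRoot G ≃ₐ[K0] AdjoinRoot P) := by
  have hmη : P = minpoly K0 η := minpoly.eq_of_irreducible_of_monic hirr hη hP
  have hiη : IsIntegral K0 η := ⟨P, hP, hη⟩
  have hiζ : IsIntegral K0 ζ := ⟨G, hG, hζ⟩
  have hmem : η ∈ IntermediateField.adjoin K0 {ζ} := by
    rw [← InfiniteGalois.fixedField_fixingSubgroup (IntermediateField.adjoin K0 {ζ}), IntermediateField.mem_fixedField_iff]
    intro τ hτ
    rw [IntermediateField.mem_fixingSubgroup_iff] at hτ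
    exact h τ (hτ ζ (IntermediateField.mem_adjoin_simple_self K0 ζ))
  have hle : IntermediateField.adjoin K0 {η} ≤ IntermediateField.adjoin K0 {ζ} := by
    rw [IntermediateField.adjoin_simple_le_iff]; exact hmem
  have hdvd : minpoly K0 ζ ∣ G := minpoly.dvd K0 ζ hζ
  have hle2 : (minpoly K0 ζ).natDegree ≤ G.natDegree := natDegree_le_of_dvd hdvd hG.ne_zero
  haveI : FiniteDimensional K0 (IntermediateField.adjoin K0 {ζ}) := IntermediateField.adjoin.finiteDimensional hiζ
  have heq : IntermediateField.adjoin K0 {η} = IntermediateField.adjoin K0 {ζ} := by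
    apply IntermediateField.eq_of_le_of_finrank_le hle
    rw [IntermediateField.adjoin.finrank hiη, IntermediateField.adjoin.finrank hiζ, ← hmη]
    omega
  have hmζ : G = minpoly K0 ζ := by
    refine Polynomial.eq_of_monic_of_dvd_of_natDegree_le (minpoly.monic hiζ) hG hdvd ?_
    rw [hd, hmη, ← IntermediateField.adjoin.finrank hiη, ← IntermediateField.adjoin.finrank hiζ, heq]
  refine ⟨hmζ ▸ minpoly.irreducible hiζ, ⟨?_⟩⟩
  rw [hmζ, hmη]
  exact ((IntermediateField.adjoinRootEquivAdjoin K0 hiζ).trans (IntermediateField.equivOfEq heq.symm)).trans (IntermediateField.adjoinRootEquivAdjoin K0 hiη).symm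

lemma exists_sep_nat {Om : Type} [Field Om] [CharZero Om] (H : Finset Om[X]) (ρ : Om[X]) : ∃ c : ℕ, ∀ h ∈ H, h.eval (c : Om) = ρ.eval (c : Om) → h = ρ := by
  classical
  by_contra hcon
  push Not at hcon
  have h0 : (∏ h ∈ H.filter (fun h => h ≠ ρ), (h - ρ)) = 0 := by
    apply Polynomial.eq_zero_of_infinite_isRoot
    refine Set.Infinite.mono ?_ (Set.infinite_range_of_injective (Nat.cast_injective (R := Om)))
    rintro _ ⟨c, rfl⟩
    obtain ⟨h, hH, h1, h2⟩ := hcon c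
    show eval _ _ = 0
    rw [eval_prod, Finset.prod_eq_zero_iff]
    exact ⟨h, Finset.mem_filter.2 ⟨hH, h2⟩, by rw [eval_sub, h1, sub_self]⟩
  rw [Finset.prod_eq_zero_iff] at h0
  obtain ⟨h, hh, h1⟩ := h0
  exact (Finset.mem_filter.1 hh).2 (sub_eq_zero.1 h1)

lemma fac1_root {R : Type} [CommRing R] {f : R[X]} (h : HasFac 1 f) : ∃ ρ : R, f.eval ρ = 0 := by
  obtain ⟨g, h, hg, -, hd, rfl⟩ := h
  refine ⟨- g.coeff 0, ?_⟩
  have h1 : g = X + C (g.coeff 0) := by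
    conv_lhs => rw [hg.as_sum, hd]
    simp
  rw [eval_mul]
  have : g.eval (- g.coeff 0) = 0 := by
    conv_lhs => rw [h1]
    simp
  rw [this, zero_mul]

lemma eval_map_hom {R S : Type} [CommRing R] [CommRing S] (φ : R →+* S) (p : R[X]) (r : R) : (p.map φ).eval (φ r) = φ (p.eval r) := by
  rw [eval_map, eval₂_at_apply]

lemma toQ_irr {n : ℕ} {F : Polynomial (MvPolynomial (Fin n) ℤ)} (hF : F.Monic) (h : AbsIrred F) : Irreducible (toQ F) := by
  have h1 : (toQ F).map (MvPolynomial.map (algebraMap ℚ (AlgebraicClosure ℚ))) = F.map (MvPolynomial.map (Int.castRingHom (AlgebraicClosure ℚ))) := by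
    rw [toQ, Polynomial.map_map]
    congr 1
    exact mvhom_ext fun l => by simp
  refine Monic.irreducible_of_irreducible_map (MvPolynomial.map (algebraMap ℚ (AlgebraicClosure ℚ))) _ (hF.map _) ?_
  rw [h1]; exact h

lemma lsub_comp {n : ℕ} (σ τ : Matrix (Fin n) (Fin n) ℚ) (h : σ * τ = 1) : (lsubMv τ).comp (lsubMv σ) = RingHom.id _ := by
  refine MvPolynomial.ringHom_ext (fun r => by simp [lsubMv]) fun l => ?_
  simp only [lsubMv, RingHom.comp_apply, AlgHom.toRingHom_eq_coe, RingHom.coe_coe, MvPolynomial.aeval_X, map_sum, map_mul, RingHom.id_apply]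
  have h1 : ∀ j, (MvPolynomial.aeval (R := ℚ) (fun i => ∑ j, MvPolynomial.C (τ i j) * MvPolynomial.X (R := ℚ) j)) (MvPolynomial.C (σ l j) : MvPolynomial (Fin n) ℚ) = MvPolynomial.C (σ l j) := fun j => by
    rw [MvPolynomial.aeval_C]; rfl
  simp_rw [h1, Finset.mul_sum]
  rw [Finset.sum_comm]
  simp_rw [← mul_assoc, ← Finset.sum_mul, ← map_mul, ← map_sum]
  have h2 : ∀ i, ∑ j, σ l j * τ j i = (1 : Matrix (Fin n) (Fin n) ℚ) l i := fun i => by rw [← h, Matrix.mul_apply]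
  simp_rw [h2, Matrix.one_apply]
  simp

lemma applyGL_irr {n : ℕ} (σ : Matrix (Fin n) (Fin n) ℚ) (hσ : IsUnit σ.det) {P : Polynomial (MvPolynomial (Fin n) ℚ)} (hP : Irreducible P) : Irreducible (applyGL σ P) := by
  have e : MvPolynomial (Fin n) ℚ ≃+* MvPolynomial (Fin n) ℚ := RingEquiv.refl _
  let e : MvPolynomial (Fin n) ℚ ≃+* MvPolynomial (Fin n) ℚ := RingEquiv.ofRingHom (lsubMv σ) (lsubMv σ⁻¹)
    (lsub_comp _ _ (Matrix.nonsing_inv_mul σ hσ)) (lsub_comp _ _ (Matrix.mul_nonsing_inv σ hσ))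
  have h1 : applyGL σ P = Polynomial.mapEquiv e P := by
    rw [Polynomial.mapEquiv_apply]; rfl
  rw [h1]
  exact (MulEquiv.irreducible_iff (Polynomial.mapEquiv e)).2 hP

lemma alg_nb {n : ℕ} {F : Polynomial (MvPolynomial (Fin n) ℤ)} (hF : IsAllowable F) {k : Fin n → ℤ} (hk : k ≠ 0) : ¬ Bad F 1 k := by
  classical
  intro hbad
  obtain ⟨i0, hi0⟩ := Function.ne_iff.1 hk
  obtain ⟨habs, hmon, hgen⟩ := hF
  set Om := AlgebraicClosure (RF n) with hOm
  set a : MvPolynomial (Fin n) ℚ →+* Om := (algebraMap (RF n) Om).comp (algebraMap (MvPolynomial (Fin n) ℚ) (RF n)) with ha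
  set x' : Fin n → Om := fun l => if l = i0 then 0 else a (MvPolynomial.X l) with hx'
  obtain ⟨ρ, hρ⟩ := fac1_root (hbad.fac hmon x')
  set kk : Fin n → Om := fun l => (k l : Om) with hkk
  have hLP := LP_monic hmon x' kk
  obtain ⟨c, hc⟩ := exists_sep_nat (LP F x' kk).roots.toFinset ρ
  have hev : ∀ t : Om, (F.map (evz (fun l => x' l + t * kk l))).eval (ρ.eval t) = 0 := by
    intro t
    have := eval_map_hom (evalRingHom t) (LP F x' kk) ρ
    rw [LP_eval, hρ, map_zero] at this
    exact this
  -- the polynomial G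
  set ψ : MvPolynomial (Fin n) ℤ →+* MvPolynomial (Fin n) ℤ := evz (fun l => (if l = i0 then 0 else MvPolynomial.X l) + MvPolynomial.C (c * k l)) with hψ
  set G := F.map ψ with hG
  have hGdeg : degX G i0 = 0 := by
    rw [degX, ← bot_eq_zero, Finset.sup_eq_bot_iff]
    intro j _
    rw [hG, coeff_map, bot_eq_zero]
    generalize F.coeff j = q
    have h1 : ψ q ∈ MvPolynomial.supported ℤ ({i0}ᶜ : Set (Fin n)) := by
      have h2 : ∀ l, (if l = i0 then (0 : MvPolynomial (Fin n) ℤ) else MvPolynomial.X l) + MvPolynomial.C (c * k l) ∈ MvPolynomial.supported ℤ ({i0}ᶜ : Set (Fin n)) := by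
        intro l
        refine Subalgebra.add_mem _ ?_ (Subalgebra.algebraMap_mem _ _)
        split_ifs with h
        · exact Subalgebra.zero_mem _
        · exact MvPolynomial.X_mem_supported.2 h
      induction q using MvPolynomial.induction_on with
      | C r =>
        have : ψ (MvPolynomial.C r) = MvPolynomial.C r := by simp [hψ, evz]
        rw [this]
        exact Subalgebra.algebraMap_mem _ _
      | add p q hp hq => rw [map_add]; exact Subalgebra.add_mem _ hp hq
      | mul_X p l hp =>
        rw [map_mul]
        refine Subalgebra.mul_mem _ hp ?_
        rw [hψ, evz_X]; exact h2 l
    rw [MvPolynomial.mem_supported] at h1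
    have h3 : i0 ∉ (ψ q).vars := fun h => h1 h rfl
    rw [MvPolynomial.degreeOf_def]
    rw [MvPolynomial.vars_def, Multiset.mem_toFinset] at h3
    convert Multiset.count_eq_zero.2 h3
  -- matrix
  set σ : Matrix (Fin n) (Fin n) ℚ := (1 : Matrix (Fin n) (Fin n) ℚ).updateCol i0 (fun l => (k l : ℚ)) with hσ
  have hdet : IsUnit σ.det := by
    rw [hσ, ← Matrix.cramer_apply, Matrix.cramer_one, isUnit_iff_ne_zero]
    simpa using hi0
  have hirrQ : Irreducible (applyGL σ (toQ F)) := applyGL_irr σ hdet (toQ_irr hmon habs)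
  have hmonσ : (applyGL σ (toQ F)).Monic := (hmon.map _).map _
  have hirr : Irreducible (toFracQ (applyGL σ (toQ F))) :=
    (hmonσ.irreducible_iff_irreducible_map_fraction_map (K := RF n)).1 hirrQ
  have hmapσ : (toFracQ (applyGL σ (toQ F))).map (algebraMap (RF n) Om) = F.map (evz (fun l => x' l + a (MvPolynomial.X i0) * kk l)) := by
    rw [toFracQ, applyGL, toQ, Polynomial.map_map, Polynomial.map_map, Polynomial.map_map]
    congr 1
    refine mvhom_ext fun l => ?_
    rw [evz_X]
    have h1 : lsubMv σ (MvPolynomial.X l) = (if l = i0 then 0 else MvPolynomial.X l) + MvPolynomial.X i0 * (k l : MvPolynomial (Fin n) ℚ) := by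
      have h2 : ∀ j, MvPolynomial.C (σ l j) * (MvPolynomial.X j : MvPolynomial (Fin n) ℚ) = (if j = l then (if l = i0 then 0 else MvPolynomial.X l) else 0) + if j = i0 then MvPolynomial.X i0 * (k l : MvPolynomial (Fin n) ℚ) else 0 := by
        intro j
        rw [hσ, Matrix.updateCol_apply]
        by_cases hj : j = i0
        · subst hj
          simp only [if_true]
          by_cases hjl : j = l
          · simp [hjl, mul_comm]
          · simp [hjl, mul_comm]
        · by_cases hjl : j = l
          · subst hjl; simp [hj]
          · have : l ≠ j := fun h => hjl h.symm
            simp [hj, hjl, Matrix.one_apply, this]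
      simp only [lsubMv, AlgHom.toRingHom_eq_coe, RingHom.coe_coe, MvPolynomial.aeval_X]
      rw [Finset.sum_congr rfl fun j _ => h2 j, Finset.sum_add_distrib]
      simp
    simp only [RingHom.comp_apply, MvPolynomial.map_X]
    rw [h1]
    show a _ = _
    rw [map_add, map_mul, map_intCast]
    simp only [hx', hkk]
    congr 1
    by_cases h : l = i0
    · rw [if_pos h, if_pos h, map_zero]
    · rw [if_neg h, if_neg h]
  have hmapG : (toFrac G).map (algebraMap (RF n) Om) = F.map (evz (fun l => x' l + (c : Om) * kk l)) := by
    rw [toFrac, toFracQ, toQ, hG, Polynomial.map_map, Polynomial.map_map, Polynomial.map_map]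
    congr 1
    refine mvhom_ext fun l => ?_
    rw [evz_X]
    simp only [RingHom.comp_apply]
    show a (MvPolynomial.map _ (ψ _)) = _
    rw [hψ, evz_X, map_add, map_add]
    simp only [hx', hkk]
    congr 1
    · by_cases h : l = i0
      · rw [if_pos h, if_pos h, map_zero, map_zero]
      · rw [if_neg h, if_neg h, MvPolynomial.map_X]
    · simp
  have hmonG : (toFrac G).Monic := ((hmon.map _).map _).map _
  have hdG : (toFrac G).natDegree = F.natDegree := by
    rw [toFrac, toFracQ, toQ, hG, ((hmon.map _).map _).natDegree_map, (hmon.map _).natDegree_map, hmon.natDegree_map]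
  have hdσ : (toFracQ (applyGL σ (toQ F))).natDegree = F.natDegree := by
    rw [toFracQ, applyGL, toQ, ((hmon.map _).map _).natDegree_map, (hmon.map _).natDegree_map, hmon.natDegree_map]
  obtain ⟨hGirr, hiso⟩ := field_part (K0 := RF n) (Om := Om) (toFracQ (applyGL σ (toQ F))) (toFrac G) (hmonσ.map _) hmonG hirr (by rw [hdG, hdσ])
    (ρ.eval (a (MvPolynomial.X i0))) (ρ.eval (c : Om)) (by rw [aeval_def, ← eval_map, hmapσ]; exact hev _) (by rw [aeval_def, ← eval_map, hmapG]; exact hev _) (by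
      intro τ hτ
      have hτa : ∀ q, τ (a q) = a q := fun q => τ.commutes _
      have h1 : ρ.map (τ : Om →+* Om) ∈ (LP F x' kk).roots.toFinset := by
        rw [Multiset.mem_toFinset, mem_roots hLP.ne_zero, IsRoot.def]
        have h2 := eval_map_hom (mapRingHom (τ : Om →+* Om)) (LP F x' kk) ρ
        rw [hρ, map_zero, LP_map] at h2
        have h3 : (fun l => (τ : Om →+* Om) (x' l)) = x' := by
          funext l
          simp only [hx']
          split_ifs
          · exact map_zero _
          · exact hτa _
        have h4 : (fun l => (τ : Om →+* Om) (kk l)) = kk := by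
          funext l
          simp only [hkk]
          exact map_intCast _ _
        rw [h3, h4] at h2
        exact h2
      have h5 : ρ.map (τ : Om →+* Om) = ρ := by
        refine hc _ h1 ?_
        have h6 := eval_map_hom (τ : Om →+* Om) ρ (c : Om)
        rw [map_natCast] at h6
        rw [h6]; exact hτ
      have h7 := eval_map_hom (τ : Om →+* Om) ρ (a (MvPolynomial.X i0))
      have h8 : (τ : Om →+* Om) (a (MvPolynomial.X i0)) = a (MvPolynomial.X i0) := hτa _
      rw [h5, h8] at h7
      exact h7.symm)
  have := (hgen σ hdet G hGirr hiso).2 i0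
  omega

end St

namespace St
open NC

lemma roots_fixed {E Om : Type} [Field E] [IsAlgClosed E] [Field Om] [IsAlgClosed Om] (j : E →+* Om) (τ : Om →+* Om) (hτ : ∀ x, τ (j x) = j x) (f0 : E[X]) (h0 : f0.Monic)
    (g h : Om[X]) (hg : g.Monic) (hgh : f0.map j = g * h) : g.map τ = g := by
  have hs : g.Splits := IsAlgClosed.splits g
  have h1 : g = (g.roots.map fun a => X - C a).prod := by
    have := hs.eq_prod_roots
    rwa [hg.leadingCoeff, C_1, one_mul] at this
  have h2 : ∀ a ∈ g.roots, τ a = a := by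
    intro a ha
    have h3 : a ∈ (f0.map j).roots := by
      rw [mem_roots (h0.map j).ne_zero, IsRoot.def, hgh, eval_mul, (mem_roots hg.ne_zero).1 ha, zero_mul]
    rw [(IsAlgClosed.splits f0).roots_map_of_injective j.injective] at h3
    obtain ⟨x, -, rfl⟩ := Multiset.mem_map.1 h3
    exact hτ x
  conv_rhs => rw [h1]
  conv_lhs => rw [h1]
  rw [Polynomial.map_multiset_prod, Multiset.map_map]
  congr 1
  refine Multiset.map_congr rfl fun a ha => ?_
  simp [h2 a ha]

lemma monic_dvd_lc {Om : Type} [Field Om] {d g : Om[X][X]} (hg : g.Monic) (h : d ∣ g) : IsUnit d.leadingCoeff := by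
  obtain ⟨c, rfl⟩ := h
  have := hg
  rw [Monic, leadingCoeff_mul] at this
  exact IsUnit.of_mul_eq_one _ this

lemma relprime_of_eval {Om : Type} [Field Om] (g h : Om[X][X]) (hg : g.Monic) (hc : IsCoprime (g.map (evalRingHom 0)) (h.map (evalRingHom 0))) : IsRelPrime g h := by
  intro d hdg hdh
  have hu := monic_dvd_lc hg hdg
  have h1 : IsUnit (d.map (evalRingHom 0)) :=
    hc.isRelPrime (Polynomial.map_dvd _ hdg) (Polynomial.map_dvd _ hdh)
  have h2 : (d.map (evalRingHom (0:Om))).natDegree = d.natDegree := by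
    apply natDegree_map_of_leadingCoeff_ne_zero
    exact (hu.map (evalRingHom (0:Om))).ne_zero
  rw [natDegree_eq_zero_of_isUnit h1] at h2
  rw [eq_C_of_natDegree_eq_zero h2.symm]
  refine IsUnit.map C ?_
  rwa [leadingCoeff, ← h2] at hu

lemma gal_fac {E K0 Om : Type} [Field E] [IsAlgClosed E] [Field K0] [Field Om] [IsAlgClosed Om] [Algebra K0 Om] [IsGalois K0 Om] (j : E →+* K0)
    (f : K0[X][X]) (hf : f.Monic) (f0 : E[X]) (h0 : f0.Monic) (hf0 : f.map (evalRingHom 0) = f0.map j) (hsep : f0.Separable) (d₁ : ℕ)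
    (hfac : HasFac d₁ (f.map (mapRingHom (algebraMap K0 Om)))) : HasFac d₁ f := by
  obtain ⟨g, h, hg, hh, hd, hgh⟩ := hfac
  have h00 : (f.map (mapRingHom (algebraMap K0 Om))).map (evalRingHom 0) = f0.map ((algebraMap K0 Om).comp j) := by
    rw [← Polynomial.map_map, ← hf0, Polynomial.map_map, Polynomial.map_map]
    congr 1
    ext <;> simp
  have hsepm : (f0.map ((algebraMap K0 Om).comp j)).Separable := hsep.map
  have hfix : ∀ τ : Om ≃ₐ[K0] Om, g.map (mapRingHom (τ : Om →+* Om)) = g := by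
    intro τ
    have hev : ∀ q : Om[X][X], (q.map (mapRingHom (τ : Om →+* Om))).map (evalRingHom 0) = (q.map (evalRingHom 0)).map (τ : Om →+* Om) := by
      intro q
      rw [Polynomial.map_map, Polynomial.map_map]
      congr 1
      ext <;> simp
    have hfτ : (f.map (mapRingHom (algebraMap K0 Om))).map (mapRingHom (τ : Om →+* Om)) = f.map (mapRingHom (algebraMap K0 Om)) := by
      rw [Polynomial.map_map]
      congr 1
      ext <;> simp
    have hg0 : (g.map (mapRingHom (τ : Om →+* Om))).map (evalRingHom 0) = g.map (evalRingHom 0) := by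
      rw [hev]
      refine roots_fixed ((algebraMap K0 Om).comp j) _ (fun x => ?_) f0 h0 _ (h.map (evalRingHom 0)) (hg.map _) ?_
      · exact τ.commutes _
      · rw [← h00, hgh, Polynomial.map_mul]
    have hgτ : f.map (mapRingHom (algebraMap K0 Om)) = g.map (mapRingHom (τ : Om →+* Om)) * h.map (mapRingHom (τ : Om →+* Om)) := by
      rw [← Polynomial.map_mul, ← hgh, hfτ]
    have hrp : IsRelPrime g (h.map (mapRingHom (τ : Om →+* Om))) := by
      refine relprime_of_eval _ _ hg ?_
      rw [← hg0]
      rw [← h00, hgτ, Polynomial.map_mul] at hsepm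
      exact hsepm.isCoprime
    have hdv : g ∣ g.map (mapRingHom (τ : Om →+* Om)) := by
      refine hrp.dvd_of_dvd_mul_right ?_
      rw [← hgτ, hgh]; exact dvd_mul_right _ _
    exact (Polynomial.eq_of_monic_of_dvd_of_natDegree_le hg (hg.map _) hdv (by rw [hg.natDegree_map]))
  have hl : g ∈ lifts (mapRingHom (algebraMap K0 Om)) := by
    rw [lifts_iff_coeff_lifts]
    intro i
    have : g.coeff i ∈ lifts (algebraMap K0 Om) := by
      rw [lifts_iff_coeff_lifts]
      intro l
      have h1 : (g.coeff i).coeff l ∈ (⊥ : IntermediateField K0 Om) := by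
        rw [InfiniteGalois.mem_bot_iff_fixed]
        intro τ
        have := congrArg (fun q => (q.coeff i).coeff l) (hfix τ)
        simpa using this
      rw [IntermediateField.mem_bot] at h1
      exact h1
    rw [mem_lifts] at this
    obtain ⟨q, hq⟩ := this
    exact ⟨q, hq⟩
  obtain ⟨G, hG, hGd, hGm⟩ := lifts_and_natDegree_eq_and_monic hl hg
  have hdv : G ∣ f := by
    rw [← Polynomial.map_dvd_map (mapRingHom (algebraMap K0 Om)) (Polynomial.map_injective _ (algebraMap K0 Om).injective) hGm, hG, hgh]
    exact dvd_mul_right _ _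
  obtain ⟨H, rfl⟩ := hdv
  exact ⟨G, H, hGm, hGm.of_mul_monic_left hf, by rw [hGd, hd], rfl⟩

lemma mv_nonzero_nat {E : Type} [Field E] [CharZero E] {n : ℕ} (r : MvPolynomial (Fin n) E) (hr : r ≠ 0) (M : ℕ) (hM : r.totalDegree ≤ M) :
    ∃ x : Fin n → ℕ, (∀ l, x l ≤ M) ∧ MvPolynomial.eval (fun l => (x l : E)) r ≠ 0 := by
  classical
  by_contra hcon
  push Not at hcon
  apply hr
  refine MvPolynomial.eq_zero_of_eval_zero_at_prod_finset r (fun _ => (Finset.range (M+1)).image (Nat.cast : ℕ → E)) ?_ ?_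
  · intro i
    rw [Finset.card_image_of_injective _ Nat.cast_injective, Finset.card_range]
    have := MvPolynomial.degreeOf_le_totalDegree r i
    omega
  · intro x hx
    have : ∀ l, ∃ a : ℕ, a ≤ M ∧ (a : E) = x l := fun l => by
      obtain ⟨a, ha, h⟩ := Finset.mem_image.1 (hx l)
      exact ⟨a, by simpa [Nat.lt_succ_iff] using ha, h⟩
    choose a ha h using this
    have h2 : x = fun l => (a l : E) := by funext l; exact (h l).symm
    rw [h2]; exact hcon a ha

lemma sep_point {n : ℕ} {F : Polynomial (MvPolynomial (Fin n) ℤ)} (hF : F.Monic) (h : AbsIrred F) :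
    ∃ x0 : Fin n → ℕ, (F.map (evz (fun l => (x0 l : AlgebraicClosure ℚ)))).Separable := by
  set A := MvPolynomial (Fin n) (AlgebraicClosure ℚ) with hA
  set F0 : A[X] := F.map (MvPolynomial.map (Int.castRingHom (AlgebraicClosure ℚ))) with hF0
  have hm : F0.Monic := hF.map _
  have hirr : Irreducible (F0.map (algebraMap A (FractionRing A))) := (hm.irreducible_iff_irreducible_map_fraction_map).1 h
  haveI : CharZero (FractionRing A) := charZero_of_injective_algebraMap (IsFractionRing.injective A (FractionRing A))
  have hsep := hirr.separable
  have hres : resultant F0 (derivative F0) ≠ 0 := by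
    intro h0
    have h1 := resultant_ne_zero _ _ hsep
    rw [derivative_map] at h1
    have hd1 : (F0.map (algebraMap A (FractionRing A))).natDegree = F0.natDegree := hm.natDegree_map _
    have hd2 : ((derivative F0).map (algebraMap A (FractionRing A))).natDegree = (derivative F0).natDegree :=
      natDegree_map_eq_of_injective (IsFractionRing.injective A (FractionRing A)) _
    rw [hd1, hd2, resultant_map_map, h0, map_zero] at h1
    exact h1 rfl
  obtain ⟨x0, -, hx0⟩ := mv_nonzero_nat _ hres _ le_rfl
  refine ⟨x0, ?_⟩
  have hpos : F0.natDegree ≠ 0 := by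
    intro h0
    exact h.not_isUnit (by have := hm.natDegree_eq_zero.1 h0; rw [hF0] at this; rw [this]; exact isUnit_one)
  obtain ⟨a, b, -, -, hab⟩ := exists_mul_add_mul_eq_C_resultant F0 (derivative F0) le_rfl le_rfl (Or.inl hpos)
  have hmap : F.map (evz (fun l => (x0 l : AlgebraicClosure ℚ))) = F0.map (MvPolynomial.eval (fun l => (x0 l : AlgebraicClosure ℚ))) := by
    rw [hF0, Polynomial.map_map]
    congr 1
    exact mvhom_ext fun l => by simp
  rw [hmap, Separable, derivative_map]
  have h2 := congrArg (Polynomial.map (MvPolynomial.eval (fun l => (x0 l : AlgebraicClosure ℚ)))) hab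
  rw [Polynomial.map_add, Polynomial.map_mul, Polynomial.map_mul, map_C] at h2
  set r := MvPolynomial.eval (fun l => (x0 l : AlgebraicClosure ℚ)) (resultant F0 (derivative F0)) with hr
  refine ⟨C r⁻¹ * a.map (MvPolynomial.eval (fun l => (x0 l : AlgebraicClosure ℚ))), C r⁻¹ * b.map (MvPolynomial.eval (fun l => (x0 l : AlgebraicClosure ℚ))), ?_⟩
  have : C r⁻¹ * C r = (1 : (AlgebraicClosure ℚ)[X]) := by rw [← C_mul, inv_mul_cancel₀ hx0, C_1]
  rw [← this, ← h2]
  ring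

lemma gen_fac {n : ℕ} {F : Polynomial (MvPolynomial (Fin n) ℤ)} (hF : F.Monic) (h : AbsIrred F) (K0 Om : Type) [Field K0] [Field Om]
    [Algebra (MvPolynomial (Fin n) (AlgebraicClosure ℚ)) K0] [IsFractionRing (MvPolynomial (Fin n) (AlgebraicClosure ℚ)) K0] [IsAlgClosed Om] [Algebra K0 Om] [IsGalois K0 Om] :
    ∃ x0 : Fin n → ℕ, ∀ d₁, 0 < d₁ → d₁ < F.natDegree →
     ¬ HasFac d₁ (LP F (fun l => (x0 l : Om))
      (fun l => algebraMap K0 Om (algebraMap (MvPolynomial (Fin n) (AlgebraicClosure ℚ)) K0 (MvPolynomial.X l)))) := by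
  obtain ⟨x0, hx0⟩ := sep_point hF h
  refine ⟨x0, fun d₁ hd1 hd2 hfac => ?_⟩
  have hLP : LP F (fun l => (x0 l : Om)) (fun l => algebraMap K0 Om (algebraMap (MvPolynomial (Fin n) (AlgebraicClosure ℚ)) K0 (MvPolynomial.X l)))
      = (LP F (fun l => (x0 l : K0)) (fun l => algebraMap (MvPolynomial (Fin n) (AlgebraicClosure ℚ)) K0 (MvPolynomial.X l))).map (mapRingHom (algebraMap K0 Om)) := by
    rw [LP_map]; simp
  rw [hLP] at hfac
  have hfac2 := gal_fac ((algebraMap (MvPolynomial (Fin n) (AlgebraicClosure ℚ)) K0).comp (MvPolynomial.C)) _ (LP_monic hF _ _) _ (hF.map _) (by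
    rw [LP_eval, Polynomial.map_map, evz_comp]; simp) hx0 d₁ hfac
  have hfac3 := hfac2.map (evalRingHom (1:K0))
  rw [LP_eval] at hfac3
  have hF1 : F.map (evz (fun l => (x0 l : K0) + 1 * algebraMap (MvPolynomial (Fin n) (AlgebraicClosure ℚ)) K0 (MvPolynomial.X l)))
      = (F.map (evz (fun l => (x0 l : MvPolynomial (Fin n) (AlgebraicClosure ℚ)) + MvPolynomial.X l))).map (algebraMap _ K0) := by
    rw [Polynomial.map_map, evz_comp]; simp
  rw [hF1] at hfac3
  have hm1 := hF.map (evz (fun l => (x0 l : MvPolynomial (Fin n) (AlgebraicClosure ℚ)) + MvPolynomial.X l))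
  have hdeg : ∀ {R : Type} [CommRing R] [Nontrivial R] (φ : MvPolynomial (Fin n) ℤ →+* R), (F.map φ).natDegree = F.natDegree := fun φ => hF.natDegree_map φ
  have hirr1 : Irreducible (F.map (evz (fun l => (x0 l : MvPolynomial (Fin n) (AlgebraicClosure ℚ)) + MvPolynomial.X l))) := by
    rw [irr_iff_fac hm1 (by rw [hdeg]; omega)]
    intro d2 h1 h2 h3
    rw [hdeg] at h2
    have h4 := h3.map (MvPolynomial.aeval (R := AlgebraicClosure ℚ) (fun l => MvPolynomial.X l - (x0 l : MvPolynomial (Fin n) (AlgebraicClosure ℚ)))).toRingHom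
    have h5 : ((F.map (evz (fun l => (x0 l : MvPolynomial (Fin n) (AlgebraicClosure ℚ)) + MvPolynomial.X l))).map
       (MvPolynomial.aeval (R := AlgebraicClosure ℚ) (fun l => MvPolynomial.X l - (x0 l : MvPolynomial (Fin n) (AlgebraicClosure ℚ)))).toRingHom)
       = F.map (MvPolynomial.map (Int.castRingHom (AlgebraicClosure ℚ))) := by
      rw [Polynomial.map_map]
      congr 1
      exact mvhom_ext fun l => by simp
    rw [h5] at h4
    exact (irr_iff_fac (hF.map _) (by rw [hdeg]; omega)).1 h d2 h1 (by rw [hdeg]; exact h2) h4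
  have hirr2 := (hm1.irreducible_iff_irreducible_map_fraction_map (K := K0)).1 hirr1
  exact (irr_iff_fac (hm1.map _) (by rw [hm1.natDegree_map, hdeg]; omega)).1 hirr2 d₁ hd1 (by rw [hm1.natDegree_map, hdeg]; omega) hfac3

lemma bert (n D : ℕ) : ∃ E : ℕ, ∀ F : Polynomial (MvPolynomial (Fin n) ℤ), F.Monic → AbsIrred F → totalDeg F = D →
    ∃ w : Fin n → ℕ, (∀ l, w l ≤ E) ∧ ∀ d₁, 0 < d₁ → d₁ < F.natDegree → ¬ Bad F d₁ (fun l => (w l : ℤ)) := by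
  classical
  refine ⟨∑ δ ∈ Finset.range (D+1), ∑ d₁ ∈ Finset.range δ, ∑ Φ ∈ NS δ D d₁, Φ.totalDegree * D, fun F hF h hD => ?_⟩
  have hA : ∃ x0 : Fin n → ℕ, ∀ d₁, ∃ Φ : MvPolynomial (Fin F.natDegree × Fin (D+1)) ℤ, 0 < d₁ → d₁ < F.natDegree → Φ ∈ NS F.natDegree D d₁ ∧
      Nk F F.natDegree D Φ (fun l => MvPolynomial.C ((x0 l : ℚ))) (fun l => (MvPolynomial.X l : MvPolynomial (Fin n) ℚ)) ≠ 0 := by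
    have := gen_fac hF h (FractionRing (MvPolynomial (Fin n) (AlgebraicClosure ℚ))) (AlgebraicClosure (FractionRing (MvPolynomial (Fin n) (AlgebraicClosure ℚ))))
    obtain ⟨x0, hx0⟩ := this
    refine ⟨x0, fun d₁ => ?_⟩
    by_cases hd1 : 0 < d₁ ∧ d₁ < F.natDegree
    swap
    · exact ⟨0, fun h1 h2 => (hd1 ⟨h1, h2⟩).elim⟩
    have h2 := hx0 d₁ hd1.1 hd1.2
    rw [LP_fac_iff hF] at h2
    push Not at h2
    obtain ⟨Φ, hΦ, hne⟩ := h2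
    subst hD
    refine ⟨Φ, fun _ _ => ⟨hΦ, fun h0 => hne ?_⟩⟩
    have h3 := Nk_map (((algebraMap (FractionRing (MvPolynomial (Fin n) (AlgebraicClosure ℚ))) (AlgebraicClosure (FractionRing (MvPolynomial (Fin n) (AlgebraicClosure ℚ))))).comp
      (algebraMap (MvPolynomial (Fin n) (AlgebraicClosure ℚ)) _)).comp (MvPolynomial.map (algebraMap ℚ (AlgebraicClosure ℚ)))) F F.natDegree (totalDeg F) Φ (fun l => MvPolynomial.C ((x0 l : ℚ))) (fun l => (MvPolynomial.X l : MvPolynomial (Fin n) ℚ))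
    rw [h0, map_zero] at h3
    rw [h3]
    simp
  obtain ⟨x0, hx0⟩ := hA
  choose Φ hΦ using hx0
  obtain ⟨w, hw, hne⟩ := mv_nonzero_nat (∏ d₁ ∈ (Finset.range F.natDegree).filter (0 < ·), Nk F F.natDegree D (Φ d₁) (fun l => MvPolynomial.C ((x0 l : ℚ))) (fun l => (MvPolynomial.X l : MvPolynomial (Fin n) ℚ)))
    (by
      rw [Finset.prod_ne_zero_iff]
      intro d₁ hd
      rw [Finset.mem_filter, Finset.mem_range] at hd
      exact (hΦ d₁ hd.2 hd.1).2) (∑ δ ∈ Finset.range (D+1), ∑ d₁ ∈ Finset.range δ, ∑ Φ ∈ NS δ D d₁, Φ.totalDegree * D) (by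
      refine (MvPolynomial.totalDegree_finsetProd _ _).trans ?_
      refine le_trans ?_ (Finset.single_le_sum (f := fun δ => ∑ d₁ ∈ Finset.range δ, ∑ Φ ∈ NS δ D d₁, Φ.totalDegree * D) (fun _ _ => Nat.zero_le _) (a := F.natDegree)
        (Finset.mem_range.2 (by have := natDegree_le_tdeg F; omega)))
      refine le_trans (Finset.sum_le_sum (g := fun d₁ => ∑ Φ ∈ NS F.natDegree D d₁, Φ.totalDegree * D) fun d₁ hd => ?_) (Finset.sum_le_sum_of_subset (Finset.filter_subset _ _))
      rw [Finset.mem_filter, Finset.mem_range] at hd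
      have h1 := Nk_tdeg F F.natDegree D (Φ d₁) (fun l => MvPolynomial.C ((x0 l : ℚ))) (fun l => (MvPolynomial.X l : MvPolynomial (Fin n) ℚ)) (fun l => by rw [MvPolynomial.totalDegree_C]; omega) (fun l => by simp [MvPolynomial.totalDegree_X])
      rw [hD] at h1
      exact h1.trans (Finset.single_le_sum (f := fun Φ : MvPolynomial (Fin F.natDegree × Fin (D+1)) ℤ => Φ.totalDegree * D) (fun _ _ => Nat.zero_le _) (hΦ d₁ hd.2 hd.1).1))
  refine ⟨w, hw, fun d₁ h1 h2 hbad => ?_⟩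
  rw [map_prod, Finset.prod_ne_zero_iff] at hne
  have h3 := hne d₁ (by rw [Finset.mem_filter, Finset.mem_range]; exact ⟨h2, h1⟩)
  apply h3
  subst hD
  rw [Nk_map]
  have h4 := NkG_ev F F.natDegree (totalDeg F) (Φ d₁) (fun l => (w l : ℤ)) (fun l => (x0 l : ℚ))
  rw [hbad _ (hΦ d₁ h1 h2).1, map_zero] at h4
  rw [h4]
  simp

end St

namespace St
open NC

/-- coefficientwise domination -/
def Dom (p : ℤ[X]) (P : ℕ[X]) : Prop := ∀ j, (p.coeff j).natAbs ≤ P.coeff j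

lemma Dom.add {p q : ℤ[X]} {P Q : ℕ[X]} (h1 : Dom p P) (h2 : Dom q Q) : Dom (p + q) (P + Q) := fun j => by
  rw [coeff_add, coeff_add]
  exact (Int.natAbs_add_le _ _).trans (Nat.add_le_add (h1 j) (h2 j))

lemma natAbs_sum_le {ι : Type*} (s : Finset ι) (f : ι → ℤ) : (∑ i ∈ s, f i).natAbs ≤ ∑ i ∈ s, (f i).natAbs := by
  classical
  induction s using Finset.induction_on with
  | empty => simp
  | insert a s ha ih => rw [Finset.sum_insert ha, Finset.sum_insert ha]; exact (Int.natAbs_add_le _ _).trans (by omega)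

lemma Dom.mul {p q : ℤ[X]} {P Q : ℕ[X]} (h1 : Dom p P) (h2 : Dom q Q) : Dom (p * q) (P * Q) := fun j => by
  rw [coeff_mul, coeff_mul]
  refine (natAbs_sum_le _ _).trans (Finset.sum_le_sum fun y _ => ?_)
  rw [Int.natAbs_mul]
  exact Nat.mul_le_mul (h1 _) (h2 _)

lemma Dom.C (a : ℤ) (A : ℕ) (h : a.natAbs ≤ A) : Dom (Polynomial.C a) (Polynomial.C A) := fun j => by
  rw [coeff_C, coeff_C]
  split_ifs
  · exact h
  · simp

lemma Dom.X : Dom Polynomial.X Polynomial.X := fun j => by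
  rw [coeff_X, coeff_X]
  split_ifs <;> simp

lemma Dom.sum {ι : Type*} (s : Finset ι) (p : ι → ℤ[X]) (P : ι → ℕ[X]) (h : ∀ i ∈ s, Dom (p i) (P i)) : Dom (∑ i ∈ s, p i) (∑ i ∈ s, P i) := by
  classical
  induction s using Finset.induction_on with
  | empty => intro j; simp
  | insert a s ha ih =>
    rw [Finset.sum_insert ha, Finset.sum_insert ha]
    exact (h a (Finset.mem_insert_self _ _)).add (ih fun i hi => h i (Finset.mem_insert_of_mem hi))

lemma Dom.prod {ι : Type*} (s : Finset ι) (p : ι → ℤ[X]) (P : ι → ℕ[X]) (h : ∀ i ∈ s, Dom (p i) (P i)) : Dom (∏ i ∈ s, p i) (∏ i ∈ s, P i) := by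
  classical
  induction s using Finset.induction_on with
  | empty => simpa using Dom.C 1 1 le_rfl
  | insert a s ha ih =>
    rw [Finset.prod_insert ha, Finset.prod_insert ha]
    exact (h a (Finset.mem_insert_self _ _)).mul (ih fun i hi => h i (Finset.mem_insert_of_mem hi))

lemma Dom.pow {p : ℤ[X]} {P : ℕ[X]} (h : Dom p P) (k : ℕ) : Dom (p ^ k) (P ^ k) := by
  have := Dom.prod (Finset.range k) (fun _ => p) (fun _ => P) (fun _ _ => h)
  simpa using this

lemma coeff_le_eval_one (P : ℕ[X]) (j : ℕ) : P.coeff j ≤ P.eval 1 := by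
  rw [eval_eq_sum, Polynomial.sum]
  by_cases h : j ∈ P.support
  · simpa using Finset.single_le_sum (f := fun i => P.coeff i * 1 ^ i) (fun _ _ => Nat.zero_le _) h
  · rw [notMem_support_iff.1 h]; exact Nat.zero_le _

lemma card_support_le {n D : ℕ} (q : MvPolynomial (Fin n) ℤ) (hq : q.totalDegree ≤ D) : q.support.card ≤ (D+1)^n := by
  classical
  have h1 : q.support.card ≤ (Fintype.piFinset fun _ : Fin n => Finset.range (D+1)).card := by
    refine Finset.card_le_card_of_injOn (fun m => (m : Fin n → ℕ)) (fun m hm => ?_) (fun a _ b _ h => DFunLike.coe_injective h)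
    rw [Finset.mem_coe, Fintype.mem_piFinset]
    intro l
    rw [Finset.mem_range]
    have h2 := MvPolynomial.le_totalDegree hm
    rw [Finsupp.sum_fintype _ _ (fun _ => rfl)] at h2
    have h3 : m l ≤ ∑ i, m i := Finset.single_le_sum (f := fun i => m i) (fun _ _ => Nat.zero_le _) (Finset.mem_univ l)
    dsimp only
    omega
  simpa using h1

lemma ln_bound {n D H M : ℕ} (q : MvPolynomial (Fin n) ℤ) (hq : q.totalDegree ≤ D) (hH : ∀ m, (q.coeff m).natAbs ≤ H) (hM : 1 ≤ M) (x k : Fin n → ℤ)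
    (hx : ∀ l, |x l| ≤ M) (hk : ∀ l, |k l| ≤ M) (j : ℕ) : |(lnHom x k q).coeff j| ≤ ((D+1)^n * H * (2*M)^D : ℕ) := by
  have hdom : Dom (lnHom x k q) (∑ m ∈ q.support, Polynomial.C H * ∏ l, (Polynomial.C M + Polynomial.C M * X) ^ (m l)) := by
    rw [lnHom, MvPolynomial.coe_eval₂Hom, MvPolynomial.eval₂_eq']
    refine Dom.sum _ _ _ fun m hm => Dom.mul ?_ (Dom.prod _ _ _ fun l _ => Dom.pow (Dom.add (Dom.C _ _ ?_) (Dom.mul (Dom.C _ _ ?_) Dom.X)) _)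
    · have : (Int.castRingHom ℤ[X]) (q.coeff m) = Polynomial.C (q.coeff m) := by simp
      rw [this]; exact Dom.C _ _ (hH m)
    · have := hx l; rw [Int.abs_eq_natAbs] at this; exact_mod_cast this
    · have := hk l; rw [Int.abs_eq_natAbs] at this; exact_mod_cast this
  have h2 := (hdom j).trans (coeff_le_eval_one _ j)
  have h3 : (∑ m ∈ q.support, Polynomial.C H * ∏ l, (Polynomial.C M + Polynomial.C M * X) ^ (m l)).eval 1 ≤ (D+1)^n * H * (2*M)^D := by
    rw [eval_finsetSum]
    calc _ ≤ ∑ m ∈ q.support, H * (2*M)^D := by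
          refine Finset.sum_le_sum fun m hm => ?_
          rw [eval_mul, eval_C, eval_prod]
          refine Nat.mul_le_mul le_rfl ?_
          have h4 := MvPolynomial.le_totalDegree hm
          rw [Finsupp.sum_fintype _ _ (fun _ => rfl)] at h4
          calc _ = ∏ l, (2*M)^(m l) := by
                refine Finset.prod_congr rfl fun l _ => ?_
                simp [two_mul]
            _ = (2*M)^(∑ l, m l) := by rw [Finset.prod_pow_eq_pow_sum]
            _ ≤ _ := Nat.pow_le_pow_right (by omega) (h4.trans hq)
      _ = q.support.card * (H * (2*M)^D) := by rw [Finset.sum_const, smul_eq_mul]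
      _ ≤ _ := by rw [mul_assoc]; exact Nat.mul_le_mul (card_support_le q hq) le_rfl
  rw [Int.abs_eq_natAbs]
  exact_mod_cast h2.trans h3

lemma coeff_norm {n : ℕ} (F : Polynomial (MvPolynomial (Fin n) ℤ)) (i : ℕ) (m) : ((F.coeff i).coeff m).natAbs ≤ polyNorm F := by
  by_cases h : m ∈ (F.coeff i).support
  · have hi : i ∈ F.support := by
      rw [mem_support_iff]; intro h0; rw [h0] at h; simp at h
    exact (Finset.le_sup (f := fun m => ((F.coeff i).coeff m).natAbs) h).trans (Finset.le_sup (f := fun k => mvNorm (F.coeff k)) hi)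
  · rw [MvPolynomial.notMem_support_iff.1 h]; simp

lemma val_bound {n D M : ℕ} (F : Polynomial (MvPolynomial (Fin n) ℤ)) (hD : totalDeg F = D) (hM : 1 ≤ M) (x : Fin n → ℤ) (hx : ∀ l, |x l| ≤ M) (i : ℕ) :
    |evz x (F.coeff i)| ≤ ((D+1)^n * polyNorm F * (2*M)^D : ℕ) := by
  have h1 := ln_bound (F.coeff i) (hD ▸ coeff_tdeg F i) (coeff_norm F i) hM x 0 hx (fun l => by simp) 0
  have h2 : (lnHom x 0 (F.coeff i)).coeff 0 = evz x (F.coeff i) := by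
    rw [coeff_zero_eq_eval_zero]
    have : (evalRingHom (0:ℤ)).comp (lnHom x 0) = evz x := mvhom_ext fun l => by simp
    rw [← this]; rfl
  rwa [h2] at h1

lemma Nk_bound (n D : ℕ) : ∃ K a : ℕ, ∀ F : Polynomial (MvPolynomial (Fin n) ℤ), totalDeg F = D → ∀ d₁ < F.natDegree, ∀ Φ ∈ NS F.natDegree D d₁, ∀ M : ℕ, 1 ≤ M → polyNorm F ≤ M →
    ∀ x k : Fin n → ℤ, (∀ l, |x l| ≤ M) → (∀ l, |k l| ≤ M) → |Nk F F.natDegree D Φ x k| ≤ (K * M ^ a : ℕ) := by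
  choose K a h using fun q : ℕ × ℕ => mv_bound_finset (NS q.1 D q.2)
  have hsup : ∀ (f : ℕ × ℕ → ℕ) (δ d₁ : ℕ), d₁ < δ → δ ≤ D → f (δ, d₁) ≤ ((Finset.range (D+1)) ×ˢ (Finset.range (D+1))).sup f := by
    intro f δ d₁ h1 h2
    exact Finset.le_sup (f := f) (Finset.mem_product.2 ⟨Finset.mem_range.2 (by dsimp only; omega), Finset.mem_range.2 (by dsimp only; omega)⟩)
  set K' := ((Finset.range (D+1)) ×ˢ (Finset.range (D+1))).sup K
  set a' := ((Finset.range (D+1)) ×ˢ (Finset.range (D+1))).sup a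
  refine ⟨K' * ((D+1)^n * 2^D)^a', (D+1)*a', fun F hD d₁ hd Φ hΦ M hM hFM x k hx hk => ?_⟩
  have hδ : F.natDegree ≤ D := by have := natDegree_le_tdeg F; omega
  set T := (D+1)^n * 2^D with hT
  have hT1 : 1 ≤ T := Nat.one_le_iff_ne_zero.2 (by positivity)
  have h1 := h (F.natDegree, d₁) Φ hΦ (T * M^(D+1)) (Nat.one_le_iff_ne_zero.2 (by positivity)) (cf F.natDegree D (LP F x k)) (fun q => by
    rw [cf, LP, coeff_map]
    refine (ln_bound _ (hD ▸ coeff_tdeg F _) (coeff_norm F _) hM x k hx hk _).trans ?_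
    norm_cast
    calc (D+1)^n * polyNorm F * (2*M)^D ≤ (D+1)^n * M * (2*M)^D := by gcongr
      _ = T * M^(D+1) := by rw [hT]; ring)
  have h2 : MvPolynomial.eval (cf F.natDegree D (LP F x k)) Φ = Nk F F.natDegree D Φ x k := by
    rw [Nk, MvPolynomial.aeval_eq_eval]
  rw [h2] at h1
  refine h1.trans ?_
  norm_cast
  calc K (F.natDegree, d₁) * (T * M^(D+1))^(a (F.natDegree, d₁)) ≤ K' * (T * M^(D+1))^a' := by
        refine Nat.mul_le_mul (hsup K _ _ hd hδ) (Nat.pow_le_pow_right (Nat.one_le_iff_ne_zero.2 (by positivity)) (hsup a _ _ hd hδ))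
    _ = _ := by rw [mul_pow, ← pow_mul]; ring

lemma sz {R : Type} [CommRing R] [IsDomain R] [DecidableEq R] {n : ℕ} (P : MvPolynomial (Fin n) R) (hP : P ≠ 0) (S : Finset R) :
    ((Fintype.piFinset fun _ : Fin n => S).filter fun x => MvPolynomial.eval x P = 0).card * S.card ≤ P.totalDegree * S.card ^ n := by
  rcases Finset.eq_empty_or_nonempty S with rfl | hS
  · simp
  have h1 := MvPolynomial.schwartz_zippel_totalDegree hP S
  have hc : (0 : ℚ≥0) < S.card := by exact_mod_cast hS.card_pos
  rw [div_le_div_iff₀ (by positivity) hc] at h1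
  exact_mod_cast h1

end St

namespace St
open NC

/-- number of roots mod `p` minus one -/
def gF (p : ℕ) [NeZero p] {n : ℕ} (F : Polynomial (MvPolynomial (Fin n) ℤ)) (x : Fin n → ZMod p) : ℝ :=
  ((Finset.univ.filter fun y : ZMod p => (F.map (evz x)).eval y = 0).card : ℝ) - 1

lemma gF_abs (p : ℕ) [Fact p.Prime] {n D : ℕ} (F : Polynomial (MvPolynomial (Fin n) ℤ)) (hF : F.Monic) (hD : totalDeg F = D) (hD1 : 1 ≤ D) (x : Fin n → ZMod p) : |gF p F x| ≤ D := by
  have h1 : (Finset.univ.filter fun y : ZMod p => (F.map (evz x)).eval y = 0).card ≤ D := by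
    have h2 : (Finset.univ.filter fun y : ZMod p => (F.map (evz x)).eval y = 0) ⊆ (F.map (evz x)).roots.toFinset := by
      intro y hy
      rw [Multiset.mem_toFinset, mem_roots (hF.map _).ne_zero]
      exact (Finset.mem_filter.1 hy).2
    refine (Finset.card_le_card h2).trans ((Multiset.toFinset_card_le _).trans ((card_roots' _).trans ?_))
    rw [hF.natDegree_map, ← hD]; exact natDegree_le_tdeg F
  have h3 : ((Finset.univ.filter fun y : ZMod p => (F.map (evz x)).eval y = 0).card : ℝ) ≤ D := by exact_mod_cast h1
  have h4 : (1:ℝ) ≤ D := by exact_mod_cast hD1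
  rw [gF, abs_le]
  constructor <;> linarith [(Nat.cast_nonneg (Finset.univ.filter fun y : ZMod p => (F.map (evz x)).eval y = 0).card : (0:ℝ) ≤ _)]

lemma Tl_triv (p : ℕ) [Fact p.Prime] {n D : ℕ} (F : Polynomial (MvPolynomial (Fin n) ℤ)) (hF : F.Monic) (hD : totalDeg F = D) (hD1 : 1 ≤ D) (k x : Fin n → ZMod p) :
    Tl p (gF p F) k x ^ 2 ≤ (D:ℝ)^2 * (p:ℝ)^2 := by
  have h1 : |Tl p (gF p F) k x| ≤ D * p := by
    rw [Tl]
    refine (Finset.abs_sum_le_sum_abs _ _).trans ((Finset.sum_le_sum fun t _ => gF_abs p F hF hD hD1 _).trans ?_)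
    rw [Finset.sum_const, Finset.card_univ, ZMod.card, nsmul_eq_mul, mul_comm]
  rw [← sq_abs, ← mul_pow]
  exact pow_le_pow_left₀ (abs_nonneg _) h1 2

lemma line_triv (p : ℕ) [Fact p.Prime] {n D : ℕ} (F : Polynomial (MvPolynomial (Fin n) ℤ)) (hF : F.Monic) (hD : totalDeg F = D) (hD1 : 1 ≤ D) (k : Fin n → ZMod p) :
    ∑ x, Tl p (gF p F) k x ^ 2 ≤ (D:ℝ)^2 * (p:ℝ)^(n+2) := by
  refine (Finset.sum_le_sum fun x _ => Tl_triv p F hF hD hD1 k x).trans ?_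
  rw [Finset.sum_const, Finset.card_univ, nsmul_eq_mul]
  simp only [Fintype.card_pi, ZMod.card, Finset.prod_const, Finset.card_univ, Fintype.card_fin]
  push_cast
  apply le_of_eq; ring

lemma Tl_eq (p : ℕ) [Fact p.Prime] {n : ℕ} (F : Polynomial (MvPolynomial (Fin n) ℤ)) (k x : Fin n → ZMod p) :
    Tl p (gF p F) k x = (Np p (LP F x k) : ℝ) - p := by
  classical
  have h1 : Np p (LP F x k) = ∑ t : ZMod p, (Finset.univ.filter fun y : ZMod p => (F.map (evz (x + t • k))).eval y = 0).card := by
    rw [Np, Finset.card_filter, Fintype.sum_prod_type]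
    refine Finset.sum_congr rfl fun t _ => ?_
    rw [Finset.card_filter]
    refine Finset.sum_congr rfl fun y _ => ?_
    have : evalEval t y (LP F x k) = (F.map (evz (x + t • k))).eval y := by
      rw [← map_evalRingHom_eval, LP_eval]; rfl
    rw [this]
  rw [h1, Tl]
  simp only [gF]
  rw [Finset.sum_sub_distrib]
  simp

/-- `p` is good for the direction `k` -/
def GoodAt (p : ℕ) {n : ℕ} (F : Polynomial (MvPolynomial (Fin n) ℤ)) (k : Fin n → ℤ) : Prop :=
  ∀ d₁, 0 < d₁ → d₁ < F.natDegree → ∃ Φ ∈ NS F.natDegree (totalDeg F) d₁, (NkG F _ _ Φ k).map (Int.castRingHom (ZMod p)) ≠ 0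

lemma line_irr {p : ℕ} {K : Type} [Field K] [IsAlgClosed K] [CharP K p] {n : ℕ} {F : Polynomial (MvPolynomial (Fin n) ℤ)} (hF : F.Monic) (hd : 1 ≤ F.natDegree)
    (k : Fin n → ℤ) (x : Fin n → K) (h : ∀ d₁, 0 < d₁ → d₁ < F.natDegree → ∃ Φ ∈ NS F.natDegree (totalDeg F) d₁, evz x (NkG F _ _ Φ k) ≠ 0) :
    Irreducible (LP F x (fun l => (k l : K))) := by
  rw [irr_iff_fac (LP_monic hF _ _) (by rw [LP_natDegree hF]; exact hd)]
  intro d₁ h1 h2 hfac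
  rw [LP_natDegree hF] at h2
  obtain ⟨Φ, hΦ, hne⟩ := h d₁ h1 h2
  rw [NkG_ev] at hne
  exact hne ((LP_fac_iff hF d₁ _ _).1 hfac Φ hΦ)

/-- sum of the Noether degrees -/
def EN (D : ℕ) : ℕ := ∑ δ ∈ Finset.range (D+1), ∑ d₁ ∈ Finset.range δ, ∑ Φ ∈ NS δ D d₁, Φ.totalDegree * D

lemma EN_bound {n D : ℕ} {S : Type} [CommRing S] (F : Polynomial (MvPolynomial (Fin n) ℤ)) (hD : totalDeg F = D)
    (Φ : ℕ → MvPolynomial (Fin F.natDegree × Fin (totalDeg F + 1)) ℤ) (hΦ : ∀ d₁, 0 < d₁ → d₁ < F.natDegree → Φ d₁ ∈ NS F.natDegree (totalDeg F) d₁) (P : ℕ → MvPolynomial (Fin n) S)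
    (hP : ∀ d₁, 0 < d₁ → d₁ < F.natDegree → (P d₁).totalDegree ≤ (Φ d₁).totalDegree * totalDeg F) :
    (∏ d₁ ∈ (Finset.range F.natDegree).filter (0 < ·), P d₁).totalDegree ≤ EN D := by
  subst hD
  refine (MvPolynomial.totalDegree_finsetProd _ _).trans ?_
  refine le_trans ?_ (Finset.single_le_sum (f := fun δ => ∑ d₁ ∈ Finset.range δ, ∑ Φ ∈ NS δ (totalDeg F) d₁, Φ.totalDegree * totalDeg F) (fun _ _ => Nat.zero_le _) (a := F.natDegree)
    (Finset.mem_range.2 (by have := natDegree_le_tdeg F; omega)))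
  refine le_trans (Finset.sum_le_sum (g := fun d₁ => ∑ Φ ∈ NS F.natDegree (totalDeg F) d₁, Φ.totalDegree * totalDeg F) fun d₁ hd => ?_) (Finset.sum_le_sum_of_subset (Finset.filter_subset _ _))
  rw [Finset.mem_filter, Finset.mem_range] at hd
  exact (hP d₁ hd.2 hd.1).trans (Finset.single_le_sum (f := fun Φ : MvPolynomial (Fin F.natDegree × Fin (totalDeg F+1)) ℤ => Φ.totalDegree * totalDeg F) (fun _ _ => Nat.zero_le _) (hΦ d₁ hd.2 hd.1))

lemma tdeg_map_le {n : ℕ} {R S : Type} [CommRing R] [CommRing S] (φ : R →+* S) (P : MvPolynomial (Fin n) R) : (P.map φ).totalDegree ≤ P.totalDegree :=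
  Finset.sup_mono (MvPolynomial.support_map_subset _ _)

lemma weilD (D : ℕ) : ∃ C : ℕ, ∀ (p : ℕ) [Fact p.Prime] (n : ℕ) (F : Polynomial (MvPolynomial (Fin n) ℤ)), F.Monic → 2 ≤ F.natDegree → totalDeg F = D → ∀ (k : Fin n → ℤ) (x : Fin n → ZMod p),
    (∀ d₁, 0 < d₁ → d₁ < F.natDegree → ∃ Φ ∈ NS F.natDegree (totalDeg F) d₁, evz x (NkG F _ _ Φ k) ≠ 0) →
    Tl p (gF p F) (fun l => (k l : ZMod p)) x ^ 2 ≤ (C:ℝ)^2 * p := by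
  have hw : ∀ δ : ℕ, ∃ C : ℕ, 2 ≤ δ → _ := fun δ => by
    by_cases h : 2 ≤ δ
    · obtain ⟨C, hC⟩ := weil δ D h
      exact ⟨C, fun _ => hC⟩
    · exact ⟨0, fun h' => (h h').elim⟩
  choose C hC using hw
  refine ⟨(Finset.range (D+1)).sup C, fun p _ n F hF hd hD k x h => ?_⟩
  have hirr := line_irr (p := p) (K := AlgebraicClosure (ZMod p)) hF (by omega) k (fun l => algebraMap (ZMod p) _ (x l)) (fun d₁ h1 h2 => by
    obtain ⟨Φ, hΦ, hne⟩ := h d₁ h1 h2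
    refine ⟨Φ, hΦ, fun h0 => hne ?_⟩
    have := congrArg (fun f => f (NkG F F.natDegree (totalDeg F) Φ k)) (evz_comp (algebraMap (ZMod p) (AlgebraicClosure (ZMod p))) x)
    simp only [RingHom.comp_apply] at this
    rw [h0] at this
    exact (map_eq_zero _).1 this)
  have hmap : (LP F x (fun l => (k l : ZMod p))).map (mapRingHom (algebraMap (ZMod p) (AlgebraicClosure (ZMod p)))) = LP F (fun l => algebraMap (ZMod p) (AlgebraicClosure (ZMod p)) (x l)) (fun l => (k l : AlgebraicClosure (ZMod p))) := by
    rw [LP_map]; simp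
  obtain ⟨h1, h2⟩ := hC F.natDegree hd p (AlgebraicClosure (ZMod p)) (algebraMap _ _) (LP F x (fun l => (k l : ZMod p))) (LP_monic hF _ _) (LP_natDegree hF _ _) (fun i => hD ▸ LP_tdeg F _ _ i) (by rw [hmap]; exact hirr)
  have hle : C F.natDegree ≤ (Finset.range (D+1)).sup C := Finset.le_sup (f := C) (Finset.mem_range.2 (by have := natDegree_le_tdeg F; omega))
  set C0 := (Finset.range (D+1)).sup C
  have h3 : C F.natDegree * p.sqrt ≤ C0 * p.sqrt := Nat.mul_le_mul hle le_rfl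
  have h4 : |Tl p (gF p F) (fun l => (k l : ZMod p)) x| ≤ C0 * p.sqrt := by
    rw [Tl_eq, abs_le]
    have h1' : (p:ℝ) ≤ Np p (LP F x (fun l => (k l : ZMod p))) + C0 * p.sqrt := by exact_mod_cast h1.trans (by omega)
    have h2' : (Np p (LP F x (fun l => (k l : ZMod p))) : ℝ) ≤ p + C0 * p.sqrt := by exact_mod_cast h2.trans (by omega)
    constructor <;> linarith
  rw [← sq_abs]
  refine (pow_le_pow_left₀ (abs_nonneg _) h4 2).trans ?_
  rw [mul_pow]
  refine mul_le_mul_of_nonneg_left ?_ (by positivity)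
  exact_mod_cast Nat.sqrt_le' p

lemma line_good (n D : ℕ) : ∃ C : ℕ, ∀ (p : ℕ) [Fact p.Prime] (F : Polynomial (MvPolynomial (Fin n) ℤ)), F.Monic → 2 ≤ F.natDegree → totalDeg F = D → ∀ (k : Fin n → ℤ), GoodAt p F k →
    ∑ x, Tl p (gF p F) (fun l => (k l : ZMod p)) x ^ 2 ≤ (C:ℝ) * (p:ℝ)^(n+1) := by
  classical
  obtain ⟨C, hC⟩ := weilD D
  refine ⟨C^2 + EN D * D^2, fun p _ F hF hd hD k hk => ?_⟩
  have hD1 : 1 ≤ D := by have := natDegree_le_tdeg F; omega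
  have hp : (0:ℝ) < p := by exact_mod_cast (Fact.out : p.Prime).pos
  have hk' : ∀ d₁, ∃ Φ, 0 < d₁ → d₁ < F.natDegree → Φ ∈ NS F.natDegree (totalDeg F) d₁ ∧ (NkG F _ _ Φ k).map (Int.castRingHom (ZMod p)) ≠ 0 := fun d₁ => by
    by_cases h : 0 < d₁ ∧ d₁ < F.natDegree
    · obtain ⟨Φ, h1, h2⟩ := hk d₁ h.1 h.2
      exact ⟨Φ, fun _ _ => ⟨h1, h2⟩⟩
    · exact ⟨0, fun h1 h2 => (h ⟨h1, h2⟩).elim⟩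
  choose Φ hΦ using hk'
  set P : MvPolynomial (Fin n) (ZMod p) := ∏ d₁ ∈ (Finset.range F.natDegree).filter (0 < ·), (NkG F _ _ (Φ d₁) k).map (Int.castRingHom (ZMod p)) with hPdef
  have hP0 : P ≠ 0 := by
    rw [hPdef, Finset.prod_ne_zero_iff]
    intro d₁ hd
    rw [Finset.mem_filter, Finset.mem_range] at hd
    exact (hΦ d₁ hd.2 hd.1).2
  have hPd : P.totalDegree ≤ EN D := EN_bound F hD Φ (fun d₁ h1 h2 => (hΦ d₁ h1 h2).1) _ (fun d₁ h1 h2 => (tdeg_map_le _ _).trans (NkG_tdeg F _ _ _ k))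
  have hsz := sz P hP0 (Finset.univ : Finset (ZMod p))
  have huniv : (Fintype.piFinset fun _ : Fin n => (Finset.univ : Finset (ZMod p))) = Finset.univ := by ext; simp
  rw [huniv, Finset.card_univ, ZMod.card] at hsz
  set Z := (Finset.univ.filter fun x : Fin n → ZMod p => MvPolynomial.eval x P = 0) with hZ
  have hZc : (Z.card : ℝ) * p ≤ EN D * (p:ℝ)^n := by
    exact_mod_cast hsz.trans (Nat.mul_le_mul hPd le_rfl)
  have hb : ∀ x, Tl p (gF p F) (fun l => (k l : ZMod p)) x ^ 2 ≤ (C:ℝ)^2 * p + if x ∈ Z then (D:ℝ)^2 * (p:ℝ)^2 else 0 := by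
    intro x
    by_cases hx : x ∈ Z
    · rw [if_pos hx]
      have := Tl_triv p F hF hD hD1 (fun l => (k l : ZMod p)) x
      have h2 : 0 ≤ (C:ℝ)^2 * p := by positivity
      linarith
    · rw [if_neg hx, add_zero]
      refine hC p n F hF hd hD k x fun d₁ h1 h2 => ⟨Φ d₁, (hΦ d₁ h1 h2).1, fun h0 => hx ?_⟩
      rw [hZ, Finset.mem_filter]
      refine ⟨Finset.mem_univ _, ?_⟩
      rw [hPdef, map_prod, Finset.prod_eq_zero_iff]
      refine ⟨d₁, Finset.mem_filter.2 ⟨Finset.mem_range.2 h2, h1⟩, ?_⟩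
      rw [MvPolynomial.eval_map]
      exact h0
  refine (Finset.sum_le_sum fun x _ => hb x).trans ?_
  rw [Finset.sum_add_distrib, Finset.sum_ite_mem, Finset.univ_inter, Finset.sum_const, Finset.sum_const, Finset.card_univ, nsmul_eq_mul, nsmul_eq_mul]
  simp only [Fintype.card_pi, ZMod.card, Finset.prod_const, Finset.card_univ, Fintype.card_fin]
  push_cast
  have h5 : (Z.card:ℝ) * ((D:ℝ)^2 * (p:ℝ)^2) ≤ EN D * (p:ℝ)^n * ((D:ℝ)^2 * p) := by
    calc (Z.card:ℝ) * ((D:ℝ)^2 * (p:ℝ)^2) = (Z.card:ℝ) * p * ((D:ℝ)^2 * p) := by ring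
      _ ≤ _ := mul_le_mul_of_nonneg_right hZc (by positivity)
  calc _ ≤ (p:ℝ)^n * ((C:ℝ)^2 * p) + EN D * (p:ℝ)^n * ((D:ℝ)^2 * p) := by linarith
    _ = _ := by ring

end St

namespace St
open NC

lemma form_expand {n m : ℕ} {F : Polynomial (MvPolynomial (Fin n) ℤ)} (hm : 2 ≤ m) (hd : 2 ≤ F.natDegree) (h : HasForm n m F) :
    m ≤ F.natDegree ∧ F.coeff 0 ≠ 0 ∧ ∃ F', F = expand _ m F' := by
  obtain ⟨d, f, hd1, hfd, hF⟩ := h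
  have hex : F = expand _ m (X ^ d + ∑ j ∈ Finset.Icc 1 d, C (f j) * X ^ (d - j)) := by
    rw [hF]
    simp [pow_mul]
  refine ⟨?_, ?_, _, hex⟩
  · have h1 : F.natDegree = (X ^ d + ∑ j ∈ Finset.Icc 1 d, C (f j) * X ^ (d - j) : Polynomial (MvPolynomial (Fin n) ℤ)).natDegree * m := by
      conv_lhs => rw [hex]
      exact natDegree_expand _ _
    rw [h1] at hd ⊢
    exact Nat.le_mul_of_pos_left _ (Nat.pos_of_ne_zero fun h0 => by rw [h0] at hd; omega)
  · have : F.coeff 0 = f d := by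
      rw [coeff_zero_eq_eval_zero, hF, eval_add, eval_finsetSum, Finset.sum_eq_single d]
      · have : m * d ≠ 0 := Nat.mul_ne_zero (by omega) (by omega)
        simp [this]
      · intro j hj hne
        rw [Finset.mem_Icc] at hj
        have : m * (d - j) ≠ 0 := Nat.mul_ne_zero (by omega) (by omega)
        simp [this]
      · intro h; exact (h (Finset.mem_Icc.2 ⟨hd1, le_rfl⟩)).elim
    rw [this]; exact hfd

lemma exists_rootunity (p l : ℕ) [Fact p.Prime] (hl : l.Prime) (hpl : (p : ZMod l) = 1) : ∃ ζ : ZMod p, ζ ^ l = 1 ∧ ζ ≠ 1 := by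
  have hp : p.Prime := Fact.out
  haveI := Fact.mk hl
  have h1 : l ∣ Fintype.card (ZMod p)ˣ := by
    rw [ZMod.card_units_eq_totient, Nat.totient_prime hp]
    rw [← ZMod.natCast_eq_zero_iff]
    rw [Nat.cast_sub hp.one_le, hpl]; simp
  obtain ⟨u, hu⟩ := exists_prime_orderOf_dvd_card l h1
  refine ⟨u, ?_, ?_⟩
  · rw [← hu, ← Units.val_pow_eq_pow_val, pow_orderOf_eq_one, Units.val_one]
  · intro h
    have : u = 1 := Units.ext h
    rw [this, orderOf_one] at hu
    exact hl.one_lt.ne hu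

lemma gF_ge (p l m : ℕ) [Fact p.Prime] {n : ℕ} (F F' : Polynomial (MvPolynomial (Fin n) ℤ)) (hF : F = expand _ m F') (hl : l.Prime) (hlm : l ∣ m) (hpl : (p : ZMod l) = 1)
    (x : Fin n → ℤ) (y : ℤ) (hy : (F.map (evz x)).eval y = 0) (hp : ¬ (p : ℤ) ∣ evz x (F.coeff 0)) : 1 ≤ gF p F (fun l => (x l : ZMod p)) := by
  classical
  have hev : evz (fun l => (x l : ZMod p)) = (Int.castRingHom (ZMod p)).comp (evz x) := by rw [evz_comp]; rfl
  have h1 : (F.map (evz (fun l => (x l : ZMod p)))).eval (y : ZMod p) = 0 := by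
    have := eval_map_hom (Int.castRingHom (ZMod p)) (F.map (evz x)) y
    rw [hy, Polynomial.map_map, ← hev, map_zero] at this
    exact this
  have hy0 : (y : ZMod p) ≠ 0 := by
    intro h0
    rw [h0, ← coeff_zero_eq_eval_zero, coeff_map, hev, RingHom.comp_apply] at h1
    exact hp ((ZMod.intCast_zmod_eq_zero_iff_dvd _ p).1 h1)
  obtain ⟨ζ, hζ, hζ1⟩ := exists_rootunity p l hl hpl
  have h2 : (F.map (evz (fun l => (x l : ZMod p)))).eval (ζ * y) = 0 := by
    rw [hF, map_expand, expand_eval] at h1 ⊢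
    obtain ⟨c, rfl⟩ := hlm
    rw [mul_pow, pow_mul ζ, hζ, one_pow, one_mul]; exact h1
  have h3 : ({(y : ZMod p), ζ * y} : Finset (ZMod p)) ⊆ Finset.univ.filter fun z : ZMod p => (F.map (evz (fun l => (x l : ZMod p)))).eval z = 0 := by
    intro z hz
    rw [Finset.mem_insert, Finset.mem_singleton] at hz
    rw [Finset.mem_filter]
    refine ⟨Finset.mem_univ _, ?_⟩
    rcases hz with rfl | rfl
    · exact h1
    · exact h2
  have h4 := Finset.card_le_card h3
  rw [Finset.card_pair (fun h => hζ1 (by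
    have : (ζ - 1) * (y : ZMod p) = 0 := by rw [sub_mul, ← h]; ring
    rcases mul_eq_zero.1 this with h5 | h5
    · exact sub_eq_zero.1 h5
    · exact (hy0 h5).elim))] at h4
  have h5 : (2:ℝ) ≤ (Finset.univ.filter fun z : ZMod p => (F.map (evz (fun l => (x l : ZMod p)))).eval z = 0).card := by exact_mod_cast h4
  rw [gF]; linarith

lemma gF_ge_neg (p : ℕ) [NeZero p] {n : ℕ} (F : Polynomial (MvPolynomial (Fin n) ℤ)) (x : Fin n → ZMod p) : -1 ≤ gF p F x := by
  rw [gF]; linarith [(Nat.cast_nonneg (Finset.univ.filter fun y : ZMod p => (F.map (evz x)).eval y = 0).card : (0:ℝ) ≤ _)]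

lemma few (a K V : ℕ) (hV : 2 ≤ V) (hK : K * 2^a ≤ V) (N : ℤ) (hN : N ≠ 0) (hNle : |N| ≤ (K * (2*V)^a : ℕ)) (S : Finset Nat.Primes) (hS : ∀ p ∈ S, V ≤ (p:ℕ))
    (hdv : ∀ p ∈ S, ((p:ℕ):ℤ) ∣ N) : S.card ≤ a + 1 := by
  have h1 : (∏ p ∈ S, (p:ℕ)) ∣ N.natAbs := by
    refine Finset.prod_dvd_of_isRelPrime (fun p _ q _ hpq => ?_) (fun p hp => Int.natCast_dvd.1 (hdv p hp))
    exact (Nat.coprime_iff_isRelPrime.1 ((Nat.coprime_primes p.2 q.2).2 fun h => hpq (Subtype.ext h)))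
  have h2 : V ^ S.card ≤ ∏ p ∈ S, (p:ℕ) := by
    rw [← Finset.prod_const]
    exact Finset.prod_le_prod' hS
  have h3 := Nat.le_of_dvd (Int.natAbs_pos.2 hN) h1
  have h4 : N.natAbs ≤ K * (2*V)^a := by
    rw [Int.abs_eq_natAbs] at hNle; exact_mod_cast hNle
  have h5 : V ^ S.card ≤ V ^ (a+1) := by
    refine h2.trans (h3.trans (h4.trans ?_))
    rw [mul_pow, ← mul_assoc, pow_succ, mul_comm]
    exact Nat.mul_le_mul le_rfl hK
  exact (Nat.pow_le_pow_iff_right hV).1 h5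

lemma bad_primes (n D : ℕ) : ∃ K a : ℕ, ∀ F : Polynomial (MvPolynomial (Fin n) ℤ), totalDeg F = D → ∀ M : ℕ, 1 ≤ M → polyNorm F ≤ M → ∀ k : Fin n → ℤ, (∀ l, |k l| ≤ M) →
    (∀ d₁, 0 < d₁ → d₁ < F.natDegree → ¬ Bad F d₁ k) → ∃ N : ℤ, N ≠ 0 ∧ |N| ≤ (K * M^a : ℕ) ∧ ∀ p : ℕ, p.Prime → ¬ GoodAt p F k → (p:ℤ) ∣ N := by
  classical
  obtain ⟨K, a, hKa⟩ := Nk_bound n D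
  refine ⟨((K+1) * (EN D + 1)^a)^D, a*D, fun F hD M hM hFM k hk hgood => ?_⟩
  have hk' : ∀ d₁, ∃ Φ, 0 < d₁ → d₁ < F.natDegree → Φ ∈ NS F.natDegree (totalDeg F) d₁ ∧ NkG F _ _ Φ k ≠ 0 := fun d₁ => by
    by_cases h : 0 < d₁ ∧ d₁ < F.natDegree
    · have := hgood d₁ h.1 h.2
      unfold Bad at this
      push Not at this
      obtain ⟨Φ, h1, h2⟩ := this
      exact ⟨Φ, fun _ _ => ⟨h1, h2⟩⟩
    · exact ⟨0, fun h1 h2 => (h ⟨h1, h2⟩).elim⟩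
  choose Φ hΦ using hk'
  have hinj : Function.Injective (MvPolynomial.map (σ := Fin n) (Int.castRingHom ℚ)) := MvPolynomial.map_injective _ Int.cast_injective
  obtain ⟨x, hx, hne⟩ := mv_nonzero_nat (∏ d₁ ∈ (Finset.range F.natDegree).filter (0 < ·), (NkG F _ _ (Φ d₁) k).map (Int.castRingHom ℚ)) (by
      rw [Finset.prod_ne_zero_iff]
      intro d₁ hd h0
      rw [Finset.mem_filter, Finset.mem_range] at hd
      exact (hΦ d₁ hd.2 hd.1).2 (hinj (by rw [h0, map_zero]))) (EN D)
    (EN_bound F hD Φ (fun d₁ h1 h2 => (hΦ d₁ h1 h2).1) _ (fun d₁ h1 h2 => (tdeg_map_le _ _).trans (NkG_tdeg F _ _ _ k)))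
  have hev : ∀ (R : Type) [CommRing R] (q : MvPolynomial (Fin n) ℤ), MvPolynomial.eval (fun l => (x l : R)) (q.map (Int.castRingHom R)) = ((evz (fun l => (x l : ℤ)) q : ℤ) : R) := by
    intro R _ q
    rw [MvPolynomial.eval_map]
    have := congrArg (fun f => f q) (evz_comp (Int.castRingHom R) (fun l => (x l : ℤ)))
    simp only [RingHom.comp_apply] at this
    simp only [eq_intCast, Int.cast_natCast] at this
    rw [this]; rfl
  refine ⟨∏ d₁ ∈ (Finset.range F.natDegree).filter (0 < ·), evz (fun l => (x l : ℤ)) (NkG F _ _ (Φ d₁) k), ?_, ?_, ?_⟩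
  · intro h0
    apply hne
    rw [map_prod]
    simp only [hev]
    exact_mod_cast congrArg (Int.cast : ℤ → ℚ) h0
  · rw [Finset.abs_prod]
    have hb : ∀ d₁ ∈ (Finset.range F.natDegree).filter (0 < ·), |evz (fun l => (x l : ℤ)) (NkG F _ _ (Φ d₁) k)| ≤ ((K+1) * ((EN D + 1)*M)^a : ℕ) := by
      intro d₁ hd
      rw [Finset.mem_filter, Finset.mem_range] at hd
      rw [NkG_ev]
      have hle : EN D ≤ (EN D+1)*M := by nlinarith
      have hle2 : M ≤ (EN D+1)*M := by nlinarith
      have hmem := (hΦ d₁ hd.2 hd.1).1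
      subst hD
      refine (hKa F rfl d₁ hd.1 (Φ d₁) hmem ((EN (totalDeg F)+1)*M) (by omega) (by omega) (fun l => (x l:ℤ)) (fun l => ((k l : ℤ):ℤ)) (fun l => ?_) (fun l => ?_)).trans ?_
      · rw [Nat.abs_cast]; exact_mod_cast (hx l).trans hle
      · exact (hk l).trans (by exact_mod_cast hle2)
      · exact_mod_cast Nat.mul_le_mul (Nat.le_succ K) le_rfl
    refine (Finset.prod_le_prod (fun _ _ => abs_nonneg _) hb).trans ?_
    rw [Finset.prod_const]
    have hcard : ((Finset.range F.natDegree).filter (0 < ·)).card ≤ D := by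
      refine (Finset.card_filter_le _ _).trans ?_
      rw [Finset.card_range, ← hD]; exact natDegree_le_tdeg F
    have h1 : 1 ≤ (K+1) * ((EN D + 1)*M)^a := Nat.one_le_iff_ne_zero.2 (by positivity)
    have h2 := Nat.pow_le_pow_right h1 hcard
    have h3 : ((K+1) * ((EN D + 1)*M)^a)^D = ((K+1) * (EN D + 1)^a)^D * M^(a*D) := by
      rw [mul_pow (EN D + 1), ← mul_assoc, mul_pow _ (M^a), ← pow_mul]
    rw [← h3]
    exact_mod_cast h2
  · intro p hp hbad
    unfold GoodAt at hbad
    push Not at hbad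
    obtain ⟨d₁, h1, h2, h3⟩ := hbad
    have h4 := h3 (Φ d₁) (hΦ d₁ h1 h2).1
    have h5 := hev (ZMod p) (NkG F _ _ (Φ d₁) k)
    rw [h4, map_zero] at h5
    exact ((ZMod.intCast_zmod_eq_zero_iff_dvd _ p).1 h5.symm).trans (Finset.dvd_prod_of_mem _ (Finset.mem_filter.2 ⟨Finset.mem_range.2 h2, h1⟩))

end St

namespace St
open NC

lemma UU_card (V n : ℕ) : (UU V n).card = V^(2*n) := by
  rw [UU, Finset.card_product, Fintype.card_piFinset]
  simp [two_mul, pow_add]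

lemma UU_diag (V n : ℕ) : ((UU V n).filter fun v => v.1 = v.2).card = V^n := by
  classical
  have h : ((UU V n).filter fun v => v.1 = v.2).card = (Fintype.piFinset fun _ : Fin n => Finset.range V).card := by
    refine Finset.card_bij' (fun v _ => v.1) (fun w _ => (w, w)) ?_ ?_ ?_ ?_
    · intro v hv; rw [Finset.mem_filter, UU, Finset.mem_product] at hv; exact hv.1.1
    · intro w hw; rw [Finset.mem_filter, UU, Finset.mem_product]; exact ⟨⟨hw, hw⟩, rfl⟩
    · intro v hv; rw [Finset.mem_filter] at hv; exact Prod.ext rfl hv.2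
    · intro w hw; rfl
  rw [h, Fintype.card_piFinset]; simp

lemma sieve_upper (n D C1 c1 V b : ℕ) (hD1 : 1 ≤ D) (hV : 0 < V) (hb : V^(n+1) ≤ b) (hb0 : 0 < b) (F : Polynomial (MvPolynomial (Fin n) ℤ)) (hF : F.Monic) (hD : totalDeg F = D)
    (hC1 : ∀ (p : ℕ) [Fact p.Prime] (k : Fin n → ℤ), GoodAt p F k → ∑ x, Tl p (gF p F) (fun l => (k l : ZMod p)) x ^ 2 ≤ (C1:ℝ) * (p:ℝ)^(n+1))
    (Ps : Finset Nat.Primes) (z : ℝ) (hz : 0 < z) (hzP : ∀ p ∈ Ps, z ≤ (p:ℕ)) (hPQ : ∀ p ∈ Ps, (p:ℕ) ≤ V^n)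
    (hbad : ∀ v ∈ UU V n, v.1 ≠ v.2 → ∀ S ⊆ Ps, (∀ p ∈ S, ¬ GoodAt p F (fun l => (v.1 l : ℤ) - (v.2 l : ℤ))) → S.card ≤ c1)
    (X : Finset (Fin n → ℤ)) (hX : ∀ x ∈ X, ∀ l, |x l| ≤ b) :
    (V:ℝ)^(2*n) * ∑ x ∈ X, (∑ p ∈ Ps, gF (p:ℕ) F (fun l => (x l : ZMod p)))^2 ≤
      (128*b)^n * (2*(V:ℝ)^n*(Ps.card*(V:ℝ)^n*(D:ℝ)^2 + C1*Ps.card*(V:ℝ)^(2*n)/z + (D:ℝ)^2*c1*(V:ℝ)^(2*n))) := by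
  classical
  have h0 := sieve_main n (V^n) V b Ps hPQ hV (by rw [← pow_succ]; exact hb) hb0 (fun p => gF (p:ℕ) F) X hX
  refine h0.trans (mul_le_mul_of_nonneg_left ?_ (by positivity))
  have hterm : ∀ p ∈ Ps, 2*((V^n:ℕ):ℝ)/((p:ℕ):ℝ)^(n+2) * ∑ v ∈ UU V n, ∑ x, Tl p (gF (p:ℕ) F) (fun l => (v.1 l : ZMod p) - (v.2 l : ZMod p)) x ^ 2 ≤
      2*(V:ℝ)^n * ∑ v ∈ UU V n, ((if v.1 = v.2 then (D:ℝ)^2 else 0) + C1/z + (if v.1 ≠ v.2 ∧ ¬ GoodAt p F (fun l => (v.1 l : ℤ) - (v.2 l : ℤ)) then (D:ℝ)^2 else 0)) := by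
    intro p hp
    have hp0 : (0:ℝ) < (p:ℕ) := by exact_mod_cast p.2.pos
    have hz1 : (C1:ℝ) * ((p:ℕ):ℝ)^(n+1) ≤ C1/z * ((p:ℕ):ℝ)^(n+2) := by
      rw [div_mul_eq_mul_div, le_div_iff₀ hz, mul_assoc, pow_succ _ (n+1)]
      exact mul_le_mul_of_nonneg_left (mul_le_mul_of_nonneg_left (hzP p hp) (by positivity)) (by positivity)
    have hC0 : 0 ≤ (C1:ℝ)/z := by positivity
    have hv : ∀ v ∈ UU V n, ∑ x, Tl p (gF (p:ℕ) F) (fun l => (v.1 l : ZMod p) - (v.2 l : ZMod p)) x ^ 2 ≤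
      ((if v.1 = v.2 then (D:ℝ)^2 else 0) + C1/z + (if v.1 ≠ v.2 ∧ ¬ GoodAt p F (fun l => (v.1 l : ℤ) - (v.2 l : ℤ)) then (D:ℝ)^2 else 0)) * ((p:ℕ):ℝ)^(n+2) := by
      intro v _
      have htriv := line_triv (p:ℕ) F hF hD hD1 (fun l => (v.1 l : ZMod p) - (v.2 l : ZMod p))
      have hpos : 0 ≤ C1/z * ((p:ℕ):ℝ)^(n+2) := by positivity
      by_cases h1 : v.1 = v.2
      · rw [if_pos h1, if_neg (fun h => h.1 h1), add_zero, add_mul]; linarith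
      · by_cases h2 : GoodAt p F (fun l => (v.1 l : ℤ) - (v.2 l : ℤ))
        · rw [if_neg h1, if_neg (fun h => h.2 h2), add_zero, zero_add]
          have h3 := hC1 p _ h2
          push_cast at h3
          exact h3.trans hz1
        · rw [if_neg h1, if_pos ⟨h1, h2⟩, zero_add, add_mul]; linarith
    calc _ ≤ 2*((V^n:ℕ):ℝ)/((p:ℕ):ℝ)^(n+2) * ∑ v ∈ UU V n, ((if v.1 = v.2 then (D:ℝ)^2 else 0) + C1/z + (if v.1 ≠ v.2 ∧ ¬ GoodAt p F (fun l => (v.1 l : ℤ) - (v.2 l : ℤ)) then (D:ℝ)^2 else 0)) * ((p:ℕ):ℝ)^(n+2) :=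
          mul_le_mul_of_nonneg_left (Finset.sum_le_sum hv) (by positivity)
      _ = _ := by
          rw [← Finset.sum_mul]
          generalize (∑ v ∈ UU V n, ((if v.1 = v.2 then (D:ℝ)^2 else 0) + C1/z + (if v.1 ≠ v.2 ∧ ¬ GoodAt p F (fun l => (v.1 l : ℤ) - (v.2 l : ℤ)) then (D:ℝ)^2 else 0))) = S
          push_cast
          field_simp
  refine (Finset.sum_le_sum hterm).trans ?_
  rw [← Finset.mul_sum]
  refine mul_le_mul_of_nonneg_left ?_ (by positivity)
  simp only [Finset.sum_add_distrib]
  have e1 : ∑ p ∈ Ps, ∑ v ∈ UU V n, (if v.1 = v.2 then (D:ℝ)^2 else 0) = Ps.card*(V:ℝ)^n*(D:ℝ)^2 := by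
    rw [Finset.sum_const, ← Finset.sum_filter, Finset.sum_const, UU_diag, nsmul_eq_mul, nsmul_eq_mul]
    push_cast; ring
  have e2 : ∑ p ∈ Ps, ∑ v ∈ UU V n, (C1:ℝ)/z = C1*Ps.card*(V:ℝ)^(2*n)/z := by
    rw [Finset.sum_const, Finset.sum_const, UU_card, nsmul_eq_mul, nsmul_eq_mul]
    push_cast; ring
  have e3 : ∑ p ∈ Ps, ∑ v ∈ UU V n, (if v.1 ≠ v.2 ∧ ¬ GoodAt p F (fun l => (v.1 l : ℤ) - (v.2 l : ℤ)) then (D:ℝ)^2 else 0) ≤ (D:ℝ)^2*c1*(V:ℝ)^(2*n) := by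
    rw [Finset.sum_comm]
    calc _ ≤ ∑ v ∈ UU V n, (D:ℝ)^2 * c1 := by
          refine Finset.sum_le_sum fun v hv => ?_
          rw [← Finset.sum_filter, Finset.sum_const, nsmul_eq_mul, mul_comm]
          refine mul_le_mul_of_nonneg_left ?_ (by positivity)
          by_cases h1 : v.1 = v.2
          · rw [Finset.filter_false_of_mem (fun p _ h => h.1 h1)]; simp
          · have h5 := hbad v hv h1 (Ps.filter fun p : Nat.Primes => v.1 ≠ v.2 ∧ ¬ GoodAt p F (fun l => (v.1 l : ℤ) - (v.2 l : ℤ))) (Finset.filter_subset _ _) (fun p hp => (Finset.mem_filter.1 hp).2.2)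
            exact_mod_cast h5
      _ = _ := by
          rw [Finset.sum_const, UU_card, nsmul_eq_mul]
          push_cast; ring
  rw [e1, e2]
  linarith

lemma sieve_lower (n V : ℕ) (F F' : Polynomial (MvPolynomial (Fin n) ℤ)) (l m c0 : ℕ) (hF : F = expand _ m F') (hl : l.Prime) (hlm : l ∣ m)
    (Ps : Finset Nat.Primes) (hP1 : ∀ p ∈ Ps, ((p:ℕ) : ZMod l) = 1) (x : Fin n → ℤ) (y : ℤ) (hy : (F.map (evz x)).eval y = 0)
    (hbad : ∀ S ⊆ Ps, (∀ p ∈ S, ((p:ℕ):ℤ) ∣ evz x (F.coeff 0)) → S.card ≤ c0) (hS : 4*c0 ≤ Ps.card) :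
    ((Ps.card:ℝ)/2)^2 ≤ (∑ p ∈ Ps, gF (p:ℕ) F (fun l => (x l : ZMod p)))^2 := by
  classical
  have h1 : ∀ p ∈ Ps, (1:ℝ) - (if ((p:ℕ):ℤ) ∣ evz x (F.coeff 0) then 2 else 0) ≤ gF (p:ℕ) F (fun l => (x l : ZMod p)) := by
    intro p hp
    by_cases h : ((p:ℕ):ℤ) ∣ evz x (F.coeff 0)
    · rw [if_pos h]; have := gF_ge_neg (p:ℕ) F (fun l => (x l : ZMod p)); linarith
    · rw [if_neg h, sub_zero]; exact gF_ge p l m F F' hF hl hlm (hP1 p hp) x y hy h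
  have h2 := Finset.sum_le_sum h1
  rw [Finset.sum_sub_distrib, ← Finset.sum_filter, Finset.sum_const, Finset.sum_const, nsmul_eq_mul, nsmul_eq_mul] at h2
  have h3 : ((Ps.filter fun p : Nat.Primes => ((p:ℕ):ℤ) ∣ evz x (F.coeff 0)).card : ℝ) ≤ c0 := by
    exact_mod_cast hbad _ (Finset.filter_subset _ _) (fun p hp => (Finset.mem_filter.1 hp).2)
  have h4 : 4*(c0:ℝ) ≤ Ps.card := by exact_mod_cast hS
  refine pow_le_pow_left₀ (by positivity) ?_ 2
  linarith

end St

namespace St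
open NC

lemma sieve_arith (Q q S X W A B c : ℝ) (hQ : 0 < Q) (hq : 1 ≤ q) (hS : 0 < S) (hSq : Q ≤ S * q^2) (hX : 0 ≤ X) (hW : 0 ≤ W) (hA : 0 ≤ A) (hB : 0 ≤ B) (hc : 0 ≤ c)
    (h : Q^2 * (X * (S/2)^2) ≤ W * (2*Q*(S*Q*A + B*S*Q^2/(Q/q) + A*c*Q^2))) : X * Q ≤ 8*W*(A+B+A*c)*q^4 := by
  have e1 : B*S*Q^2/(Q/q) = B*S*Q*q := by field_simp
  rw [e1] at h
  have h1 : Q^2 * (X * S^2) ≤ Q^2 * (8*W*(S*A + B*S*q + A*c*Q)) := by nlinarith [h]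
  have h2 := le_of_mul_le_mul_left h1 (by positivity)
  have hq2 : q ≤ q^2 := by nlinarith
  have hq1 : 1 ≤ q^2 := by nlinarith
  have h3 : S*A + B*S*q + A*c*Q ≤ S * ((A+B+A*c)*q^2) := by
    have a1 : S*A ≤ S*A*q^2 := le_mul_of_one_le_right (by positivity) hq1
    have a2 : B*S*q ≤ B*S*q^2 := mul_le_mul_of_nonneg_left hq2 (by positivity)
    have a3 : A*c*Q ≤ A*c*(S*q^2) := mul_le_mul_of_nonneg_left hSq (by positivity)
    nlinarith
  have h4 : S*(X*S) ≤ S*(8*W*((A+B+A*c)*q^2)) := by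
    have := mul_le_mul_of_nonneg_left h3 (show 0 ≤ 8*W by positivity)
    nlinarith
  have h5 := le_of_mul_le_mul_left h4 hS
  calc X*Q ≤ X*(S*q^2) := mul_le_mul_of_nonneg_left hSq hX
    _ = X*S*q^2 := by ring
    _ ≤ (8*W*((A+B+A*c)*q^2))*q^2 := mul_le_mul_of_nonneg_right h5 (by positivity)
    _ = _ := by ring

lemma ap_all (D : ℕ) (η : ℝ) (h0 : 0 < η) (h1 : η < 1) : ∃ X0 : ℝ, ∀ q : ℕ, 0 < q → q ≤ D → ∀ X : ℝ, X0 ≤ X →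
    X ^ (1 - 2 * η) ≤ ((Finset.range (⌊X⌋₊ + 1)).filter fun p : ℕ => p.Prime ∧ (p : ZMod q) = 1 ∧ X ^ (1 - η) ≤ (p : ℝ)).card := by
  have h : ∀ q : ℕ, ∃ X0 : ℝ, 0 < q → ∀ X : ℝ, X0 ≤ X →
    X ^ (1 - 2 * η) ≤ ((Finset.range (⌊X⌋₊ + 1)).filter fun p : ℕ => p.Prime ∧ (p : ZMod q) = 1 ∧ X ^ (1 - η) ≤ (p : ℝ)).card := by
    intro q
    rcases Nat.eq_zero_or_pos q with rfl | hq
    · exact ⟨0, fun h => absurd h (lt_irrefl _)⟩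
    · haveI : NeZero q := ⟨hq.ne'⟩
      obtain ⟨X0, hX0⟩ := ap q η h0 h1
      exact ⟨X0, fun _ => hX0⟩
  choose f hf using h
  refine ⟨∑ q ∈ Finset.range (D+1), |f q|, fun q hq hqD X hX => hf q hq X (le_trans ?_ hX)⟩
  exact (le_abs_self _).trans (Finset.single_le_sum (f := fun q => |f q|) (fun i _ => abs_nonneg _) (Finset.mem_range.2 (Nat.lt_succ_of_le hqD)))

lemma deg_le_D {n : ℕ} (F : Polynomial (MvPolynomial (Fin n) ℤ)) : F.natDegree ≤ totalDeg F := by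
  exact natDegree_le_tdeg F

theorem sieve_count (n D : ℕ) (hn : 2 ≤ n) (η : ℝ) (hη : 0 < η) (hη4 : η ≤ 1/4) : ∃ C : ℝ, 0 < C ∧ ∃ V0 : ℕ, ∀ V b : ℕ, V0 ≤ V → V^(n+1) ≤ b → b ≤ (2*V)^(n+1) →
    ∀ (m : ℕ) (F : Polynomial (MvPolynomial (Fin n) ℤ)), 2 ≤ m → 2 ≤ F.natDegree → F.Monic → HasForm n m F → totalDeg F = D → polyNorm F ≤ b →
    (∀ k : Fin n → ℤ, k ≠ 0 → (∀ l, |k l| < V) → ∀ d₁, 0 < d₁ → d₁ < F.natDegree → ¬ Bad F d₁ k) →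
    ∀ X : Finset (Fin n → ℤ), (∀ x ∈ X, (∀ l, |x l| ≤ b) ∧ evz x (F.coeff 0) ≠ 0 ∧ ∃ y : ℤ, (F.map (evz x)).eval y = 0) →
    (X.card : ℝ) * (V:ℝ)^n ≤ C * (b:ℝ)^n * ((V:ℝ)^n) ^ (4*η) := by
  classical
  obtain ⟨C1, hC1⟩ := line_good n D
  obtain ⟨K, a, hKa⟩ := bad_primes n D
  obtain ⟨X0, hX0⟩ := ap_all D η hη (by linarith)
  set c1 := (n+1)*a + 1 with hc1
  set c0 := (n+1)*(D+1) + 1 with hc0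
  set K0 := (D+1)^n * 2^D with hK0
  refine ⟨8*128^n*((D:ℝ)^2 + C1 + (D:ℝ)^2*c1) + 1, by positivity, 2 + ⌈X0⌉₊ + K*2^((n+1)*a) + K0*2^((n+1)*(D+1)) + 4*c0, ?_⟩
  intro V b hV hb hb2 m F hm hd hmon hform hD hnorm hgood X hX
  have hV1 : 2 ≤ V := by omega
  have hVX0 : ⌈X0⌉₊ ≤ V := by omega
  have hVK : K*2^((n+1)*a) ≤ V := by omega
  have hVK0 : K0*2^((n+1)*(D+1)) ≤ V := by omega
  have hVc0 : 4*c0 ≤ V := by omega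
  have hVpow : V ≤ b := le_trans (by simpa using Nat.pow_le_pow_right (by omega : 0 < V) (by omega : 1 ≤ n+1)) hb
  have hb0 : 0 < b := by omega
  have hD1 : 1 ≤ D := by have := deg_le_D F; omega
  obtain ⟨hmd, hc, F', hF'⟩ := form_expand hm hd hform
  have hl : m.minFac.Prime := Nat.minFac_prime (by omega)
  have hlD : m.minFac ≤ D := by
    have := Nat.minFac_le (show 0 < m by omega); have := deg_le_D F; omega
  have hVr : (1:ℝ) ≤ V := by exact_mod_cast (by omega : 1 ≤ V)
  have hQr : (1:ℝ) ≤ (V:ℝ)^n := one_le_pow₀ hVr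
  have hVQ : (V:ℝ) ≤ (V:ℝ)^n := le_self_pow₀ hVr (by omega)
  have hap := hX0 m.minFac hl.pos hlD ((V:ℝ)^n) ((Nat.le_ceil X0).trans (le_trans (by exact_mod_cast hVX0) hVQ))
  set P0 : Finset ℕ := (Finset.range (⌊(V:ℝ)^n⌋₊ + 1)).filter fun p : ℕ => p.Prime ∧ (p : ZMod m.minFac) = 1 ∧ ((V:ℝ)^n) ^ (1 - η) ≤ (p : ℝ) with hP0
  have hVge : ∀ θ : ℝ, 1/2 ≤ θ → (V:ℝ) ≤ ((V:ℝ)^n)^θ := by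
    intro θ hθ
    rw [← Real.rpow_natCast, ← Real.rpow_mul (by positivity)]
    refine Real.self_le_rpow_of_one_le hVr ?_
    have : (2:ℝ) ≤ n := by exact_mod_cast hn
    nlinarith
  obtain ⟨Ps, hPs1, hPs2⟩ : ∃ Ps : Finset Nat.Primes, Ps.card = P0.card ∧ ∀ p ∈ Ps, (p:ℕ) ∈ P0 := by
    refine ⟨P0.subtype Nat.Prime, ?_, fun p hp => Finset.mem_subtype.1 hp⟩
    refine (Finset.card_subtype Nat.Prime P0).trans ?_
    rw [Finset.filter_true_of_mem]
    intro p hp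
    rw [hP0, Finset.mem_filter] at hp
    exact hp.2.1
  have hPz : ∀ p ∈ Ps, ((V:ℝ)^n) ^ (1 - η) ≤ ((p:ℕ):ℝ) := fun p hp => (Finset.mem_filter.1 (hPs2 p hp)).2.2.2
  have hP1 : ∀ p ∈ Ps, ((p:ℕ) : ZMod m.minFac) = 1 := fun p hp => (Finset.mem_filter.1 (hPs2 p hp)).2.2.1
  have hPQ : ∀ p ∈ Ps, (p:ℕ) ≤ V^n := fun p hp => by
    have h1 := Finset.mem_range.1 (Finset.mem_filter.1 (hPs2 p hp)).1
    have h2 : ⌊(V:ℝ)^n⌋₊ = V^n := by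
      rw [← Nat.cast_pow, Nat.floor_natCast]
    omega
  have hPV : ∀ p ∈ Ps, V ≤ (p:ℕ) := fun p hp => by
    have := (hVge (1-η) (by linarith)).trans (hPz p hp)
    exact_mod_cast this
  have hScard : ((V:ℝ)^n)^(1-2*η) ≤ (Ps.card:ℝ) := by rw [hPs1]; exact hap
  have hSV : V ≤ Ps.card := by
    have := (hVge (1-2*η) (by linarith)).trans hScard
    exact_mod_cast this
  -- bad primes
  have hbad : ∀ v ∈ UU V n, v.1 ≠ v.2 → ∀ S ⊆ Ps, (∀ p ∈ S, ¬ GoodAt p F (fun l => (v.1 l : ℤ) - (v.2 l : ℤ))) → S.card ≤ c1 := by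
    intro v hv hne S hS hSb
    rw [UU, Finset.mem_product, Fintype.mem_piFinset, Fintype.mem_piFinset] at hv
    have hk : ∀ l, |(v.1 l : ℤ) - (v.2 l : ℤ)| < V := fun l => by
      have h1 := Finset.mem_range.1 (hv.1 l)
      have h2 := Finset.mem_range.1 (hv.2 l)
      rw [abs_lt]; constructor <;> omega
    have hk0 : (fun l => (v.1 l : ℤ) - (v.2 l : ℤ)) ≠ 0 := by
      intro h
      apply hne
      funext l
      have := congrFun h l
      simp only [Pi.zero_apply] at this
      omega
    obtain ⟨N, hN0, hN, hNd⟩ := hKa F hD b hb0 hnorm _ (fun l => (hk l).le.trans (by exact_mod_cast hVpow)) (hgood _ hk0 hk)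
    refine few ((n+1)*a) K V hV1 hVK N hN0 (hN.trans ?_) S (fun p hp => hPV p (hS hp)) (fun p hp => hNd p p.2 (hSb p hp))
    have : K * b^a ≤ K * (2*V)^((n+1)*a) := by
      rw [pow_mul]; exact Nat.mul_le_mul_left _ (Nat.pow_le_pow_left hb2 a)
    exact_mod_cast this
  have hup := sieve_upper n D C1 c1 V b hD1 (by omega) hb hb0 F hmon hD (fun p _ k hk => hC1 p F hmon hd hD k hk) Ps (((V:ℝ)^n)^(1-η)) (by positivity) hPz hPQ hbad X (fun x hx => (hX x hx).1)
  have hlow : ∀ x ∈ X, ((Ps.card:ℝ)/2)^2 ≤ (∑ p ∈ Ps, gF (p:ℕ) F (fun l => (x l : ZMod p)))^2 := by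
    intro x hx
    obtain ⟨hxb, hx0, y, hy⟩ := hX x hx
    refine sieve_lower n V F F' m.minFac m c0 hF' hl (Nat.minFac_dvd m) Ps hP1 x y hy ?_ (hVc0.trans hSV)
    intro S hS hSd
    refine few ((n+1)*(D+1)) K0 V hV1 hVK0 _ hx0 ((val_bound F hD hb0 x hxb 0).trans ?_) S (fun p hp => hPV p (hS hp)) hSd
    have : (D+1)^n * polyNorm F * (2*b)^D ≤ K0 * (2*V)^((n+1)*(D+1)) := by
      calc (D+1)^n * polyNorm F * (2*b)^D ≤ (D+1)^n * b * (2*b)^D := Nat.mul_le_mul_right _ (Nat.mul_le_mul_left _ hnorm)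
        _ = K0 * b^(D+1) := by rw [hK0, mul_pow]; ring
        _ ≤ _ := by rw [pow_mul]; exact Nat.mul_le_mul_left _ (Nat.pow_le_pow_left hb2 _)
    exact_mod_cast this
  have hsum : (X.card:ℝ) * ((Ps.card:ℝ)/2)^2 ≤ ∑ x ∈ X, (∑ p ∈ Ps, gF (p:ℕ) F (fun l => (x l : ZMod p)))^2 := by
    rw [← nsmul_eq_mul]; exact Finset.card_nsmul_le_sum _ _ _ hlow
  have hS0 : (0:ℝ) < Ps.card := by exact_mod_cast (by omega : 0 < Ps.card)
  have hfin := sieve_arith ((V:ℝ)^n) (((V:ℝ)^n)^η) Ps.card X.card ((128*b)^n) ((D:ℝ)^2) C1 c1 (by positivity) (Real.one_le_rpow hQr hη.le) hS0 ?_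
    (by positivity) (by positivity) (by positivity) (by positivity) (by positivity) ?_
  · have e4 : (((V:ℝ)^n)^η)^4 = ((V:ℝ)^n)^(4*η) := by
      rw [← Real.rpow_natCast, ← Real.rpow_mul (by positivity)]; congr 1; push_cast; ring
    rw [e4] at hfin
    refine hfin.trans ?_
    rw [mul_pow]
    have : 0 ≤ (b:ℝ)^n * ((V:ℝ)^n)^(4*η) := by positivity
    nlinarith
  · have e : ((V:ℝ)^n)^(1-2*η) * (((V:ℝ)^n)^η)^2 = (V:ℝ)^n := by
      rw [← Real.rpow_natCast (((V:ℝ)^n)^η), ← Real.rpow_mul (by positivity), ← Real.rpow_add (by positivity)]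
      norm_num
      ring_nf
      rw [Real.rpow_one]
    calc (V:ℝ)^n = ((V:ℝ)^n)^(1-2*η) * (((V:ℝ)^n)^η)^2 := e.symm
      _ ≤ _ := mul_le_mul_of_nonneg_right hScard (by positivity)
  · have e1 : ((V:ℝ)^n)^(1-η) = (V:ℝ)^n / ((V:ℝ)^n)^η := by
      rw [Real.rpow_sub (by positivity), Real.rpow_one]
    have e2 : (V:ℝ)^(2*n) = ((V:ℝ)^n)^2 := by rw [← pow_mul, mul_comm]
    rw [e1, e2] at hup
    have h7 := mul_le_mul_of_nonneg_left hsum (show 0 ≤ ((V:ℝ)^n)^2 by positivity)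
    exact h7.trans hup

end St

namespace St
open NC

lemma lam_exists : ∃ lam : AlgebraicClosure ℚ →ₗ[ℚ] ℚ, lam 1 = 1 := by
  obtain ⟨g, hg⟩ := LinearMap.exists_leftInverse_of_injective (Algebra.linearMap ℚ (AlgebraicClosure ℚ))
    (LinearMap.ker_eq_bot.2 (algebraMap ℚ (AlgebraicClosure ℚ)).injective)
  refine ⟨g, ?_⟩
  have := LinearMap.congr_fun hg 1
  simpa using this

lemma bpoly_evalEval {R : Type} [CommRing R] (d e : ℕ) (c : Fin d × Fin (e+1) → R) (t y : R) :
    evalEval t y (bpoly d e c) = y^d + ∑ q : Fin d × Fin (e+1), c q * (t^(q.2:ℕ) * y^(q.1:ℕ)) := by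
  unfold bpoly
  rw [evalEval_add, evalEval_finsetSum, evalEval_pow, evalEval_X]
  congr 1
  refine Finset.sum_congr rfl fun q _ => ?_
  rw [evalEval_mul, evalEval_pow, evalEval_X, evalEval_C]
  simp [mul_assoc]

lemma bpoly_wt {R : Type} [CommRing R] (d e : ℕ) (c : Fin d × Fin (e+1) → R) : wt e (e + d*e) (bpoly d e c) := by
  unfold bpoly
  refine wt.add ((wt_Y.pow d).mono (by omega)) (wt_sum _ _ fun q _ => ?_)
  refine ((wt_C (e := e) (w := e) ?_).mul (wt_Y.pow q.1)).mono ?_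
  · exact (natDegree_C_mul_X_pow_le _ _).trans (by have := q.2.2; omega)
  · have := Nat.mul_le_mul_right e q.1.2.le; omega

lemma lam_part (lam : AlgebraicClosure ℚ →ₗ[ℚ] ℚ) (hlam : lam 1 = 1) {e d₁ : ℕ} (g : (AlgebraicClosure ℚ)[X][X]) (hg : g.Monic) (hd : g.natDegree = d₁)
    (he : ∀ i, (g.coeff i).natDegree ≤ e) (t y : ℤ) (h : evalEval (t : AlgebraicClosure ℚ) (y : AlgebraicClosure ℚ) g = 0) :
    evalEval (t:ℚ) (y:ℚ) (bpoly d₁ e (fun q => lam (cf d₁ e g q))) = 0 := by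
  rw [← bpoly_cf d₁ e g hg hd he, bpoly_evalEval] at h
  rw [bpoly_evalEval]
  have h2 := congrArg lam h
  rw [map_zero, map_add, map_sum] at h2
  rw [← h2]
  have key : ∀ (z : AlgebraicClosure ℚ) (a : ℤ), lam (z * (a : AlgebraicClosure ℚ)) = lam z * a := fun z a => by
    have : z * (a : AlgebraicClosure ℚ) = (a:ℚ) • z := by
      rw [Algebra.smul_def, mul_comm]; simp
    rw [this, map_smul, smul_eq_mul, mul_comm]
  congr 1
  · have := key 1 (y^d₁)
    rw [hlam, one_mul, one_mul] at this
    push_cast at this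
    exact this.symm
  · refine Finset.sum_congr rfl fun q _ => ?_
    have := key (cf d₁ e g q) (t^(q.2:ℕ) * y^(q.1:ℕ))
    push_cast at this
    exact this.symm

theorem lam_count {e δ d₁ : ℕ} (f : ℤ[X][X]) (hf : f.Monic) (hd : f.natDegree = δ) (he : ∀ i, (f.coeff i).natDegree ≤ e)
    (hirr : Irreducible (f.map (mapRingHom (Int.castRingHom ℚ)))) (h0 : 0 < d₁) (h1 : d₁ < δ)
    (hfac : HasFac d₁ (f.map (mapRingHom (Int.castRingHom (AlgebraicClosure ℚ)))))
    (T : Finset ℤ) (hT : ∀ t ∈ T, ∃ y : ℤ, evalEval t y f = 0) : T.card ≤ 2*(δ*((e + δ*e) + e*δ)) := by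
  classical
  obtain ⟨lam, hlam⟩ := lam_exists
  obtain ⟨g, h, hg, hh, hgd, hgh⟩ := hfac
  have hfm := hf.map (mapRingHom (Int.castRingHom ℚ))
  have hfK := hf.map (mapRingHom (Int.castRingHom (AlgebraicClosure ℚ)))
  have heK : ∀ i, ((f.map (mapRingHom (Int.castRingHom (AlgebraicClosure ℚ)))).coeff i).natDegree ≤ e := natDegree_coeff_map_le _ he
  have hge := tdeg_factor e _ g h hfK.ne_zero heK hgh
  have hhe := tdeg_factor e _ h g hfK.ne_zero heK (hgh.trans (mul_comm _ _))
  have hhd : h.natDegree = δ - d₁ := by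
    have := congrArg natDegree hgh
    rw [hg.natDegree_mul hh, hf.natDegree_map, hd, hgd] at this
    omega
  have key : ∀ (g : (AlgebraicClosure ℚ)[X][X]) (d : ℕ), 0 < d → d < δ → ∀ S : Finset ℤ, g.Monic → g.natDegree = d → (∀ i, (g.coeff i).natDegree ≤ e) →
      (∀ t ∈ S, ∃ y : ℤ, evalEval t y f = 0 ∧ evalEval (t : AlgebraicClosure ℚ) (y : AlgebraicClosure ℚ) g = 0) → S.card ≤ δ*((e + δ*e) + e*δ) := by
    intro g d hd0 hdδ S hg hgd hge hS
    rw [← Finset.card_image_of_injective S (Int.cast_injective (α := ℚ))]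
    refine elim_count (RingHom.id ℚ) hfm (by rw [hf.natDegree_map, hd]) (natDegree_coeff_map_le _ he) hirr (bpoly d e (fun q => lam (cf d e g q)))
      ((bpoly_wt d e _).mono (by have := Nat.mul_le_mul_right e hdδ.le; omega)) ?_ _ ?_
    · intro hdvd
      have := natDegree_le_of_dvd hdvd (bpoly_monic d e _).ne_zero
      rw [bpoly_natDegree, hf.natDegree_map, hd] at this
      omega
    · intro t ht
      obtain ⟨t, ht5, rfl⟩ := Finset.mem_image.1 ht
      obtain ⟨y, hy1, hy2⟩ := hS t ht5
      refine ⟨(y:ℚ), ?_, ?_⟩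
      · rw [mapRingHom_id, Polynomial.map_id, RingHom.id_apply]
        have := map_mapRingHom_evalEval (Int.castRingHom ℚ) f t y
        simp only [eq_intCast] at this
        rw [this, hy1, Int.cast_zero]
      · rw [mapRingHom_id, Polynomial.map_id, RingHom.id_apply]
        exact lam_part lam hlam g hg hgd hge t y hy2
  have hsplit : T ⊆ (T.filter fun t => ∃ y : ℤ, evalEval t y f = 0 ∧ evalEval (t : AlgebraicClosure ℚ) (y : AlgebraicClosure ℚ) g = 0) ∪
      (T.filter fun t => ∃ y : ℤ, evalEval t y f = 0 ∧ evalEval (t : AlgebraicClosure ℚ) (y : AlgebraicClosure ℚ) h = 0) := by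
    intro t ht
    obtain ⟨y, hy⟩ := hT t ht
    have h3 := map_mapRingHom_evalEval (Int.castRingHom (AlgebraicClosure ℚ)) f t y
    rw [hy, hgh, evalEval_mul, map_zero] at h3
    simp only [eq_intCast] at h3
    rw [Finset.mem_union, Finset.mem_filter, Finset.mem_filter]
    rcases mul_eq_zero.1 h3 with h4 | h4
    · exact Or.inl ⟨ht, y, hy, h4⟩
    · exact Or.inr ⟨ht, y, hy, h4⟩
  refine (Finset.card_le_card hsplit).trans ((Finset.card_union_le _ _).trans ?_)
  have a1 := key g d₁ h0 h1 (T.filter fun t => ∃ y : ℤ, evalEval t y f = 0 ∧ evalEval (t : AlgebraicClosure ℚ) (y : AlgebraicClosure ℚ) g = 0) hg hgd hge (fun t ht => (Finset.mem_filter.1 ht).2)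
  have a2 := key h (δ - d₁) (by omega) (by omega) (T.filter fun t => ∃ y : ℤ, evalEval t y f = 0 ∧ evalEval (t : AlgebraicClosure ℚ) (y : AlgebraicClosure ℚ) h = 0) hh hhd hhe (fun t ht => (Finset.mem_filter.1 ht).2)
  omega

/-! ### decomposition into lines -/

/-- representative of the line through `x` in direction `k` -/
def rp {n : ℕ} (k : Fin n → ℤ) (i : Fin n) (x : Fin n → ℤ) : Fin n → ℤ := fun l => x l - (x i / k i) * k l

lemma rp_add {n : ℕ} (k : Fin n → ℤ) (i : Fin n) (x : Fin n → ℤ) : x = fun l => rp k i x l + (x i / k i) * k l := by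
  funext l; simp [rp]

lemma rp_q {n b κ : ℕ} (k : Fin n → ℤ) (i : Fin n) (hk : |k i| = κ) (hκ : 1 ≤ κ) (x : Fin n → ℤ) (hx : |x i| ≤ b) : |x i / k i| ≤ (b/κ + 1 : ℕ) := by
  have h0 : k i ≠ 0 := by intro h; rw [h, abs_zero] at hk; omega
  have h1 := Int.emod_add_mul_ediv (x i) (k i)
  have h2 := Int.emod_nonneg (x i) h0
  have h3 := Int.emod_lt_abs (x i) h0
  have h4 : |k i * (x i / k i)| < b + κ := by
    rw [abs_lt]
    have := abs_le.1 hx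
    constructor <;> linarith
  rw [abs_mul, hk] at h4
  have h5 : (b:ℤ) < κ * (b/κ + 1 : ℕ) := by
    have := Nat.lt_mul_div_succ b (show 0 < κ by omega)
    exact_mod_cast this
  have h6 : (κ:ℤ) * |x i / k i| < κ * ((b/κ + 1 : ℕ) + 1) := by linarith
  have h7 := lt_of_mul_lt_mul_left h6 (by positivity)
  omega

lemma rp_box {n b κ : ℕ} (k : Fin n → ℤ) (i : Fin n) (hk : |k i| = κ) (hkl : ∀ l, |k l| ≤ κ) (hκ : 1 ≤ κ) (hκb : κ ≤ b) (x : Fin n → ℤ) (hx : ∀ l, |x l| ≤ b) (l : Fin n) : |rp k i x l| ≤ (3*b:ℕ) := by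
  have h1 := rp_q k i hk hκ x (hx i)
  have h2 : |(x i / k i) * k l| ≤ (b/κ + 1 : ℕ) * (κ:ℤ) := by
    rw [abs_mul]; exact mul_le_mul h1 (hkl l) (abs_nonneg _) (by positivity)
  have h3 : (b/κ + 1) * κ ≤ 2*b := by have := Nat.div_mul_le_self b κ; nlinarith
  have h4 : ((b/κ + 1 : ℕ):ℤ) * (κ:ℤ) ≤ 2*b := by exact_mod_cast h3
  have h5 := abs_sub (x l) ((x i / k i) * k l)
  have h6 := hx l
  unfold rp
  push_cast
  linarith

lemma rp_i {n κ : ℕ} (k : Fin n → ℤ) (i : Fin n) (hk : |k i| = κ) (hκ : 1 ≤ κ) (x : Fin n → ℤ) : 0 ≤ rp k i x i ∧ rp k i x i < κ := by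
  have h0 : k i ≠ 0 := by intro h; rw [h, abs_zero] at hk; omega
  have h1 := Int.emod_add_mul_ediv (x i) (k i)
  have h2 := Int.emod_nonneg (x i) h0
  have h3 := Int.emod_lt_abs (x i) h0
  rw [hk] at h3
  have h4 : rp k i x i = x i % k i := by unfold rp; linarith
  rw [h4]; exact ⟨h2, h3⟩

lemma rp_line {n κ : ℕ} (k : Fin n → ℤ) (i : Fin n) (hk : |k i| = κ) (hκ : 1 ≤ κ) (r : Fin n → ℤ) (hr : 0 ≤ r i ∧ r i < κ) (t : ℤ) :
    (r i + t * k i) / k i = t ∧ rp k i (fun l => r l + t * k l) = r := by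
  have h0 : k i ≠ 0 := by intro h; rw [h, abs_zero] at hk; omega
  have h1 : (r i + t * k i) / k i = t := by
    rw [Int.add_mul_ediv_right _ _ h0, Int.ediv_eq_zero_of_lt_abs hr.1 (by rw [hk]; exact hr.2), zero_add]
  refine ⟨h1, ?_⟩
  funext l
  unfold rp
  dsimp only
  rw [h1]; ring

lemma rp_image_card {n b κ : ℕ} (k : Fin n → ℤ) (i : Fin n) (hk : |k i| = κ) (hkl : ∀ l, |k l| ≤ κ) (hκ : 1 ≤ κ) (hκb : κ ≤ b) (X : Finset (Fin n → ℤ)) (hX : ∀ x ∈ X, ∀ l, |x l| ≤ b) :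
    (X.image (rp k i)).card ≤ κ * (7*b)^(n-1) := by
  classical
  have hsub : X.image (rp k i) ⊆ Fintype.piFinset (fun l : Fin n => if l = i then Finset.Ico (0:ℤ) κ else Finset.Icc (-(3*b:ℕ):ℤ) (3*b:ℕ)) := by
    intro r hr
    obtain ⟨x, hx, rfl⟩ := Finset.mem_image.1 hr
    rw [Fintype.mem_piFinset]
    intro l
    by_cases h : l = i
    · rw [if_pos h, Finset.mem_Ico, h]; exact rp_i k i hk hκ x
    · rw [if_neg h, Finset.mem_Icc]; exact abs_le.1 (rp_box k i hk hkl hκ hκb x (hX x hx) l)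
  refine (Finset.card_le_card hsub).trans ?_
  rw [Fintype.card_piFinset, ← Finset.mul_prod_erase _ _ (Finset.mem_univ i), if_pos rfl, Int.card_Ico]
  have h2 : ∏ l ∈ Finset.univ.erase i, (if l = i then Finset.Ico (0:ℤ) κ else Finset.Icc (-(3*b:ℕ):ℤ) (3*b:ℕ)).card ≤ (7*b)^(n-1) := by
    have : ((Finset.univ : Finset (Fin n)).erase i).card = n-1 := by rw [Finset.card_erase_of_mem (Finset.mem_univ _)]; simp
    rw [← this]
    refine Finset.prod_le_pow_card _ _ _ fun l hl => ?_
    rw [if_neg (Finset.ne_of_mem_erase hl), Int.card_Icc]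
    omega
  simpa using Nat.mul_le_mul_left κ h2

end St

namespace St
open NC

lemma zbox {n b : ℕ} (hn : 1 ≤ n) (hb : 1 ≤ b) (P : MvPolynomial (Fin n) ℤ) (hP : P ≠ 0) (X : Finset (Fin n → ℤ)) (hX : ∀ x ∈ X, (∀ l, |x l| ≤ b) ∧ evz x P = 0) :
    X.card ≤ P.totalDegree * 3^n * b^(n-1) := by
  classical
  have h1 := sz P hP (Finset.Icc (-(b:ℤ)) b)
  have hc : (Finset.Icc (-(b:ℤ)) b).card = 2*b+1 := by rw [Int.card_Icc]; omega
  rw [hc] at h1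
  have hsub : X ⊆ (Fintype.piFinset fun _ : Fin n => Finset.Icc (-(b:ℤ)) b).filter fun x => MvPolynomial.eval x P = 0 := by
    intro x hx
    rw [Finset.mem_filter, Fintype.mem_piFinset]
    refine ⟨fun l => Finset.mem_Icc.2 (abs_le.1 ((hX x hx).1 l)), ?_⟩
    rw [← evz_int]; exact (hX x hx).2
  have h2 := Nat.mul_le_mul_right (2*b+1) (Finset.card_le_card hsub)
  have h3 : (2*b+1)^n = (2*b+1)^(n-1) * (2*b+1) := by rw [← pow_succ]; congr 1; omega
  have h4 : X.card * (2*b+1) ≤ (P.totalDegree * (2*b+1)^(n-1)) * (2*b+1) := by rw [mul_assoc, ← h3]; exact h2.trans h1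
  refine (Nat.le_of_mul_le_mul_right h4 (by omega)).trans ?_
  rw [mul_assoc]
  refine Nat.mul_le_mul_left _ ?_
  calc (2*b+1)^(n-1) ≤ (3*b)^(n-1) := Nat.pow_le_pow_left (by omega) _
    _ = 3^(n-1) * b^(n-1) := mul_pow _ _ _
    _ ≤ _ := Nat.mul_le_mul_right _ (Nat.pow_le_pow_right (by omega) (by omega))

lemma nb_count {n D b d₁ : ℕ} (hn : 1 ≤ n) (hb : 1 ≤ b) (F : Polynomial (MvPolynomial (Fin n) ℤ)) (hF : F.Monic) (hD : totalDeg F = D) (k : Fin n → ℤ)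
    (h0 : d₁ < F.natDegree) (hbad : ¬ Bad F d₁ k)
    (X : Finset (Fin n → ℤ)) (hX : ∀ x ∈ X, (∀ l, |x l| ≤ b) ∧ HasFac d₁ (LP F (fun l => (x l : AlgebraicClosure ℚ)) (fun l => (k l : AlgebraicClosure ℚ)))) :
    X.card ≤ EN D * 3^n * b^(n-1) := by
  unfold Bad at hbad
  push Not at hbad
  obtain ⟨Φ, hΦ, hne⟩ := hbad
  have hdeg : (NkG F _ _ Φ k).totalDegree ≤ EN D := by
    refine (NkG_tdeg F _ _ Φ k).trans ?_
    subst hD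
    refine le_trans ?_ (Finset.single_le_sum (f := fun δ => ∑ d₁ ∈ Finset.range δ, ∑ Φ ∈ NS δ (totalDeg F) d₁, Φ.totalDegree * totalDeg F) (fun _ _ => Nat.zero_le _) (a := F.natDegree)
      (Finset.mem_range.2 (by have := natDegree_le_tdeg F; omega)))
    refine le_trans ?_ (Finset.single_le_sum (f := fun d₁ => ∑ Φ ∈ NS F.natDegree (totalDeg F) d₁, Φ.totalDegree * totalDeg F) (fun _ _ => Nat.zero_le _) (Finset.mem_range.2 h0))
    exact Finset.single_le_sum (f := fun Φ : MvPolynomial (Fin F.natDegree × Fin (totalDeg F+1)) ℤ => Φ.totalDegree * totalDeg F) (fun _ _ => Nat.zero_le _) hΦ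
  refine (zbox hn hb _ hne X fun x hx => ⟨(hX x hx).1, ?_⟩).trans ?_
  · have h1 := (LP_fac_iff hF d₁ _ _).1 (hX x hx).2 Φ hΦ
    rw [← NkG_ev] at h1
    have h2 := RingHom.congr_fun (evz_comp (Int.castRingHom (AlgebraicClosure ℚ)) x) (NkG F _ _ Φ k)
    simp only [RingHom.comp_apply, eq_intCast] at h2
    rw [h1] at h2
    exact_mod_cast h2
  · exact Nat.mul_le_mul_right _ (Nat.mul_le_mul_right _ hdeg)

lemma LP_shift {R : Type} [CommRing R] {n : ℕ} (F : Polynomial (MvPolynomial (Fin n) ℤ)) (x k : Fin n → R) (t : R) :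
    LP F (fun l => x l + t * k l) k = (LP F x k).map (compRingHom (X + C t)) := by
  rw [LP, LP, Polynomial.map_map]
  congr 1
  refine mvhom_ext fun l => ?_
  simp
  ring

lemma bad_zero {n : ℕ} (F : Polynomial (MvPolynomial (Fin n) ℤ)) (hF : F.Monic) (hd : 2 ≤ F.natDegree) : Bad F 1 (fun _ => 0) := by
  intro Φ hΦ
  have hinj : Function.Injective (MvPolynomial.map (σ := Fin n) (Int.castRingHom (AlgebraicClosure ℚ))) := MvPolynomial.map_injective _ Int.cast_injective
  apply hinj
  rw [map_zero]
  refine MvPolynomial.funext fun x => ?_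
  rw [map_zero, MvPolynomial.eval_map]
  change evz x _ = 0
  rw [NkG_ev]
  refine (LP_fac_iff hF 1 _ _).1 ?_ Φ hΦ
  have e : LP F x (fun _ => ((0:ℤ) : AlgebraicClosure ℚ)) = (F.map (evz x)).map C := by
    rw [LP, Polynomial.map_map]
    congr 1
    refine mvhom_ext fun l => ?_
    simp
  rw [e]
  apply HasFac.map
  have hm : (F.map (evz x)).Monic := hF.map _
  have hdeg : (F.map (evz x)).degree ≠ 0 := by
    intro h
    have := natDegree_eq_zero_iff_degree_le_zero.2 h.le
    rw [hF.natDegree_map] at this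
    omega
  obtain ⟨a, ha⟩ := IsAlgClosed.exists_root _ hdeg
  obtain ⟨h, hh⟩ := dvd_iff_isRoot.2 ha
  exact ⟨X - C a, h, monic_X_sub_C a, (monic_X_sub_C a).of_mul_monic_left (hh ▸ hm), natDegree_X_sub_C a, hh⟩

lemma line_count {n b κ N : ℕ} (k : Fin n → ℤ) (i : Fin n) (hk : |k i| = κ) (hκ : 1 ≤ κ) (X : Finset (Fin n → ℤ)) (hX : ∀ x ∈ X, ∀ l, |x l| ≤ b)
    (h : ∀ r ∈ X.image (rp k i), ∀ T : Finset ℤ, (∀ t ∈ T, |t| ≤ (b/κ+1:ℕ) ∧ (fun l => r l + t * k l) ∈ X) → T.card ≤ N) : X.card ≤ N * (X.image (rp k i)).card := by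
  classical
  refine Finset.card_le_mul_card_image_of_maps_to (f := rp k i) (fun x hx => Finset.mem_image_of_mem _ hx) N fun r hr => ?_
  have hinj : Set.InjOn (fun x : Fin n → ℤ => x i / k i) (X.filter fun x => rp k i x = r : Finset _) := by
    intro x hx y hy hxy
    rw [Finset.mem_coe, Finset.mem_filter] at hx hy
    dsimp only at hxy
    rw [rp_add k i x, rp_add k i y, hx.2, hy.2, hxy]
  rw [← Finset.card_image_of_injOn hinj]
  refine h r hr _ fun t ht => ?_
  obtain ⟨x, hx, rfl⟩ := Finset.mem_image.1 ht
  rw [Finset.mem_filter] at hx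
  refine ⟨rp_q k i hk hκ x (hX x hx.1 i), ?_⟩
  rw [← hx.2, ← rp_add k i x]
  exact hx.1

lemma exists_max {n : ℕ} (k : Fin n → ℤ) (hk : k ≠ 0) : ∃ (i : Fin n) (κ : ℕ), |k i| = κ ∧ 1 ≤ κ ∧ ∀ l, |k l| ≤ κ := by
  obtain ⟨j, hj⟩ := Function.ne_iff.1 hk
  obtain ⟨i, -, hi⟩ := Finset.exists_max_image Finset.univ (fun l => (k l).natAbs) ⟨j, Finset.mem_univ _⟩
  refine ⟨i, (k i).natAbs, (Int.natCast_natAbs _).symm, ?_, fun l => ?_⟩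
  · have := hi j (Finset.mem_univ _)
    have h2 : k j ≠ 0 := hj
    omega
  · have := hi l (Finset.mem_univ _)
    rw [Int.abs_eq_natAbs]
    exact_mod_cast this

lemma line_val {n D b κ : ℕ} (hb : 1 ≤ b) (F : Polynomial (MvPolynomial (Fin n) ℤ)) (hD : totalDeg F = D) (hnorm : polyNorm F ≤ b) (k r : Fin n → ℤ) (hκ : 1 ≤ κ) (hκb : κ ≤ b) (hkl : ∀ l, |k l| ≤ κ)
    (hr : ∀ l, |r l| ≤ (3*b:ℕ)) (t : ℤ) (ht : |t| ≤ (b/κ+1:ℕ)) : (∀ l, |r l + t * k l| ≤ (5*b:ℕ)) ∧ ∀ j, |((LP F r k).coeff j).eval t| ≤ (((D+1)^n * 10^D) * b^(D+1) : ℕ) := by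
  have hbox : ∀ l, |r l + t * k l| ≤ (5*b:ℕ) := by
    intro l
    have h2 : |t * k l| ≤ (b/κ + 1 : ℕ) * (κ:ℤ) := by
      rw [abs_mul]; exact mul_le_mul ht (hkl l) (abs_nonneg _) (by positivity)
    have h3 : (b/κ + 1) * κ ≤ 2*b := by have := Nat.div_mul_le_self b κ; nlinarith
    have h4 : ((b/κ + 1 : ℕ):ℤ) * (κ:ℤ) ≤ 2*b := by exact_mod_cast h3
    have h5 := abs_add_le (r l) (t * k l)
    have h6 := hr l
    push_cast at h6 ⊢
    linarith
  refine ⟨hbox, fun j => ?_⟩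
  have h1 : ((LP F r k).coeff j).eval t = evz (fun l => r l + t * k l) (F.coeff j) := by
    have := congrArg (fun q => q.coeff j) (LP_eval F r k t)
    simpa using this
  rw [h1]
  refine (val_bound F hD (by omega : 1 ≤ 5*b) _ hbox j).trans ?_
  have : (D+1)^n * polyNorm F * (2*(5*b))^D ≤ ((D+1)^n * 10^D) * b^(D+1) := by
    calc _ ≤ (D+1)^n * b * (2*(5*b))^D := Nat.mul_le_mul_right _ (Nat.mul_le_mul_left _ hnorm)
      _ = _ := by rw [show 2*(5*b) = 10*b by ring, mul_pow]; ring
  exact_mod_cast this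

lemma pow_num {L M b G e0 a A k0 : ℕ} (hG : 1 ≤ G) (hM : M ≤ b^a) (hbG : b ≤ G^e0) (hk0 : e0*a*A ≤ 2*k0) :
    L^k0 * M^A ≤ ((Nat.sqrt L + 1) * G)^(2*k0) := by
  rw [mul_pow]
  refine Nat.mul_le_mul ?_ ?_
  · rw [pow_mul]
    refine Nat.pow_le_pow_left ?_ _
    rw [pow_two]; exact (Nat.lt_succ_sqrt L).le
  · calc M^A ≤ (b^a)^A := Nat.pow_le_pow_left hM _
      _ ≤ ((G^e0)^a)^A := Nat.pow_le_pow_left (Nat.pow_le_pow_left hbG _) _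
      _ = G^(e0*a*A) := by rw [← pow_mul, ← pow_mul, mul_assoc]
      _ ≤ _ := Nat.pow_le_pow_right hG hk0

end St

namespace St
open NC

lemma LP_castK {n : ℕ} (F : Polynomial (MvPolynomial (Fin n) ℤ)) (x k : Fin n → ℤ) {S : Type} [CommRing S] :
    (LP F x k).map (mapRingHom (Int.castRingHom S)) = LP F (fun l => (x l : S)) (fun l => (k l : S)) := by
  rw [LP_map]; rfl

lemma irr_of_nofac {n : ℕ} {F : Polynomial (MvPolynomial (Fin n) ℤ)} (hF : F.Monic) (hd : 1 ≤ F.natDegree) (r k : Fin n → ℤ) (t : ℤ)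
    (h : ∀ d₁, 0 < d₁ → d₁ < F.natDegree → ¬ HasFac d₁ (LP F (fun l => ((r l + t * k l : ℤ) : AlgebraicClosure ℚ)) (fun l => (k l : AlgebraicClosure ℚ)))) :
    Irreducible ((LP F r k).map (mapRingHom (Int.castRingHom ℚ))) := by
  have hm := (LP_monic hF r k).map (mapRingHom (Int.castRingHom ℚ))
  have hdeg : ((LP F r k).map (mapRingHom (Int.castRingHom ℚ))).natDegree = F.natDegree := by
    rw [(LP_monic hF r k).natDegree_map, LP_natDegree hF]
  rw [irr_iff_fac hm (by rw [hdeg]; exact hd)]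
  intro d₁ h0 h1 hfac
  rw [hdeg] at h1
  apply h d₁ h0 h1
  have h2 := hfac.map (mapRingHom (algebraMap ℚ (AlgebraicClosure ℚ)))
  rw [Polynomial.map_map, mapRingHom_comp, RingHom.ext_int ((algebraMap ℚ (AlgebraicClosure ℚ)).comp (Int.castRingHom ℚ)) (Int.castRingHom _), LP_castK] at h2
  have h3 := h2.map (compRingHom (X + C (t : AlgebraicClosure ℚ)))
  rw [← LP_shift] at h3
  simpa using h3

lemma hit_box_aux (n D e0 δ : ℕ) (hn : 1 ≤ n) (hδ : 2 ≤ δ) : ∃ C b0 : ℕ, ∀ F : Polynomial (MvPolynomial (Fin n) ℤ), F.Monic → AbsIrred F → F.natDegree = δ → totalDeg F = D →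
    ∀ b G : ℕ, b0 ≤ b → polyNorm F ≤ b → 1 ≤ G → b ≤ G^e0 → ∀ X : Finset (Fin n → ℤ), (∀ x ∈ X, (∀ l, |x l| ≤ b) ∧ ¬ Irreducible (F.map (evz x))) →
    X.card ≤ C * (b^(n-1) * ((Nat.sqrt b + 1) * G)) := by
  classical
  obtain ⟨E, hE⟩ := bert n D
  obtain ⟨A, hA⟩ := hit1 δ D (by omega)
  set k0 := e0*(D+2)*A + 1 with hk0
  obtain ⟨Cc, hCc⟩ := hA k0 (by omega)
  set K0 := (D+1)^n * 10^D with hK0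
  refine ⟨δ * (EN D * 3^n) + 2*Cc*E*7^n, K0 + E + 2, ?_⟩
  intro F hF habs hdeg hD b G hb hnorm hG hbG X hX
  obtain ⟨w, hwE, hw⟩ := hE F hF habs hD
  have hw0 : (fun l => (w l : ℤ)) ≠ 0 := by
    intro h
    have h1 := bad_zero F hF (by omega)
    apply hw 1 one_pos (by omega)
    rw [h]; exact h1
  obtain ⟨k, hkdef⟩ : ∃ k : Fin n → ℤ, (fun l => (w l : ℤ)) = k := ⟨_, rfl⟩
  simp only [hkdef] at hw hw0
  obtain ⟨i, κ, hki, hκ, hkl⟩ := exists_max k hw0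
  have hκE : κ ≤ E := by
    have h1 := hwE i
    have h2 : k i = (w i : ℤ) := by rw [← hkdef]
    rw [h2] at hki
    rw [abs_of_nonneg (by positivity)] at hki
    omega
  have hb1 : 1 ≤ b := by omega
  set X1 := X.filter fun x => ∃ d₁, 0 < d₁ ∧ d₁ < δ ∧ HasFac d₁ (LP F (fun l => (x l : AlgebraicClosure ℚ)) (fun l => (k l : AlgebraicClosure ℚ))) with hX1
  set X2 := X.filter fun x => ¬ ∃ d₁, 0 < d₁ ∧ d₁ < δ ∧ HasFac d₁ (LP F (fun l => (x l : AlgebraicClosure ℚ)) (fun l => (k l : AlgebraicClosure ℚ))) with hX2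
  have hcard : X.card = X1.card + X2.card := (Finset.card_filter_add_card_filter_not _).symm
  have h1 : X1.card ≤ δ * (EN D * 3^n * b^(n-1)) := by
    have hsub : X1 ⊆ ((Finset.range δ).filter (0 < ·)).biUnion fun d₁ => X.filter fun x => HasFac d₁ (LP F (fun l => (x l : AlgebraicClosure ℚ)) (fun l => (k l : AlgebraicClosure ℚ))) := by
      intro x hx
      rw [hX1, Finset.mem_filter] at hx
      obtain ⟨hx, d₁, h0, h1, h2⟩ := hx
      rw [Finset.mem_biUnion]
      exact ⟨d₁, Finset.mem_filter.2 ⟨Finset.mem_range.2 h1, h0⟩, Finset.mem_filter.2 ⟨hx, h2⟩⟩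
    refine (Finset.card_le_card hsub).trans ((Finset.card_biUnion_le_card_mul _ _ (EN D * 3^n * b^(n-1)) ?_).trans ?_)
    · intro d₁ hd₁
      rw [Finset.mem_filter, Finset.mem_range] at hd₁
      refine nb_count hn hb1 F hF hD k (by omega) (hw d₁ hd₁.2 (by omega)) _ fun x hx => ?_
      rw [Finset.mem_filter] at hx
      exact ⟨(hX x hx.1).1, hx.2⟩
    · exact Nat.mul_le_mul_right _ ((Finset.card_filter_le _ _).trans (by simp))
  have h2 : X2.card ≤ (Cc * ((Nat.sqrt (b/κ+1) + 1) * G)) * (X2.image (rp k i)).card := by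
    refine line_count (b := b) k i hki hκ X2 (fun x hx => (hX x (Finset.mem_filter.1 hx).1).1) ?_
    intro r hr T hT
    rcases Finset.eq_empty_or_nonempty T with rfl | ⟨t0, ht0⟩
    · simp
    obtain ⟨x, hx, rfl⟩ := Finset.mem_image.1 hr
    have hrbox := rp_box k i hki hkl hκ (by omega : κ ≤ b) x (hX x (Finset.mem_filter.1 hx).1).1
    generalize rp k i x = r at hT hrbox
    have hval := fun t ht => line_val hb1 F hD hnorm k r hκ (by omega) hkl hrbox t ht
    refine hCc (LP F r k) (LP_monic hF r k) ((LP_natDegree hF r k).trans hdeg) (fun j => hD ▸ LP_tdeg F r k j) ?_ (b/κ+1) (K0*b^(D+1)+1) _ (Nat.le_add_left 1 _) ?_ ?_ ?_ ?_ T ?_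
    · have h3 := (hT t0 ht0).2
      rw [hX2, Finset.mem_filter] at h3
      refine irr_of_nofac hF (by omega) r k t0 fun d₁ h0 h1 hf => h3.2 ⟨d₁, h0, by omega, hf⟩
    · have : 0 < K0 * b^(D+1) := by positivity
      omega
    · exact Nat.mul_pos (by omega) hG
    · intro t ht j
      refine ((hval t ht).2 j).trans ?_
      exact_mod_cast Nat.le_succ _
    · refine pow_num (b := b) (e0 := e0) (a := D+2) hG ?_ hbG (by omega)
      have h4 : 1 ≤ b^(D+1) := Nat.one_le_pow _ _ (by omega)
      calc K0*b^(D+1)+1 ≤ (K0+1) * b^(D+1) := by linarith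
        _ ≤ b * b^(D+1) := Nat.mul_le_mul_right _ (by omega)
        _ = b^(D+2) := by ring
    · intro t ht
      refine ⟨(hT t ht).1, ?_⟩
      rw [LP_eval]
      exact (hX _ (Finset.mem_filter.1 (hT t ht).2).1).2
  have h3 := rp_image_card k i hki hkl hκ (by omega : κ ≤ b) X2 (fun x hx => (hX x (Finset.mem_filter.1 hx).1).1)
  have h4 : Nat.sqrt (b/κ+1) + 1 ≤ 2*(Nat.sqrt b + 1) := by
    have h5 : b/κ + 1 ≤ b + 1 := by have := Nat.div_le_self b κ; omega
    have h6 : Nat.sqrt (b/κ+1) ≤ Nat.sqrt b + 1 := (Nat.sqrt_le_sqrt h5).trans (by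
      have := Nat.sqrt_succ_le_succ_sqrt b; simpa using this)
    omega
  have h5 : X2.card ≤ 2*Cc*E*7^n * (b^(n-1) * ((Nat.sqrt b + 1) * G)) := by
    calc X2.card ≤ (Cc * ((Nat.sqrt (b/κ+1) + 1) * G)) * (X2.image (rp k i)).card := h2
      _ ≤ (Cc * ((2*(Nat.sqrt b + 1)) * G)) * (E * (7^n * b^(n-1))) := by
        refine Nat.mul_le_mul (Nat.mul_le_mul_left _ (Nat.mul_le_mul_right _ h4)) (h3.trans (Nat.mul_le_mul hκE ?_))
        rw [mul_pow]
        exact Nat.mul_le_mul_right _ (Nat.pow_le_pow_right (by omega) (by omega))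
      _ = _ := by ring
  have h6 : X1.card ≤ δ * (EN D * 3^n) * (b^(n-1) * ((Nat.sqrt b + 1) * G)) := by
    calc X1.card ≤ δ * (EN D * 3^n) * b^(n-1) := by rw [mul_assoc]; exact h1
      _ ≤ _ := Nat.mul_le_mul_left _ (Nat.le_mul_of_pos_right _ (Nat.mul_pos (by omega) hG))
  rw [hcard, add_mul]
  exact add_le_add h6 h5

lemma hit_box (n D e0 : ℕ) (hn : 1 ≤ n) : ∃ C b0 : ℕ, ∀ F : Polynomial (MvPolynomial (Fin n) ℤ), F.Monic → AbsIrred F → 2 ≤ F.natDegree → totalDeg F = D →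
    ∀ b G : ℕ, b0 ≤ b → polyNorm F ≤ b → 1 ≤ G → b ≤ G^e0 → ∀ X : Finset (Fin n → ℤ), (∀ x ∈ X, (∀ l, |x l| ≤ b) ∧ ¬ Irreducible (F.map (evz x))) →
    X.card ≤ C * (b^(n-1) * ((Nat.sqrt b + 1) * G)) := by
  have h := fun δ : ℕ => hit_box_aux n D e0 (δ+2) hn (by omega)
  choose C b0 hC using h
  refine ⟨∑ δ ∈ Finset.range (D+1), C δ, ∑ δ ∈ Finset.range (D+1), b0 δ, ?_⟩
  intro F hF habs hdeg hD b G hb hnorm hG hbG X hX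
  have h1 := deg_le_D F
  have h2 : F.natDegree - 2 ∈ Finset.range (D+1) := by rw [Finset.mem_range]; omega
  have h3 : b0 (F.natDegree - 2) ≤ b := (Finset.single_le_sum (f := b0) (fun _ _ => Nat.zero_le _) h2).trans hb
  refine (hC (F.natDegree - 2) F hF habs (by omega) hD b G h3 hnorm hG hbG X hX).trans (Nat.mul_le_mul_right _ ?_)
  exact Finset.single_le_sum (f := C) (fun _ _ => Nat.zero_le _) h2

end St

namespace St
open NC

lemma sq_num {L b κ : ℕ} (hL : 1 ≤ L) (hb : 1 ≤ b) (hκ : 1 ≤ κ) (h : b ≤ κ * L) :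
    (Nat.sqrt L + 1) * (Nat.sqrt (5*b) + 1) ≤ 9 * (κ * L) := by
  have key : ∀ a : ℕ, 1 ≤ a → (Nat.sqrt a + 1)^2 ≤ 4 * a := by
    intro a ha
    have h1 := Nat.sqrt_le' a
    have h2 : 1 ≤ Nat.sqrt a := Nat.sqrt_pos.2 ha
    nlinarith
  have h1 := key L hL
  have h2 := key (5*b) (by omega)
  have h3 : (Nat.sqrt (5*b) + 1)^2 ≤ 20 * (κ * L) := by omega
  by_contra hcon
  push Not at hcon
  have h4 : (9 * (κ * L))^2 < ((Nat.sqrt L + 1) * (Nat.sqrt (5*b) + 1))^2 := Nat.pow_lt_pow_left hcon (by norm_num)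
  rw [mul_pow (Nat.sqrt L + 1)] at h4
  have h5 := Nat.mul_le_mul h1 h3
  have h6 : L ≤ κ * L := Nat.le_mul_of_pos_left _ hκ
  have h7 : L * (κ * L) ≤ (κ * L) * (κ * L) := Nat.mul_le_mul_right _ h6
  nlinarith

lemma hasFac_one_of_root {R : Type} [CommRing R] [IsDomain R] {f : R[X]} (hf : f.Monic) (ρ : R) (h : f.eval ρ = 0) : HasFac 1 f := by
  obtain ⟨g, hg⟩ := dvd_iff_isRoot.2 h
  exact ⟨X - C ρ, g, monic_X_sub_C ρ, (monic_X_sub_C ρ).of_mul_monic_left (hg ▸ hf), natDegree_X_sub_C ρ, hg⟩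

lemma fac_shift {n : ℕ} {F : Polynomial (MvPolynomial (Fin n) ℤ)} {d₁ : ℕ} (r k : Fin n → ℤ) (t : ℤ) (h : HasFac d₁ (LP F r k)) :
    HasFac d₁ (LP F (fun l => ((r l + t * k l : ℤ) : AlgebraicClosure ℚ)) (fun l => (k l : AlgebraicClosure ℚ))) := by
  have h2 := h.map (mapRingHom (Int.castRingHom (AlgebraicClosure ℚ)))
  rw [LP_castK] at h2
  have h3 := h2.map (compRingHom (X + C (t : AlgebraicClosure ℚ)))
  rw [← LP_shift] at h3
  simpa using h3

lemma LP_evalEval {n : ℕ} (F : Polynomial (MvPolynomial (Fin n) ℤ)) (r k : Fin n → ℤ) (t y : ℤ) :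
    evalEval t y (LP F r k) = (F.map (evz (fun l => r l + t * k l))).eval y := by
  rw [← LP_eval, ← Polynomial.map_evalRingHom_eval]

/-- case (c) : lines with irreducible restriction -/
lemma dcase_c {n D b κ d₁ : ℕ} (F : Polynomial (MvPolynomial (Fin n) ℤ)) (hF : F.Monic) (hD : totalDeg F = D)
    (k : Fin n → ℤ) (i : Fin n) (hki : |k i| = κ) (hκ : 1 ≤ κ) (hκb : κ ≤ b) (hkl : ∀ l, |k l| ≤ κ) (h0 : 0 < d₁) (h1 : d₁ < F.natDegree) (hbad : Bad F d₁ k)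
    (X : Finset (Fin n → ℤ)) (hX : ∀ x ∈ X, (∀ l, |x l| ≤ b) ∧ (∃ y : ℤ, (F.map (evz x)).eval y = 0) ∧ Irreducible ((LP F (rp k i x) k).map (mapRingHom (Int.castRingHom ℚ)))) :
    X.card ≤ (2*(D*((D + D*D) + D*D))) * (κ * (7*b)^(n-1)) := by
  classical
  have h2 := line_count (b := b) (N := 2*(D*((D + D*D) + D*D))) k i hki hκ X (fun x hx => (hX x hx).1) (by
    intro r hr T hT
    obtain ⟨x, hx, rfl⟩ := Finset.mem_image.1 hr
    have hirr := (hX x hx).2.2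
    generalize rp k i x = r at hT hirr
    have hδ : F.natDegree ≤ D := hD ▸ deg_le_D F
    refine (lam_count (e := D) (LP F r k) (LP_monic hF r k) (LP_natDegree hF r k) (fun j => hD ▸ LP_tdeg F r k j) hirr h0 h1 ?_ T ?_).trans ?_
    · rw [LP_castK]; exact hbad.fac hF _
    · intro t ht
      obtain ⟨y, hy⟩ := (hX _ (hT t ht).2).2.1
      exact ⟨y, by rw [LP_evalEval]; exact hy⟩
    · gcongr)
  exact h2.trans (Nat.mul_le_mul_left _ (rp_image_card k i hki hkl hκ hκb X (fun x hx => (hX x hx).1)))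

/-- case (b) : lines with reducible restriction without polynomial roots -/
lemma dcase_b (n D e0 : ℕ) (hn : 1 ≤ n) : ∃ C b0 : ℕ, ∀ F : Polynomial (MvPolynomial (Fin n) ℤ), F.Monic → AbsIrred F → 2 ≤ F.natDegree → totalDeg F = D →
    ∀ b G κ : ℕ, b0 ≤ b → polyNorm F ≤ b → 1 ≤ G → 5*b ≤ G^e0 → ∀ (k : Fin n → ℤ) (i : Fin n), |k i| = κ → 1 ≤ κ → κ ≤ b → (∀ l, |k l| ≤ κ) →
    ∀ X : Finset (Fin n → ℤ), (∀ x ∈ X, (∀ l, |x l| ≤ b) ∧ (∃ y : ℤ, (F.map (evz x)).eval y = 0) ∧ ¬ Irreducible ((LP F (rp k i x) k).map (mapRingHom (Int.castRingHom ℚ)))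
      ∧ ¬ HasFac 1 (LP F (fun l => (x l : AlgebraicClosure ℚ)) (fun l => (k l : AlgebraicClosure ℚ)))) →
    X.card ≤ C * (κ * G^2 * b^(n-1)) := by
  classical
  obtain ⟨C1, hC1⟩ := bpfac D D (e0*(D+3)*(2*D)+1) (by omega)
  obtain ⟨C2, b0, hC2⟩ := hit_box n D e0 hn
  obtain ⟨K0, hK0⟩ : ∃ K0, K0 = (D+1)^n * 10^D := ⟨_, rfl⟩
  refine ⟨C1*C2*5^n*9, b0 + 2*K0 + 4, ?_⟩
  intro F hF habs hdeg hD b G κ hb hnorm hG hbG k i hki hκ hκb hkl X hX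
  have hb1 : 1 ≤ b := by omega
  obtain ⟨L, hL⟩ : ∃ L, L = b/κ+1 := ⟨_, rfl⟩
  have hL1 : 1 ≤ L := by rw [hL]; exact Nat.le_add_left 1 _
  have hbL : b ≤ κ * L := by rw [hL]; exact (Nat.lt_mul_div_succ b (by omega)).le
  have h2 : X.card ≤ (C1 * ((Nat.sqrt L + 1) * G)) * (X.image (rp k i)).card := by
    refine line_count (b := b) k i hki hκ X (fun x hx => (hX x hx).1) ?_
    intro r hr T hT
    rcases Finset.eq_empty_or_nonempty T with rfl | ⟨t0, ht0⟩
    · simp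
    obtain ⟨x, hx, rfl⟩ := Finset.mem_image.1 hr
    have hrbox := rp_box k i hki hkl hκ hκb x (hX x hx).1
    generalize rp k i x = r at hT hrbox
    have hval := fun t ht => line_val hb1 F hD hnorm k r hκ hκb hkl hrbox t ht
    rw [← hL, ← hK0] at hval
    refine hC1 (LP F r k) (LP_monic hF r k) ((LP_natDegree hF r k).trans_le (hD ▸ deg_le_D F)) (fun j => hD ▸ LP_tdeg F r k j) L (K0*b^(D+1)+1) _ hL1 (Nat.le_add_left 1 _) ?_ ?_ ?_ T ?_
    · exact Nat.mul_pos (Nat.succ_pos _) hG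
    · exact RB_of_coeff _ (LP_monic hF r k) _ _ fun t ht j _ => (hval t ht).2 j
    · refine pow_num (b := b) (e0 := e0) (a := D+3) hG ?_ (by omega) (by omega)
      have h4 : 1 ≤ b^(D+1) := Nat.one_le_pow _ _ (by omega)
      calc 2*(K0*b^(D+1)+1) ≤ (2*K0+2) * b^(D+1) := by linarith
        _ ≤ b * b^(D+1) := Nat.mul_le_mul_right _ (by omega)
        _ = b^(D+2) := by ring
        _ ≤ b^(D+3) := Nat.pow_le_pow_right (by omega) (by omega)
    · intro t ht
      obtain ⟨h5, h6⟩ := hT t ht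
      obtain ⟨_, ⟨y, hy⟩, _, hno⟩ := hX _ h6
      refine ⟨by rw [hL]; exact h5, y, by rw [LP_evalEval]; exact hy, fun ρ hρ => ?_⟩
      exact absurd (fac_shift r k t (hasFac_one_of_root (LP_monic hF r k) ρ hρ)) hno
  have h3 : (X.image (rp k i)).card * L ≤ C2 * ((5*b)^(n-1) * ((Nat.sqrt (5*b) + 1) * G)) := by
    have hinj : Set.InjOn (fun p : (Fin n → ℤ) × ℕ => (fun l => p.1 l + (p.2 : ℤ) * k l : Fin n → ℤ)) ((X.image (rp k i) ×ˢ Finset.range L : Finset ((Fin n → ℤ) × ℕ)) : Set ((Fin n → ℤ) × ℕ)) := by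
      rintro ⟨r, t⟩ h ⟨r', t'⟩ h' heq
      rw [Finset.mem_coe, Finset.mem_product] at h h'
      obtain ⟨x, _, hx⟩ := Finset.mem_image.1 h.1
      obtain ⟨x', _, hx'⟩ := Finset.mem_image.1 h'.1
      have hr := rp_i k i hki hκ x
      have hr' := rp_i k i hki hκ x'
      simp only at hx hx' heq
      rw [hx] at hr
      rw [hx'] at hr'
      have e1 := rp_line k i hki hκ r hr t
      have e2 := rp_line k i hki hκ r' hr' t'
      rw [heq] at e1
      have e3 := congrFun heq i
      rw [e3] at e1
      have e4 : r = r' := e1.2.symm.trans e2.2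
      have e5 : (t:ℤ) = t' := e1.1.symm.trans e2.1
      rw [e4, Nat.cast_injective e5]
    have hc := Finset.card_image_of_injOn hinj
    rw [Finset.card_product, Finset.card_range] at hc
    rw [← hc]
    refine hC2 F hF habs hdeg hD (5*b) G (by omega) (by omega) hG hbG _ ?_
    intro z hz
    obtain ⟨⟨r, t⟩, hp, rfl⟩ := Finset.mem_image.1 hz
    rw [Finset.mem_product, Finset.mem_range] at hp
    obtain ⟨hr, ht⟩ := hp
    obtain ⟨x, hx, hrx⟩ := Finset.mem_image.1 hr
    simp only at hrx ht ⊢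
    have hrbox := rp_box k i hki hkl hκ hκb x (hX x hx).1
    have hred := (hX x hx).2.2.1
    rw [hrx] at hred
    have hrbox' : ∀ l, |r l| ≤ (3*b:ℕ) := by rw [← hrx]; exact hrbox
    refine ⟨(line_val hb1 F hD hnorm k r hκ hκb hkl hrbox' t ?_).1, ?_⟩
    · rw [Nat.abs_cast, ← hL]; exact_mod_cast ht.le
    · intro hirr
      apply hred
      apply irr_Q_of_irr (LP_monic hF r k)
      rw [irr_iff_fac (LP_monic hF r k) (by rw [LP_natDegree hF]; omega)]
      intro d₁ h0 h1 hf
      have hf2 := hf.map (evalRingHom (t:ℤ))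
      rw [LP_eval] at hf2
      rw [LP_natDegree hF] at h1
      rw [irr_iff_fac (hF.map _) (by rw [hF.natDegree_map]; omega)] at hirr
      exact hirr d₁ h0 (by rw [hF.natDegree_map]; exact h1) hf2
  have h4 := sq_num hL1 hb1 hκ hbL
  refine Nat.le_of_mul_le_mul_right (c := L) ?_ hL1
  calc X.card * L ≤ ((C1 * ((Nat.sqrt L + 1) * G)) * (X.image (rp k i)).card) * L := Nat.mul_le_mul_right _ h2
    _ = (C1 * ((Nat.sqrt L + 1) * G)) * ((X.image (rp k i)).card * L) := by ring
    _ ≤ (C1 * ((Nat.sqrt L + 1) * G)) * (C2 * ((5*b)^(n-1) * ((Nat.sqrt (5*b) + 1) * G))) := Nat.mul_le_mul_left _ h3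
    _ = C1*C2*(5*b)^(n-1)*G^2*((Nat.sqrt L + 1) * (Nat.sqrt (5*b) + 1)) := by ring
    _ ≤ C1*C2*(5^n*b^(n-1))*G^2*(9 * (κ * L)) := by
      refine Nat.mul_le_mul (Nat.mul_le_mul_right _ (Nat.mul_le_mul_left _ ?_)) h4
      rw [mul_pow]
      exact Nat.mul_le_mul_right _ (Nat.pow_le_pow_right (by omega) (by omega))
    _ = _ := by ring

theorem dcase (n D e0 : ℕ) (hn : 1 ≤ n) : ∃ C b0 : ℕ, ∀ F : Polynomial (MvPolynomial (Fin n) ℤ), IsAllowable F → 2 ≤ F.natDegree → totalDeg F = D →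
    ∀ b G V : ℕ, b0 ≤ b → polyNorm F ≤ b → 1 ≤ G → 5*b ≤ G^e0 → V ≤ b → ∀ (k : Fin n → ℤ), k ≠ 0 → (∀ l, |k l| < V) →
    ∀ d₁, 0 < d₁ → d₁ < F.natDegree → Bad F d₁ k →
    ∀ X : Finset (Fin n → ℤ), (∀ x ∈ X, (∀ l, |x l| ≤ b) ∧ (∃ y : ℤ, (F.map (evz x)).eval y = 0)) →
    X.card ≤ C * (V * G^2 * b^(n-1)) := by
  classical
  obtain ⟨C1, b0, hC1⟩ := dcase_b n D e0 hn
  refine ⟨EN D * 3^n + (C1 + 2*(D*((D + D*D) + D*D))*7^n), b0 + 1, ?_⟩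
  intro F hall hdeg hD b G V hb hnorm hG hbG hVb k hk hkV d₁ h0 h1 hbad X hX
  have hF : F.Monic := hall.2.1
  obtain ⟨i, κ, hki, hκ, hkl⟩ := exists_max k hk
  have hκV : κ ≤ V := by have := hkV i; rw [hki] at this; omega
  have hκb : κ ≤ b := hκV.trans hVb
  obtain ⟨Xa, hXa⟩ : ∃ Xa, Xa = X.filter fun x => HasFac 1 (LP F (fun l => (x l : AlgebraicClosure ℚ)) (fun l => (k l : AlgebraicClosure ℚ))) := ⟨_, rfl⟩
  obtain ⟨Y, hY⟩ : ∃ Y, Y = X.filter fun x => ¬ HasFac 1 (LP F (fun l => (x l : AlgebraicClosure ℚ)) (fun l => (k l : AlgebraicClosure ℚ))) := ⟨_, rfl⟩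
  obtain ⟨Xc, hXc⟩ : ∃ Xc, Xc = Y.filter fun x => Irreducible ((LP F (rp k i x) k).map (mapRingHom (Int.castRingHom ℚ))) := ⟨_, rfl⟩
  obtain ⟨Xb, hXb⟩ : ∃ Xb, Xb = Y.filter fun x => ¬ Irreducible ((LP F (rp k i x) k).map (mapRingHom (Int.castRingHom ℚ))) := ⟨_, rfl⟩
  have hc1 : X.card = Xa.card + Y.card := by rw [hXa, hY]; exact (Finset.card_filter_add_card_filter_not _).symm
  have hc2 : Y.card = Xc.card + Xb.card := by rw [hXc, hXb]; exact (Finset.card_filter_add_card_filter_not _).symm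
  have ha : Xa.card ≤ EN D * 3^n * b^(n-1) := by
    refine nb_count hn (by omega) F hF hD k (by omega) (alg_nb hall hk) Xa fun x hx => ?_
    rw [hXa, Finset.mem_filter] at hx
    exact ⟨(hX x hx.1).1, hx.2⟩
  have hbb : Xb.card ≤ C1 * (κ * G^2 * b^(n-1)) := by
    refine hC1 F hF hall.1 hdeg hD b G κ (by omega) hnorm hG hbG k i hki hκ hκb hkl Xb fun x hx => ?_
    rw [hXb, Finset.mem_filter, hY, Finset.mem_filter] at hx
    exact ⟨(hX x hx.1.1).1, (hX x hx.1.1).2, hx.2, hx.1.2⟩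
  have hcc : Xc.card ≤ (2*(D*((D + D*D) + D*D))) * (κ * (7*b)^(n-1)) := by
    refine dcase_c F hF hD k i hki hκ hκb hkl h0 h1 hbad Xc fun x hx => ?_
    rw [hXc, Finset.mem_filter, hY, Finset.mem_filter] at hx
    exact ⟨(hX x hx.1.1).1, (hX x hx.1.1).2, hx.2⟩
  have hG2 : 1 ≤ G^2 := Nat.one_le_pow _ _ hG
  have hV1 : 1 ≤ V := hκ.trans hκV
  have e1 : b^(n-1) ≤ V * G^2 * b^(n-1) := Nat.le_mul_of_pos_left _ (Nat.mul_pos hV1 hG2)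
  have e2 : κ * G^2 * b^(n-1) ≤ V * G^2 * b^(n-1) := Nat.mul_le_mul_right _ (Nat.mul_le_mul_right _ hκV)
  have e3 : κ * (7*b)^(n-1) ≤ 7^n * (V * G^2 * b^(n-1)) := by
    calc κ * (7*b)^(n-1) = 7^(n-1) * (κ * 1 * b^(n-1)) := by rw [mul_pow]; ring
      _ ≤ 7^n * (V * G^2 * b^(n-1)) := by
        refine Nat.mul_le_mul (Nat.pow_le_pow_right (by omega) (by omega)) (Nat.mul_le_mul_right _ (Nat.mul_le_mul hκV hG2))
  rw [hc1, hc2, add_mul, add_mul]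
  refine add_le_add (ha.trans (Nat.mul_le_mul_left _ e1)) ?_
  rw [add_comm]
  refine add_le_add (hbb.trans (Nat.mul_le_mul_left _ e2)) (hcc.trans ?_)
  rw [mul_assoc (2*(D*((D + D*D) + D*D)))]
  exact Nat.mul_le_mul_left _ e3

end St

namespace St
open NC

lemma sieve_num {n : ℕ} {N C β v η ε : ℝ} (hβ : 1 ≤ β) (hC : 0 < C) (hv1 : 1 ≤ v) (hv2 : v ≤ β^(1/((n:ℝ)+1))) (hv3 : β^(1/((n:ℝ)+1)) ≤ 2*v) (hη : 0 < η) (hηε : 4*n*η ≤ ε)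
    (h : N * v^n ≤ C * β^n * (v^n)^(4*η)) : N ≤ C*2^n * β^((n:ℝ) - 1 + 1/((n:ℝ)+1) + ε) := by
  have hβ0 : 0 < β := by linarith
  have hv0 : 0 < v := by linarith
  have hn1 : (0:ℝ) < (n:ℝ)+1 := by positivity
  have h1 : (v^n)^(4*η) ≤ β^ε := by
    rw [← Real.rpow_natCast v n, ← Real.rpow_mul hv0.le]
    have hvβ : v ≤ β := hv2.trans (by
      conv_rhs => rw [← Real.rpow_one β]
      apply Real.rpow_le_rpow_of_exponent_le hβ
      rw [div_le_one hn1]; linarith [(Nat.cast_nonneg n : (0:ℝ) ≤ n)])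
    calc v^((n:ℝ)*(4*η)) ≤ β^((n:ℝ)*(4*η)) := Real.rpow_le_rpow hv0.le hvβ (by positivity)
      _ ≤ β^ε := Real.rpow_le_rpow_of_exponent_le hβ (by linarith)
  have h2 : β^((n:ℝ)/((n:ℝ)+1)) ≤ 2^n * v^n := by
    rw [← mul_pow]
    calc β^((n:ℝ)/((n:ℝ)+1)) = (β^(1/((n:ℝ)+1)))^n := by
          rw [← Real.rpow_natCast (β^(1/((n:ℝ)+1))) n, ← Real.rpow_mul hβ0.le]; congr 1; ring
      _ ≤ (2*v)^n := pow_le_pow_left₀ (by positivity) hv3 n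
  have h3 : β^n = β^((n:ℝ) - 1 + 1/((n:ℝ)+1)) * β^((n:ℝ)/((n:ℝ)+1)) := by
    rw [← Real.rpow_add hβ0, ← Real.rpow_natCast β n]
    congr 1
    field_simp
    ring
  have hvn : 0 < v^n := by positivity
  refine le_of_mul_le_mul_right ?_ hvn
  calc N * v^n ≤ C * β^n * (v^n)^(4*η) := h
    _ ≤ C * β^n * β^ε := by gcongr
    _ = C * (β^((n:ℝ) - 1 + 1/((n:ℝ)+1)) * β^((n:ℝ)/((n:ℝ)+1))) * β^ε := by rw [← h3]
    _ ≤ C * (β^((n:ℝ) - 1 + 1/((n:ℝ)+1)) * (2^n * v^n)) * β^ε := by gcongr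
    _ = C*2^n * β^((n:ℝ) - 1 + 1/((n:ℝ)+1) + ε) * v^n := by rw [Real.rpow_add hβ0 _ ε]; ring

lemma exists_V (n b : ℕ) (hb : 1 ≤ b) : ∃ V : ℕ, 1 ≤ V ∧ (V:ℝ) ≤ (b:ℝ)^(1/((n:ℝ)+1)) ∧ (b:ℝ)^(1/((n:ℝ)+1)) ≤ 2*(V:ℝ) ∧ V^(n+1) ≤ b ∧ b ≤ (2*V)^(n+1) ∧
    ∀ V0 : ℕ, V0^(n+1) ≤ b → V0 ≤ V := by
  have hβ : (1:ℝ) ≤ b := by exact_mod_cast hb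
  have hn1 : (0:ℝ) < (n:ℝ)+1 := by positivity
  have hroot : ((b:ℝ)^(1/((n:ℝ)+1)))^(n+1) = b := by
    rw [← Real.rpow_natCast, ← Real.rpow_mul (by positivity)]
    push_cast
    rw [one_div, inv_mul_cancel₀ hn1.ne', Real.rpow_one]
  have h1 : (1:ℝ) ≤ (b:ℝ)^(1/((n:ℝ)+1)) := Real.one_le_rpow hβ (by positivity)
  generalize (b:ℝ)^(1/((n:ℝ)+1)) = ρ at hroot h1
  have hV1 : 1 ≤ ⌊ρ⌋₊ := Nat.le_floor (by simpa using h1)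
  have hle : (⌊ρ⌋₊ : ℝ) ≤ ρ := Nat.floor_le (by linarith)
  have hlt := Nat.lt_floor_add_one ρ
  have hV1' : (1:ℝ) ≤ ⌊ρ⌋₊ := by exact_mod_cast hV1
  have h2 : ρ ≤ 2*(⌊ρ⌋₊:ℝ) := by linarith
  refine ⟨⌊ρ⌋₊, hV1, hle, h2, ?_, ?_, ?_⟩
  · have := pow_le_pow_left₀ (by positivity) hle (n+1)
    rw [hroot] at this; exact_mod_cast this
  · have := pow_le_pow_left₀ (by linarith) h2 (n+1)
    rw [hroot] at this; exact_mod_cast this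
  · intro V0 h0
    apply Nat.le_floor
    refine le_of_pow_le_pow_left₀ (n := n+1) (by omega) (by linarith) ?_
    rw [hroot]; exact_mod_cast h0

lemma exists_G (e0 : ℕ) (he : 1 ≤ e0) (ε : ℝ) (hε : 2 ≤ e0 * ε) (b : ℕ) (hb : 1 ≤ b) : ∃ G : ℕ, 1 ≤ G ∧ 5*b ≤ G^e0 ∧ (G:ℝ)^2 ≤ 100 * (b:ℝ)^ε := by
  have hβ : (1:ℝ) ≤ b := by exact_mod_cast hb
  have he0 : (0:ℝ) < e0 := by exact_mod_cast he
  have hroot : ((5*(b:ℝ))^(1/(e0:ℝ)))^e0 = 5*b := by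
    rw [← Real.rpow_natCast, ← Real.rpow_mul (by positivity), one_div, inv_mul_cancel₀ he0.ne', Real.rpow_one]
  have h1 : (1:ℝ) ≤ (5*(b:ℝ))^(1/(e0:ℝ)) := Real.one_le_rpow (by linarith) (by positivity)
  have hsq : ((5*(b:ℝ))^(1/(e0:ℝ)))^2 ≤ 25 * (b:ℝ)^ε := by
    rw [Real.mul_rpow (by norm_num) (by positivity), mul_pow]
    have h5 : ((5:ℝ)^(1/(e0:ℝ)))^2 ≤ 5^2 := by
      refine pow_le_pow_left₀ (by positivity) ?_ 2
      conv_rhs => rw [← Real.rpow_one 5]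
      apply Real.rpow_le_rpow_of_exponent_le (by norm_num)
      rw [div_le_one he0]; exact_mod_cast he
    have h6 : ((b:ℝ)^(1/(e0:ℝ)))^2 ≤ (b:ℝ)^ε := by
      rw [← Real.rpow_natCast, ← Real.rpow_mul (by positivity)]
      apply Real.rpow_le_rpow_of_exponent_le hβ
      rw [div_mul_eq_mul_div, div_le_iff₀ he0]; push_cast; linarith
    calc _ ≤ (5:ℝ)^2 * (b:ℝ)^ε := mul_le_mul h5 h6 (by positivity) (by norm_num)
      _ = _ := by norm_num
  generalize (5*(b:ℝ))^(1/(e0:ℝ)) = ρ at hroot h1 hsq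
  have hle : ρ ≤ ⌈ρ⌉₊ := Nat.le_ceil ρ
  have hlt := Nat.ceil_lt_add_one (by linarith : 0 ≤ ρ)
  refine ⟨⌈ρ⌉₊, Nat.one_le_ceil_iff.2 (by linarith), ?_, ?_⟩
  · have := pow_le_pow_left₀ (by linarith) hle e0
    rw [hroot] at this; exact_mod_cast this
  · nlinarith

lemma d_num {n : ℕ} (hn : 1 ≤ n) {c v g β ε : ℝ} (hβ : 1 ≤ β) (hc : 0 ≤ c) (hv0 : 0 ≤ v) (hv : v ≤ β^(1/((n:ℝ)+1))) (hg0 : 0 ≤ g) (hg : g ≤ 100 * β^ε) :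
    c * (v * g * β^(n-1)) ≤ c * 100 * β^((n:ℝ) - 1 + 1/((n:ℝ)+1) + ε) := by
  have hβ0 : 0 < β := by linarith
  have h1 : β^(n-1) = β^((n:ℝ)-1) := by
    rw [← Real.rpow_natCast]; congr 1; push_cast [Nat.cast_sub hn]; ring
  calc c * (v * g * β^(n-1)) ≤ c * (β^(1/((n:ℝ)+1)) * (100 * β^ε) * β^(n-1)) := by gcongr
    _ = _ := by rw [h1, Real.rpow_add hβ0, Real.rpow_add hβ0]; ring

theorem core_count (n D : ℕ) (hn : 2 ≤ n) (ε : ℝ) (hε : 0 < ε) : ∃ C : ℝ, 0 < C ∧ ∃ b0 : ℕ, ∀ (m : ℕ) (F : Polynomial (MvPolynomial (Fin n) ℤ)), 2 ≤ m → 2 ≤ F.natDegree → IsAllowable F → HasForm n m F → totalDeg F = D →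
    ∀ b : ℕ, 1 ≤ b → b0 ≤ b → polyNorm F ≤ b → ∀ X : Finset (Fin n → ℤ), (∀ x ∈ X, (∀ l, |x l| ≤ b) ∧ ∃ y : ℤ, (F.map (evz x)).eval y = 0) →
    (X.card : ℝ) ≤ C * (b:ℝ)^((n:ℝ) - 1 + 1/((n:ℝ)+1) + ε) := by
  classical
  have hn0 : (0:ℝ) < n := by exact_mod_cast (by omega : 0 < n)
  obtain ⟨η, hη, hη4, hηε⟩ : ∃ η : ℝ, 0 < η ∧ η ≤ 1/4 ∧ 4*n*η ≤ ε := by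
    refine ⟨min (1/4) (ε/(4*n)), lt_min (by norm_num) (by positivity), min_le_left _ _, ?_⟩
    calc 4*(n:ℝ)*min (1/4) (ε/(4*n)) ≤ 4*n*(ε/(4*n)) := by gcongr; exact min_le_right _ _
      _ = ε := by field_simp
  obtain ⟨e0, he1, he2⟩ : ∃ e0 : ℕ, 1 ≤ e0 ∧ 2 ≤ (e0:ℝ)*ε := by
    refine ⟨⌈2/ε⌉₊, Nat.one_le_ceil_iff.2 (by positivity), ?_⟩
    rw [← div_le_iff₀ hε]; exact Nat.le_ceil _
  obtain ⟨C1, hC1, V0, hsv⟩ := sieve_count n D hn η hη hη4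
  obtain ⟨C2, b0, hdc⟩ := dcase n D e0 (by omega)
  refine ⟨C1*2^n + (C2:ℝ)*100 + ((D*3^n : ℕ):ℝ), by positivity, V0^(n+1) + b0, ?_⟩
  intro m F hm hd hall hform hD b hb1 hb hnorm X hX
  have hβ : (1:ℝ) ≤ b := by exact_mod_cast hb1
  obtain ⟨V, hV1, hVr, hVr2, hVb, hVb2, hVV0⟩ := exists_V n b hb1
  have hEpos : 0 ≤ (b:ℝ)^((n:ℝ) - 1 + 1/((n:ℝ)+1) + ε) := by positivity
  by_cases hgood : ∀ k : Fin n → ℤ, k ≠ 0 → (∀ l, |k l| < V) → ∀ d₁, 0 < d₁ → d₁ < F.natDegree → ¬ Bad F d₁ k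
  · obtain ⟨Z, hZ⟩ : ∃ Z, Z = X.filter fun x => evz x (F.coeff 0) = 0 := ⟨_, rfl⟩
    obtain ⟨Y, hY⟩ : ∃ Y, Y = X.filter fun x => ¬ evz x (F.coeff 0) = 0 := ⟨_, rfl⟩
    have hc : X.card = Z.card + Y.card := by rw [hZ, hY]; exact (Finset.card_filter_add_card_filter_not _).symm
    have h1 := hsv V b (hVV0 V0 (by omega)) hVb hVb2 m F hm hd hall.2.1 hform hD hnorm hgood Y (by
      intro x hx
      rw [hY, Finset.mem_filter] at hx
      exact ⟨(hX x hx.1).1, hx.2, (hX x hx.1).2⟩)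
    have h2 := sieve_num hβ hC1 (by exact_mod_cast hV1) hVr hVr2 hη hηε h1
    have h3 : Z.card ≤ (D*3^n) * b^(n-1) := by
      refine (zbox (by omega) hb1 (F.coeff 0) (form_expand hm hd hform).2.1 Z ?_).trans ?_
      · intro x hx
        rw [hZ, Finset.mem_filter] at hx
        exact ⟨(hX x hx.1).1, hx.2⟩
      · exact Nat.mul_le_mul_right _ (Nat.mul_le_mul_right _ (hD ▸ coeff_tdeg F 0))
    have h4 : (b:ℝ)^(n-1) ≤ (b:ℝ)^((n:ℝ) - 1 + 1/((n:ℝ)+1) + ε) := by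
      rw [← Real.rpow_natCast]
      apply Real.rpow_le_rpow_of_exponent_le hβ
      rw [Nat.cast_sub (by omega)]
      have : 0 ≤ 1/((n:ℝ)+1) := by positivity
      push_cast; linarith
    have h5 : (Z.card:ℝ) ≤ ((D*3^n : ℕ):ℝ) * (b:ℝ)^((n:ℝ) - 1 + 1/((n:ℝ)+1) + ε) := by
      calc (Z.card:ℝ) ≤ ((D*3^n : ℕ):ℝ) * (b:ℝ)^(n-1) := by exact_mod_cast h3
        _ ≤ _ := mul_le_mul_of_nonneg_left h4 (Nat.cast_nonneg _)
    rw [hc, add_mul, add_mul]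
    push_cast at h5 ⊢
    have : 0 ≤ (C2:ℝ)*100*(b:ℝ)^((n:ℝ) - 1 + 1/((n:ℝ)+1) + ε) := by positivity
    linarith
  · push Not at hgood
    obtain ⟨k, hk0, hkV, d₁, h0, h1, hbad⟩ := hgood
    obtain ⟨G, hG1, hGb, hG2⟩ := exists_G e0 he1 ε he2 b hb1
    have hVleb : V ≤ b := (Nat.le_self_pow (by omega) V).trans hVb
    have h2 := hdc F hall hd hD b G V (by omega) hnorm hG1 hGb hVleb k hk0 hkV d₁ h0 h1 hbad X hX
    have h3 : (X.card:ℝ) ≤ (C2:ℝ) * (V * (G:ℝ)^2 * (b:ℝ)^(n-1)) := by exact_mod_cast h2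
    have h4 := d_num (n := n) (by omega) hβ (Nat.cast_nonneg C2) (Nat.cast_nonneg V) hVr (sq_nonneg (G:ℝ)) hG2
    rw [add_mul, add_mul]
    have : 0 ≤ C1*2^n*(b:ℝ)^((n:ℝ) - 1 + 1/((n:ℝ)+1) + ε) := by positivity
    have : 0 ≤ ((D*3^n : ℕ):ℝ)*(b:ℝ)^((n:ℝ) - 1 + 1/((n:ℝ)+1) + ε) := by positivity
    linarith

end St

namespace St
open NC

lemma one_le_polyNorm {n : ℕ} {F : Polynomial (MvPolynomial (Fin n) ℤ)} (hF : F.Monic) : 1 ≤ polyNorm F := by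
  have h1 : F.natDegree ∈ F.support := by
    rw [mem_support_iff, hF.coeff_natDegree]; exact one_ne_zero
  have h2 : mvNorm (F.coeff F.natDegree) ≤ polyNorm F :=
    Finset.le_sup (f := fun k => mvNorm (F.coeff k)) h1
  refine le_trans ?_ h2
  rw [hF.coeff_natDegree]
  have h3 : (0 : Fin n →₀ ℕ) ∈ (1 : MvPolynomial (Fin n) ℤ).support := by
    rw [MvPolynomial.mem_support_iff]; simp
  refine le_trans ?_ (Finset.le_sup (f := fun m => ((1 : MvPolynomial (Fin n) ℤ).coeff m).natAbs) h3)
  simp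

lemma nfb_finset {n : ℕ} (F : Polynomial (MvPolynomial (Fin n) ℤ)) (B : ℝ) (hB : 1 ≤ B) :
    ∃ X : Finset (Fin n → ℤ), NFB F B = X.card ∧ X.card ≤ (2*⌊B⌋₊+1)^n ∧
      ∀ x ∈ X, (∀ l, |x l| ≤ (⌊B⌋₊:ℤ)) ∧ ∃ y : ℤ, (F.map (evz x)).eval y = 0 := by
  classical
  obtain ⟨b, hb⟩ : ∃ b, b = ⌊B⌋₊ := ⟨_, rfl⟩
  rw [← hb]
  have hbox : ∀ x : Fin n → ℤ, (∀ i, |(x i : ℝ)| ≤ B) → ∀ l, |x l| ≤ (b:ℤ) := by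
    intro x hx l
    have h1 := hx l
    have h2 : ((x l).natAbs : ℝ) ≤ B := by rw [Nat.cast_natAbs]; push_cast; exact h1
    have h3 : (x l).natAbs ≤ b := by rw [hb]; exact Nat.le_floor h2
    rw [Int.abs_eq_natAbs]; exact_mod_cast h3
  have hsub : {x : Fin n → ℤ | (∀ i, |(x i : ℝ)| ≤ B) ∧ ∃ y : ℤ, Polynomial.eval y (F.map (MvPolynomial.eval x)) = 0} ⊆
      ((Fintype.piFinset fun _ : Fin n => Finset.Icc (-(b:ℤ)) b : Finset (Fin n → ℤ)) : Set (Fin n → ℤ)) := by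
    intro x hx
    rw [Finset.mem_coe, Fintype.mem_piFinset]
    intro l
    rw [Finset.mem_Icc]
    exact abs_le.1 (hbox x hx.1 l)
  have hfin := (Finset.finite_toSet _).subset hsub
  refine ⟨hfin.toFinset, ?_, ?_, ?_⟩
  · exact Set.ncard_eq_toFinset_card _ hfin
  · have h1 : hfin.toFinset ⊆ (Fintype.piFinset fun _ : Fin n => Finset.Icc (-(b:ℤ)) b) := by
      intro x hx
      exact Finset.mem_coe.1 (hsub (hfin.mem_toFinset.1 hx))
    refine (Finset.card_le_card h1).trans (le_of_eq ?_)
    rw [Fintype.card_piFinset]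
    simp only [Int.card_Icc, Finset.prod_const, Finset.card_univ, Fintype.card_fin]
    congr 1
    omega
  · intro x hx
    have h1 := hfin.mem_toFinset.1 hx
    refine ⟨hbox x h1.1, ?_⟩
    rw [evz_int]; exact h1.2

end St

theorem statement1 (n : ℕ) (hn : 2 ≤ n) (D : ℕ) :
    ∃ h : ℕ, 1 ≤ h ∧ ∀ ε : ℝ, 0 < ε → ∃ C : ℝ, 0 < C ∧
      ∀ (m : ℕ) (F : Polynomial (MvPolynomial (Fin n) ℤ)),
        2 ≤ m → 2 ≤ F.natDegree → IsAllowable F → HasForm n m F → totalDeg F = D →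
        ∀ B : ℝ, 1 ≤ B →
          (NFB F B : ℝ) ≤
            C * (polyNorm F : ℝ) ^ h * B ^ ((n : ℝ) - 1 + 1 / ((n : ℝ) + 1) + ε) := by
  refine ⟨n, by omega, fun ε hε => ?_⟩
  obtain ⟨C, hC, b0, hcore⟩ := St.core_count n D hn ε hε
  refine ⟨C + 3^n + (2*b0+1)^n, by positivity, ?_⟩
  intro m F hm hd hall hform hD B hB
  obtain ⟨X, hX1, hX2, hX3⟩ := St.nfb_finset F B hB
  rw [hX1]
  have hnn : (0:ℝ) ≤ (n:ℝ) - 1 + 1 / ((n:ℝ)+1) + ε := by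
    have h1 : (2:ℝ) ≤ n := by exact_mod_cast hn
    have : 0 ≤ 1/((n:ℝ)+1) := by positivity
    linarith
  have hp1 : (1:ℝ) ≤ polyNorm F := by exact_mod_cast St.one_le_polyNorm hall.2.1
  have hpn : (1:ℝ) ≤ (polyNorm F:ℝ)^n := one_le_pow₀ hp1
  have hBE : 1 ≤ B ^ ((n : ℝ) - 1 + 1 / ((n : ℝ) + 1) + ε) := Real.one_le_rpow hB hnn
  have hb1 : 1 ≤ ⌊B⌋₊ := Nat.le_floor (by simpa using hB)
  have hbB : (⌊B⌋₊:ℝ) ≤ B := Nat.floor_le (by linarith)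
  generalize ⌊B⌋₊ = b at hX2 hX3 hb1 hbB
  have hX2' : (X.card:ℝ) ≤ (2*(b:ℝ)+1)^n := by exact_mod_cast hX2
  have hE : ∀ c : ℝ, 0 ≤ c → (X.card:ℝ) ≤ c * ((polyNorm F:ℝ)^n * B ^ ((n : ℝ) - 1 + 1 / ((n : ℝ) + 1) + ε)) → c ≤ C + 3^n + (2*b0+1)^n →
      (X.card:ℝ) ≤ (C + 3^n + (2*b0+1)^n) * (polyNorm F:ℝ)^n * B ^ ((n : ℝ) - 1 + 1 / ((n : ℝ) + 1) + ε) := by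
    intro c _ h1 h2
    rw [mul_assoc]
    exact h1.trans (mul_le_mul_of_nonneg_right h2 (by positivity))
  have h3 : (0:ℝ) ≤ 3^n := by positivity
  have h4 : (0:ℝ) ≤ (2*b0+1)^n := by positivity
  by_cases hbb : b0 ≤ b
  · by_cases hnorm : polyNorm F ≤ b
    · refine hE C hC.le ?_ (by linarith)
      refine (hcore m F hm hd hall hform hD b hb1 hbb hnorm X hX3).trans (mul_le_mul_of_nonneg_left ?_ hC.le)
      calc (b:ℝ) ^ ((n : ℝ) - 1 + 1 / ((n : ℝ) + 1) + ε) ≤ B ^ ((n : ℝ) - 1 + 1 / ((n : ℝ) + 1) + ε) := Real.rpow_le_rpow (by positivity) hbB hnn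
        _ ≤ _ := le_mul_of_one_le_left (by linarith) hpn
    · refine hE (3^n) h3 ?_ (by linarith)
      push Not at hnorm
      have h5 : (b:ℝ) ≤ polyNorm F := by exact_mod_cast hnorm.le
      calc (X.card:ℝ) ≤ (2*(b:ℝ)+1)^n := hX2'
        _ ≤ (3*(polyNorm F:ℝ))^n := pow_le_pow_left₀ (by positivity) (by linarith) n
        _ = 3^n * (polyNorm F:ℝ)^n := mul_pow _ _ _
        _ ≤ _ := mul_le_mul_of_nonneg_left (le_mul_of_one_le_right (by linarith) hBE) h3
  · refine hE ((2*b0+1)^n) h4 ?_ (by linarith)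
    push Not at hbb
    have h5 : (b:ℝ) ≤ b0 := by exact_mod_cast hbb.le
    calc (X.card:ℝ) ≤ (2*(b:ℝ)+1)^n := hX2'
      _ ≤ (2*(b0:ℝ)+1)^n := pow_le_pow_left₀ (by positivity) (by linarith) n
      _ ≤ _ := le_mul_of_one_le_right h4 (one_le_mul_of_one_le_of_one_le hpn hBE)
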